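/- Let K be a number field with ring of integers 𝓞_K, let n ≥ 2, and let I ⊆ {1,…,n−1}. Then the standard parabolic subgroup P_I(𝓞_K) ≤ SL_n(𝓞_K) is finitely presented. (This is the characteristic-zero case of the paper's theorem on S-arithmetic parabolic subgroups, for split groups of type A_{n−1}.) -/

import Mathlib

/-- A group is finitely presented if it is isomorphic to the quotient of a
finitely generated free group by the normal closure of a finite set. -/
def IsFinitelyPresented (G : Type*) [Group G] : Prop :=
  ∃ (m : ℕ) (S : Finset (FreeGroup (Fin m))),
    Nonempty ((FreeGroup (Fin m) ⧸ Subgroup.normalClosure (S : Set (FreeGroup (Fin m)))) ≃* G)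

/-- The elementary matrix `1 + r·E i j` as an element of `SL_n(R)`. -/
def elemMat {n : ℕ} {R : Type*} [CommRing R] (i j : Fin n) (hij : i ≠ j) (r : R) :
    Matrix.SpecialLinearGroup (Fin n) R :=
  ⟨Matrix.transvection i j r, Matrix.det_transvection_of_ne i j hij r⟩

/-- The set of diagonal matrices in `SL_n(R)`. -/
def diagMats (n : ℕ) (R : Type*) [CommRing R] :
    Set (Matrix.SpecialLinearGroup (Fin n) R) :=
  {g | (g : Matrix (Fin n) (Fin n) R).IsDiag}

/-- For (0-based) indices `i < j` in `Fin n`, the (1-based) pair `(i+1, j+1)` is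
`I`-connected if every simple-root index `k` with `i+1 ≤ k ≤ j` lies in `I`. -/
def IConn {n : ℕ} (I : Set ℕ) (i j : Fin n) : Prop :=
  ∀ k : ℕ, i.val + 1 ≤ k → k ≤ j.val → k ∈ I

/-- Upper elementary matrices `e_{ij}(r)` with `i < j` a `J`-connected pair. -/
def upperElems (n : ℕ) (R : Type*) [CommRing R] (J : Set ℕ) :
    Set (Matrix.SpecialLinearGroup (Fin n) R) :=
  {g | ∃ (i j : Fin n) (h : i < j) (r : R), IConn J i j ∧ g = elemMat i j (ne_of_lt h) r}

/-- All upper elementary matrices `e_{ij}(r)`, `i < j`. -/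
def allUpperElems (n : ℕ) (R : Type*) [CommRing R] :
    Set (Matrix.SpecialLinearGroup (Fin n) R) :=
  {g | ∃ (i j : Fin n) (h : i < j) (r : R), g = elemMat i j (ne_of_lt h) r}

/-- Lower elementary matrices `e_{ji}(r)` with `i < j` an `I`-connected pair. -/
def lowerElems (n : ℕ) (R : Type*) [CommRing R] (I : Set ℕ) :
    Set (Matrix.SpecialLinearGroup (Fin n) R) :=
  {g | ∃ (i j : Fin n) (h : i < j) (r : R), IConn I i j ∧ g = elemMat j i (ne_of_gt h) r}

/-- The standard parabolic subgroup `P_I(R) ≤ SL_n(R)`. -/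
def parabolic (n : ℕ) (R : Type*) [CommRing R] (I : Set ℕ) :
    Subgroup (Matrix.SpecialLinearGroup (Fin n) R) :=
  Subgroup.closure (diagMats n R ∪ allUpperElems n R ∪ lowerElems n R I)

/-- The Levi factor `L_I(R) ≤ SL_n(R)`. -/
def levi (n : ℕ) (R : Type*) [CommRing R] (I : Set ℕ) :
    Subgroup (Matrix.SpecialLinearGroup (Fin n) R) :=
  Subgroup.closure (diagMats n R ∪ upperElems n R I ∪ lowerElems n R I)

/-- `Adj(I)`: simple-root indices not in `I` adjacent to an element of `I`. -/
def adjSet (n : ℕ) (I : Set ℕ) : Set ℕ :=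
  {k | k ∈ Set.Icc 1 (n - 1) ∧ k ∉ I ∧ (k - 1 ∈ I ∨ k + 1 ∈ I)}

/-- `nonAdj(I)`: simple-root indices neither in `I` nor adjacent to `I`. -/
def nonAdjSet (n : ℕ) (I : Set ℕ) : Set ℕ :=
  Set.Icc 1 (n - 1) \ (I ∪ adjSet n I)

/-- The extended Levi factor `LE_I(R)` (for `I ≠ ∅`): generated by the Levi factor
together with all `e_{ij}(r)`, `i < j` a `nonAdj(I)`-connected pair. -/
def extLevi (n : ℕ) (R : Type*) [CommRing R] (I : Set ℕ) :
    Subgroup (Matrix.SpecialLinearGroup (Fin n) R) :=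
  Subgroup.closure (diagMats n R ∪ upperElems n R I ∪ lowerElems n R I ∪
    upperElems n R (nonAdjSet n I))

section GroupTheory

open Subgroup

variable {G H : Type*} [Group G] [Group H]

lemma Group.IsFinitelyPresented.fg (G : Type*) [Group G] [h : Group.IsFinitelyPresented G] :
    Group.FG G := by
  obtain ⟨n, φ, hφ, -⟩ := h.out
  exact Group.fg_of_surjective hφ

/-- A retract of a finitely presented group is finitely presented. -/
lemma Group.IsFinitelyPresented.of_retract' [Group.FG G] [Group.IsFinitelyPresented G]
    (r : G →* H) (s : H →* G) (h : ∀ x, r (s x) = x) : Group.IsFinitelyPresented H := by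
  refine Group.IsFinitelyPresented.of_surjective r (fun x => ⟨s x, h x⟩) ?_
  obtain ⟨S, hS⟩ := (Group.fg_iff (G := G)).1 inferInstance
  refine ⟨(fun x => x⁻¹ * s (r x)) '' S, hS.2.image _, le_antisymm ?_ ?_⟩
  · refine normalClosure_le_normal ?_
    rintro _ ⟨x, -, rfl⟩
    simp [MonoidHom.mem_ker, h]
  · intro g hg
    set M := normalClosure ((fun x => x⁻¹ * s (r x)) '' S)
    have key : (QuotientGroup.mk' M) = (QuotientGroup.mk' M).comp (s.comp r) := by
      refine MonoidHom.eq_of_eqOn_dense hS.1 ?_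
      intro x hx
      refine (QuotientGroup.eq (s := M)).2 ?_
      exact subset_normalClosure ⟨x, hx, rfl⟩
    have := DFunLike.congr_fun key g
    simp only [MonoidHom.comp_apply, (MonoidHom.mem_ker).1 hg, map_one] at this
    exact (QuotientGroup.eq_one_iff g).1 this

lemma Group.IsFinitelyPresented.of_retract [Group.IsFinitelyPresented G]
    (r : G →* H) (s : H →* G) (h : ∀ x, r (s x) = x) : Group.IsFinitelyPresented H :=
  have := Group.IsFinitelyPresented.fg G
  Group.IsFinitelyPresented.of_retract' r s h

lemma Group.IsFinitelyPresented.of_isFreeGroup (G : Type*) [Group G] [IsFreeGroup G]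
    [hG : Group.FG G] : Group.IsFinitelyPresented G := by
  obtain ⟨n, φ, hφ⟩ : ∃ (n : ℕ) (φ : FreeGroup (Fin n) →* G), Function.Surjective φ := by
    obtain ⟨S, hS⟩ := hG.out
    let e := S.equivFin
    refine ⟨S.card, FreeGroup.lift (fun i => (e.symm i : G)), ?_⟩
    rw [← MonoidHom.range_eq_top, eq_top_iff, ← hS, closure_le]
    intro x hx
    exact ⟨FreeGroup.of (e ⟨x, hx⟩), by simp⟩
  choose g hg using fun i => hφ (IsFreeGroup.of (G := G) i)
  refine Group.IsFinitelyPresented.of_retract φ (IsFreeGroup.lift g) ?_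
  intro x
  have : φ.comp (IsFreeGroup.lift g) = MonoidHom.id G := by
    apply IsFreeGroup.ext_hom
    intro a
    simp [hg]
  exact DFunLike.congr_fun this x

/-- Finite index subgroups of finitely presented groups are finitely presented. -/
lemma Group.IsFinitelyPresented.of_finiteIndex [hG : Group.IsFinitelyPresented G]
    (H : Subgroup G) [H.FiniteIndex] : Group.IsFinitelyPresented H := by
  obtain ⟨n, φ, hφ, R, hRf, hR⟩ := hG.out
  set F' := H.comap φ with hF'
  have hfi : F'.FiniteIndex := ⟨by
    rw [hF', Subgroup.index_comap_of_surjective _ hφ]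
    exact FiniteIndex.index_ne_zero⟩
  have : Group.FG F' := Subgroup.fg_of_index_ne_zero F'
  have := Group.IsFinitelyPresented.of_isFreeGroup F'
  let ψ : F' →* H := φ.subgroupComap H
  refine Group.IsFinitelyPresented.of_surjective ψ ?_ ?_
  · rintro ⟨h, hh⟩
    obtain ⟨x, rfl⟩ := hφ h
    exact ⟨⟨x, hh⟩, rfl⟩
  · have hR' : ∀ r ∈ R, φ r = 1 := fun r hr => by
      have : r ∈ φ.ker := hR ▸ subset_normalClosure hr
      exact this
    let f : (FreeGroup (Fin n) ⧸ F') × R → F' := fun p =>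
      ⟨p.1.out⁻¹ * p.2.1 * p.1.out, by simp [hF', mem_comap, hR' _ p.2.2]⟩
    have : Finite R := hRf
    refine ⟨Set.range f, Set.finite_range f, le_antisymm ?_ ?_⟩
    · refine normalClosure_le_normal ?_
      rintro _ ⟨p, rfl⟩
      refine Subtype.ext ?_
      change φ (p.1.out⁻¹ * p.2.1 * p.1.out) = 1
      simp [hR' _ p.2.2]
    · set M := normalClosure (Set.range f)
      rintro ⟨x, hx⟩ hxk
      have hxφ : x ∈ φ.ker := congrArg Subtype.val hxk
      suffices h : φ.ker ≤ M.map F'.subtype by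
        obtain ⟨y, hy, hyx⟩ := h hxφ
        have : y = ⟨x, hx⟩ := Subtype.ext hyx
        exact this ▸ hy
      rw [← hR]
      unfold normalClosure
      rw [closure_le]
      intro y hy
      obtain ⟨r, hr, hry⟩ := Group.mem_conjugatesOfSet_iff.1 hy
      obtain ⟨c, rfl⟩ := isConj_iff.1 hry
      obtain ⟨d, hd⟩ := QuotientGroup.mk_out_eq_mul F' c⁻¹
      refine ⟨(d : F') * f (QuotientGroup.mk c⁻¹, ⟨r, hr⟩) * d⁻¹,
        normalClosure_normal.conj_mem _ (subset_normalClosure (Set.mem_range_self _)) _, ?_⟩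
      simp [f, hd, mul_assoc]

/-- Extensions of finitely presented groups are finitely presented. -/
lemma Group.IsFinitelyPresented.of_extension {Q : Type*} [Group Q] (f : G →* Q)
    (hf : Function.Surjective f) [hN : Group.IsFinitelyPresented f.ker]
    [hQ : Group.IsFinitelyPresented Q] : Group.IsFinitelyPresented G := by
  obtain ⟨n₁, π, hπ, R₁, hR₁f, hR₁⟩ := hN.out
  obtain ⟨n₂, φ, hφ, R₂, hR₂f, hR₂⟩ := hQ.out
  choose g hg using fun i => hf (φ (FreeGroup.of i))
  let ψ : FreeGroup (Fin n₂) →* G := FreeGroup.lift g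
  have hψ : ∀ x, f (ψ x) = φ x := fun x => by
    have : f.comp ψ = φ := by ext i; simp [ψ, hg]
    exact DFunLike.congr_fun this x
  let π' : FreeGroup (Fin n₁) →* G := f.ker.subtype.comp π
  obtain ⟨P, _, _, inl, inr, hind, Φ, hΦl, hΦr⟩ : ∃ (P : Type) (_ : Group P)
      (_ : Group.IsFinitelyPresented P) (inl : FreeGroup (Fin n₁) →* P)
      (inr : FreeGroup (Fin n₂) →* P), (∀ C : P → Prop, (∀ a, C (inl a)) → (∀ b, C (inr b)) →
        (∀ x y, C x → C y → C (x * y)) → ∀ x, C x) ∧ ∃ Φ : P →* G,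
        (∀ x, Φ (inl x) = π' x) ∧ ∀ x, Φ (inr x) = ψ x :=
    ⟨Monoid.Coprod (FreeGroup (Fin n₁)) (FreeGroup (Fin n₂)), inferInstance, inferInstance,
      Monoid.Coprod.inl, Monoid.Coprod.inr,
      fun C h1 h2 h3 x => Monoid.Coprod.induction_on x h1 h2 h3,
      Monoid.Coprod.lift π' ψ, fun x => Monoid.Coprod.lift_apply_inl _ _ _,
      fun x => Monoid.Coprod.lift_apply_inr _ _ _⟩
  have hπ' : ∀ x ∈ f.ker, ∃ y, π' y = x := fun x hx => by
    obtain ⟨y, hy⟩ := hπ ⟨x, hx⟩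
    exact ⟨y, by simp [π', hy]⟩
  have hfπ' : ∀ y, f (π' y) = 1 := fun y => (π y).2
  have h1 : ∀ r : R₂, ∃ y, π' y = ψ r := fun r => hπ' _ (by
    rw [MonoidHom.mem_ker, hψ]
    exact (MonoidHom.mem_ker).1 (hR₂ ▸ subset_normalClosure r.2))
  choose m hm using h1
  have h2 : ∀ p : Fin n₁ × Fin n₂ × Bool, ∃ y, π' y =
      ψ (FreeGroup.of p.2.1 ^ (cond p.2.2 1 (-1 : ℤ))) * π' (FreeGroup.of p.1) *
      (ψ (FreeGroup.of p.2.1 ^ (cond p.2.2 1 (-1 : ℤ))))⁻¹ := fun p => hπ' _ (by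
    simp [MonoidHom.mem_ker, hfπ'])
  choose k hk using h2
  have : Finite R₁ := hR₁f
  have : Finite R₂ := hR₂f
  let S : Set P := (inl '' R₁) ∪ Set.range (fun r : R₂ => inr r * (inl (m r))⁻¹) ∪
    Set.range (fun p : Fin n₁ × Fin n₂ × Bool =>
      inr (FreeGroup.of p.2.1 ^ (cond p.2.2 1 (-1 : ℤ))) * inl (FreeGroup.of p.1) *
      (inr (FreeGroup.of p.2.1 ^ (cond p.2.2 1 (-1 : ℤ))))⁻¹ * (inl (k p))⁻¹)
  have hΦsurj : Function.Surjective Φ := fun x => by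
    obtain ⟨b, hb⟩ := hφ (f x)
    obtain ⟨a, ha⟩ := hπ' (x * (ψ b)⁻¹) (by simp [MonoidHom.mem_ker, hψ, hb])
    exact ⟨inl a * inr b, by simp [hΦl, hΦr, ha]⟩
  refine Group.IsFinitelyPresented.of_surjective Φ hΦsurj ⟨S, ?_, ?_⟩
  · exact ((hR₁f.image _).union (Set.finite_range _)).union (Set.finite_range _)
  · refine le_antisymm ?_ ?_
    · refine normalClosure_le_normal ?_
      rintro _ ((⟨r, hr, rfl⟩ | ⟨r, rfl⟩) | ⟨p, rfl⟩)
      · have : π r = 1 := (MonoidHom.mem_ker).1 (hR₁ ▸ subset_normalClosure hr)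
        simp [MonoidHom.mem_ker, hΦl, π', this]
      · simp [MonoidHom.mem_ker, hΦl, hΦr, hm]
      · simp only [SetLike.mem_coe, MonoidHom.mem_ker, map_mul, map_inv, hΦl, hΦr, hk]
        group
    · let M := normalClosure S
      obtain ⟨PM, _, q, hqs, hMk⟩ : ∃ (PM : Type) (_ : Group PM) (q : P →* PM),
          Function.Surjective q ∧ ∀ x, x ∈ M ↔ q x = 1 :=
        ⟨P ⧸ M, inferInstance, QuotientGroup.mk' M, QuotientGroup.mk'_surjective M,
          fun x => (QuotientGroup.eq_one_iff x).symm⟩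
      have hq : ∀ x ∈ S, q x = 1 := fun x hx => (hMk x).1 (subset_normalClosure hx)
      let N' : Subgroup PM := (q.comp inl).range
      have hl : ∀ a, q (inl a) ∈ N' := fun a => ⟨a, rfl⟩
      have hk' : ∀ p : Fin n₁ × Fin n₂ × Bool,
          q (inr (FreeGroup.of p.2.1 ^ (cond p.2.2 1 (-1 : ℤ)))) * q (inl (FreeGroup.of p.1)) *
          (q (inr (FreeGroup.of p.2.1 ^ (cond p.2.2 1 (-1 : ℤ)))))⁻¹ = q (inl (k p)) := fun p => by
        have := hq _ (Or.inr ⟨p, rfl⟩)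
        simpa [mul_inv_eq_one] using this
      have hgen : ∀ (i : Fin n₂) (e : Bool) (a : FreeGroup (Fin n₁)),
          q (inr (FreeGroup.of i ^ (cond e 1 (-1 : ℤ)))) * q (inl a) *
          (q (inr (FreeGroup.of i ^ (cond e 1 (-1 : ℤ)))))⁻¹ ∈ N' := fun i e a => by
        induction a using FreeGroup.induction_on with
        | C1 => simp [one_mem]
        | of x => rw [hk' (x, i, e)]; exact hl _
        | inv_of x _ =>
          have := N'.inv_mem (hl (k (x, i, e)))
          rw [← hk' (x, i, e)] at this
          simpa [mul_assoc] using this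
        | mul x y hx hy => simpa [mul_assoc] using N'.mul_mem hx hy
      have hbr : ∀ (b : FreeGroup (Fin n₂)), ∀ z ∈ N', q (inr b) * z * (q (inr b))⁻¹ ∈ N' := by
        intro b
        induction b using FreeGroup.induction_on with
        | C1 => simp
        | of x => rintro _ ⟨a, rfl⟩; simpa using hgen x true a
        | inv_of x _ => rintro _ ⟨a, rfl⟩; simpa using hgen x false a
        | mul x y hx hy =>
          intro z hz
          simpa [mul_assoc] using hx _ (hy z hz)
      have hN' : N'.Normal := ⟨fun z hz g => by
        obtain ⟨p, rfl⟩ := hqs g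
        refine hind (fun p => ∀ z ∈ N', q p * z * (q p)⁻¹ ∈ N') (fun a z hz => ?_)
          (fun b z hz => hbr b z hz) (fun x y hx hy z hz => ?_) p z hz
        · exact N'.mul_mem (N'.mul_mem (hl a) hz) (N'.inv_mem (hl a))
        · simpa [mul_assoc] using hx _ (hy z hz)⟩
      have hdec : ∀ p : P, ∃ b, q p * (q (inr b))⁻¹ ∈ N' := fun p => by
        refine hind (fun p => ∃ b, q p * (q (inr b))⁻¹ ∈ N') (fun a => ⟨1, by simpa using hl a⟩)
          (fun b => ⟨b, by simp [one_mem]⟩) ?_ p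
        · rintro x y ⟨b, hb⟩ ⟨c, hc⟩
          refine ⟨b * c, ?_⟩
          have := N'.mul_mem hb (hN'.conj_mem _ hc (q (inr b)))
          simpa [mul_assoc] using this
      have hker2 : ∀ b, φ b = 1 → q (inr b) ∈ N' := fun b hb => by
        have hb : b ∈ normalClosure R₂ := hR₂ ▸ hb
        have : normalClosure R₂ ≤ N'.comap (q.comp inr) := by
          refine normalClosure_le_normal ?_
          intro r hr
          have := hq _ (Or.inl (Or.inr ⟨⟨r, hr⟩, rfl⟩))
          have h3 : q (inr r) = q (inl (m ⟨r, hr⟩)) := by simpa [mul_inv_eq_one] using this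
          change q (inr r) ∈ N'
          rw [h3]
          exact hl _
        exact this hb
      intro p hp
      have hp : Φ p = 1 := hp
      have hMle : ∀ x, q x = 1 → Φ x = 1 := fun x hx => by
        have hx : x ∈ M := (hMk x).2 hx
        have : M ≤ Φ.ker := by
          refine normalClosure_le_normal ?_
          rintro _ ((⟨r, hr, rfl⟩ | ⟨r, rfl⟩) | ⟨p, rfl⟩)
          · have : π r = 1 := (MonoidHom.mem_ker).1 (hR₁ ▸ subset_normalClosure hr)
            simp [MonoidHom.mem_ker, hΦl, π', this]
          · simp [MonoidHom.mem_ker, hΦl, hΦr, hm]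
          · simp only [SetLike.mem_coe, MonoidHom.mem_ker, map_mul, map_inv, hΦl, hΦr, hk]
            group
        exact this hx
      obtain ⟨b, a, ha⟩ := hdec p
      have ha : q (inl a) = q p * (q (inr b))⁻¹ := ha
      have h4 : q (inl a * inr b * p⁻¹) = 1 := by simp [ha]
      have h5 := hMle _ h4
      have h6 : π' a * ψ b = 1 := by simpa [hp, hΦl, hΦr] using h5
      have h7 : φ b = 1 := by
        have := congrArg f h6
        simpa [hfπ', hψ] using this
      obtain ⟨c, hc⟩ := N'.mul_mem ⟨a, ha⟩ (hker2 b h7)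
      have hc : q (inl c) = q p := by simpa using hc
      have h8 : Φ (inl c * p⁻¹) = 1 := hMle _ (by simp [hc])
      have h9 : π c = 1 := Subtype.ext (by simpa [hp, hΦl, π'] using h8)
      have h10 : c ∈ normalClosure R₁ := hR₁ ▸ h9
      have h11 : normalClosure R₁ ≤ (q.comp inl).ker := by
        refine normalClosure_le_normal ?_
        intro r hr
        exact hq _ (Or.inl (Or.inl ⟨r, hr, rfl⟩))
      exact (hMk p).2 (hc ▸ h11 h10)

lemma Group.IsFinitelyPresented.of_mulEquiv_ker {N Q : Type*} [Group N] [Group Q]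
    [Group.IsFinitelyPresented N] [Group.IsFinitelyPresented Q] (f : G →* Q)
    (hf : Function.Surjective f) (e : N ≃* f.ker) : Group.IsFinitelyPresented G :=
  have := Group.IsFinitelyPresented.equiv e
  Group.IsFinitelyPresented.of_extension f hf

instance Group.IsFinitelyPresented.prod [Group.IsFinitelyPresented G]
    [Group.IsFinitelyPresented H] : Group.IsFinitelyPresented (G × H) := by
  refine Group.IsFinitelyPresented.of_mulEquiv_ker (MonoidHom.snd G H) (fun x => ⟨(1, x), rfl⟩)
    (N := G) ?_
  exact
    { toFun := fun g => ⟨(g, 1), rfl⟩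
      invFun := fun g => g.1.1
      left_inv := fun g => rfl
      right_inv := fun ⟨⟨a, b⟩, h⟩ => Subtype.ext (Prod.ext rfl h.symm)
      map_mul' := fun a b => Subtype.ext (Prod.ext rfl (mul_one _).symm) }

lemma Group.IsFinitelyPresented.multiplicative_fin_int (n : ℕ) :
    Group.IsFinitelyPresented (Multiplicative (Fin n → ℤ)) := by
  induction n with
  | zero => infer_instance
  | succ n ih =>
    let e : ℤ × (Fin n → ℤ) ≃+ (Fin (n + 1) → ℤ) :=
      { toFun := fun p => Fin.cons p.1 p.2
        invFun := fun v => (v 0, Fin.tail v)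
        left_inv := fun p => by simp
        right_inv := fun v => by simp
        map_add' := fun p q => by ext i; refine Fin.cases ?_ (fun i => ?_) i <;> simp }
    let e' : Multiplicative ℤ × Multiplicative (Fin n → ℤ) ≃* Multiplicative (ℤ × (Fin n → ℤ)) :=
      { toFun := fun p => Multiplicative.ofAdd (p.1.toAdd, p.2.toAdd)
        invFun := fun v => (Multiplicative.ofAdd v.toAdd.1, Multiplicative.ofAdd v.toAdd.2)
        left_inv := fun p => rfl
        right_inv := fun p => rfl
        map_mul' := fun p q => rfl }
    exact Group.IsFinitelyPresented.equiv (e'.trans (AddEquiv.toMultiplicative e))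

/-- Finitely generated abelian groups are finitely presented. -/
lemma Group.IsFinitelyPresented.of_comm (G : Type*) [CommGroup G] [hG : Group.FG G] :
    Group.IsFinitelyPresented G := by
  have : Module.Finite ℤ (Additive G) :=
    Module.Finite.iff_addGroup_fg.2 (GroupFG.iff_add_fg.1 hG)
  obtain ⟨n, f, hf⟩ := Module.Finite.exists_fin' ℤ (Additive G)
  have := Group.IsFinitelyPresented.multiplicative_fin_int n
  let F : Multiplicative (Fin n → ℤ) →* G :=
    { toFun := fun v => (f v.toAdd).toMul
      map_one' := by simp
      map_mul' := fun a b => by simp }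
  refine Group.IsFinitelyPresented.of_surjective F (fun x => ?_) ?_
  · obtain ⟨v, hv⟩ := hf (Additive.ofMul x)
    exact ⟨Multiplicative.ofAdd v, by simp [F, hv]⟩
  · obtain ⟨S, hS⟩ := IsNoetherian.noetherian (LinearMap.ker f)
    refine ⟨Multiplicative.ofAdd '' (S : Set (Fin n → ℤ)), S.finite_toSet.image _, ?_⟩
    refine le_antisymm (normalClosure_le_normal ?_) ?_
    · rintro _ ⟨s, hs, rfl⟩
      have : s ∈ LinearMap.ker f := hS ▸ Submodule.subset_span hs
      simpa [F, MonoidHom.mem_ker] using this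
    · intro v hv
      have h1 : v.toAdd ∈ LinearMap.ker f := by simpa [F, MonoidHom.mem_ker] using hv
      rw [← hS] at h1
      let M := normalClosure (Multiplicative.ofAdd '' (S : Set (Fin n → ℤ)))
      have h2 : Submodule.span ℤ (S : Set (Fin n → ℤ)) ≤
          AddSubgroup.toIntSubmodule (Subgroup.toAddSubgroup' M) := by
        rw [Submodule.span_le]
        intro s hs
        exact subset_normalClosure (s := Multiplicative.ofAdd '' (S : Set (Fin n → ℤ))) ⟨s, hs, rfl⟩
      exact h2 h1

end GroupTheory

section Macbeath

open Set Topology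

variable {X B : Type*} [TopologicalSpace X]

/-- A function on the index set of an open cover of a connected space by nonempty sets which
agrees on overlapping indices is constant. -/
lemma eq_of_overlap_of_cover [PreconnectedSpace X] {S : Type*} (V : B → Set X)
    (hopen : ∀ b, IsOpen (V b)) (hne : ∀ b, (V b).Nonempty) (hcov : ∀ x, ∃ b, x ∈ V b)
    (u : B → S) (hu : ∀ b b', (V b ∩ V b').Nonempty → u b = u b') (b b' : B) : u b = u b' := by
  choose β hβ using hcov
  have hF : ∀ b, ∀ x ∈ V b, u (β x) = u b := fun b x hx => hu _ _ ⟨x, hβ x, hx⟩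
  have hlc : IsLocallyConstant (fun x => u (β x)) := by
    rw [IsLocallyConstant.iff_exists_open]
    intro x
    exact ⟨V (β x), hopen _, hβ x, fun y hy => hF _ y hy⟩
  obtain ⟨x, hx⟩ := hne b
  obtain ⟨y, hy⟩ := hne b'
  rw [← hF b x hx, ← hF b' y hy]
  exact hlc.apply_eq_of_isPreconnected isPreconnected_univ (mem_univ x) (mem_univ y)

/-- A cocycle with values in a discrete group over a cover of a simply connected space by
connected open sets is a coboundary. -/
lemma exists_coboundary_of_simplyConnected [SimplyConnectedSpace X] [LocallyPathConnectedSpace X]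
    {Γ : Type*} [Group Γ] (V : B → Set X)
    (hopen : ∀ b, IsOpen (V b)) (hconn : ∀ b, IsPreconnected (V b)) (hne : ∀ b, (V b).Nonempty)
    (hcov : ∀ x, ∃ b, x ∈ V b) (c : B → B → Γ)
    (hc : ∀ b b' b'' x, x ∈ V b → x ∈ V b' → x ∈ V b'' → c b b' * c b' b'' = c b b'') :
    ∃ f : B → Γ, ∀ b b', (V b ∩ V b').Nonempty → c b b' = (f b)⁻¹ * f b' := by
  let _ : TopologicalSpace Γ := ⊥
  have _ : DiscreteTopology Γ := ⟨rfl⟩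
  choose β hβ using hcov
  let Z : FiberBundleCore B X Γ :=
    { baseSet := V
      isOpen_baseSet := hopen
      indexAt := β
      mem_baseSet_at := hβ
      coordChange := fun i j _ v => (c i j)⁻¹ * v
      coordChange_self := fun i x hx v => by
        have := hc i i i x hx hx hx
        rw [mul_eq_left] at this
        simp [this]
      continuousOn_coordChange := fun i j => by
        have : Continuous (fun v : Γ => (c i j)⁻¹ * v) := continuous_of_discreteTopology
        exact (this.comp continuous_snd).continuousOn
      coordChange_comp := fun i j k x hx v => by
        rw [← hc i j k x hx.1.1 hx.1.2 hx.2]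
        group }
  have cov : IsCoveringMap (Bundle.TotalSpace.proj : Z.TotalSpace → X) :=
    FiberBundle.isCoveringMap
  obtain ⟨x₀⟩ : Nonempty X := inferInstance
  obtain ⟨s, ⟨-, hs⟩, -⟩ := cov.existsUnique_continuousMap_lifts (ContinuousMap.id X) x₀
    (⟨x₀, (1 : Γ)⟩ : Z.TotalSpace) rfl
  have hs' : ∀ x, (s x).1 = x := fun x => congrFun hs x
  choose p hp using hne
  let t : B → X → Γ := fun b x => (Z.localTriv b (s x)).2
  obtain ⟨y, ht⟩ : ∃ y : X → Γ, ∀ b x, t b x = (c (β x) b)⁻¹ * y x := by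
    refine ⟨fun x => (s x).2, fun b x => ?_⟩
    simp only [t, Z.localTriv_apply]
    change (c (β (s x).1) b)⁻¹ * _ = _
    rw [hs']
  have htc : ∀ b, ∀ x ∈ V b, t b x = t b (p b) := by
    intro b x hx
    have hcont : ContinuousOn (t b) (V b) := by
      refine continuous_snd.comp_continuousOn ?_
      refine (Z.localTriv b).continuousOn_toFun.comp s.continuous.continuousOn ?_
      intro y hy
      change s y ∈ (Z.localTriv b).source
      rw [Z.mem_localTriv_source, ← Z.baseSet_at, hs']
      exact hy
    exact (hconn b).constant hcont hx (hp b)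
  refine ⟨fun b => (t b (p b))⁻¹, fun b b' ⟨x, hx, hx'⟩ => ?_⟩
  beta_reduce
  rw [← htc b x hx, ← htc b' x hx', ht, ht, ← hc (β x) b b' x (hβ x) hx hx']
  group

/-- A group acting freely and cofinitely on the index set of a locally finite cover of a simply
connected space by connected open sets, preserving the intersection pattern, is finitely
presented. -/
theorem Group.IsFinitelyPresented.of_cover [SimplyConnectedSpace X] [LocallyPathConnectedSpace X]
    {G : Type*} [Group G] [MulAction G B] (V : B → Set X)
    (hopen : ∀ b, IsOpen (V b)) (hconn : ∀ b, IsPreconnected (V b)) (hne : ∀ b, (V b).Nonempty)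
    (hcov : ∀ x, ∃ b, x ∈ V b)
    (hfree : ∀ (g : G) (b : B), g • b = b → g = 1)
    (horb : Finite (MulAction.orbitRel.Quotient G B))
    (hlf : ∀ b, {b' | (V b ∩ V b').Nonempty}.Finite)
    (hinv : ∀ (g : G) b b' b'', (V b ∩ V b' ∩ V b'').Nonempty →
      (V (g • b) ∩ V (g • b') ∩ V (g • b'')).Nonempty) :
    Group.IsFinitelyPresented G := by
  classical
  let ι := MulAction.orbitRel.Quotient G B
  let o : B → ι := fun b => Quotient.mk'' b
  let r : ι → B := fun i => i.out
  have hγ : ∀ b, ∃ g : G, g • r (o b) = b := fun b => by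
    have : (MulAction.orbitRel G B) b (r (o b)) := (MulAction.orbitRel G B).symm (Quotient.mk_out (s := MulAction.orbitRel G B) b)
    exact MulAction.orbitRel_apply.1 this
  choose γ hγ using hγ
  have ho : ∀ (g : G) b, o (g • b) = o b := fun g b =>
    Quotient.sound (MulAction.orbitRel_apply.2 ⟨g, rfl⟩)
  have hfree' : ∀ (g h : G) (b : B), g • b = h • b → g = h := fun g h b hgh => by
    have := hfree (h⁻¹ * g) b (by rw [mul_smul, hgh, inv_smul_smul])
    rwa [inv_mul_eq_one, eq_comm] at this
  have hγm : ∀ (g : G) b, γ (g • b) = g * γ b := fun g b => by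
    refine hfree' _ _ (r (o b)) ?_
    rw [mul_smul, hγ, ← ho g b, hγ]
  have hinv2 : ∀ (g : G) b b', (V b ∩ V b').Nonempty → (V (g • b) ∩ V (g • b')).Nonempty :=
    fun g b b' h => by
      have := hinv g b b' b' (by rwa [inter_assoc, inter_self])
      rwa [inter_assoc, inter_self] at this
  let α := {p : ι × ι × G // (V (r p.1) ∩ V (p.2.2 • r p.2.1)).Nonempty}
  have hα : Finite α := by
    have : Finite (Σ i : ι, {b' | (V (r i) ∩ V b').Nonempty}) :=
      have : ∀ i : ι, Finite {b' | (V (r i) ∩ V b').Nonempty} := fun i => hlf _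
      inferInstance
    refine Finite.of_injective
      (fun p : α => (⟨p.1.1, ⟨p.1.2.2 • r p.1.2.1, p.2⟩⟩ :
        Σ i : ι, {b' | (V (r i) ∩ V b').Nonempty})) ?_
    rintro ⟨⟨i, j, g⟩, h⟩ ⟨⟨i', j', g'⟩, h'⟩ heq
    have h1 := congrArg (fun s => s.1) heq
    have h2 : g • r j = g' • r j' := congrArg (fun s => s.2.1) heq
    have h3 : j = j' := by
      have := congrArg o h2
      rw [ho, ho] at this
      simpa [o, r] using this
    have h1 : i = i' := h1
    subst h3 h1
    have := hfree' _ _ _ h2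
    subst this
    rfl
  let rel : Set (FreeGroup α) := {w | ∃ p q s : α, w = FreeGroup.of p * FreeGroup.of q *
      (FreeGroup.of s)⁻¹ ∧ s.1.2.2 = p.1.2.2 * q.1.2.2 ∧ p.1.1 = s.1.1 ∧ p.1.2.1 = q.1.1 ∧
      q.1.2.1 = s.1.2.1}
  have hrel : Finite rel := by
    refine Set.Finite.subset (Set.finite_range (fun p : α × α × α =>
      FreeGroup.of p.1 * FreeGroup.of p.2.1 * (FreeGroup.of p.2.2)⁻¹)) ?_
    rintro w ⟨p, q, s, rfl, -⟩
    exact ⟨(p, q, s), rfl⟩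
  obtain ⟨Γ, _, _, x, θ, hx, hθ⟩ : ∃ (Γ : Type _) (_ : Group Γ) (_ : Group.IsFinitelyPresented Γ)
      (x : ι → ι → G → Γ) (θ : Γ →* G), (∀ i j l g h,
        (V (r i) ∩ V (g • r j) ∩ V ((g * h) • r l)).Nonempty →
        x i j g * x j l h = x i l (g * h)) ∧
      ∀ i j g, (V (r i) ∩ V (g • r j)).Nonempty → θ (x i j g) = g := by
    refine ⟨PresentedGroup rel, inferInstance, inferInstance,
      fun i j g => if h : (V (r i) ∩ V (g • r j)).Nonempty then
        PresentedGroup.of (rels := rel) ⟨(i, j, g), h⟩ else 1,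
      PresentedGroup.toGroup (f := fun p => p.1.2.2) ?_, ?_, ?_⟩
    · rintro w ⟨p, q, s, rfl, h, -⟩
      simp [h]
    · intro i j l g h hT
      have h1 : (V (r i) ∩ V (g • r j)).Nonempty := hT.mono inter_subset_left
      have h2 : (V (r j) ∩ V (h • r l)).Nonempty := by
        have : (V (g • r j) ∩ V ((g * h) • r l)).Nonempty :=
          hT.mono fun y hy => ⟨hy.1.2, hy.2⟩
        have := hinv2 g⁻¹ _ _ this
        simpa [mul_smul] using this
      have h3 : (V (r i) ∩ V ((g * h) • r l)).Nonempty := hT.mono fun y hy => ⟨hy.1.1, hy.2⟩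
      beta_reduce
      rw [dif_pos h1, dif_pos h2, dif_pos h3]
      rw [← mul_inv_eq_one]
      exact PresentedGroup.one_of_mem (rels := rel) ⟨⟨(i, j, g), h1⟩, ⟨(j, l, h), h2⟩,
        ⟨(i, l, g * h), h3⟩, rfl, rfl, rfl, rfl, rfl⟩
    · intro i j g h
      beta_reduce
      rw [dif_pos h]
      simp
  let c : B → B → Γ := fun b b' => x (o b) (o b') ((γ b)⁻¹ * γ b')
  have hc : ∀ b b' b'' x, x ∈ V b → x ∈ V b' → x ∈ V b'' → c b b' * c b' b'' = c b b'' := by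
    intro b b' b'' y h1 h2 h3
    have h4 := hinv (γ b)⁻¹ b b' b'' ⟨y, ⟨h1, h2⟩, h3⟩
    have h5 := hx (o b) (o b') (o b'') ((γ b)⁻¹ * γ b') ((γ b')⁻¹ * γ b'') (by
      rwa [show (γ b)⁻¹ * γ b' * ((γ b')⁻¹ * γ b'') = (γ b)⁻¹ * γ b'' by group, mul_smul, hγ,
        mul_smul, hγ, eq_inv_smul_iff.2 (hγ b)])
    simp only [c]
    rw [h5]
    congr 1
    group
  obtain ⟨f, hf⟩ := exists_coboundary_of_simplyConnected V hopen hconn hne hcov c hc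
  have hcinv : ∀ (h : G) b b', c (h • b) (h • b') = c b b' := fun h b b' => by
    simp only [c, ho, hγm]
    congr 1
    group
  obtain ⟨x₀⟩ : Nonempty X := inferInstance
  obtain ⟨b₀, -⟩ := hcov x₀
  have hφ : ∀ (h : G) b b', f (h • b) * (f b)⁻¹ = f (h • b') * (f b')⁻¹ := fun h =>
    eq_of_overlap_of_cover V hopen hne hcov (fun b => f (h • b) * (f b)⁻¹) fun b b' hbb => by
      have h1 := hf _ _ hbb
      have h2 := hf _ _ (hinv2 h _ _ hbb)
      rw [hcinv, h1] at h2
      have h3 : f b' = f b * ((f (h • b))⁻¹ * f (h • b')) := by rw [← h2]; group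
      rw [h3]; group
  have hk : ∀ b b', θ (f b) * (γ b)⁻¹ = θ (f b') * (γ b')⁻¹ :=
    eq_of_overlap_of_cover V hopen hne hcov (fun b => θ (f b) * (γ b)⁻¹) fun b b' hbb => by
      have h1 := congrArg θ (hf _ _ hbb)
      have h2 : θ (c b b') = (γ b)⁻¹ * γ b' := by
        refine hθ _ _ _ ?_
        have := hinv2 (γ b)⁻¹ _ _ hbb
        rwa [mul_smul, hγ, eq_inv_smul_iff.2 (hγ b)]
      rw [h2, map_mul, map_inv] at h1
      have h3 : θ (f b') = θ (f b) * ((γ b)⁻¹ * γ b') := by rw [h1]; group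
      change θ (f b) * (γ b)⁻¹ = θ (f b') * (γ b')⁻¹
      rw [h3]; group
  let ψ : G →* Γ :=
    { toFun := fun h => f (h • b₀) * (f b₀)⁻¹
      map_one' := by simp
      map_mul' := fun g h => by
        rw [hφ g b₀ (h • b₀), mul_smul]
        group }
  set k := θ (f b₀) * (γ b₀)⁻¹ with hkdef
  refine Group.IsFinitelyPresented.of_retract ((MulAut.conj k).symm.toMonoidHom.comp θ) ψ fun h => ?_
  have h1 : ∀ b, θ (f b) = k * γ b := fun b => by rw [hkdef, ← hk b b₀]; group
  simp only [MonoidHom.comp_apply, ψ, MonoidHom.coe_mk, OneHom.coe_mk, map_mul, map_inv, h1, hγm,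
    MulEquiv.coe_toMonoidHom, MulAut.conj_symm_apply]
  group

end Macbeath

section Approximation

open NumberField

variable (K : Type*) [Field K] [NumberField K]

/-- The embedding of the ring of integers at an infinite place. -/
noncomputable def placeEmb {K : Type*} [Field K] (w : InfinitePlace K) : 𝓞 K →+* ℂ :=
  w.embedding.comp (algebraMap (𝓞 K) K)

/-- A family of complex numbers indexed by infinite places is real if its entries at real places
are real. -/
def RealFam {K : Type*} [Field K] (μ : InfinitePlace K → ℂ) : Prop :=
  ∀ w : InfinitePlace K, w.IsReal → (μ w).im = 0

lemma norm_placeEmb {K : Type*} [Field K] (w : InfinitePlace K) (x : 𝓞 K) :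
    ‖placeEmb w x‖ = w x := InfinitePlace.norm_embedding_eq w x

lemma realFam_placeEmb {K : Type*} [Field K] (x : 𝓞 K) : RealFam (fun w => placeEmb w x) := by
  intro w hw
  change (w.embedding (x : K)).im = 0
  rw [← InfinitePlace.embedding_of_isReal_apply hw]
  exact Complex.ofReal_im _

lemma exists_placeEmb_coordinates : ∃ (m : ℕ) (ω : Fin m → 𝓞 K), ∀ μ : InfinitePlace K → ℂ,
    RealFam μ → ∃ t : Fin m → ℝ, ∀ w, μ w = ∑ i, (t i : ℂ) * placeEmb w (ω i) := by
  let b := mixedEmbedding.latticeBasis K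
  let e := Fintype.equivFin (Module.Free.ChooseBasisIndex ℤ (𝓞 K))
  refine ⟨_, fun i => RingOfIntegers.basis K (e.symm i), fun μ hμ => ?_⟩
  let x : mixedEmbedding.mixedSpace K := (fun w => (μ w.1).re, fun w => μ w.1)
  refine ⟨fun i => b.repr x (e.symm i), fun w => ?_⟩
  have hx : ∑ i, b.repr x i • mixedEmbedding K (integralBasis K i) = x := by
    conv_rhs => rw [← b.sum_repr x]
    simp only [b, mixedEmbedding.latticeBasis_apply]
  rw [Fintype.sum_equiv e.symm _ (fun i => (b.repr x i : ℂ) * placeEmb w (RingOfIntegers.basis K i))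
    (fun i => rfl)]
  rcases w.isReal_or_isComplex with hw | hw
  · have := congrArg (fun y => ((y.1 ⟨w, hw⟩ : ℝ) : ℂ)) hx
    simp only [Prod.fst_sum, Prod.smul_fst, Finset.sum_apply, Pi.smul_apply,
      mixedEmbedding.mixedEmbedding_apply_isReal, smul_eq_mul, Complex.ofReal_sum,
      Complex.ofReal_mul, InfinitePlace.embedding_of_isReal_apply, integralBasis_apply, x] at this
    rw [show μ w = ((μ w).re : ℂ) from Complex.ext rfl (by simp [hμ w hw]), ← this]
    rfl
  · have := congrArg (fun y => (y.2 ⟨w, hw⟩ : ℂ)) hx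
    simp only [Prod.snd_sum, Prod.smul_snd, Finset.sum_apply, Pi.smul_apply,
      mixedEmbedding.mixedEmbedding_apply_isComplex, Complex.real_smul, integralBasis_apply, x]
      at this
    rw [← this]
    rfl

lemma exists_integral_approx : ∃ C : ℝ, 0 < C ∧ ∀ μ : InfinitePlace K → ℂ, RealFam μ →
    ∃ α : 𝓞 K, ∀ w, ‖placeEmb w α - μ w‖ ≤ C := by
  obtain ⟨m, ω, hω⟩ := exists_placeEmb_coordinates K
  refine ⟨1 + ∑ w : InfinitePlace K, ∑ i, ‖placeEmb w (ω i)‖, by positivity, fun μ hμ => ?_⟩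
  obtain ⟨t, ht⟩ := hω μ hμ
  refine ⟨∑ i, (⌊t i⌋ : 𝓞 K) * ω i, fun w => ?_⟩
  have h1 : placeEmb w (∑ i, (⌊t i⌋ : 𝓞 K) * ω i) - μ w =
      ∑ i, ((⌊t i⌋ - t i : ℝ) : ℂ) * placeEmb w (ω i) := by
    rw [ht w, map_sum, ← Finset.sum_sub_distrib]
    refine Finset.sum_congr rfl fun i _ => ?_
    push_cast
    rw [map_mul, map_intCast]
    ring
  rw [h1]
  calc _ ≤ ∑ i, ‖placeEmb w (ω i)‖ := by
        refine (norm_sum_le _ _).trans (Finset.sum_le_sum fun i _ => ?_)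
        rw [norm_mul, Complex.norm_real, Real.norm_eq_abs]
        have : |(⌊t i⌋ : ℝ) - t i| ≤ 1 := by
          rw [abs_le]
          constructor <;> linarith [Int.floor_le (t i), Int.lt_floor_add_one (t i)]
        exact mul_le_of_le_one_left (norm_nonneg _) this
    _ ≤ ∑ w : InfinitePlace K, ∑ i, ‖placeEmb w (ω i)‖ :=
        Finset.single_le_sum (f := fun w : InfinitePlace K => ∑ i, ‖placeEmb w (ω i)‖)
          (fun w _ => by positivity) (Finset.mem_univ w)
    _ ≤ _ := by linarith

/-- Dirichlet's simultaneous approximation theorem over the ring of integers. -/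
lemma exists_simultaneous_approx (n : ℕ) (η : ℝ) (hη : 0 < η) : ∃ T : ℕ, 1 ≤ T ∧
    ∀ μ : Fin n → InfinitePlace K → ℂ, (∀ k, RealFam (μ k)) → ∃ t : ℕ, 1 ≤ t ∧ t ≤ T ∧
      ∃ α : Fin n → 𝓞 K, (∀ k w, ‖t * μ k w - placeEmb w (α k)‖ ≤ η) ∧
        ∀ k, (∀ w, μ k w = 0) → α k = 0 := by
  obtain ⟨m, ω, hω⟩ := exists_placeEmb_coordinates K
  obtain ⟨M, hM⟩ := exists_nat_gt ((∑ w : InfinitePlace K, ∑ i, ‖placeEmb w (ω i)‖) / η)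
  have hM0 : 0 < (M : ℝ) := lt_of_le_of_lt (by positivity) hM
  have hM0' : 0 < M := by exact_mod_cast hM0
  rw [div_lt_iff₀ hη] at hM
  have : NeZero M := ⟨hM0'.ne'⟩
  refine ⟨Fintype.card (Fin n → Fin m → Fin M), Fintype.card_pos, fun μ hμ => ?_⟩
  choose τ' hτ' using fun k => hω (μ k) (hμ k)
  obtain ⟨τ, hτ, hτ0⟩ : ∃ τ : Fin n → Fin m → ℝ, (∀ k w, μ k w = ∑ i, (τ k i : ℂ) *
      placeEmb w (ω i)) ∧ ∀ k, (∀ w, μ k w = 0) → τ k = 0 := by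
    classical
    refine ⟨fun k => if (∀ w, μ k w = 0) then 0 else τ' k, fun k w => ?_, fun k hk => if_pos hk⟩
    by_cases h : ∀ w, μ k w = 0
    · simp [h]
    · simp only [if_neg h]
      exact hτ' k w
  let cell : ℕ → Fin n → Fin m → Fin M := fun t k i =>
    ⟨⌊M * Int.fract (t * τ k i)⌋₊, by
      rw [Nat.floor_lt (by positivity)]
      have := Int.fract_lt_one (t * τ k i)
      nlinarith⟩
  obtain ⟨t₁, ht₁, t₂, ht₂, hne, heq⟩ := Finset.exists_ne_map_eq_of_card_lt_of_maps_to
    (s := Finset.range (Fintype.card (Fin n → Fin m → Fin M) + 1)) (t := Finset.univ) (f := cell)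
    (by rw [Finset.card_univ, Finset.card_range]; omega) (fun _ _ => Finset.mem_univ _)
  wlog hlt : t₁ < t₂ generalizing t₁ t₂
  · exact this t₂ ht₂ t₁ ht₁ hne.symm heq.symm (by omega)
  rw [Finset.mem_range] at ht₁ ht₂
  refine ⟨t₂ - t₁, by omega, by omega,
    fun k => ∑ i, ((⌊t₂ * τ k i⌋ - ⌊t₁ * τ k i⌋ : ℤ) : 𝓞 K) * ω i, fun k w => ?_, fun k hk => ?_⟩
  · have h1 : ((t₂ - t₁ : ℕ) : ℂ) * μ k w - placeEmb w
        (∑ i, ((⌊t₂ * τ k i⌋ - ⌊t₁ * τ k i⌋ : ℤ) : 𝓞 K) * ω i) =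
        ∑ i, ((Int.fract (t₂ * τ k i) - Int.fract (t₁ * τ k i) : ℝ) : ℂ) * placeEmb w (ω i) := by
      rw [hτ, map_sum, Finset.mul_sum, ← Finset.sum_sub_distrib]
      refine Finset.sum_congr rfl fun i _ => ?_
      rw [map_mul, map_intCast, Nat.cast_sub hlt.le, Int.fract, Int.fract]
      push_cast
      ring
    rw [h1]
    have h2 : ∀ i, |Int.fract (t₂ * τ k i) - Int.fract (t₁ * τ k i)| ≤ 1 / M := fun i => by
      have h3 : ⌊M * Int.fract (t₁ * τ k i)⌋₊ = ⌊M * Int.fract (t₂ * τ k i)⌋₊ :=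
        congrArg (fun c => (c k i).1) heq
      have a1 := Nat.floor_le (a := M * Int.fract (t₁ * τ k i)) (by positivity)
      have a2 := Nat.lt_floor_add_one (M * Int.fract (t₁ * τ k i))
      have a3 := Nat.floor_le (a := M * Int.fract (t₂ * τ k i)) (by positivity)
      have a4 := Nat.lt_floor_add_one (M * Int.fract (t₂ * τ k i))
      rw [h3] at a1 a2
      have h4 : |Int.fract (t₂ * τ k i) - Int.fract (t₁ * τ k i)| * M ≤ 1 := by
        nth_rewrite 1 [← abs_of_pos hM0]
        rw [← abs_mul, abs_le]
        constructor <;> nlinarith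
      rwa [le_div_iff₀ hM0]
    calc _ ≤ ∑ i, 1 / M * ‖placeEmb w (ω i)‖ := by
          refine (norm_sum_le _ _).trans (Finset.sum_le_sum fun i _ => ?_)
          rw [norm_mul, Complex.norm_real, Real.norm_eq_abs]
          exact mul_le_mul_of_nonneg_right (h2 i) (norm_nonneg _)
      _ = 1 / M * ∑ i, ‖placeEmb w (ω i)‖ := by rw [Finset.mul_sum]
      _ ≤ 1 / M * ∑ w : InfinitePlace K, ∑ i, ‖placeEmb w (ω i)‖ := by
          refine mul_le_mul_of_nonneg_left ?_ (by positivity)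
          exact Finset.single_le_sum (f := fun w : InfinitePlace K => ∑ i, ‖placeEmb w (ω i)‖)
            (fun w _ => by positivity) (Finset.mem_univ w)
      _ ≤ η := by
          rw [one_div, inv_mul_le_iff₀ hM0]
          linarith
  · simp [hτ0 k hk]

lemma exists_one_le_norm_placeEmb {K : Type*} [Field K] [NumberField K] (x : 𝓞 K) (hx : x ≠ 0) :
    ∃ w, 1 ≤ ‖placeEmb w x‖ := by
  by_contra! h
  obtain ⟨w⟩ : Nonempty (InfinitePlace K) := inferInstance
  refine absurd (h w) (not_lt.2 ?_)
  rw [norm_placeEmb]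
  exact InfinitePlace.one_le_of_lt_one hx fun z _ => by rw [← norm_placeEmb]; exact h z

lemma finite_setOf_norm_placeEmb_le (R : ℝ) : {x : 𝓞 K | ∀ w, ‖placeEmb w x‖ ≤ R}.Finite := by
  refine Set.Finite.subset ((Embeddings.finite_of_norm_le K ℂ R).preimage
    (f := algebraMap (𝓞 K) K) (RingOfIntegers.coe_injective.injOn)) ?_
  intro x hx
  refine ⟨x.2, fun φ => ?_⟩
  have := hx (InfinitePlace.mk φ)
  rwa [norm_placeEmb] at this

end Approximation

section Reduction

open NumberField

variable {K : Type*} [Field K] [NumberField K] {n : ℕ}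

/-- The total norm of a vector with respect to a family of hermitian pairings. -/
noncomputable def totalNorm (B : InfinitePlace K → (Fin n → K) → (Fin n → K) → ℂ)
    (x : Fin n → K) : ℝ := ∑ w, (B w x x).re

/-- A basis consisting of vectors of a lattice is reduced if its members approximately realize the
successive minima and are approximately size-reduced. -/
structure IsReducedBasis (Λ : Submodule (𝓞 K) (Fin n → K)) (C : ℝ)
    (B : InfinitePlace K → (Fin n → K) → (Fin n → K) → ℂ) (v : Fin n → Fin n → K) : Prop where
  mem : ∀ k, v k ∈ Λ
  li : LinearIndependent K v
  min : ∀ i, ∀ x ∈ Λ, x ∉ Submodule.span K (v '' Set.Iio i) → totalNorm B (v i) < 2 * totalNorm B x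
  small : ∀ i j, i < j → ∀ w, ‖B w (v i) (v j)‖ < C * totalNorm B (v i)

variable {E : Type*} [NormedAddCommGroup E] [InnerProductSpace ℂ E]

/-- The family of hermitian pairings induced by maps to a hermitian space. -/
noncomputable def pairingOf (u : ∀ w : InfinitePlace K, (Fin n → K) →ₛₗ[w.embedding] E) :
    InfinitePlace K → (Fin n → K) → (Fin n → K) → ℂ := fun w x y => inner ℂ (u w x) (u w y)

variable {Λ : Submodule (𝓞 K) (Fin n → K)} {C : ℝ}
  {u : ∀ w : InfinitePlace K, (Fin n → K) →ₛₗ[w.embedding] E} {v v' : Fin n → Fin n → K}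

lemma totalNorm_pairingOf (u : ∀ w : InfinitePlace K, (Fin n → K) →ₛₗ[w.embedding] E)
    (x : Fin n → K) : totalNorm (pairingOf u) x = ∑ w, ‖u w x‖ ^ 2 := by
  refine Finset.sum_congr rfl fun w _ => ?_
  rw [pairingOf, inner_self_eq_norm_sq_to_K]
  norm_cast

/-- The total norm of a linear combination with independent coefficients at each place. -/
noncomputable def combNorm (u : ∀ w : InfinitePlace K, (Fin n → K) →ₛₗ[w.embedding] E)
    (v : Fin n → Fin n → K) (c : Fin n → InfinitePlace K → ℂ) : ℝ :=
  ∑ w, ‖∑ k, c k w • u w (v k)‖ ^ 2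

lemma totalNorm_sum_smul (μ : Fin n → K) :
    totalNorm (pairingOf u) (∑ k, μ k • v k) = combNorm u v fun k w => w.embedding (μ k) := by
  rw [totalNorm_pairingOf, combNorm]
  simp [map_sum]

lemma combNorm_nonneg (c : Fin n → InfinitePlace K → ℂ) : 0 ≤ combNorm u v c :=
  Finset.sum_nonneg fun _ _ => by positivity

lemma totalNorm_nonneg (x : Fin n → K) : 0 ≤ totalNorm (pairingOf u) x := by
  rw [totalNorm_pairingOf]
  exact Finset.sum_nonneg fun _ _ => by positivity

lemma norm_sq_le_totalNorm (w : InfinitePlace K) (x : Fin n → K) :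
    ‖u w x‖ ^ 2 ≤ totalNorm (pairingOf u) x := by
  rw [totalNorm_pairingOf]
  exact Finset.single_le_sum (f := fun w => ‖u w x‖ ^ 2) (fun w _ => by positivity)
    (Finset.mem_univ w)

lemma combNorm_add_le (c c' : Fin n → InfinitePlace K → ℂ) :
    combNorm u v (c + c') ≤ 2 * combNorm u v c + 2 * combNorm u v c' := by
  simp only [combNorm, Finset.mul_sum, ← Finset.sum_add_distrib]
  refine Finset.sum_le_sum fun w _ => ?_
  simp only [Pi.add_apply, add_smul, Finset.sum_add_distrib]
  set a := ∑ k, c k w • u w (v k)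
  set b := ∑ k, c' k w • u w (v k)
  nlinarith [norm_add_le a b, norm_nonneg (a + b), norm_nonneg a, norm_nonneg b,
    sq_nonneg (‖a‖ - ‖b‖)]

lemma combNorm_smul (r : ℝ) (c : Fin n → InfinitePlace K → ℂ) :
    combNorm u v (fun k w => r * c k w) = r ^ 2 * combNorm u v c := by
  simp only [combNorm, Finset.mul_sum]
  refine Finset.sum_congr rfl fun w _ => ?_
  rw [Finset.sum_congr rfl fun k _ => mul_smul (r : ℂ) (c k w) _, ← Finset.smul_sum, norm_smul,
    mul_pow, Complex.norm_real, Real.norm_eq_abs, sq_abs]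

lemma combNorm_le (c : Fin n → InfinitePlace K → ℂ) (s : Fin n → ℝ) (hs : ∀ k, 0 ≤ s k)
    (h : ∀ k w, ‖c k w‖ ^ 2 * totalNorm (pairingOf u) (v k) ≤ s k) :
    combNorm u v c ≤ n * ∑ k, s k := by
  have h1 : ∀ k, ∑ w, ‖c k w • u w (v k)‖ ^ 2 ≤ s k := fun k => by
    rcases (totalNorm_nonneg (u := u) (v k)).eq_or_lt with h0 | h0
    · refine le_trans (le_of_eq (Finset.sum_eq_zero fun w _ => ?_)) (hs k)
      have := norm_sq_le_totalNorm (u := u) w (v k)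
      have h2 : ‖u w (v k)‖ ^ 2 = 0 := le_antisymm (by linarith) (by positivity)
      rw [norm_smul, mul_pow, h2, mul_zero]
    · refine le_of_mul_le_mul_right ?_ h0
      rw [Finset.sum_mul]
      calc _ ≤ ∑ w, s k * ‖u w (v k)‖ ^ 2 := by
            refine Finset.sum_le_sum fun w _ => ?_
            rw [norm_smul, mul_pow]
            nlinarith [h k w, sq_nonneg ‖u w (v k)‖]
        _ = _ := by rw [← Finset.mul_sum, totalNorm_pairingOf]
  calc combNorm u v c ≤ ∑ w, n * ∑ k, ‖c k w • u w (v k)‖ ^ 2 := by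
        refine Finset.sum_le_sum fun w _ => ?_
        calc _ ≤ (∑ k, ‖c k w • u w (v k)‖) ^ 2 := by
              gcongr
              exact norm_sum_le _ _
          _ ≤ _ := by
              simpa using sq_sum_le_card_mul_sum_sq (s := Finset.univ)
                (f := fun k => ‖c k w • u w (v k)‖)
    _ = n * ∑ k, ∑ w, ‖c k w • u w (v k)‖ ^ 2 := by
        rw [← Finset.mul_sum, Finset.sum_comm]
    _ ≤ _ := by gcongr with k; exact h1 k

namespace IsReducedBasis

lemma notMem_span (h : IsReducedBasis Λ C (pairingOf u) v) {i : Fin n} {μ : Fin n → K}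
    (hi : μ i ≠ 0) (h0 : ∀ k, i < k → μ k = 0) :
    ∑ k, μ k • v k ∉ Submodule.span K (v '' Set.Iio i) := by
  intro hmem
  refine h.li.notMem_span_image (s := Set.Iio i) (x := i) (by simp) ?_
  have h1 : ∑ k ∈ Finset.univ.erase i, μ k • v k ∈ Submodule.span K (v '' Set.Iio i) := by
    refine Submodule.sum_mem _ fun k hk => ?_
    rcases lt_trichotomy k i with hlt | rfl | hlt
    · exact Submodule.smul_mem _ _ (Submodule.subset_span ⟨k, hlt, rfl⟩)
    · simp at hk
    · rw [h0 k hlt, zero_smul]; exact Submodule.zero_mem _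
  rw [← Finset.add_sum_erase _ _ (Finset.mem_univ i)] at hmem
  have := (Submodule.add_mem_iff_left _ h1).1 hmem
  exact (Submodule.smul_mem_iff _ hi).1 this

lemma pos (h : IsReducedBasis Λ C (pairingOf u) v) (i : Fin n) : 0 < totalNorm (pairingOf u) (v i) := by
  have := h.min i _ (h.mem i) (h.li.notMem_span_image (by simp))
  linarith

lemma le_two_mul (h : IsReducedBasis Λ C (pairingOf u) v) {k i : Fin n} (hki : k ≤ i) :
    totalNorm (pairingOf u) (v k) ≤ 2 * totalNorm (pairingOf u) (v i) :=
  (h.min k _ (h.mem i) (h.li.notMem_span_image (by simpa using hki))).le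

end IsReducedBasis

end Reduction

section CompactnessOfReduction

open NumberField

variable {n : ℕ} {E : Type*} [NormedAddCommGroup E] [InnerProductSpace ℂ E]

lemma exists_leading_coeff_bound (K : Type*) [Field K] [NumberField K] (n : ℕ) :
    ∃ ε : ℝ, 0 < ε ∧ ∀ {E : Type} [NormedAddCommGroup E] [InnerProductSpace ℂ E]
      {Λ : Submodule (𝓞 K) (Fin n → K)} {C : ℝ}
      {u : ∀ w : InfinitePlace K, (Fin n → K) →ₛₗ[w.embedding] E} {v : Fin n → Fin n → K},
      IsReducedBasis Λ C (pairingOf u) v → ∀ (c : Fin n → InfinitePlace K → ℂ), (∀ k, RealFam (c k)) →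
      ∀ i, (∀ k, i < k → c k = 0) → ∀ w, ε * ‖c i w‖ ^ 2 * totalNorm (pairingOf u) (v i) ≤
        combNorm u v c := by
  have hη : (0 : ℝ) < 1 / (4 * (n + 1)) := by positivity
  obtain ⟨T, hT, happ⟩ := exists_simultaneous_approx K n _ hη
  set η : ℝ := 1 / (4 * (n + 1)) with hηdef
  have hn1 : n * η ≤ 1 / 4 := by
    rw [hηdef, mul_one_div, div_le_div_iff₀ (by positivity) (by positivity)]; linarith
  have hT0 : (0 : ℝ) < T := by exact_mod_cast hT
  refine ⟨1 / (8 * T ^ 2), by positivity, ?_⟩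
  intro E _ _ Λ C u v h c hc i h0 w
  obtain ⟨w₀, hw₀⟩ := Finite.exists_max fun w => ‖c i w‖
  rcases (norm_nonneg (c i w₀)).eq_or_lt with hm | hm
  · have : ‖c i w‖ = 0 := le_antisymm (by linarith [hw₀ w]) (norm_nonneg _)
    rw [this]
    simpa using combNorm_nonneg (u := u) (v := v) c
  set m := ‖c i w₀‖ with hmdef
  let μ : Fin n → InfinitePlace K → ℂ := fun k w => ((m⁻¹ : ℝ) : ℂ) * c k w
  have hμ : ∀ k, RealFam (μ k) := fun k w hw => by
    simp only [μ, Complex.im_ofReal_mul]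
    rw [hc k w hw, mul_zero]
  obtain ⟨t, ht1, htT, α, hα, hα0⟩ := happ μ hμ
  have ht1' : (1 : ℝ) ≤ t := by exact_mod_cast ht1
  have htT' : (t : ℝ) ≤ T := by exact_mod_cast htT
  have hμi : ‖μ i w₀‖ = 1 := by
    simp only [μ, norm_mul, Complex.norm_real, norm_inv, Real.norm_eq_abs, abs_of_pos hm]
    exact inv_mul_cancel₀ hm.ne'
  have hαi : α i ≠ 0 := by
    intro h1
    have := hα i w₀
    rw [h1, map_zero, sub_zero, norm_mul, hμi, Complex.norm_natCast, mul_one] at this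
    have : η ≤ 1 / 4 := by
      rw [hηdef, div_le_div_iff₀ (by positivity) (by positivity)]
      have : (0 : ℝ) ≤ n := by positivity
      linarith
    linarith
  have hαk : ∀ k, i < k → α k = 0 := fun k hk => hα0 k fun w => by simp [μ, h0 k hk]
  have hlt := h.min i (∑ k, (α k : K) • v k)
    (Submodule.sum_mem _ fun k _ => Λ.smul_mem (α k) (h.mem k))
    (h.notMem_span (by exact_mod_cast hαi) fun k hk => by rw [hαk k hk]; rfl)
  rw [totalNorm_sum_smul] at hlt
  have hle := combNorm_add_le (u := u) (v := v) (fun k w => ((t : ℝ) : ℂ) * μ k w)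
    (fun k w => placeEmb w (α k) - t * μ k w)
  have hsum : ((fun k w => ((t : ℝ) : ℂ) * μ k w) + (fun k w => placeEmb w (α k) - t * μ k w)) =
      fun k w => w.embedding (α k : K) := by
    funext k w
    simp [placeEmb]
  rw [hsum, combNorm_smul, combNorm_smul] at hle
  have hpos := h.pos i
  have hrest : combNorm u v (fun k w => placeEmb w (α k) - t * μ k w) ≤
      n * ∑ k : Fin n, η ^ 2 * (2 * totalNorm (pairingOf u) (v i)) := by
    refine combNorm_le _ _ (fun _ => by positivity) fun k w => ?_
    rcases le_or_gt k i with hk | hk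
    · refine mul_le_mul ?_ (h.le_two_mul hk) (totalNorm_nonneg _) (by positivity)
      rw [norm_sub_rev]
      exact pow_le_pow_left₀ (norm_nonneg _) (hα k w) 2
    · rw [hαk k hk]
      simp only [μ, h0 k hk]
      simp only [map_zero, Pi.zero_apply, mul_zero, sub_zero, norm_zero]
      rw [zero_pow two_ne_zero, zero_mul]
      positivity
  simp only [Finset.sum_const, Finset.card_univ, Fintype.card_fin, nsmul_eq_mul] at hrest
  set l := totalNorm (pairingOf u) (v i)
  have h5 : (n : ℝ) * (n * (η ^ 2 * (2 * l))) ≤ l / 8 := by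
    have : (n * η) ^ 2 ≤ (1 / 4) ^ 2 := pow_le_pow_left₀ (by positivity) hn1 2
    nlinarith
  have hS : (0 : ℝ) ≤ combNorm u v c := combNorm_nonneg c
  have h6 : (t : ℝ) ^ 2 * (m⁻¹ ^ 2 * combNorm u v c) ≤ T ^ 2 * (m⁻¹ ^ 2 * combNorm u v c) := by
    gcongr
  have h7 : l ≤ 8 * T ^ 2 * (m⁻¹ ^ 2 * combNorm u v c) := by linarith
  have h8 : ‖c i w‖ ^ 2 ≤ m ^ 2 := pow_le_pow_left₀ (norm_nonneg _) (hw₀ w) 2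
  calc 1 / (8 * (T : ℝ) ^ 2) * ‖c i w‖ ^ 2 * l ≤ 1 / (8 * (T : ℝ) ^ 2) * m ^ 2 *
        (8 * T ^ 2 * (m⁻¹ ^ 2 * combNorm u v c)) := by gcongr
    _ = combNorm u v c := by field_simp

lemma exists_coeff_bound (K : Type*) [Field K] [NumberField K] (n : ℕ) :
    ∃ ε : ℝ, 0 < ε ∧ ∀ {E : Type} [NormedAddCommGroup E] [InnerProductSpace ℂ E]
      {Λ : Submodule (𝓞 K) (Fin n → K)} {C : ℝ}
      {u : ∀ w : InfinitePlace K, (Fin n → K) →ₛₗ[w.embedding] E} {v : Fin n → Fin n → K},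
      IsReducedBasis Λ C (pairingOf u) v → ∀ (c : Fin n → InfinitePlace K → ℂ), (∀ k, RealFam (c k)) →
      ∀ i w, ε * ‖c i w‖ ^ 2 * totalNorm (pairingOf u) (v i) ≤ combNorm u v c := by
  obtain ⟨ε₀, hε₀, H₀⟩ := exists_leading_coeff_bound K n
  suffices ∀ m : ℕ, ∃ ε : ℝ, 0 < ε ∧ ∀ {E : Type} [NormedAddCommGroup E] [InnerProductSpace ℂ E]
      {Λ : Submodule (𝓞 K) (Fin n → K)} {C : ℝ}
      {u : ∀ w : InfinitePlace K, (Fin n → K) →ₛₗ[w.embedding] E} {v : Fin n → Fin n → K},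
      IsReducedBasis Λ C (pairingOf u) v → ∀ (c : Fin n → InfinitePlace K → ℂ), (∀ k, RealFam (c k)) →
      ∀ i : Fin n, n ≤ i + m → ∀ w, ε * ‖c i w‖ ^ 2 * totalNorm (pairingOf u) (v i) ≤
        combNorm u v c by
    obtain ⟨ε, hε, H⟩ := this n
    exact ⟨ε, hε, fun h c hc i w => H h c hc i (by omega) w⟩
  intro m
  induction m with
  | zero => exact ⟨1, one_pos, fun _ _ _ i hi => absurd i.2 (by omega)⟩
  | succ m ih =>
    obtain ⟨ε, hε, H⟩ := ih
    have hM : (0 : ℝ) < 2 + 2 * (n * (n * ε⁻¹)) := by positivity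
    refine ⟨min ε (ε₀ / (2 + 2 * (n * (n * ε⁻¹)))), by positivity, ?_⟩
    intro E _ _ Λ C u v h c hc i hi w
    have hl := h.pos i
    by_cases hi' : n ≤ i + m
    · refine le_trans ?_ (H h c hc i hi' w)
      gcongr
      exact min_le_left _ _
    have hS := combNorm_nonneg (u := u) (v := v) c
    have h1 := H₀ h (fun k => if k ≤ i then c k else 0) (fun k => by
      split_ifs
      · exact hc k
      · intro w _; simp) i (fun k hk => if_neg (not_le.2 hk)) w
    have h2 : combNorm u v (fun k => if k ≤ i then c k else 0) ≤
        2 * combNorm u v c + 2 * combNorm u v (fun k => if k ≤ i then 0 else -c k) := by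
      refine le_trans (le_of_eq (congrArg _ ?_)) (combNorm_add_le _ _)
      funext k
      by_cases hk : k ≤ i <;> simp [hk]
    have h3 : combNorm u v (fun k => if k ≤ i then 0 else -c k) ≤
        n * ∑ k : Fin n, ε⁻¹ * combNorm u v c := by
      refine combNorm_le _ _ (fun _ => by positivity) fun k w => ?_
      by_cases hk : k ≤ i
      · simp only [hk, if_true, Pi.zero_apply, norm_zero]
        rw [zero_pow two_ne_zero, zero_mul]
        positivity
      · simp only [hk, if_false, Pi.neg_apply, norm_neg]
        have := H h c hc k (by rw [not_le, Fin.lt_def] at hk; omega) w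
        rw [le_inv_mul_iff₀ hε]
        linarith
    simp only [Finset.sum_const, Finset.card_univ, Fintype.card_fin, nsmul_eq_mul] at h3
    simp only [le_refl, if_true] at h1
    have h4 : ε₀ * ‖c i w‖ ^ 2 * totalNorm (pairingOf u) (v i) ≤
        (2 + 2 * (n * (n * ε⁻¹))) * combNorm u v c := by linarith
    calc _ ≤ ε₀ / (2 + 2 * (n * (n * ε⁻¹))) * ‖c i w‖ ^ 2 * totalNorm (pairingOf u) (v i) := by
          gcongr
          exact min_le_right _ _
      _ = (ε₀ * ‖c i w‖ ^ 2 * totalNorm (pairingOf u) (v i)) / (2 + 2 * (n * (n * ε⁻¹))) := by ring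
      _ ≤ _ := by rw [div_le_iff₀ hM]; linarith

/-- The index of the lattice spanned by a reduced basis is bounded. -/
lemma exists_index_bound (K : Type*) [Field K] [NumberField K] (n : ℕ) :
    ∃ D : ℕ, 1 ≤ D ∧ ∀ {E : Type} [NormedAddCommGroup E] [InnerProductSpace ℂ E]
      {Λ : Submodule (𝓞 K) (Fin n → K)} {C : ℝ}
      {u : ∀ w : InfinitePlace K, (Fin n → K) →ₛₗ[w.embedding] E} {v : Fin n → Fin n → K},
      IsReducedBasis Λ C (pairingOf u) v → ∀ x ∈ Λ, ∃ α : Fin n → 𝓞 K,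
        (D : K) • x = ∑ k, (α k : K) • v k := by
  have hη : (0 : ℝ) < 1 / (2 * (n + 1)) := by positivity
  obtain ⟨T, hT, happ⟩ := exists_simultaneous_approx K n _ hη
  set η : ℝ := 1 / (2 * (n + 1)) with hηdef
  have hn1 : n * η ≤ 1 / 2 := by
    rw [hηdef, mul_one_div, div_le_div_iff₀ (by positivity) (by positivity)]; linarith
  refine ⟨T.factorial, Nat.factorial_pos T, ?_⟩
  intro E _ _ Λ C u v h x hx
  let b := Module.Basis.mk h.li (h.li.span_eq_top_of_card_eq_finrank' (by simp)).ge
  have hxb : ∑ k, b.repr x k • v k = x := by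
    conv_rhs => rw [← b.sum_repr x]
    simp [b]
  set μ := fun k => b.repr x k
  obtain ⟨t, ht1, htT, α, hα, -⟩ := happ (fun k w => w.embedding (μ k)) fun k w hw => by
    change (w.embedding (μ k)).im = 0
    rw [← InfinitePlace.embedding_of_isReal_apply hw]
    exact Complex.ofReal_im _
  have hd : ∀ k, (t : K) * μ k - α k = 0 := by
    by_contra! hne
    obtain ⟨i, hi, hmax⟩ : ∃ i, (t : K) * μ i - α i ≠ 0 ∧
        ∀ k, i < k → (t : K) * μ k - α k = 0 := by
      obtain ⟨i, hi⟩ := (Set.toFinite {k | (t : K) * μ k - α k ≠ 0}).exists_maximal hne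
      refine ⟨i, hi.1, fun k hk => ?_⟩
      by_contra hk'
      exact absurd (hi.2 hk' hk.le) (not_le.2 hk)
    have hmem : ∑ k, ((t : K) * μ k - α k) • v k ∈ Λ := by
      have : ∑ k, ((t : K) * μ k - α k) • v k = (t : 𝓞 K) • x - ∑ k, α k • v k := by
        rw [← hxb, Finset.smul_sum, ← Finset.sum_sub_distrib]
        refine Finset.sum_congr rfl fun k _ => ?_
        rw [sub_smul, mul_smul]
        congr 1
      rw [this]
      exact Λ.sub_mem (Λ.smul_mem _ hx) (Λ.sum_mem fun k _ => Λ.smul_mem _ (h.mem k))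
    have hlt := h.min i _ hmem (h.notMem_span hi hmax)
    have hpos := h.pos i
    rw [totalNorm_sum_smul] at hlt
    have hrest : combNorm u v (fun k w => w.embedding ((t : K) * μ k - α k)) ≤
        n * ∑ k : Fin n, η ^ 2 * (2 * totalNorm (pairingOf u) (v i)) := by
      refine combNorm_le _ _ (fun _ => by positivity) fun k w => ?_
      rcases le_or_gt k i with hk | hk
      · refine mul_le_mul ?_ (h.le_two_mul hk) (totalNorm_nonneg _) (by positivity)
        have := hα k w
        refine pow_le_pow_left₀ (norm_nonneg _) ?_ 2
        rw [map_sub, map_mul, map_natCast]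
        exact this
      · rw [hmax k hk, map_zero, norm_zero]
        simp only [ne_eq, OfNat.ofNat_ne_zero, not_false_eq_true, zero_pow, zero_mul]
        positivity
    simp only [Finset.sum_const, Finset.card_univ, Fintype.card_fin, nsmul_eq_mul] at hrest
    have : (n * η) ^ 2 ≤ (1 / 2) ^ 2 := pow_le_pow_left₀ (by positivity) hn1 2
    nlinarith
  obtain ⟨s, hs⟩ := Nat.dvd_factorial ht1 htT
  refine ⟨fun k => s * α k, ?_⟩
  rw [← hxb, Finset.smul_sum]
  refine Finset.sum_congr rfl fun k _ => ?_
  rw [smul_smul]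
  congr 1
  calc (T.factorial : K) * b.repr x k = (s : K) * (t * μ k) := by rw [hs]; push_cast; ring
    _ = algebraMap (𝓞 K) K s * algebraMap (𝓞 K) K (α k) := by
      rw [map_natCast, sub_eq_zero.1 (hd k)]
    _ = _ := (map_mul _ _ _).symm

end CompactnessOfReduction

section FinitenessOfReduction

open NumberField

variable {K : Type*} [Field K] [NumberField K] {n : ℕ} {E : Type} [NormedAddCommGroup E]
  [InnerProductSpace ℂ E] {Λ : Submodule (𝓞 K) (Fin n → K)} {C : ℝ}
  {u : ∀ w : InfinitePlace K, (Fin n → K) →ₛₗ[w.embedding] E} {v v' : Fin n → Fin n → K}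

open Classical in
lemma combNorm_single (w : InfinitePlace K) (c : Fin n → ℂ) :
    combNorm u v (fun k w' => if w' = w then c k else 0) = ‖∑ k, c k • u w (v k)‖ ^ 2 := by
  rw [combNorm, Finset.sum_eq_single w]
  · simp
  · intro w' _ h
    simp [h]
  · simp

lemma totalNorm_natCast_smul (D : ℕ) (x : Fin n → K) :
    totalNorm (pairingOf u) ((D : K) • x) = D ^ 2 * totalNorm (pairingOf u) x := by
  simp only [totalNorm_pairingOf, Finset.mul_sum, map_smulₛₗ, map_natCast, norm_smul, mul_pow,
    Complex.norm_natCast]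

lemma IsReducedBasis.norm_pairing_le (hC : 1 ≤ C) (h : IsReducedBasis Λ C (pairingOf u) v)
    (w : InfinitePlace K) (k j : Fin n) :
    ‖inner ℂ (u w (v k)) (u w (v j))‖ ≤ 2 * C * totalNorm (pairingOf u) (v k) := by
  have h1 := h.pos k
  rcases lt_trichotomy k j with hkj | rfl | hkj
  · have := h.small k j hkj w
    rw [pairingOf] at this
    nlinarith
  · have := norm_sq_le_totalNorm (u := u) w (v k)
    refine (norm_inner_le_norm _ _).trans ?_
    nlinarith
  · have := h.small j k hkj w
    rw [pairingOf, norm_inner_symm] at this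
    have h2 := h.le_two_mul hkj.le
    nlinarith

lemma exists_cross_pairing_bound (K : Type*) [Field K] [NumberField K] (n : ℕ) (C : ℝ)
    (hC : 1 ≤ C) : ∃ C₁ : ℝ, 0 < C₁ ∧ ∀ {E : Type} [NormedAddCommGroup E] [InnerProductSpace ℂ E]
      {Λ : Submodule (𝓞 K) (Fin n → K)}
      {u : ∀ w : InfinitePlace K, (Fin n → K) →ₛₗ[w.embedding] E} {v v' : Fin n → Fin n → K},
      IsReducedBasis Λ C (pairingOf u) v → IsReducedBasis Λ C (pairingOf u) v' →
      ∀ w i j, ‖inner ℂ (u w (v i)) (u w (v' j))‖ ≤ C₁ * totalNorm (pairingOf u) (v i) := by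
  obtain ⟨ε, hε, H⟩ := exists_coeff_bound K n
  obtain ⟨D, hD, HD⟩ := exists_index_bound K n
  have hD' : (1 : ℝ) ≤ D := by exact_mod_cast hD
  refine ⟨1 + n * (2 * C * (D ^ 2 / ε)), by positivity, ?_⟩
  intro E _ _ Λ u v v' h h' w i j
  obtain ⟨α, hα⟩ := HD h' (v i) (h.mem i)
  have hpos := h.pos i
  set l := totalNorm (pairingOf u) (v i)
  have hcomb : combNorm u v' (fun k w => placeEmb w (α k)) = D ^ 2 * l := by
    rw [← totalNorm_natCast_smul, hα, totalNorm_sum_smul]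
    rfl
  have hb := fun k w => H h' (fun k w => placeEmb w (α k)) (fun k => realFam_placeEmb _) k w
  rw [hcomb] at hb
  have hk : ∀ k, ‖placeEmb w (α k)‖ * totalNorm (pairingOf u) (v' k) ≤ D ^ 2 / ε * l := by
    intro k
    have hp := h'.pos k
    by_cases hk0 : α k = 0
    · rw [hk0, map_zero, norm_zero, zero_mul]
      positivity
    obtain ⟨w₀, hw₀⟩ := exists_one_le_norm_placeEmb (α k) hk0
    have h1 : ε * totalNorm (pairingOf u) (v' k) ≤ D ^ 2 * l := by
      refine le_trans ?_ (hb k w₀)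
      have : (1 : ℝ) ≤ ‖placeEmb w₀ (α k)‖ ^ 2 := one_le_pow₀ hw₀
      gcongr
      nlinarith
    have h2 := hb k w
    rw [div_mul_eq_mul_div, le_div_iff₀ hε]
    refine abs_le_of_sq_le_sq' ?_ (by positivity) |>.2
    calc _ = (ε * ‖placeEmb w (α k)‖ ^ 2 * totalNorm (pairingOf u) (v' k)) *
          (ε * totalNorm (pairingOf u) (v' k)) := by ring
      _ ≤ (D ^ 2 * l) * (D ^ 2 * l) := by gcongr
      _ = _ := by ring
  have hD2 : (D : ℝ) * ‖inner ℂ (u w (v i)) (u w (v' j))‖ ≤ n * (2 * C * (D ^ 2 / ε)) * l := by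
    calc (D : ℝ) * ‖inner ℂ (u w (v i)) (u w (v' j))‖
        = ‖inner ℂ (u w ((D : K) • v i)) (u w (v' j))‖ := by
          rw [map_smulₛₗ, map_natCast, inner_smul_left, norm_mul]
          simp
      _ = ‖∑ k, inner ℂ (placeEmb w (α k) • u w (v' k)) (u w (v' j))‖ := by
          rw [hα, map_sum, sum_inner]
          simp only [map_smulₛₗ]
          rfl
      _ ≤ ∑ k : Fin n, 2 * C * (D ^ 2 / ε * l) := by
          refine (norm_sum_le _ _).trans (Finset.sum_le_sum fun k _ => ?_)
          rw [inner_smul_left, norm_mul, RCLike.norm_conj]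
          have := h'.norm_pairing_le hC w k j
          calc _ ≤ ‖placeEmb w (α k)‖ * (2 * C * totalNorm (pairingOf u) (v' k)) := by gcongr
            _ = 2 * C * (‖placeEmb w (α k)‖ * totalNorm (pairingOf u) (v' k)) := by ring
            _ ≤ _ := mul_le_mul_of_nonneg_left (hk k) (by positivity)
      _ = _ := by
          simp only [Finset.sum_const, Finset.card_univ, Fintype.card_fin, nsmul_eq_mul]
          ring
  have := norm_nonneg (inner ℂ (u w (v i)) (u w (v' j)))
  nlinarith

lemma exists_transition_bound (K : Type*) [Field K] [NumberField K] (n : ℕ) (C : ℝ)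
    (hC : 1 ≤ C) : ∃ (D : ℕ) (R : ℝ), 1 ≤ D ∧
      ∀ {E : Type} [NormedAddCommGroup E] [InnerProductSpace ℂ E]
      {Λ : Submodule (𝓞 K) (Fin n → K)}
      {u : ∀ w : InfinitePlace K, (Fin n → K) →ₛₗ[w.embedding] E} {v v' : Fin n → Fin n → K},
      IsReducedBasis Λ C (pairingOf u) v → IsReducedBasis Λ C (pairingOf u) v' →
      ∀ j, ∃ β : Fin n → 𝓞 K, (D : K) • v' j = ∑ k, (β k : K) • v k ∧
        ∀ k w, ‖placeEmb w (β k)‖ ≤ R := by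
  obtain ⟨ε, hε, H⟩ := exists_coeff_bound K n
  obtain ⟨D, hD, HD⟩ := exists_index_bound K n
  obtain ⟨C₁, hC₁, HC₁⟩ := exists_cross_pairing_bound K n C hC
  suffices ∀ m : ℕ, ∃ R : ℝ, 0 ≤ R ∧ ∀ {E : Type} [NormedAddCommGroup E] [InnerProductSpace ℂ E]
      {Λ : Submodule (𝓞 K) (Fin n → K)}
      {u : ∀ w : InfinitePlace K, (Fin n → K) →ₛₗ[w.embedding] E} {v v' : Fin n → Fin n → K},
      IsReducedBasis Λ C (pairingOf u) v → IsReducedBasis Λ C (pairingOf u) v' →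
      ∀ j, ∀ β : Fin n → 𝓞 K, (D : K) • v' j = ∑ k, (β k : K) • v k → ∀ w,
        ∀ i : Fin n, n ≤ i + m → ‖placeEmb w (β i)‖ ≤ R by
    obtain ⟨R, hR, HR⟩ := this n
    refine ⟨D, R, hD, fun h h' j => ?_⟩
    obtain ⟨β, hβ⟩ := HD h _ (h'.mem j)
    exact ⟨β, hβ, fun k w => HR h h' j β hβ w k (by omega)⟩
  intro m
  induction m with
  | zero => exact ⟨1, zero_le_one, fun _ _ _ _ _ _ i hi => absurd i.2 (by omega)⟩
  | succ m ih =>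
    obtain ⟨R, hR, HR⟩ := ih
    set C₃ := D * C₁ + n * (R * (2 * C)) with hC₃
    have hC₃0 : 0 ≤ C₃ := by positivity
    refine ⟨max R (1 + 2 * n ^ 2 * C₃ ^ 2 / ε ^ 2), by positivity, ?_⟩
    intro E _ _ Λ u v v' h h' j β hβ w i hi
    by_cases hi' : n ≤ i + m
    · exact (HR h h' j β hβ w i hi').trans (le_max_left _ _)
    refine le_trans ?_ (le_max_right _ _)
    have hn0 : (0 : ℝ) < n := by exact_mod_cast i.pos
    have hn1 : (1 : ℝ) ≤ n := by exact_mod_cast i.pos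
    set c : Fin n → ℂ := fun k => placeEmb w (β k)
    set c' : Fin n → ℂ := fun k => if k ≤ i then c k else 0
    set y : E := ∑ k, c' k • u w (v k) with hy
    have hsplit : y = (D : ℂ) • u w (v' j) - ∑ k, (if k ≤ i then 0 else c k) • u w (v k) := by
      have : (D : ℂ) • u w (v' j) = ∑ k, c k • u w (v k) := by
        have := congrArg (u w) hβ
        rw [map_smulₛₗ, map_natCast, map_sum] at this
        rw [this]
        simp only [map_smulₛₗ]
        rfl
      rw [this, hy, ← Finset.sum_sub_distrib]
      refine Finset.sum_congr rfl fun k _ => ?_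
      by_cases hk : k ≤ i <;> simp [c', hk]
    have hcoef : ∀ l, l ≤ i → ε * ‖c l‖ ^ 2 * totalNorm (pairingOf u) (v l) ≤ ‖y‖ ^ 2 := by
      intro l hl
      classical
      have := H h (fun k w' => if w' = w then c' k else 0) (fun k w' hw' => by
        change (if w' = w then c' k else 0).im = 0
        split_ifs with hw
        · subst hw
          by_cases hk : k ≤ i
          · simpa [c', hk, c] using realFam_placeEmb (β k) w' hw'
          · simp [c', hk]
        · rfl) l w
      rw [combNorm_single] at this
      simpa only [if_true, c', hl] using this
    have hinner : ∀ l, l ≤ i → ‖inner ℂ (u w (v l)) y‖ ≤ C₃ * totalNorm (pairingOf u) (v l) := by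
      intro l hl
      have hp := h.pos l
      have h1 : ‖∑ k, inner ℂ (u w (v l)) ((if k ≤ i then 0 else c k) • u w (v k))‖ ≤
          ∑ k : Fin n, R * (2 * C * totalNorm (pairingOf u) (v l)) := by
        refine (norm_sum_le _ _).trans (Finset.sum_le_sum fun k _ => ?_)
        rw [inner_smul_right, norm_mul]
        refine mul_le_mul ?_ (h.norm_pairing_le hC w l k) (norm_nonneg _) hR
        split_ifs with hk
        · simpa using hR
        · exact HR h h' j β hβ w k (by rw [not_le, Fin.lt_def] at hk; omega)
      simp only [Finset.sum_const, Finset.card_univ, Fintype.card_fin, nsmul_eq_mul] at h1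
      rw [hsplit, inner_sub_right, inner_smul_right, inner_sum]
      refine (norm_sub_le _ _).trans ?_
      rw [norm_mul, Complex.norm_natCast]
      have h2 : (D : ℝ) * ‖inner ℂ (u w (v l)) (u w (v' j))‖ ≤
          D * (C₁ * totalNorm (pairingOf u) (v l)) := by
        gcongr
        exact HC₁ h h' w l j
      rw [hC₃]
      linarith
    have hpi := h.pos i
    set l₀ := totalNorm (pairingOf u) (v i)
    have hY : ‖y‖ ^ 2 ≤ ∑ l : Fin n, (‖y‖ ^ 2 / (2 * n) + n * C₃ ^ 2 * l₀ / ε) := by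
      have h1 : ‖y‖ ^ 2 = ‖inner ℂ y y‖ := by
        rw [inner_self_eq_norm_sq_to_K]
        simp
      have h1' : inner ℂ y y = ∑ l, inner ℂ (c' l • u w (v l)) y := by
        nth_rewrite 1 [hy]
        rw [sum_inner]
      refine (h1.trans (congrArg _ h1')).le.trans ?_
      refine (norm_sum_le _ _).trans (Finset.sum_le_sum fun l _ => ?_)
      rw [inner_smul_left, norm_mul, RCLike.norm_conj]
      by_cases hl : l ≤ i
      · have h2 := hinner l hl
        have h3 := hcoef l hl
        have h4 := h.le_two_mul hl
        have hp := h.pos l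
        set L := totalNorm (pairingOf u) (v l)
        have h5 : ‖c l‖ * (C₃ * L) ≤ ε * ‖c l‖ ^ 2 * L / (2 * n) + n * C₃ ^ 2 * (L / 2) / ε := by
          have : ε * ‖c l‖ ^ 2 * L / (2 * n) + n * C₃ ^ 2 * (L / 2) / ε - ‖c l‖ * (C₃ * L) =
              L / (2 * n * ε) * (ε * ‖c l‖ - n * C₃) ^ 2 := by
            field_simp
            ring
          have h6 : 0 ≤ L / (2 * n * ε) * (ε * ‖c l‖ - n * C₃) ^ 2 := by positivity
          linarith
        simp only [c', hl, if_true]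
        calc _ ≤ ‖c l‖ * (C₃ * L) := by gcongr
          _ ≤ _ := h5
          _ ≤ _ := by gcongr; linarith
      · simp only [c', hl, if_false, norm_zero, zero_mul]
        positivity
    simp only [Finset.sum_const, Finset.card_univ, Fintype.card_fin, nsmul_eq_mul] at hY
    have hY2 : ‖y‖ ^ 2 ≤ 2 * n ^ 2 * C₃ ^ 2 * l₀ / ε := by
      have : (n : ℝ) * (‖y‖ ^ 2 / (2 * n) + n * C₃ ^ 2 * l₀ / ε) =
        ‖y‖ ^ 2 / 2 + (2 * n ^ 2 * C₃ ^ 2 * l₀ / ε) / 2 := by field_simp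
      linarith
    have h1 := (hcoef i le_rfl).trans hY2
    have h2 : ‖c i‖ ^ 2 ≤ 2 * n ^ 2 * C₃ ^ 2 / ε ^ 2 := by
      rw [le_div_iff₀ (by positivity)]
      rw [le_div_iff₀ hε] at h1
      refine le_of_mul_le_mul_right ?_ hpi
      linarith
    nlinarith [sq_nonneg (‖c i‖ - 1)]

end FinitenessOfReduction

section ReducedLattices

open NumberField

variable {K : Type*} [Field K] [NumberField K] {n : ℕ} {E : Type} [NormedAddCommGroup E]
  [InnerProductSpace ℂ E] {Λ : Submodule (𝓞 K) (Fin n → K)} {C : ℝ}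
  {u : ∀ w : InfinitePlace K, (Fin n → K) →ₛₗ[w.embedding] E} {v v' : Fin n → Fin n → K}

lemma linearIndependent_of_notMem_span_Iio {K : Type*} [Field K] {n : ℕ} {v : Fin n → Fin n → K}
    (h : ∀ i, v i ∉ Submodule.span K (v '' Set.Iio i)) : LinearIndependent K v := by
  rw [Fintype.linearIndependent_iff]
  by_contra! hne
  obtain ⟨g, hg, hne⟩ := hne
  obtain ⟨i, hi⟩ := (Set.toFinite {k | g k ≠ 0}).exists_maximal hne
  refine h i ?_
  have h1 : ∑ k ∈ Finset.univ.erase i, g k • v k ∈ Submodule.span K (v '' Set.Iio i) := by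
    refine Submodule.sum_mem _ fun k hk => ?_
    rcases lt_trichotomy k i with hlt | rfl | hlt
    · exact Submodule.smul_mem _ _ (Submodule.subset_span ⟨k, hlt, rfl⟩)
    · simp at hk
    · have : g k = 0 := by
        by_contra hk'
        exact absurd (hi.2 hk' hlt.le) (not_le.2 hlt)
      rw [this, zero_smul]; exact Submodule.zero_mem _
  rw [← Finset.add_sum_erase _ _ (Finset.mem_univ i)] at hg
  have : g i • v i ∈ Submodule.span K (v '' Set.Iio i) := by
    rw [eq_neg_of_add_eq_zero_left hg]
    exact Submodule.neg_mem _ h1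
  exact (Submodule.smul_mem_iff _ hi.1).1 this

lemma exists_successive_minima (hfin : ∀ R, {x ∈ Λ | totalNorm (pairingOf u) x ≤ R}.Finite)
    (hspan : Submodule.span K (Λ : Set (Fin n → K)) = ⊤) :
    ∃ v : Fin n → Fin n → K, ∀ i, v i ∈ Λ ∧ v i ∉ Submodule.span K (v '' Set.Iio i) ∧
      ∀ x ∈ Λ, x ∉ Submodule.span K (v '' Set.Iio i) →
        totalNorm (pairingOf u) (v i) ≤ totalNorm (pairingOf u) x := by
  have hnext : ∀ S : Submodule K (Fin n → K), ∃ y, S ≠ ⊤ → y ∈ Λ ∧ y ∉ S ∧ ∀ x ∈ Λ, x ∉ S →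
      totalNorm (pairingOf u) y ≤ totalNorm (pairingOf u) x := by
    intro S
    by_cases hS : S = ⊤
    · exact ⟨0, fun h => absurd hS h⟩
    obtain ⟨x₀, hx₀, hx₀'⟩ : ∃ x ∈ Λ, x ∉ S := by
      by_contra! hall
      exact hS (top_le_iff.1 (hspan ▸ Submodule.span_le.2 hall))
    obtain ⟨y, hy, hmin⟩ := Set.exists_min_image
      ({x ∈ Λ | totalNorm (pairingOf u) x ≤ totalNorm (pairingOf u) x₀} ∩ {x | x ∉ S})
      (totalNorm (pairingOf u)) ((hfin _).inter_of_left _) ⟨x₀, ⟨hx₀, le_rfl⟩, hx₀'⟩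
    refine ⟨y, fun _ => ⟨hy.1.1, hy.2, fun x hx hxS => ?_⟩⟩
    rcases le_total (totalNorm (pairingOf u) x) (totalNorm (pairingOf u) x₀) with h | h
    · exact hmin x ⟨⟨hx, h⟩, hxS⟩
    · exact hy.1.2.trans h
  choose g hg using hnext
  obtain ⟨S, hS0, hSs⟩ : ∃ S : ℕ → Submodule K (Fin n → K), S 0 = ⊥ ∧
      ∀ m, S (m + 1) = S m ⊔ Submodule.span K {g (S m)} :=
    ⟨fun m => Nat.rec ⊥ (fun _ T => T ⊔ Submodule.span K {g T}) m, rfl, fun _ => rfl⟩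
  have hS : ∀ m, S m = Submodule.span K ((fun k => g (S k)) '' Set.Iio m) := by
    intro m
    induction m with
    | zero => simp [hS0]
    | succ m ih =>
      have : Set.Iio (m + 1) = insert m (Set.Iio m) := by
        ext k; simp
      rw [this, Set.image_insert_eq, Submodule.span_insert, ← ih, sup_comm, hSs]
  have hfr : ∀ m, Module.finrank K ↥(S m) ≤ m := by
    intro m
    induction m with
    | zero => simp [hS0]
    | succ m ih =>
      rw [hSs]
      refine (Submodule.finrank_add_le_finrank_add_finrank (S m) _).trans ?_
      have : Module.finrank K (Submodule.span K {g (S m)}) ≤ 1 :=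
        (finrank_span_le_card _).trans (by simp)
      omega
  refine ⟨fun i => g (S i), fun i => ?_⟩
  have himg : (fun i : Fin n => g (S i)) '' Set.Iio i = (fun k => g (S k)) '' Set.Iio i.val := by
    ext x
    constructor
    · rintro ⟨k, hk, rfl⟩
      exact ⟨k, hk, rfl⟩
    · rintro ⟨k, hk, rfl⟩
      exact ⟨⟨k, lt_trans hk i.2⟩, hk, rfl⟩
  rw [himg, ← hS]
  refine hg _ fun h => ?_
  have := hfr i
  rw [h, finrank_top, Module.finrank_fin_fun] at this
  omega

lemma norm_add_smul_sq_add (x y : E) (a : ℂ) (hy : y ≠ 0) :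
    ‖x + a • y‖ ^ 2 + ‖inner ℂ y x‖ ^ 2 / ‖y‖ ^ 2 =
      ‖x‖ ^ 2 + ‖a + inner ℂ y x / (‖y‖ ^ 2 : ℝ)‖ ^ 2 * ‖y‖ ^ 2 := by
  have h : ‖y‖ ≠ 0 := norm_ne_zero_iff.2 hy
  rw [norm_add_sq (𝕜 := ℂ), inner_smul_right, norm_smul, mul_pow, ← inner_conj_symm x y]
  set b := inner ℂ y x
  simp only [Complex.sq_norm, Complex.normSq_apply, RCLike.re_to_complex, Complex.mul_re,
    Complex.add_re, Complex.add_im, Complex.conj_re, Complex.conj_im, Complex.div_ofReal_re,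
    Complex.div_ofReal_im]
  field_simp
  ring

lemma exists_isReducedBasis (K : Type*) [Field K] [NumberField K] (n : ℕ) :
    ∃ C : ℝ, 1 ≤ C ∧ ∀ {E : Type} [NormedAddCommGroup E] [InnerProductSpace ℂ E]
      {Λ : Submodule (𝓞 K) (Fin n → K)}
      {u : ∀ w : InfinitePlace K, (Fin n → K) →ₛₗ[w.embedding] E},
      (∀ R, {x ∈ Λ | totalNorm (pairingOf u) x ≤ R}.Finite) →
      Submodule.span K (Λ : Set (Fin n → K)) = ⊤ → (∀ w x, x ≠ 0 → u w x ≠ 0) →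
      (∀ w : InfinitePlace K, w.IsReal → ∀ x y, (inner ℂ (u w x) (u w y)).im = 0) →
      ∃ v, IsReducedBasis Λ C (pairingOf u) v := by
  obtain ⟨C₀, hC₀, happ⟩ := exists_integral_approx K
  refine ⟨C₀ + 1, by linarith, ?_⟩
  intro E _ _ Λ u hfin hspan hpos hreal
  obtain ⟨v, hv⟩ := exists_successive_minima hfin hspan
  have hli := linearIndependent_of_notMem_span_Iio fun i => (hv i).2.1
  have htpos : ∀ x, x ≠ 0 → 0 < totalNorm (pairingOf u) x := fun x hx => by
    obtain ⟨w⟩ : Nonempty (InfinitePlace K) := inferInstance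
    refine lt_of_lt_of_le ?_ (norm_sq_le_totalNorm (u := u) w x)
    have := norm_pos_iff.2 (hpos w x hx)
    positivity
  refine ⟨v, fun k => (hv k).1, hli, fun i x hx hxS => ?_, fun i j hij w => ?_⟩
  · have := (hv i).2.2 x hx hxS
    have := htpos x fun h => hxS (h ▸ Submodule.zero_mem _)
    linarith
  have hne : ∀ w, u w (v i) ≠ 0 := fun w => hpos w _ (hli.ne_zero i)
  have hl := htpos _ (hli.ne_zero i)
  let μ : InfinitePlace K → ℂ := fun w => -(inner ℂ (u w (v i)) (u w (v j)) / (‖u w (v i)‖ ^ 2 : ℝ))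
  obtain ⟨α, hα⟩ := happ μ fun w hw => by
    simp only [μ, Complex.neg_im, Complex.div_ofReal_im, hreal w hw]
    simp
  have hmin := (hv j).2.2 (v j + α • v i) (Λ.add_mem (hv j).1 (Λ.smul_mem _ (hv i).1)) (by
    have h1 : α • v i ∈ Submodule.span K (v '' Set.Iio j) :=
      Submodule.smul_mem _ (α : K) (Submodule.subset_span ⟨i, hij, rfl⟩)
    rw [Submodule.add_mem_iff_left _ h1]
    exact (hv j).2.1)
  rw [totalNorm_pairingOf, totalNorm_pairingOf] at hmin
  have hsum : ∑ w, ‖inner ℂ (u w (v i)) (u w (v j))‖ ^ 2 / ‖u w (v i)‖ ^ 2 ≤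
      C₀ ^ 2 * totalNorm (pairingOf u) (v i) := by
    have h1 : ∀ w, ‖u w (v j + α • v i)‖ ^ 2 +
        ‖inner ℂ (u w (v i)) (u w (v j))‖ ^ 2 / ‖u w (v i)‖ ^ 2 ≤
        ‖u w (v j)‖ ^ 2 + C₀ ^ 2 * ‖u w (v i)‖ ^ 2 := by
      intro w
      have h2 : u w (v j + α • v i) = u w (v j) + placeEmb w α • u w (v i) := by
        rw [map_add]
        congr 1
        exact (u w).map_smulₛₗ (α : K) (v i)
      rw [h2, norm_add_smul_sq_add _ _ _ (hne w)]
      have h3 := hα w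
      simp only [μ, sub_neg_eq_add] at h3
      gcongr
    have h2 := Finset.sum_le_sum fun w (_ : w ∈ Finset.univ) => h1 w
    rw [Finset.sum_add_distrib, Finset.sum_add_distrib, ← Finset.mul_sum] at h2
    rw [totalNorm_pairingOf]
    linarith
  have h3 : ‖inner ℂ (u w (v i)) (u w (v j))‖ ^ 2 / ‖u w (v i)‖ ^ 2 ≤
      C₀ ^ 2 * totalNorm (pairingOf u) (v i) := le_trans
    (Finset.single_le_sum (f := fun w => ‖inner ℂ (u w (v i)) (u w (v j))‖ ^ 2 / ‖u w (v i)‖ ^ 2)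
      (fun _ _ => by positivity) (Finset.mem_univ w)) hsum
  have h4 := norm_pos_iff.2 (hne w)
  rw [div_le_iff₀ (by positivity)] at h3
  have h5 := norm_sq_le_totalNorm (u := u) w (v i)
  have h6 : ‖inner ℂ (u w (v i)) (u w (v j))‖ ≤ C₀ * totalNorm (pairingOf u) (v i) := by
    refine abs_le_of_sq_le_sq' ?_ (by positivity) |>.2
    calc _ ≤ _ := h3
      _ ≤ C₀ ^ 2 * totalNorm (pairingOf u) (v i) * totalNorm (pairingOf u) (v i) := by gcongr
      _ = _ := by ring
  rw [pairingOf]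
  nlinarith

end ReducedLattices

section FormSpace

open NumberField
open scoped ComplexOrder

variable {K : Type*} [Field K] {n : ℕ}

lemma Matrix.PosDef.exists_eq_conjTranspose_mul_self {A : Matrix (Fin n) (Fin n) ℂ}
    (hA : A.PosDef) : ∃ X : Matrix (Fin n) (Fin n) ℂ, A = X.conjTranspose * X := by
  open scoped MatrixOrder in
  obtain ⟨X, hX, -, rfl⟩ := CFC.exists_sqrt_of_isSelfAdjoint_of_quasispectrumRestricts
    hA.posSemidef.isHermitian (QuasispectrumRestricts.nnreal_of_nonneg hA.posSemidef.nonneg)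
  exact ⟨X, by rw [← Matrix.star_eq_conjTranspose, hX.star_eq]⟩

/-- The coordinatewise embedding of a vector at an infinite place. -/
noncomputable def placeVec (w : InfinitePlace K) (x : Fin n → K) : Fin n → ℂ :=
  fun j => w.embedding (x j)

/-- The space of families of positive definite hermitian forms, real at real places. -/
def formSpace (K : Type*) [Field K] (n : ℕ) :
    Set (InfinitePlace K → Fin n → Fin n → ℂ) :=
  {H | (∀ w, (Matrix.of (H w)).PosDef) ∧ ∀ w : InfinitePlace K, w.IsReal → ∀ i j, (H w i j).im = 0}

/-- The hermitian pairing attached to a family of matrices. -/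
noncomputable def formPairing (H : InfinitePlace K → Fin n → Fin n → ℂ) (w : InfinitePlace K)
    (x y : Fin n → K) : ℂ := star (placeVec w x) ⬝ᵥ (Matrix.of (H w)).mulVec (placeVec w y)

lemma formPairing_add (H H' : InfinitePlace K → Fin n → Fin n → ℂ) (w : InfinitePlace K)
    (x y : Fin n → K) : formPairing (H + H') w x y = formPairing H w x y + formPairing H' w x y := by
  rw [formPairing, formPairing, formPairing, ← dotProduct_add, ← Matrix.add_mulVec]
  rfl

lemma formPairing_smul (a : ℝ) (H : InfinitePlace K → Fin n → Fin n → ℂ) (w : InfinitePlace K)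
    (x y : Fin n → K) : formPairing (a • H) w x y = a * formPairing H w x y := by
  rw [formPairing, formPairing, ← smul_eq_mul, ← dotProduct_smul, ← Matrix.smul_mulVec]
  congr 2

lemma continuous_formPairing (w : InfinitePlace K) (x y : Fin n → K) :
    Continuous fun H => formPairing H w x y := by
  simp only [formPairing, dotProduct, Matrix.mulVec, Matrix.of_apply]
  fun_prop

lemma convex_formSpace : Convex ℝ (formSpace K n) := by
  intro H hH H' hH' a b ha hb hab
  refine ⟨fun w => ?_, fun w hw i j => ?_⟩
  · have h1 : Matrix.of ((a • H + b • H') w) = a • Matrix.of (H w) + b • Matrix.of (H' w) := rfl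
    rw [h1]
    rcases ha.eq_or_lt with rfl | ha'
    · rw [show b = 1 by linarith]
      simpa using hH'.1 w
    · exact ((hH.1 w).smul ha').add_posSemidef ((hH'.1 w).posSemidef.smul hb)
  · change (a • H w i j + b • H' w i j).im = 0
    rw [Complex.add_im, Complex.smul_im, Complex.smul_im, hH.2 w hw i j, hH'.2 w hw i j]
    simp

lemma nonempty_formSpace : (formSpace K n).Nonempty := by
  refine ⟨fun _ i j => (1 : Matrix (Fin n) (Fin n) ℂ) i j, fun w => ?_, fun w _ i j => ?_⟩
  · exact Matrix.PosDef.one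
  · by_cases h : i = j
    · subst h; simp
    · simp [h]

variable [NumberField K]

lemma continuous_totalNorm_formPairing (x : Fin n → K) :
    Continuous fun H => totalNorm (formPairing H) x :=
  continuous_finsetSum _ fun w _ => Complex.continuous_re.comp (continuous_formPairing w x x)

lemma totalNorm_formPairing_comb (a b : ℝ) (H H' : InfinitePlace K → Fin n → Fin n → ℂ)
    (x : Fin n → K) : totalNorm (formPairing (a • H + b • H')) x =
      a * totalNorm (formPairing H) x + b * totalNorm (formPairing H') x := by
  simp only [totalNorm, formPairing_add, formPairing_smul, Finset.mul_sum, ← Finset.sum_add_distrib]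
  simp

lemma exists_pairingOf_eq {H : InfinitePlace K → Fin n → Fin n → ℂ} (hH : H ∈ formSpace K n) :
    ∃ u : ∀ w : InfinitePlace K, (Fin n → K) →ₛₗ[w.embedding] EuclideanSpace ℂ (Fin n),
      formPairing H = pairingOf u ∧ ∀ w x, x ≠ 0 → u w x ≠ 0 := by
  choose X hX using fun w => (hH.1 w).exists_eq_conjTranspose_mul_self
  let u : ∀ w : InfinitePlace K, (Fin n → K) →ₛₗ[w.embedding] EuclideanSpace ℂ (Fin n) := fun w =>
    { toFun := fun x => WithLp.toLp 2 ((X w).mulVec (placeVec w x))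
      map_add' := fun x y => by
        rw [← WithLp.toLp_add, ← Matrix.mulVec_add]
        congr 2
        funext j
        simp [placeVec]
      map_smul' := fun c x => by
        rw [← WithLp.toLp_smul, ← Matrix.mulVec_smul]
        congr 2
        funext j
        simp [placeVec] }
  have hu : formPairing H = pairingOf u := by
    funext w x y
    change _ = inner ℂ (WithLp.toLp 2 _) (WithLp.toLp 2 _)
    rw [EuclideanSpace.inner_toLp_toLp, formPairing, hX, ← Matrix.mulVec_mulVec,
      Matrix.dotProduct_mulVec, Matrix.vecMul_conjTranspose, star_star, dotProduct_comm]
  refine ⟨u, hu, fun w x hx h0 => ?_⟩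
  have h1 : formPairing H w x x = 0 := by rw [hu, pairingOf, h0, inner_zero_left]
  refine ((hH.1 w).dotProduct_mulVec_pos (x := placeVec w x) fun h => hx ?_).ne' h1
  funext j
  exact (map_eq_zero w.embedding).1 (congrFun h j)

lemma exists_lower_bound {H : InfinitePlace K → Fin n → Fin n → ℂ} (hH : H ∈ formSpace K n) :
    ∃ c : ℝ, 0 < c ∧ ∀ w (x : Fin n → K), c * ‖placeVec w x‖ ^ 2 ≤ (formPairing H w x x).re := by
  suffices ∀ w, ∃ c : ℝ, 0 < c ∧ ∀ x : Fin n → K,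
      c * ‖placeVec w x‖ ^ 2 ≤ (formPairing H w x x).re by
    choose c hc0 hc using this
    obtain ⟨w₀, hw₀⟩ := Finite.exists_min c
    exact ⟨c w₀, hc0 w₀, fun w x => le_trans (by gcongr; exact hw₀ w) (hc w x)⟩
  intro w
  obtain ⟨X, hX⟩ := (hH.1 w).exists_eq_conjTranspose_mul_self
  let f : (Fin n → ℂ) →ₗ[ℂ] EuclideanSpace ℂ (Fin n) :=
    (WithLp.linearEquiv 2 ℂ (Fin n → ℂ)).symm.toLinearMap ∘ₗ X.mulVecLin
  have hf : ∀ y, ‖f y‖ ^ 2 = (star y ⬝ᵥ (Matrix.of (H w)).mulVec y).re := fun y => by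
    rw [hX, ← Matrix.mulVec_mulVec, Matrix.dotProduct_mulVec, Matrix.vecMul_conjTranspose,
      star_star, dotProduct_comm, ← EuclideanSpace.inner_toLp_toLp]
    change _ = (inner ℂ (f y) (f y)).re
    rw [inner_self_eq_norm_sq_to_K]
    norm_cast
  have hker : LinearMap.ker f = ⊥ := by
    refine LinearMap.ker_eq_bot'.2 fun y hy => ?_
    by_contra hne
    have h1 := (hH.1 w).re_dotProduct_pos hne
    have h2 := hf y
    rw [hy, norm_zero] at h2
    have h3 : (star y ⬝ᵥ (Matrix.of (H w)).mulVec y).re = 0 := by rw [← h2]; norm_num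
    exact h1.ne' h3
  obtain ⟨C, hC, hanti⟩ := f.exists_antilipschitzWith hker
  have hC' : (0 : ℝ) < C := hC
  refine ⟨((C : ℝ) ^ 2)⁻¹, by positivity, fun x => ?_⟩
  have h1 := hanti.le_mul_dist (placeVec w x) 0
  rw [map_zero, dist_zero_right, dist_zero_right] at h1
  have h2 : ‖placeVec w x‖ ^ 2 ≤ (C * ‖f (placeVec w x)‖) ^ 2 :=
    pow_le_pow_left₀ (norm_nonneg _) h1 2
  rw [formPairing, ← hf, inv_mul_le_iff₀ (by positivity)]
  linarith

lemma norm_formPairing_le (H : InfinitePlace K → Fin n → Fin n → ℂ) (w : InfinitePlace K)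
    (x : Fin n → K) : ‖formPairing H w x x‖ ≤ n * n * ‖H‖ * ‖placeVec w x‖ ^ 2 := by
  have h1 : ∀ i j, ‖H w i j‖ ≤ ‖H‖ := fun i j =>
    (norm_le_pi_norm (H w i) j).trans ((norm_le_pi_norm (H w) i).trans (norm_le_pi_norm H w))
  have h2 : ∀ i, ‖placeVec w x i‖ ≤ ‖placeVec w x‖ := norm_le_pi_norm _
  simp only [formPairing, dotProduct, Matrix.mulVec, Matrix.of_apply, Finset.mul_sum]
  calc _ ≤ ∑ i : Fin n, ∑ j : Fin n, ‖placeVec w x‖ * (‖H‖ * ‖placeVec w x‖) := by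
        refine (norm_sum_le _ _).trans (Finset.sum_le_sum fun i _ => ?_)
        refine (norm_sum_le _ _).trans (Finset.sum_le_sum fun j _ => ?_)
        rw [norm_mul, norm_mul, Pi.star_apply, norm_star]
        gcongr
        exacts [h2 i, h1 i j, h2 j]
    _ = _ := by
        simp only [Finset.sum_const, Finset.card_univ, Fintype.card_fin, nsmul_eq_mul]
        ring

/-- Near a given family of forms, the total norm decreases at most by a factor of two. -/
lemma eventually_totalNorm_le_two_mul {H₀ : InfinitePlace K → Fin n → Fin n → ℂ}
    (hH₀ : H₀ ∈ formSpace K n) : ∀ᶠ H in nhds H₀, ∀ x : Fin n → K,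
      totalNorm (formPairing H₀) x ≤ 2 * totalNorm (formPairing H) x := by
  obtain ⟨c, hc, hb⟩ := exists_lower_bound hH₀
  have h1 : ∀ᶠ H in nhds H₀, n * n * ‖H - H₀‖ < c / 2 := by
    have : ContinuousAt (fun H => (n : ℝ) * n * ‖H - H₀‖) H₀ := by fun_prop
    refine this.eventually_lt continuousAt_const ?_
    simp [hc]
  filter_upwards [h1] with H hH x
  rw [totalNorm, totalNorm, Finset.mul_sum]
  refine Finset.sum_le_sum fun w _ => ?_
  have h2 := norm_formPairing_le (H - H₀) w x
  have h3 : formPairing H w x x = formPairing (H - H₀) w x x + formPairing H₀ w x x := by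
    rw [← formPairing_add, sub_add_cancel]
  have h4 := hb w x
  have h5 := (Complex.abs_re_le_norm (formPairing (H - H₀) w x x)).trans h2
  have h6 := neg_le_of_abs_le h5
  rw [h3, Complex.add_re]
  have h7 : (n * n * ‖H - H₀‖) * ‖placeVec w x‖ ^ 2 ≤ c / 2 * ‖placeVec w x‖ ^ 2 := by gcongr
  linarith

/-- The standard lattice of integral vectors. -/
def intLattice (K : Type*) [Field K] (n : ℕ) : Submodule (𝓞 K) (Fin n → K) where
  carrier := {x | ∃ a : Fin n → 𝓞 K, ∀ j, x j = a j}
  add_mem' := by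
    rintro x y ⟨a, ha⟩ ⟨b, hb⟩
    exact ⟨a + b, fun j => by simp [ha, hb]⟩
  zero_mem' := ⟨0, fun j => by simp⟩
  smul_mem' := by
    rintro c x ⟨a, ha⟩
    exact ⟨fun j => c * a j, fun j => by rw [Pi.smul_apply, ha, Algebra.smul_def]; rfl⟩

lemma finite_totalNorm_le {H : InfinitePlace K → Fin n → Fin n → ℂ} (hH : H ∈ formSpace K n)
    (R : ℝ) : {x ∈ intLattice K n | totalNorm (formPairing H) x ≤ R}.Finite := by
  obtain ⟨c, hc, hb⟩ := exists_lower_bound hH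
  have hfin : {a : Fin n → 𝓞 K | ∀ j, a j ∈ {x : 𝓞 K | ∀ w, ‖placeEmb w x‖ ≤ 1 + R / c}}.Finite :=
    Set.Finite.pi' fun _ => finite_setOf_norm_placeEmb_le K (1 + R / c)
  refine (hfin.image fun a j => (a j : K)).subset ?_
  rintro x ⟨⟨a, ha⟩, hx⟩
  refine ⟨a, fun j w => ?_, funext fun j => (ha j).symm⟩
  have h1 : c * ‖placeVec w x‖ ^ 2 ≤ R := by
    refine ((hb w x).trans ?_).trans hx
    exact Finset.single_le_sum (f := fun w => (formPairing H w x x).re)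
      (fun w _ => le_trans (by positivity) (hb w x)) (Finset.mem_univ w)
  have h2 : ‖placeEmb w (a j)‖ ≤ ‖placeVec w x‖ := by
    refine le_trans (le_of_eq ?_) (norm_le_pi_norm (placeVec w x) j)
    rw [placeVec, ha]
    rfl
  have h3 : ‖placeVec w x‖ ^ 2 ≤ R / c := by
    rw [le_div_iff₀ hc]; linarith
  nlinarith [sq_nonneg (‖placeVec w x‖ - 1)]

end FormSpace

section ReducedForms

open NumberField
open scoped ComplexOrder

variable {K : Type*} [Field K] [NumberField K] {n : ℕ}

lemma combo_lt_combo {a b p p' q q' : ℝ} (ha : 0 ≤ a) (hb : 0 ≤ b) (hab : a + b = 1)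
    (h : p < p') (h' : q < q') : a * p + b * q < a * p' + b * q' := by
  rcases ha.eq_or_lt with rfl | ha'
  · rw [show b = 1 by linarith]; linarith
  · nlinarith

lemma convex_isReducedBasis (C : ℝ) (v : Fin n → Fin n → K) :
    Convex ℝ {H | H ∈ formSpace K n ∧ IsReducedBasis (intLattice K n) C (formPairing H) v} := by
  rintro H ⟨hH, hr⟩ H' ⟨hH', hr'⟩ a b ha hb hab
  refine ⟨convex_formSpace hH hH' ha hb hab, hr.mem, hr.li, fun i x hx hxs => ?_,
    fun i j hij w => ?_⟩
  · rw [totalNorm_formPairing_comb, totalNorm_formPairing_comb]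
    have := combo_lt_combo ha hb hab (hr.min i x hx hxs) (hr'.min i x hx hxs)
    linarith
  · rw [totalNorm_formPairing_comb, formPairing_add, formPairing_smul, formPairing_smul]
    have := combo_lt_combo ha hb hab (hr.small i j hij w) (hr'.small i j hij w)
    refine (norm_add_le _ _).trans_lt ?_
    rw [norm_mul, norm_mul, Complex.norm_real, Complex.norm_real, Real.norm_of_nonneg ha,
      Real.norm_of_nonneg hb]
    linarith

lemma eventually_isReducedBasis {C : ℝ} {v : Fin n → Fin n → K}
    {H₀ : InfinitePlace K → Fin n → Fin n → ℂ} (hH₀ : H₀ ∈ formSpace K n)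
    (hr : IsReducedBasis (intLattice K n) C (formPairing H₀) v) :
    ∀ᶠ H in nhds H₀, IsReducedBasis (intLattice K n) C (formPairing H) v := by
  have hc : ∀ x : Fin n → K, ContinuousAt (fun H => totalNorm (formPairing H) x) H₀ :=
    fun x => (continuous_totalNorm_formPairing x).continuousAt
  have h1 : ∀ᶠ H in nhds H₀, ∀ i j, i < j → ∀ w,
      ‖formPairing H w (v i) (v j)‖ < C * totalNorm (formPairing H) (v i) := by
    simp only [Filter.eventually_all]
    intro i j hij w
    exact ((continuous_formPairing w (v i) (v j)).norm.continuousAt).eventually_lt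
      (continuousAt_const.mul (hc (v i))) (hr.small i j hij w)
  have h2 : ∀ᶠ H in nhds H₀, ∀ i, totalNorm (formPairing H) (v i) <
      totalNorm (formPairing H₀) (v i) + 1 := by
    simp only [Filter.eventually_all]
    exact fun i => (hc (v i)).eventually_lt continuousAt_const (by simp)
  have h3 : ∀ i, ∀ᶠ H in nhds H₀, ∀ x ∈ {x ∈ intLattice K n |
      totalNorm (formPairing H₀) x ≤ totalNorm (formPairing H₀) (v i) + 1},
      x ∉ Submodule.span K (v '' Set.Iio i) →
        totalNorm (formPairing H) (v i) < 2 * totalNorm (formPairing H) x := by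
    intro i
    rw [Filter.eventually_all_finite (finite_totalNorm_le hH₀ _)]
    intro x hx
    by_cases hxs : x ∈ Submodule.span K (v '' Set.Iio i)
    · exact Filter.Eventually.of_forall fun H h => absurd hxs h
    · filter_upwards [(hc (v i)).eventually_lt (continuousAt_const.mul (hc x))
        (hr.min i x hx.1 hxs)] with H hH _ using hH
  filter_upwards [h1, h2, Filter.eventually_all.2 h3, eventually_totalNorm_le_two_mul hH₀]
    with H g1 g2 g3 g4
  refine ⟨hr.mem, hr.li, fun i x hx hxs => ?_, g1⟩
  by_cases hx1 : totalNorm (formPairing H₀) x ≤ totalNorm (formPairing H₀) (v i) + 1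
  · exact g3 i x ⟨hx, hx1⟩ hxs
  · linarith [g2 i, g4 x]

/-- The forms for which a given basis is reduced. -/
def reducedForms (C : ℝ) (v : Fin n → Fin n → K) : Set (formSpace K n) :=
  {H | IsReducedBasis (intLattice K n) C (formPairing H.1) v}

lemma isOpen_reducedForms (C : ℝ) (v : Fin n → Fin n → K) : IsOpen (reducedForms C v) :=
  isOpen_iff_eventually.2 fun H hH =>
    continuous_subtype_val.continuousAt.eventually (eventually_isReducedBasis H.2 hH)

lemma isPreconnected_reducedForms (C : ℝ) (v : Fin n → Fin n → K) :
    IsPreconnected (reducedForms C v) := by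
  rw [← Topology.IsInducing.subtypeVal.isPreconnected_image]
  convert (convex_isReducedBasis C v).isPreconnected using 1
  ext H
  exact ⟨fun ⟨H', h, he⟩ => he ▸ ⟨H'.2, h⟩, fun h => ⟨⟨H, h.1⟩, h.2, rfl⟩⟩

lemma exists_mem_reducedForms (K : Type*) [Field K] [NumberField K] (n : ℕ) :
    ∃ C : ℝ, 1 ≤ C ∧ ∀ H : formSpace K n, ∃ v, H ∈ reducedForms C v := by
  obtain ⟨C, hC, h⟩ := exists_isReducedBasis K n
  refine ⟨C, hC, fun H => ?_⟩
  obtain ⟨u, hu, hu0⟩ := exists_pairingOf_eq H.2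
  suffices ∃ v, IsReducedBasis (intLattice K n) C (pairingOf u) v by
    rw [← hu] at this
    exact this
  refine h (Λ := intLattice K n) (u := u) (fun R => hu ▸ finite_totalNorm_le H.2 R)
    ?_ hu0 fun w hw x y => ?_
  · rw [eq_top_iff, ← (Pi.basisFun K (Fin n)).span_eq]
    refine Submodule.span_mono ?_
    rintro _ ⟨i, rfl⟩
    refine ⟨Pi.single i 1, fun j => ?_⟩
    by_cases hij : j = i
    · subst hij; simp
    · simp [hij]
  · have h1 : inner ℂ (u w x) (u w y) = formPairing H.1 w x y := by rw [hu]; rfl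
    have h2 : ∀ i j, (starRingEnd ℂ) (H.1 w i j) = H.1 w i j := fun i j =>
      Complex.conj_eq_iff_im.2 (H.2.2 w hw i j)
    have h3 : ∀ t : K, (starRingEnd ℂ) (w.embedding t) = w.embedding t := fun t =>
      RingHom.congr_fun (InfinitePlace.isReal_iff.1 hw) t
    rw [h1, ← Complex.conj_eq_iff_im]
    simp only [formPairing, dotProduct, Matrix.mulVec, Matrix.of_apply, map_sum, map_mul, h2,
      placeVec, Pi.star_apply, h3, Complex.star_def]

end ReducedForms

section Action

open NumberField
open scoped ComplexOrder

variable {K : Type*} [Field K] {n : ℕ}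

lemma IsReducedBasis.map [NumberField K] {Λ : Submodule (𝓞 K) (Fin n → K)} {C : ℝ}
    {B B' : InfinitePlace K → (Fin n → K) → (Fin n → K) → ℂ} {v : Fin n → Fin n → K}
    (h : IsReducedBasis Λ C B v) (e : (Fin n → K) ≃ₗ[K] (Fin n → K))
    (he : ∀ x, e x ∈ Λ ↔ x ∈ Λ) (hB : ∀ w x y, B' w (e x) (e y) = B w x y) :
    IsReducedBasis Λ C B' fun k => e (v k) := by
  have ht : ∀ x, totalNorm B' (e x) = totalNorm B x := fun x => by simp only [totalNorm, hB]
  refine ⟨fun k => (he _).2 (h.mem k), h.li.map' e.toLinearMap e.ker, fun i x hx hxs => ?_,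
    fun i j hij w => ?_⟩
  · obtain ⟨y, rfl⟩ := e.surjective x
    rw [ht, ht]
    refine h.min i y ((he _).1 hx) fun hy => hxs ?_
    have := Submodule.mem_map_of_mem (f := e.toLinearMap) hy
    rw [Submodule.map_span, Set.image_image] at this
    exact this
  · rw [ht, hB]
    exact h.small i j hij w

/-- The linear action of an invertible integral matrix. -/
noncomputable def latticeAct (K : Type*) [Field K] (n : ℕ) :
    GL (Fin n) (𝓞 K) →* ((Fin n → K) ≃ₗ[K] (Fin n → K)) :=
  ((LinearMap.GeneralLinearGroup.generalLinearEquiv K (Fin n → K)).toMonoidHom.comp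
    Matrix.GeneralLinearGroup.toLin.toMonoidHom).comp
      (Matrix.GeneralLinearGroup.map (algebraMap (𝓞 K) K))

lemma latticeAct_apply (g : GL (Fin n) (𝓞 K)) (x : Fin n → K) :
    latticeAct K n g x = (g.1.map (algebraMap (𝓞 K) K)).mulVec x := rfl

lemma latticeAct_mem (g : GL (Fin n) (𝓞 K)) {x : Fin n → K} (hx : x ∈ intLattice K n) :
    latticeAct K n g x ∈ intLattice K n := by
  obtain ⟨a, ha⟩ := hx
  refine ⟨g.1.mulVec a, fun j => ?_⟩
  rw [latticeAct_apply, show x = fun j => (a j : K) from funext ha]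
  simp [Matrix.mulVec, dotProduct, map_sum]

lemma latticeAct_mem_iff (g : GL (Fin n) (𝓞 K)) (x : Fin n → K) :
    latticeAct K n g x ∈ intLattice K n ↔ x ∈ intLattice K n := by
  refine ⟨fun h => ?_, latticeAct_mem g⟩
  have := latticeAct_mem g⁻¹ h
  rwa [← LinearEquiv.mul_apply, ← map_mul, inv_mul_cancel, map_one] at this

lemma latticeAct_injective : Function.Injective (latticeAct K n) := by
  intro g h hgh
  ext i j
  have h1 := congrFun (LinearEquiv.congr_fun hgh (Pi.single j 1)) i
  rw [latticeAct_apply, latticeAct_apply, Matrix.mulVec_single_one, Matrix.mulVec_single_one] at h1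
  exact h1

lemma exists_reducedForms_smul [NumberField K] (C : ℝ) (g : GL (Fin n) (𝓞 K))
    (H : formSpace K n) : ∃ H' : formSpace K n, ∀ v, H ∈ reducedForms C v →
      H' ∈ reducedForms C fun k => latticeAct K n g (v k) := by
  let P : InfinitePlace K → Matrix (Fin n) (Fin n) ℂ := fun w =>
    ((g⁻¹ : GL (Fin n) (𝓞 K)) : Matrix (Fin n) (Fin n) (𝓞 K)).map (placeEmb w)
  have hPv : ∀ w x, (P w).mulVec (placeVec w (latticeAct K n g x)) = placeVec w x := fun w x => by
    have h0 : ∀ y, (P w).mulVec (placeVec w y) = placeVec w (latticeAct K n g⁻¹ y) := fun y => by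
      funext j
      rw [latticeAct_apply]
      simp [P, placeVec, Matrix.mulVec, dotProduct, map_sum, placeEmb]
    rw [h0, ← LinearEquiv.mul_apply, ← map_mul, inv_mul_cancel, map_one]
    rfl
  have hPinj : ∀ w, Function.Injective (P w).mulVec := fun w => by
    have h1 : (g.1.map (placeEmb w)) * P w = 1 := by
      rw [← Matrix.map_mul, ← Units.val_mul, mul_inv_cancel]
      simp
    intro x y hxy
    have h2 := congrArg (g.1.map (placeEmb w)).mulVec hxy
    simpa [Matrix.mulVec_mulVec, h1] using h2
  let H' : InfinitePlace K → Fin n → Fin n → ℂ := fun w =>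
    (P w).conjTranspose * Matrix.of (H.1 w) * P w
  have hH' : H' ∈ formSpace K n := by
    refine ⟨fun w => (H.2.1 w).conjTranspose_mul_mul_same (hPinj w), fun w hw i j => ?_⟩
    have h2 : ∀ i j, (starRingEnd ℂ) (H.1 w i j) = H.1 w i j := fun i j =>
      Complex.conj_eq_iff_im.2 (H.2.2 w hw i j)
    have h3 : ∀ i j, (starRingEnd ℂ) (P w i j) = P w i j := fun i j =>
      RingHom.congr_fun (InfinitePlace.isReal_iff.1 hw) _
    rw [← Complex.conj_eq_iff_im]
    simp only [H', Matrix.mul_apply, map_sum, map_mul, Matrix.conjTranspose_apply, Complex.star_def,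
      h3, Matrix.of_apply, h2]
  refine ⟨⟨H', hH'⟩, fun v hv => IsReducedBasis.map hv _ (latticeAct_mem_iff g) fun w x y => ?_⟩
  simp only [formPairing]
  change _ ⬝ᵥ ((P w).conjTranspose * Matrix.of (H.1 w) * P w).mulVec _ = _
  rw [← Matrix.mulVec_mulVec, hPv, ← Matrix.mulVec_mulVec, Matrix.dotProduct_mulVec,
    Matrix.vecMul_conjTranspose, star_star, hPv]

lemma Matrix.mul_eq_smul_one_comm {R : Type*} [CommRing R] [IsDomain R] {a b : Matrix (Fin n) (Fin n) R}
    {D : R} (hD : D ≠ 0) (h : a * b = D • 1) : b * a = D • 1 := by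
  have hdet : a.det ≠ 0 := fun h0 => by
    have := congrArg Matrix.det h
    rw [Matrix.det_mul, h0, zero_mul, Matrix.det_smul, Matrix.det_one, mul_one] at this
    exact pow_ne_zero _ hD this.symm
  have h1 : a * (b * a - D • 1) = 0 := by
    rw [mul_sub, ← mul_assoc, h]; simp
  have h2 := congrArg (a.adjugate * ·) h1
  simp only [← mul_assoc, Matrix.adjugate_mul, mul_zero, Matrix.smul_mul, one_mul] at h2
  exact sub_eq_zero.1 ((smul_eq_zero.1 h2).resolve_left hdet)

/-- Integral matrices with quasi-inverses congruent modulo their index are associated. -/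
lemma exists_units_mul_eq {R : Type*} [CommRing R] [IsDomain R] {m m' N N' M : Matrix (Fin n) (Fin n) R}
    {D : R} (hD : D ≠ 0) (h : m * N = D • 1) (h' : m' * N' = D • 1) (hN : N' = N + D • M) :
    ∃ g : GL (Fin n) R, g.1 * m = m' := by
  have key : ∀ {a a' b b' c : Matrix (Fin n) (Fin n) R}, a * b = D • 1 → a' * b' = D • 1 →
      b' = b + D • c → (1 + a * c) * a' = a := by
    intro a a' b b' c hab hab' hb
    have h1 : a * b' = D • (1 + a * c) := by rw [hb, mul_add, hab, smul_add, Matrix.mul_smul]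
    have h2 := congrArg (· * a') h1
    simp only [mul_assoc, Matrix.mul_eq_smul_one_comm hD hab', Matrix.smul_mul, Matrix.mul_smul,
      mul_one] at h2
    exact (smul_right_injective _ hD h2).symm
  have hg := key h h' hN
  have hg' := key h' h (c := -M) (by rw [hN]; simp)
  have h1 : (1 + m * M) * (1 + m' * -M) = 1 := by
    have h3 : (1 + m * M) * (1 + m' * -M) * m * N = m * N := by
      rw [mul_assoc (1 + m * M), hg', hg]
    rw [mul_assoc _ m, h, Matrix.mul_smul, mul_one] at h3
    exact smul_right_injective _ hD h3
  exact ⟨⟨1 + m' * -M, 1 + m * M, mul_eq_one_comm.1 h1, h1⟩, hg'⟩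

end Action

section ReducedBases

open NumberField
open scoped ComplexOrder

variable (K : Type*) [Field K] [NumberField K] (n : ℕ)

/-- The set of reduced bases of some form. -/
abbrev ReducedBases (C : ℝ) : Type _ := {v : Fin n → Fin n → K // (reducedForms C v).Nonempty}

noncomputable instance (C : ℝ) : MulAction (GL (Fin n) (𝓞 K)) (ReducedBases K n C) where
  smul g b := ⟨fun k => latticeAct K n g (b.1 k), by
    obtain ⟨H, hH⟩ := b.2
    obtain ⟨H', h⟩ := exists_reducedForms_smul C g H
    exact ⟨H', h _ hH⟩⟩
  one_smul b := Subtype.ext <| funext fun k => by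
    change latticeAct K n 1 (b.1 k) = b.1 k
    rw [map_one]; rfl
  mul_smul g h b := Subtype.ext <| funext fun k => by
    change latticeAct K n (g * h) (b.1 k) = latticeAct K n g (latticeAct K n h (b.1 k))
    rw [map_mul]; rfl

variable {K n}

lemma ReducedBases.smul_val {C : ℝ} (g : GL (Fin n) (𝓞 K)) (b : ReducedBases K n C) :
    (g • b).1 = fun k => latticeAct K n g (b.1 k) := rfl

lemma exists_isReducedBasis_pairingOf {C : ℝ} {v : Fin n → Fin n → K} {H : formSpace K n}
    (h : H ∈ reducedForms C v) :
    ∃ u : ∀ w : InfinitePlace K, (Fin n → K) →ₛₗ[w.embedding] EuclideanSpace ℂ (Fin n),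
      ∀ v, H ∈ reducedForms C v → IsReducedBasis (intLattice K n) C (pairingOf u) v := by
  obtain ⟨u, hu, -⟩ := exists_pairingOf_eq H.2
  exact ⟨u, fun v hv => hu ▸ hv⟩

lemma ReducedBases.finite_inter {C : ℝ} (hC : 1 ≤ C) (b : ReducedBases K n C) :
    {b' : ReducedBases K n C | (reducedForms C b.1 ∩ reducedForms C b'.1).Nonempty}.Finite := by
  obtain ⟨D, R, hD, h⟩ := exists_transition_bound K n C hC
  have hfin : {β : Fin n → Fin n → 𝓞 K |
      ∀ j k, β j k ∈ {x : 𝓞 K | ∀ w, ‖placeEmb w x‖ ≤ R}}.Finite :=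
    Set.Finite.pi' fun _ => Set.Finite.pi' fun _ => finite_setOf_norm_placeEmb_le K R
  refine ((hfin.image fun β j => (D : K)⁻¹ • ∑ k, (β j k : K) • b.1 k).preimage
    Subtype.val_injective.injOn).subset ?_
  rintro b' ⟨H, hb, hb'⟩
  obtain ⟨u, hu⟩ := exists_isReducedBasis_pairingOf hb
  choose β hβ hR using h (hu _ hb) (hu _ hb')
  refine ⟨β, fun j k w => hR j k w, funext fun j => ?_⟩
  beta_reduce
  rw [← hβ, inv_smul_smul₀ (by exact_mod_cast (by omega : D ≠ 0))]

lemma ReducedBases.finite_orbits (C : ℝ) :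
    Finite (MulAction.orbitRel.Quotient (GL (Fin n) (𝓞 K)) (ReducedBases K n C)) := by
  obtain ⟨D, hD, h⟩ := exists_index_bound K n
  have hDK : (D : 𝓞 K) ≠ 0 := by exact_mod_cast (by omega : D ≠ 0)
  have key : ∀ b : ReducedBases K n C, ∃ m N : Matrix (Fin n) (Fin n) (𝓞 K),
      (∀ k j, b.1 k j = (m j k : K)) ∧ m * N = (D : 𝓞 K) • 1 := by
    rintro ⟨v, H, hv⟩
    obtain ⟨u, hu⟩ := exists_isReducedBasis_pairingOf hv
    have hr := hu _ hv
    choose a ha using hr.mem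
    choose α hα using fun j : Fin n => h hr (Pi.single j 1) ⟨Pi.single j 1, fun i => by
      by_cases hij : i = j
      · subst hij; simp
      · simp [hij]⟩
    refine ⟨Matrix.of fun j k => a k j, Matrix.of fun k j => α j k, ha, ?_⟩
    ext i j
    have h1 := congrFun (hα j) i
    simp only [Finset.sum_apply, Pi.smul_apply, ha, smul_eq_mul] at h1
    simp only [Matrix.mul_apply, Matrix.of_apply, Matrix.smul_apply, smul_eq_mul, map_sum, map_mul]
    rw [Finset.sum_congr rfl fun k _ => mul_comm _ _]
    refine h1.symm.trans ?_
    by_cases hij : i = j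
    · subst hij; simp
    · simp [hij]
  choose m N hm hN using key
  have : Finite (𝓞 K ⧸ Ideal.span {(D : 𝓞 K)}) :=
    Ring.HasFiniteQuotients.finiteQuotient (by simpa using hDK)
  refine Finite.of_injective (β := Matrix (Fin n) (Fin n) (𝓞 K ⧸ Ideal.span {(D : 𝓞 K)}))
    (fun q => (N q.out).map (Ideal.Quotient.mk _)) fun q q' hqq => ?_
  have hM : ∀ i j, ∃ c, N q'.out i j = N q.out i j + D * c := fun i j => by
    have h1 := congrFun (congrFun hqq i) j
    obtain ⟨c, hc⟩ := Ideal.mem_span_singleton'.1 (Ideal.Quotient.eq.1 h1.symm)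
    exact ⟨c, by rw [mul_comm, hc]; ring⟩
  choose M hM using hM
  obtain ⟨g, hg⟩ := exists_units_mul_eq (M := Matrix.of M) hDK (hN q.out) (hN q'.out) (by
    ext i j; simp [hM])
  rw [← Quotient.out_eq q, ← Quotient.out_eq q']
  refine (Quotient.sound (MulAction.orbitRel_apply.2 ⟨g, Subtype.ext ?_⟩)).symm
  beta_reduce
  rw [ReducedBases.smul_val]
  funext k j
  rw [hm, ← hg, latticeAct_apply, show q.out.1 k = fun j => (m q.out j k : K) from funext (hm _ k)]
  simp [Matrix.mulVec, dotProduct, Matrix.mul_apply, map_sum]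

theorem Matrix.GeneralLinearGroup.isFinitelyPresented_ringOfIntegers (K : Type*) [Field K]
    [NumberField K] (n : ℕ) : Group.IsFinitelyPresented (GL (Fin n) (𝓞 K)) := by
  obtain ⟨C, hC, hcov⟩ := exists_mem_reducedForms K n
  have : ContractibleSpace (formSpace K n) := convex_formSpace.contractibleSpace nonempty_formSpace
  have : LocallyPathConnectedSpace (formSpace K n) := convex_formSpace.locallyPathConnectedSpace
  refine Group.IsFinitelyPresented.of_cover (fun b : ReducedBases K n C => reducedForms C b.1)
    (fun b => isOpen_reducedForms C _) (fun b => isPreconnected_reducedForms C _) (fun b => b.2)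
    (fun H => ?_) (fun g b hg => ?_) (ReducedBases.finite_orbits C) (ReducedBases.finite_inter hC)
    fun g b b' b'' h => ?_
  · obtain ⟨v, hv⟩ := hcov H
    exact ⟨⟨v, H, hv⟩, hv⟩
  · obtain ⟨H, hH⟩ := b.2
    have h1 := congrArg Subtype.val hg
    rw [ReducedBases.smul_val] at h1
    refine latticeAct_injective (K := K) ?_
    rw [map_one]
    refine LinearEquiv.toLinearMap_injective
      ((basisOfLinearIndependentOfCardEqFinrank' b.1 hH.li (by simp)).ext fun k => ?_)
    simpa using congrFun h1 k
  · obtain ⟨H, ⟨h1, h2⟩, h3⟩ := h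
    obtain ⟨H', h'⟩ := exists_reducedForms_smul C g H
    exact ⟨H', ⟨h' _ h1, h' _ h2⟩, h' _ h3⟩

end ReducedBases

section SpecialLinear

open NumberField

/-- Unimodular matrices times scalars. -/
noncomputable def scalarMulSL (n : ℕ) (R : Type*) [CommRing R] :
    Rˣ × Matrix.SpecialLinearGroup (Fin n) R →* GL (Fin n) R :=
  MonoidHom.noncommCoprod (Matrix.GeneralLinearGroup.scalar (Fin n)) Matrix.SpecialLinearGroup.toGL
    fun u s => by
      ext i j
      simp [Matrix.GeneralLinearGroup.scalar, Matrix.scalar_apply, Matrix.mul_diagonal, Matrix.diagonal_mul, mul_comm]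

lemma scalarMulSL_apply {n : ℕ} {R : Type*} [CommRing R] (u : Rˣ)
    (s : Matrix.SpecialLinearGroup (Fin n) R) : (scalarMulSL n R (u, s)).1 = (u : R) • s.1 := by
  ext i j
  simp [scalarMulSL, Matrix.GeneralLinearGroup.scalar, Matrix.scalar_apply, Matrix.diagonal_mul]

theorem Matrix.SpecialLinearGroup.isFinitelyPresented_of_GL {R : Type*} [CommRing R] [IsDomain R]
    (n : ℕ) [NeZero n] [Group.FG Rˣ] [Group.IsFinitelyPresented (GL (Fin n) R)] :
    Group.IsFinitelyPresented (Matrix.SpecialLinearGroup (Fin n) R) := by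
  let f := scalarMulSL n R
  have h1 : ((powMonoidHom (α := Rˣ) n).range.comap
      (Matrix.GeneralLinearGroup.det (n := Fin n) (R := R))) ≤ f.range := by
    rintro g ⟨u, hu⟩
    have hdet : (((u⁻¹ : Rˣ) : R) • g.1).det = 1 := by
      rw [Matrix.det_smul, Fintype.card_fin, ← Matrix.GeneralLinearGroup.val_det_apply, ← hu]
      simp [← mul_pow]
    refine ⟨(u, ⟨_, hdet⟩), Units.ext ?_⟩
    refine (scalarMulSL_apply u _).trans ?_
    simp [smul_smul]
  have := Subgroup.finiteIndex_range_powMonoidHom_of_fg Rˣ (NeZero.ne n)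
  have : ((powMonoidHom (α := Rˣ) n).range.comap
      (Matrix.GeneralLinearGroup.det (n := Fin n) (R := R))).FiniteIndex := ⟨by
    rw [Subgroup.index_comap]
    exact fun h => Subgroup.FiniteIndex.index_ne_zero (H := (powMonoidHom (α := Rˣ) n).range)
      (Subgroup.index_eq_zero_of_relIndex_eq_zero h)⟩
  have := Subgroup.finiteIndex_of_le h1
  have := Group.IsFinitelyPresented.of_finiteIndex f.range
  have : Group.FG (rootsOfUnity n R) := Group.fg_of_finite
  have := Group.IsFinitelyPresented.of_comm (rootsOfUnity n R)
  have hinv : ∀ (x : Rˣ × Matrix.SpecialLinearGroup (Fin n) R), x ∈ f.rangeRestrict.ker →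
      (x.1 : R) • x.2.1 = 1 := fun x hx => by
    rw [← scalarMulSL_apply, show scalarMulSL n R (x.1, x.2) = 1 from congrArg Subtype.val hx]
    rfl
  have hpow : ∀ (x : Rˣ × Matrix.SpecialLinearGroup (Fin n) R), x ∈ f.rangeRestrict.ker →
      x.1 ^ n = 1 := fun x hx => by
    have h2 := congrArg Matrix.det (hinv x hx)
    rw [Matrix.det_smul, x.2.2, Matrix.det_one, Fintype.card_fin, mul_one] at h2
    exact Units.ext (by simpa using h2)
  have e : rootsOfUnity n R ≃* f.rangeRestrict.ker := by
    refine MulEquiv.symm (MulEquiv.ofBijective (M := f.rangeRestrict.ker) (N := rootsOfUnity n R) (F := _ →* _)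
      { toFun := fun x => ⟨x.1.1, hpow x.1 x.2⟩
        map_one' := rfl
        map_mul' := fun x y => rfl } ⟨?_, ?_⟩)
    · rintro ⟨⟨u, s⟩, hx⟩ ⟨⟨u', s'⟩, hx'⟩ h
      obtain rfl : u = u' := congrArg Subtype.val h
      have h2 := (hinv _ hx).trans (hinv _ hx').symm
      refine Subtype.ext (Prod.ext rfl (Subtype.ext ?_))
      have h3 := congrArg (((u⁻¹ : Rˣ) : R) • ·) h2
      simpa [smul_smul] using h3
    · rintro ⟨u, hu⟩
      have hu' : u ^ n = 1 := hu
      refine ⟨⟨(u, ⟨((u⁻¹ : Rˣ) : R) • 1, ?_⟩), ?_⟩, rfl⟩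
      · rw [Matrix.det_smul, Matrix.det_one, Fintype.card_fin, mul_one, ← Units.val_pow_eq_pow_val,
          inv_pow, hu', inv_one, Units.val_one]
      · refine MonoidHom.mem_ker.2 (Subtype.ext (Units.ext ?_))
        refine (scalarMulSL_apply u _).trans ?_
        simp [smul_smul]
  have := Group.IsFinitelyPresented.of_mulEquiv_ker f.rangeRestrict f.rangeRestrict_surjective e
  exact Group.IsFinitelyPresented.of_retract (MonoidHom.snd Rˣ _) (MonoidHom.inr Rˣ _) fun x => rfl

instance Matrix.SpecialLinearGroup.isFinitelyPresented_ringOfIntegers (K : Type*) [Field K]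
    [NumberField K] (n : ℕ) [NeZero n] :
    Group.IsFinitelyPresented (Matrix.SpecialLinearGroup (Fin n) (𝓞 K)) := by
  have := Matrix.GeneralLinearGroup.isFinitelyPresented_ringOfIntegers K n
  have : Group.FG (𝓞 K)ˣ := Group.fg_iff_monoid_fg.2 inferInstance
  exact Matrix.SpecialLinearGroup.isFinitelyPresented_of_GL n

end SpecialLinear

section ElementaryGroups

variable {ι A : Type*} [Fintype ι] [DecidableEq ι] [CommRing A]

/-- A transvection as an invertible matrix. -/
def transGL (i j : ι) (h : i ≠ j) (t : A) : GL ι A :=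
  ⟨Matrix.transvection i j t, Matrix.transvection i j (-t),
    by rw [Matrix.transvection_mul_transvection_same _ _ h, add_neg_cancel, Matrix.transvection_zero],
    by rw [Matrix.transvection_mul_transvection_same _ _ h, neg_add_cancel, Matrix.transvection_zero]⟩

lemma transGL_inv (i j : ι) (h : i ≠ j) (t : A) : (transGL i j h t)⁻¹ = transGL i j h (-t) :=
  Units.ext rfl

lemma transGL_apply (i j : ι) (h : i ≠ j) (t : A) (a b : ι) :
    (transGL i j h t).1 a b = (if a = b then 1 else 0) + if i = a ∧ j = b then t else 0 := by
  simp [transGL, Matrix.transvection, Matrix.one_apply, Matrix.single_apply]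

/-- The group generated by the transvections whose position is allowed by a relation. -/
def elemGL (A : Type*) [CommRing A] (r : ι → ι → Prop) : Subgroup (GL ι A) :=
  Subgroup.closure {g | ∃ (i j : ι) (h : i ≠ j) (t : A), r i j ∧ g = transGL i j h t}

lemma transGL_mem {r : ι → ι → Prop} {i j : ι} (hr : r i j) (h : i ≠ j) (t : A) :
    transGL i j h t ∈ elemGL A r := Subgroup.subset_closure ⟨i, j, h, t, hr, rfl⟩

lemma rel_of_mem_elemGL {r : ι → ι → Prop} (hrefl : ∀ i, r i i)
    (htrans : ∀ i j k, r i j → r j k → r i k) {g : GL ι A} (hg : g ∈ elemGL A r) {i j : ι}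
    (hij : ¬ r i j) : g.1 i j = 0 := by
  suffices h : (∀ i j, ¬ r i j → g.1 i j = 0) ∧ (∀ i j, ¬ r i j → (g⁻¹).1 i j = 0) from h.1 i j hij
  have hmul : ∀ a b : Matrix ι ι A, (∀ i j, ¬ r i j → a i j = 0) → (∀ i j, ¬ r i j → b i j = 0) →
      ∀ i j, ¬ r i j → (a * b) i j = 0 := fun a b ha hb i j h => by
    rw [Matrix.mul_apply]
    refine Finset.sum_eq_zero fun k _ => ?_
    by_cases h1 : r i k
    · rw [hb k j fun h2 => h (htrans _ _ _ h1 h2), mul_zero]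
    · rw [ha i k h1, zero_mul]
  have hgen : ∀ (i j : ι) (h : i ≠ j) (t : A), r i j → ∀ a b, ¬ r a b →
      (transGL i j h t).1 a b = 0 := fun i j h t hr a b hab => by
    have h1 : a ≠ b := by rintro rfl; exact hab (hrefl a)
    have h2 : ¬ (i = a ∧ j = b) := by rintro ⟨rfl, rfl⟩; exact hab hr
    rw [transGL_apply, if_neg h1, if_neg h2, add_zero]
  induction hg using Subgroup.closure_induction with
  | mem x hx =>
    obtain ⟨i, j, h, t, hr, rfl⟩ := hx
    exact ⟨hgen i j h t hr, by rw [transGL_inv]; exact hgen i j h _ hr⟩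
  | one =>
    have : ∀ i j, ¬ r i j → (1 : Matrix ι ι A) i j = 0 := fun i j h =>
      Matrix.one_apply_ne fun e => h (e ▸ hrefl i)
    exact ⟨this, by rw [inv_one]; exact this⟩
  | mul x y _ _ hx hy =>
    exact ⟨hmul _ _ hx.1 hy.1, by rw [mul_inv_rev]; exact hmul _ _ hy.2 hx.2⟩
  | inv x _ hx => exact ⟨hx.2, by rw [inv_inv]; exact hx.1⟩

/-- Restriction of matrices to a diagonal block. -/
def restrictGL (q : ι → Prop) [DecidablePred q] (T : Subgroup (GL ι A))
    (hT : ∀ g ∈ T, ∀ h ∈ T, ∀ i j k, q i → q j → ¬ q k → g.1 i k * h.1 k j = 0) :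
    T →* GL {x // q x} A :=
  MonoidHom.toHomUnits
    { toFun := fun g => g.1.1.submatrix Subtype.val Subtype.val
      map_one' := by
        ext i j
        simp [Matrix.one_apply, Subtype.ext_iff]
      map_mul' := fun g h => by
        ext i j
        change (g.1.1 * h.1.1) i.1 j.1 = _
        rw [Matrix.mul_apply, Matrix.mul_apply, ← Fintype.sum_subtype_add_sum_subtype q,
          Finset.sum_eq_zero (s := (Finset.univ : Finset {x // ¬ q x}))
          fun k _ => hT g.1 g.2 h.1 h.2 i j k i.2 j.2 k.2, add_zero]
        rfl }

/-- The upper triangular block of a matrix, as a unipotent matrix. -/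
def unipGL (p : ι → Prop) [DecidablePred p] :
    Multiplicative (Matrix {x // p x} {x // ¬ p x} A) →* GL ι A :=
  MonoidHom.toHomUnits
    { toFun := fun N => 1 + Matrix.of fun i j =>
        if h : p i ∧ ¬ p j then N.toAdd ⟨i, h.1⟩ ⟨j, h.2⟩ else 0
      map_one' := by
        ext i j
        simp
      map_mul' := fun N M => by
        set f : Multiplicative (Matrix {x // p x} {x // ¬ p x} A) → Matrix ι ι A :=
          fun N => Matrix.of fun i j => if h : p i ∧ ¬ p j then N.toAdd ⟨i, h.1⟩ ⟨j, h.2⟩ else 0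
        change 1 + f (N * M) = (1 + f N) * (1 + f M)
        have h1 : f N * f M = 0 := by
          ext i j
          rw [Matrix.mul_apply]
          refine Finset.sum_eq_zero fun k _ => ?_
          by_cases hk : p k <;> simp [f, hk]
        have h2 : f (N * M) = f N + f M := by
          ext i j
          by_cases h : p i ∧ ¬ p j <;> simp [f, h]
        rw [h2, mul_add, add_mul, add_mul, h1]
        simp [add_assoc] }

lemma unipGL_apply {p : ι → Prop} [DecidablePred p]
    (N : Multiplicative (Matrix {x // p x} {x // ¬ p x} A)) (i j : ι) : (unipGL p N).1 i j =
      (if i = j then 1 else 0) + if h : p i ∧ ¬ p j then N.toAdd ⟨i, h.1⟩ ⟨j, h.2⟩ else 0 := by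
  rw [← Matrix.one_apply]
  rfl

lemma unipGL_mem {p : ι → Prop} [DecidablePred p] {r : ι → ι → Prop}
    (hr : ∀ i j, p i → ¬ p j → r i j)
    (N : Multiplicative (Matrix {x // p x} {x // ¬ p x} A)) : unipGL p N ∈ elemGL A r := by
  suffices ∀ M : Matrix {x // p x} {x // ¬ p x} A,
      unipGL p (Multiplicative.ofAdd M) ∈ elemGL A r from this N.toAdd
  intro M
  induction M using Matrix.induction_on' with
  | h_zero => rw [ofAdd_zero, map_one]; exact one_mem _
  | h_add x y hx hy => rw [ofAdd_add, map_mul]; exact mul_mem hx hy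
  | h_std_basis i j t =>
    have hij : i.1 ≠ j.1 := fun h => j.2 (h ▸ i.2)
    convert transGL_mem (hr i j i.2 j.2) hij t using 1
    ext a b
    rw [unipGL_apply, transGL_apply]
    congr 1
    by_cases h : p a ∧ ¬ p b
    · simp [h, Matrix.single_apply, Subtype.ext_iff]
    · rw [dif_neg h, if_neg]
      rintro ⟨rfl, rfl⟩
      exact h ⟨i.2, j.2⟩

lemma Group.FG.multiplicative_matrix {m n : Type*} [Finite m] [Finite n] [AddGroup.FG A] :
    Group.FG (Multiplicative (Matrix m n A)) := by
  have : Module.Finite ℤ A := Module.Finite.iff_addGroup_fg.2 inferInstance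
  have : Module.Finite ℤ (Matrix m n A) := inferInstanceAs (Module.Finite ℤ (m → n → A))
  have : AddGroup.FG (Matrix m n A) := Module.Finite.iff_addGroup_fg.1 this
  infer_instance

end ElementaryGroups

section Step

variable {ι A : Type*} [Fintype ι] [DecidableEq ι] [CommRing A]

lemma elemGL_isFinitelyPresented_of_block {r : ι → ι → Prop} (hrefl : ∀ i, r i i)
    (htrans : ∀ i j k, r i j → r j k → r i k) (p : ι → Prop) [DecidablePred p]
    (hp : ∀ i, p i ↔ ∀ j, r i j) [AddGroup.FG A]
    [Group.IsFinitelyPresented (elemGL (ι := {x // p x}) A fun _ _ => True)]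
    [Group.IsFinitelyPresented (elemGL (ι := {x // ¬ p x}) A fun i j => r i j)] :
    Group.IsFinitelyPresented (elemGL A r) := by
  have hr : ∀ {i j}, ¬ p i → p j → ¬ r i j := fun {i j} hi hj h =>
    hi ((hp i).2 fun k => htrans _ _ _ h ((hp j).1 hj k))
  have h0 : ∀ g ∈ elemGL A r, ∀ i j, ¬ p i → p j → g.1 i j = 0 := fun g hg i j hi hj =>
    rel_of_mem_elemGL hrefl htrans hg (hr hi hj)
  have hT : ∀ g ∈ elemGL A r, ∀ h ∈ elemGL A r, ∀ i j k, p i → p j → ¬ p k →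
      g.1 i k * h.1 k j = 0 := fun g _ h hh i j k _ hj hk => by rw [h0 h hh k j hk hj, mul_zero]
  have hT' : ∀ g ∈ elemGL A r, ∀ h ∈ elemGL A r, ∀ i j k, ¬ p i → ¬ p j → ¬ ¬ p k →
      g.1 i k * h.1 k j = 0 := fun g hg h _ i j k hi _ hk => by
    rw [h0 g hg i k hi (not_not.1 hk), zero_mul]
  let f := (restrictGL p (elemGL A r) hT).prod (restrictGL (fun x => ¬ p x) (elemGL A r) hT')
  have hgen1 : ∀ (i j : {x // p x}) (h : i ≠ j) (t : A),
      f ⟨transGL i.1 j.1 (fun e => h (Subtype.ext e)) t, transGL_mem ((hp i).1 i.2 j) _ t⟩ =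
        (transGL i j h t, 1) := fun i j h t => by
    refine Prod.ext ?_ ?_
    · ext a b
      refine (transGL_apply i.1 j.1 (fun e => h (Subtype.ext e)) t a.1 b.1).trans ?_
      rw [transGL_apply]
      simp [Subtype.ext_iff]
    · ext a b
      refine (transGL_apply i.1 j.1 (fun e => h (Subtype.ext e)) t a.1 b.1).trans ?_
      rw [if_neg (c := _ ∧ _)]
      · simp [Matrix.one_apply, Subtype.ext_iff]
      · exact fun e => a.2 (e.1 ▸ i.2)
  have hgen2 : ∀ (i j : {x // ¬ p x}) (h : i ≠ j) (t : A) (hij : r i j),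
      f ⟨transGL i.1 j.1 (fun e => h (Subtype.ext e)) t, transGL_mem hij _ t⟩ =
        (1, transGL i j h t) := fun i j h t hij => by
    refine Prod.ext ?_ ?_
    · ext a b
      refine (transGL_apply i.1 j.1 (fun e => h (Subtype.ext e)) t a.1 b.1).trans ?_
      rw [if_neg (c := _ ∧ _)]
      · simp [Matrix.one_apply, Subtype.ext_iff]
      · exact fun e => i.2 (e.1 ▸ a.2)
    · ext a b
      refine (transGL_apply i.1 j.1 (fun e => h (Subtype.ext e)) t a.1 b.1).trans ?_
      rw [transGL_apply]
      simp [Subtype.ext_iff]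
  have hgen3 : ∀ (i j : ι) (h : i ≠ j) (t : A) (hij : r i j), p i → ¬ p j →
      f ⟨transGL i j h t, transGL_mem hij _ t⟩ = 1 := fun i j h t hij hi hj => by
    refine Prod.ext ?_ ?_
    · ext a b
      refine (transGL_apply i j h t a.1 b.1).trans ?_
      rw [if_neg (c := _ ∧ _)]
      · simp [Matrix.one_apply, Subtype.ext_iff]
      · exact fun e => hj (e.2 ▸ b.2)
    · ext a b
      refine (transGL_apply i j h t a.1 b.1).trans ?_
      rw [if_neg (c := _ ∧ _)]
      · simp [Matrix.one_apply, Subtype.ext_iff]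
      · exact fun e => a.2 (e.1 ▸ hi)
  set P := (elemGL (ι := {x // p x}) A fun _ _ => True).prod
    (elemGL (ι := {x // ¬ p x}) A fun i j => r i j)
  have hfP : ∀ x, f x ∈ P := by
    rintro ⟨x, hx⟩
    induction hx using Subgroup.closure_induction with
    | mem x hx =>
      obtain ⟨i, j, h, t, hij, rfl⟩ := hx
      by_cases hi : p i
      · by_cases hj : p j
        · rw [hgen1 ⟨i, hi⟩ ⟨j, hj⟩ (fun e => h (congrArg Subtype.val e)) t]
          exact ⟨transGL_mem trivial (fun e => h (congrArg Subtype.val e)) t, one_mem _⟩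
        · rw [hgen3 i j h t hij hi hj]
          exact one_mem _
      · by_cases hj : p j
        · exact absurd hij (hr hi hj)
        · rw [hgen2 ⟨i, hi⟩ ⟨j, hj⟩ (fun e => h (congrArg Subtype.val e)) t hij]
          exact ⟨one_mem _, transGL_mem (r := fun a b : {x // ¬ p x} => r a b) hij
            (fun e => h (congrArg Subtype.val e)) t⟩
    | one => exact (map_one f).symm ▸ one_mem P
    | mul x y hx hy h1 h2 => exact (map_mul f ⟨x, hx⟩ ⟨y, hy⟩).symm ▸ mul_mem h1 h2
    | inv x hx h1 => exact (map_inv f ⟨x, hx⟩).symm ▸ inv_mem h1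
  have hPf : ∀ y ∈ P, y ∈ f.range := by
    rintro ⟨a, b⟩ ⟨ha, hb⟩
    have h1 : elemGL (ι := {x // p x}) A (fun _ _ => True) ≤
        f.range.comap (MonoidHom.inl _ _) := by
      rw [elemGL, Subgroup.closure_le]
      rintro _ ⟨i, j, h, t, -, rfl⟩
      exact ⟨_, hgen1 i j h t⟩
    have h2 : elemGL (ι := {x // ¬ p x}) A (fun i j => r i j) ≤
        f.range.comap (MonoidHom.inr _ _) := by
      rw [elemGL, Subgroup.closure_le]
      rintro _ ⟨i, j, h, t, hij, rfl⟩
      exact ⟨_, hgen2 i j h t hij⟩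
    have h3 : (a, 1) ∈ f.range := h1 ha
    have h4 : (1, b) ∈ f.range := h2 hb
    simpa only [Prod.mk_mul_mk, mul_one, one_mul] using mul_mem h3 h4
  let f' : elemGL A r →* P := f.codRestrict P hfP
  have hf' : Function.Surjective f' := fun ⟨y, hy⟩ => by
    obtain ⟨x, hx⟩ := hPf y hy
    exact ⟨x, Subtype.ext hx⟩
  have : Group.IsFinitelyPresented P := Group.IsFinitelyPresented.equiv (Subgroup.prodEquiv _ _).symm
  have := Group.FG.multiplicative_matrix (m := {x // p x}) (n := {x // ¬ p x}) (A := A)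
  have := Group.IsFinitelyPresented.of_comm (Multiplicative (Matrix {x // p x} {x // ¬ p x} A))
  have hup : ∀ N, unipGL (A := A) p N ∈ elemGL A r := unipGL_mem fun i j hi _ => (hp i).1 hi j
  have hker : ∀ N, (unipGL (A := A) p).codRestrict (elemGL A r) hup N ∈ f'.ker := fun N => by
    refine MonoidHom.mem_ker.2 (Subtype.ext (Prod.ext ?_ ?_))
    · ext a b
      refine (unipGL_apply _ _ _).trans ?_
      rw [dif_neg fun e => e.2 b.2]
      simp [Matrix.one_apply, Subtype.ext_iff]
    · ext a b
      refine (unipGL_apply _ _ _).trans ?_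
      rw [dif_neg fun e => a.2 e.1]
      simp [Matrix.one_apply, Subtype.ext_iff]
  refine Group.IsFinitelyPresented.of_mulEquiv_ker f' hf' (MulEquiv.ofBijective
    (((unipGL p).codRestrict (elemGL A r) hup).codRestrict f'.ker hker) ⟨fun N M h => ?_, ?_⟩)
  · refine Multiplicative.toAdd.injective ?_
    ext a b
    have h1 : (unipGL p N).1 a b = (unipGL p M).1 a b :=
      congrArg (fun x : f'.ker => x.1.1.1 a.1 b.1) h
    rw [unipGL_apply, unipGL_apply, dif_pos ⟨a.2, b.2⟩, dif_pos ⟨a.2, b.2⟩] at h1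
    exact add_left_cancel h1
  · rintro ⟨⟨g, hg⟩, hk⟩
    refine ⟨Multiplicative.ofAdd (g.1.submatrix Subtype.val Subtype.val), Subtype.ext (Subtype.ext ?_)⟩
    have hk1 : f ⟨g, hg⟩ = 1 := congrArg Subtype.val hk
    have hone : ∀ {a b : ι}, g.1 a b = (1 : Matrix ι ι A) a b →
        ((if a = b then (1 : A) else 0) + 0) = g.1 a b := fun {a b} h => by
      rw [h, add_zero, Matrix.one_apply]
    ext a b
    refine (unipGL_apply _ _ _).trans ?_
    by_cases ha : p a
    · by_cases hb : p b
      · rw [dif_neg fun e => e.2 hb]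
        refine hone ?_
        have := congrArg (fun z : GL {x // p x} A => z.1 ⟨a, ha⟩ ⟨b, hb⟩) (congrArg Prod.fst hk1)
        refine this.trans ?_
        simp [Matrix.one_apply]
      · rw [dif_pos ⟨ha, hb⟩, if_neg (show ¬ a = b from fun e => hb (e ▸ ha)), zero_add]
        rfl
    · rw [dif_neg fun e => ha e.1]
      refine hone ?_
      by_cases hb : p b
      · rw [h0 g hg a b ha hb, Matrix.one_apply_ne (show a ≠ b from fun e => ha (e ▸ hb))]
      · have := congrArg (fun z : GL {x // ¬ p x} A => z.1 ⟨a, ha⟩ ⟨b, hb⟩) (congrArg Prod.snd hk1)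
        refine this.trans ?_
        simp [Matrix.one_apply]

end Step

section Assembly

lemma Subgroup.fg_of_commGroup {G : Type*} [CommGroup G] [hG : Group.FG G] (H : Subgroup G) :
    Group.FG H := by
  have : Module.Finite ℤ (Additive G) := Module.Finite.iff_addGroup_fg.2 inferInstance
  have h1 : (AddSubgroup.toIntSubmodule H.toAddSubgroup).FG := IsNoetherian.noetherian _
  rw [Submodule.fg_iff_addSubgroup_fg] at h1
  rw [Group.fg_iff_subgroup_fg, Subgroup.fg_iff_add_fg]
  exact h1

lemma Group.FG.pi_commGroup {κ G : Type*} [Finite κ] [CommGroup G] [Group.FG G] :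
    Group.FG (κ → G) := by
  have : Module.Finite ℤ (Additive G) := Module.Finite.iff_addGroup_fg.2 inferInstance
  have : Module.Finite ℤ (κ → Additive G) := inferInstance
  have h1 : AddGroup.FG (κ → Additive G) := Module.Finite.iff_addGroup_fg.1 this
  have h2 : AddGroup.FG (Additive (κ → G)) := h1
  exact GroupFG.iff_add_fg.2 h2

lemma Group.IsFinitelyPresented.sup_range {G D : Type*} [Group G] [CommGroup D] [Group.FG D]
    (N : Subgroup G) [Group.IsFinitelyPresented N] (δ : D →* G)
    (h : ∀ d, ∀ x ∈ N, δ d * x * (δ d)⁻¹ ∈ N) :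
    Group.IsFinitelyPresented (N ⊔ δ.range : Subgroup G) := by
  set P := N ⊔ δ.range
  have hnorm : P ≤ Subgroup.normalizer (N : Set G) := by
    refine sup_le Subgroup.le_normalizer ?_
    rintro _ ⟨d, rfl⟩
    refine Subgroup.mem_normalizer_iff.2 fun x => ⟨h d x, fun hx => ?_⟩
    simpa [mul_assoc] using h d⁻¹ _ hx
  have : (N.subgroupOf P).Normal := Subgroup.normal_subgroupOf_iff_le_normalizer le_sup_left |>.2 hnorm
  have : Group.IsFinitelyPresented (N.subgroupOf P) :=
    Group.IsFinitelyPresented.equiv (Subgroup.subgroupOfEquivOfLe le_sup_left).symm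
  let q := QuotientGroup.mk' (N.subgroupOf P)
  let ε : D →* P ⧸ N.subgroupOf P := q.comp (δ.codRestrict P fun d => le_sup_right (a := N) ⟨d, rfl⟩)
  have hε : Function.Surjective ε := by
    have h1 : P ≤ (ε.range.comap q).map P.subtype := by
      refine sup_le (fun x hx => ?_) ?_
      · refine ⟨⟨x, le_sup_left (b := δ.range) hx⟩, ?_, rfl⟩
        refine ⟨1, ?_⟩
        rw [map_one]
        exact ((QuotientGroup.eq_one_iff (N := N.subgroupOf P) ⟨x, le_sup_left (b := δ.range) hx⟩).2
          hx).symm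
      · rintro _ ⟨d, rfl⟩
        exact ⟨⟨δ d, le_sup_right (a := N) ⟨d, rfl⟩⟩, ⟨d, rfl⟩, rfl⟩
    intro y
    obtain ⟨x, rfl⟩ := QuotientGroup.mk'_surjective _ y
    obtain ⟨x', hx', hxx⟩ := h1 x.2
    rwa [Subtype.ext hxx] at hx'
  have : Group.IsFinitelyPresented (D ⧸ ε.ker) := by
    have : Group.FG (D ⧸ ε.ker) := Group.fg_of_surjective (QuotientGroup.mk'_surjective _)
    exact Group.IsFinitelyPresented.of_comm _
  have : Group.IsFinitelyPresented (P ⧸ N.subgroupOf P) :=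
    Group.IsFinitelyPresented.equiv (QuotientGroup.quotientKerEquivOfSurjective ε hε)
  exact Group.IsFinitelyPresented.of_mulEquiv_ker q (QuotientGroup.mk'_surjective _)
    (MulEquiv.subgroupCongr (QuotientGroup.ker_mk' _).symm)

variable {ι κ A : Type*} [Fintype ι] [DecidableEq ι] [Fintype κ] [DecidableEq κ] [CommRing A]

lemma map_reindex_elemGL (e : ι ≃ κ) :
    (elemGL (ι := ι) A fun _ _ => True).map
      (Units.mapEquiv (Matrix.reindexAlgEquiv ℤ A e).toMulEquiv).toMonoidHom =
        elemGL (ι := κ) A fun _ _ => True := by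
  have h1 : ∀ (i j : ι) (h : i ≠ j) (t : A),
      Units.mapEquiv (Matrix.reindexAlgEquiv ℤ A e).toMulEquiv (transGL i j h t) =
        transGL (e i) (e j) (e.injective.ne h) t := fun i j h t => by
    ext a b
    refine (transGL_apply i j h t (e.symm a) (e.symm b)).trans ?_
    rw [transGL_apply]
    simp [Equiv.eq_symm_apply]
  rw [elemGL, elemGL, MonoidHom.map_closure]
  congr 1
  ext g
  constructor
  · rintro ⟨_, ⟨i, j, h, t, -, rfl⟩, rfl⟩
    exact ⟨e i, e j, e.injective.ne h, t, trivial, h1 i j h t⟩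
  · rintro ⟨i, j, h, t, -, rfl⟩
    refine ⟨_, ⟨e.symm i, e.symm j, e.symm.injective.ne h, t, trivial, rfl⟩, ?_⟩
    refine (h1 _ _ _ t).trans ?_
    congr 1 <;> simp

lemma elemGL_top_isFinitelyPresented
    (hE : ∀ n, Group.IsFinitelyPresented (elemGL (ι := Fin n) A fun _ _ => True))
    (ι : Type*) [Fintype ι] [DecidableEq ι] :
    Group.IsFinitelyPresented (elemGL (ι := ι) A fun _ _ => True) := by
  have := hE (Fintype.card ι)
  have e := (Units.mapEquiv (Matrix.reindexAlgEquiv ℤ A (Fintype.equivFin ι).symm).toMulEquiv).subgroupMap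
    (elemGL (ι := Fin (Fintype.card ι)) A fun _ _ => True)
  exact Group.IsFinitelyPresented.equiv (e.trans (MulEquiv.subgroupCongr (map_reindex_elemGL _)))

theorem elemGL_isFinitelyPresented [AddGroup.FG A]
    (hE : ∀ n, Group.IsFinitelyPresented (elemGL (ι := Fin n) A fun _ _ => True)) (m : ℕ) :
    ∀ (ι : Type) [Fintype ι] [DecidableEq ι], Fintype.card ι ≤ m → ∀ f : ι → ℕ,
      Group.IsFinitelyPresented (elemGL (ι := ι) A fun i j => f i ≤ f j) := by
  induction m with
  | zero =>
    intro ι _ _ hι f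
    have : IsEmpty ι := Fintype.card_eq_zero_iff.1 (by omega)
    have h1 : (fun i j => f i ≤ f j) = fun (_ _ : ι) => True := by
      funext i; exact isEmptyElim i
    rw [h1]
    exact elemGL_top_isFinitelyPresented hE ι
  | succ m ih =>
    intro ι _ _ hι f
    by_cases hall : ∀ i j, f i ≤ f j
    · have h1 : (fun i j => f i ≤ f j) = fun (_ _ : ι) => True := by
        funext i j; simp [hall i j]
      rw [h1]
      exact elemGL_top_isFinitelyPresented hE ι
    · push Not at hall
      obtain ⟨i₀, -⟩ := hall
      have : Nonempty ι := ⟨i₀⟩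
      obtain ⟨i₁, hi₁⟩ := Finite.exists_min f
      have h2 := elemGL_top_isFinitelyPresented hE {x // ∀ j, f x ≤ f j}
      have h3 := ih {x // ¬ ∀ j, f x ≤ f j} (by
        have := Fintype.card_subtype_lt (p := fun x => ¬ ∀ j, f x ≤ f j) (x := i₁) (by simpa using hi₁)
        omega) fun x => f x
      exact elemGL_isFinitelyPresented_of_block (r := fun i j => f i ≤ f j) (fun i => le_rfl)
        (fun i j k => le_trans) (fun i => ∀ j, f i ≤ f j) fun i => Iff.rfl

end Assembly

section ParabolicAssembly

lemma Group.IsFinitelyPresented.exists_finset {G : Type*} [Group G]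
    (h : Group.IsFinitelyPresented G) : _root_.IsFinitelyPresented G := by
  obtain ⟨n, rels, hr, ⟨e⟩⟩ := Group.IsFinitelyPresented.exists_mulEquiv_presentedGroup (G := G)
  refine ⟨n, hr.toFinset, ⟨?_⟩⟩
  exact (QuotientGroup.quotientMulEquivOfEq (by rw [hr.coe_toFinset])).trans e.symm

variable {A : Type*} [CommRing A] {n : ℕ}

/-- Diagonal units as invertible matrices. -/
def diagGL (A : Type*) [CommRing A] (n : ℕ) : (Fin n → Aˣ) →* GL (Fin n) A :=
  (Units.map (Matrix.diagonalRingHom (Fin n) A : (Fin n → A) →* Matrix (Fin n) (Fin n) A)).comp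
    MulEquiv.piUnits.symm.toMonoidHom

lemma diagGL_coe (d : Fin n → Aˣ) :
    (diagGL A n d).1 = Matrix.diagonal fun i => (d i : A) := rfl

/-- The homomorphism multiplying the entries of a tuple of units. -/
def prodUnits (A : Type*) [CommRing A] (n : ℕ) : (Fin n → Aˣ) →* Aˣ where
  toFun d := ∏ i, d i
  map_one' := by simp
  map_mul' a b := by simp [Finset.prod_mul_distrib]

open Classical in
/-- The number of simple roots outside `I` before an index. -/
noncomputable def blockIndex (I : Set ℕ) (i : Fin n) : ℕ :=
  ((Finset.Icc 1 i.val).filter (· ∉ I)).card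

lemma blockIndex_mono (I : Set ℕ) {i j : Fin n} (h : i ≤ j) : blockIndex I i ≤ blockIndex I j := by
  classical
  exact Finset.card_le_card (Finset.filter_subset_filter _ (Finset.Icc_subset_Icc_right h))

lemma blockIndex_le_iff (I : Set ℕ) {i j : Fin n} (h : i < j) :
    blockIndex I j ≤ blockIndex I i ↔ IConn I i j := by
  classical
  have hsub : (Finset.Icc 1 i.val).filter (· ∉ I) ⊆ (Finset.Icc 1 j.val).filter (· ∉ I) :=
    Finset.filter_subset_filter _ (Finset.Icc_subset_Icc_right h.le)
  constructor
  · intro hle k hik hkj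
    by_contra hk
    have h1 : k ∈ (Finset.Icc 1 i.val).filter (· ∉ I) := by
      rw [Finset.eq_of_subset_of_card_le hsub hle]
      simp only [Finset.mem_filter, Finset.mem_Icc]
      exact ⟨⟨by omega, hkj⟩, hk⟩
    simp only [Finset.mem_filter, Finset.mem_Icc] at h1
    omega
  · intro hc
    refine Finset.card_le_card fun k hk => ?_
    simp only [Finset.mem_filter, Finset.mem_Icc] at hk ⊢
    refine ⟨⟨hk.1.1, ?_⟩, hk.2⟩
    by_contra hlt
    exact hk.2 (hc k (by omega) hk.1.2)

lemma diagGL_conj (d : Fin n → Aˣ) (i j : Fin n) (h : i ≠ j) (t : A) :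
    diagGL A n d * transGL i j h t * (diagGL A n d)⁻¹ =
      transGL i j h (d i * t * ((d j)⁻¹ : Aˣ)) := by
  rw [mul_inv_eq_iff_eq_mul]
  ext a b
  change (Matrix.diagonal (fun i => (d i : A)) * Matrix.transvection i j t) a b =
    (Matrix.transvection i j (d i * t * ((d j)⁻¹ : Aˣ)) * Matrix.diagonal (fun i => (d i : A))) a b
  rw [Matrix.diagonal_mul, Matrix.mul_diagonal]
  refine (congrArg ((d a : A) * ·) (transGL_apply i j h t a b)).trans
    (Eq.trans ?_ (congrArg (· * (d b : A)) (transGL_apply i j h _ a b)).symm)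
  by_cases h1 : a = b
  · subst h1
    have : ¬ (i = a ∧ j = a) := fun e => h (e.1.trans e.2.symm)
    simp [this]
  · by_cases h2 : i = a ∧ j = b
    · obtain ⟨rfl, rfl⟩ := h2
      simp [h, mul_assoc]
    · simp [h1, h2]

lemma map_parabolic (I : Set ℕ) :
    (parabolic n A I).map Matrix.SpecialLinearGroup.toGL =
      elemGL A (fun i j : Fin n => blockIndex I i ≤ blockIndex I j) ⊔
        ((diagGL A n).comp (prodUnits A n).ker.subtype).range := by
  have helem : ∀ (i j : Fin n) (h : i ≠ j) (t : A),
      Matrix.SpecialLinearGroup.toGL (elemMat i j h t) = transGL i j h t := fun i j h t =>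
    Units.ext rfl
  refine le_antisymm ?_ (sup_le ?_ ?_)
  · rw [parabolic, MonoidHom.map_closure, Subgroup.closure_le]
    rintro _ ⟨g, (hg | ⟨i, j, h, t, rfl⟩) | ⟨i, j, h, t, hc, rfl⟩, rfl⟩
    · have hg' : (g.1.IsDiag) := hg
      have hdet : ∏ i, g.1 i i = 1 := by
        refine Eq.trans ?_ g.2
        conv_rhs => rw [← hg'.diagonal_diag]
        exact Matrix.det_diagonal.symm
      have hu : ∀ i, IsUnit (g.1 i i) := fun i =>
        isUnit_of_dvd_one ((Finset.dvd_prod_of_mem (fun i => g.1 i i) (Finset.mem_univ i)).trans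
          (dvd_of_eq hdet))
      choose u hu using hu
      refine Subgroup.mem_sup_right ⟨⟨u, ?_⟩, ?_⟩
      · refine MonoidHom.mem_ker.2 (Units.ext ?_)
        simp [prodUnits, hu, hdet]
      · refine Units.ext ?_
        refine Eq.trans ?_ hg'.diagonal_diag
        refine (diagGL_coe _).trans ?_
        congr 1
        funext i
        exact hu i
    · rw [helem]
      exact Subgroup.mem_sup_left (transGL_mem (r := fun i j : Fin n => blockIndex I i ≤ blockIndex I j)
        (blockIndex_mono I h.le) _ _)
    · rw [helem]
      exact Subgroup.mem_sup_left (transGL_mem (r := fun i j : Fin n => blockIndex I i ≤ blockIndex I j)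
        ((blockIndex_le_iff I h).2 hc) _ _)
  · rw [elemGL, Subgroup.closure_le]
    rintro _ ⟨i, j, h, t, hr, rfl⟩
    refine ⟨elemMat i j h t, ?_, helem i j h t⟩
    rcases lt_or_gt_of_ne h with hlt | hlt
    · exact Subgroup.subset_closure (Or.inl (Or.inr ⟨i, j, hlt, t, rfl⟩))
    · exact Subgroup.subset_closure (Or.inr ⟨j, i, hlt, t, (blockIndex_le_iff I hlt).1 hr, rfl⟩)
  · rintro _ ⟨⟨d, hd⟩, rfl⟩
    have hd' : ∏ i, (d i : A) = 1 := by
      simpa [prodUnits] using congrArg Units.val (MonoidHom.mem_ker.1 hd)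
    refine ⟨⟨Matrix.diagonal fun i => (d i : A), by rw [Matrix.det_diagonal, hd']⟩,
      Subgroup.subset_closure (Or.inl (Or.inl (Matrix.isDiag_diagonal _))), Units.ext rfl⟩

theorem parabolic_isFinitelyPresented [AddGroup.FG A] [Group.FG Aˣ]
    (hE : ∀ n, Group.IsFinitelyPresented (elemGL (ι := Fin n) A fun _ _ => True)) (I : Set ℕ) :
    Group.IsFinitelyPresented (parabolic n A I) := by
  have := elemGL_isFinitelyPresented hE n (Fin n) (by simp) (blockIndex I)
  have := Group.FG.pi_commGroup (κ := Fin n) (G := Aˣ)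
  have := Subgroup.fg_of_commGroup (prodUnits A n).ker
  have h1 := Group.IsFinitelyPresented.sup_range
    (elemGL A (fun i j : Fin n => blockIndex I i ≤ blockIndex I j))
    ((diagGL A n).comp (prodUnits A n).ker.subtype) (by
      rintro ⟨d, hd⟩ x hx
      refine (Subgroup.closure_le (K := (elemGL A _).comap
        (MulAut.conj (diagGL A n d)).toMonoidHom)).2 ?_ hx
      rintro _ ⟨i, j, h, t, hr, rfl⟩
      change diagGL A n d * transGL i j h t * (diagGL A n d)⁻¹ ∈ elemGL A _
      rw [diagGL_conj]
      exact transGL_mem (r := fun i j : Fin n => blockIndex I i ≤ blockIndex I j) hr h _)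
  rw [← map_parabolic] at h1
  exact Group.IsFinitelyPresented.equiv (Subgroup.equivMapOfInjective _ _
    Matrix.SpecialLinearGroup.toGL_injective).symm

end ParabolicAssembly

section ElementarySL

variable {A : Type*} [CommRing A]

/-- The subgroup of `SL_n` generated by the elementary matrices. -/
def elemSL (n : ℕ) (A : Type*) [CommRing A] : Subgroup (Matrix.SpecialLinearGroup (Fin n) A) :=
  Subgroup.closure {g | ∃ (i j : Fin n) (h : i ≠ j) (t : A), g = elemMat i j h t}

lemma elemMat_mem {n : ℕ} (i j : Fin n) (h : i ≠ j) (t : A) : elemMat i j h t ∈ elemSL n A :=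
  Subgroup.subset_closure ⟨i, j, h, t, rfl⟩

lemma elemMat_apply {n : ℕ} (i j : Fin n) (h : i ≠ j) (t : A) (a b : Fin n) :
    (elemMat i j h t).1 a b = (if a = b then 1 else 0) + if i = a ∧ j = b then t else 0 := by
  simp [elemMat, Matrix.transvection, Matrix.one_apply, Matrix.single_apply]

lemma map_elemSL (n : ℕ) :
    (elemSL n A).map Matrix.SpecialLinearGroup.toGL =
      elemGL (ι := Fin n) A fun _ _ => True := by
  rw [elemSL, MonoidHom.map_closure, elemGL]
  congr 1
  ext g
  constructor
  · rintro ⟨_, ⟨i, j, h, t, rfl⟩, rfl⟩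
    exact ⟨i, j, h, t, trivial, Units.ext rfl⟩
  · rintro ⟨i, j, h, t, -, rfl⟩
    exact ⟨_, ⟨i, j, h, t, rfl⟩, Units.ext rfl⟩

lemma elemGL_isFinitelyPresented_of_elemSL {n : ℕ} [Group.IsFinitelyPresented (elemSL n A)] :
    Group.IsFinitelyPresented (elemGL (ι := Fin n) A fun _ _ => True) :=
  Group.IsFinitelyPresented.equiv ((Subgroup.equivMapOfInjective _ _
    Matrix.SpecialLinearGroup.toGL_injective).trans (MulEquiv.subgroupCongr (map_elemSL n)))

variable {n : ℕ}

/-- Adding multiples of the zeroth row to the other rows. -/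
def colSL (n : ℕ) (A : Type*) [CommRing A] :
    Multiplicative (Fin n → A) →* Matrix.SpecialLinearGroup (Fin (n + 1)) A where
  toFun c := ⟨1 + Matrix.of fun i j => if j = 0 then (Fin.cons 0 c.toAdd : Fin (n + 1) → A) i else 0, by
    rw [Matrix.det_of_isLowerTriangular]
    · refine Finset.prod_eq_one fun i _ => ?_
      by_cases h : i = 0
      · subst h; simp
      · simp [h]
    · intro i j hij
      have h1 : i < j := hij
      have h2 : j ≠ 0 := (Fin.pos_of_ne_zero (Fin.ne_zero_of_lt h1)).ne'
      simp [h2, Matrix.one_apply_ne h1.ne]⟩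
  map_one' := by
    ext i j
    refine Fin.cases ?_ (fun i => ?_) i <;> simp
  map_mul' c d := by
    ext i j
    change _ = (_ * _ : Matrix _ _ _) i j
    rw [Matrix.mul_apply, Fin.sum_univ_succ]
    refine Fin.cases ?_ (fun i => ?_) i <;> refine Fin.cases ?_ (fun j => ?_) j <;>
    simp [Matrix.one_apply, Fin.succ_ne_zero, (Fin.succ_ne_zero _).symm, add_comm]

/-- Adding multiples of the other rows to the zeroth row. -/
def rowSL (n : ℕ) (A : Type*) [CommRing A] :
    Multiplicative (Fin n → A) →* Matrix.SpecialLinearGroup (Fin (n + 1)) A where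
  toFun c := ⟨1 + Matrix.of fun i j => if i = 0 then (Fin.cons 0 c.toAdd : Fin (n + 1) → A) j else 0, by
    rw [Matrix.det_of_isUpperTriangular]
    · refine Finset.prod_eq_one fun i _ => ?_
      by_cases h : i = 0
      · subst h; simp
      · simp [h]
    · intro i j hij
      have h1 : j < i := hij
      have h2 : i ≠ 0 := (Fin.pos_of_ne_zero (Fin.ne_zero_of_lt h1)).ne'
      simp [h2, Matrix.one_apply_ne h1.ne']⟩
  map_one' := by
    ext i j
    refine Fin.cases ?_ (fun i => ?_) j <;> simp
  map_mul' c d := by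
    ext i j
    change _ = (_ * _ : Matrix _ _ _) i j
    rw [Matrix.mul_apply, Fin.sum_univ_succ]
    refine Fin.cases ?_ (fun i => ?_) i <;> refine Fin.cases ?_ (fun j => ?_) j <;>
    simp [Matrix.one_apply, Fin.succ_ne_zero, (Fin.succ_ne_zero _).symm, add_comm]

lemma colSL_mem (c : Multiplicative (Fin n → A)) : colSL n A c ∈ elemSL (n + 1) A := by
  have h : ∀ i t, Multiplicative.ofAdd (Pi.single i t) ∈ (elemSL (n + 1) A).comap (colSL n A) :=
    fun i t => by
      refine (congrArg (· ∈ elemSL (n + 1) A) ?_).mpr (elemMat_mem i.succ 0 (Fin.succ_ne_zero i) t)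
      ext a b
      rw [elemMat_apply]
      refine congrArg₂ (fun x y : A => x + y) Matrix.one_apply ?_
      refine Fin.cases ?_ (fun a => ?_) a <;> refine Fin.cases ?_ (fun b => ?_) b <;>
      simp [Fin.succ_ne_zero, (Fin.succ_ne_zero _).symm, Pi.single_apply, eq_comm]
  have h1 : c = ∏ i, Multiplicative.ofAdd (Pi.single i (c.toAdd i)) := by
    rw [← ofAdd_sum, Finset.univ_sum_single]
    rfl
  rw [h1]
  exact Subgroup.prod_mem ((elemSL (n + 1) A).comap (colSL n A)) fun i _ => h i _

lemma rowSL_mem (c : Multiplicative (Fin n → A)) : rowSL n A c ∈ elemSL (n + 1) A := by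
  have h : ∀ i t, Multiplicative.ofAdd (Pi.single i t) ∈ (elemSL (n + 1) A).comap (rowSL n A) :=
    fun i t => by
      refine (congrArg (· ∈ elemSL (n + 1) A) ?_).mpr (elemMat_mem 0 i.succ (Fin.succ_ne_zero i).symm t)
      ext a b
      rw [elemMat_apply]
      refine congrArg₂ (fun x y : A => x + y) Matrix.one_apply ?_
      refine Fin.cases ?_ (fun a => ?_) a <;> refine Fin.cases ?_ (fun b => ?_) b <;>
      simp [Fin.succ_ne_zero, (Fin.succ_ne_zero _).symm, Pi.single_apply, eq_comm]
  have h1 : c = ∏ i, Multiplicative.ofAdd (Pi.single i (c.toAdd i)) := by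
    rw [← ofAdd_sum, Finset.univ_sum_single]
    rfl
  rw [h1]
  exact Subgroup.prod_mem ((elemSL (n + 1) A).comap (rowSL n A)) fun i _ => h i _

lemma colSL_mul_apply_zero (c : Fin n → A) (g : Matrix.SpecialLinearGroup (Fin (n + 1)) A)
    (j : Fin (n + 1)) : (colSL n A (.ofAdd c) * g).1 0 j = g.1 0 j := by
  change ((1 + Matrix.of fun i j : Fin (n + 1) =>
    if j = 0 then (Fin.cons 0 c : Fin (n + 1) → A) i else 0) * g.1) 0 j = _
  rw [Matrix.add_mul, Matrix.one_mul, Matrix.add_apply, Matrix.mul_apply, Fin.sum_univ_succ]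
  simp [Fin.succ_ne_zero]

lemma colSL_mul_apply_succ (c : Fin n → A) (g : Matrix.SpecialLinearGroup (Fin (n + 1)) A)
    (i : Fin n) (j : Fin (n + 1)) :
    (colSL n A (.ofAdd c) * g).1 i.succ j = g.1 i.succ j + c i * g.1 0 j := by
  change ((1 + Matrix.of fun i j : Fin (n + 1) =>
    if j = 0 then (Fin.cons 0 c : Fin (n + 1) → A) i else 0) * g.1) i.succ j = _
  rw [Matrix.add_mul, Matrix.one_mul, Matrix.add_apply, Matrix.mul_apply, Fin.sum_univ_succ]
  simp [Fin.succ_ne_zero]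

lemma rowSL_mul_apply_zero (c : Fin n → A) (g : Matrix.SpecialLinearGroup (Fin (n + 1)) A)
    (j : Fin (n + 1)) :
    (rowSL n A (.ofAdd c) * g).1 0 j = g.1 0 j + ∑ i, c i * g.1 (Fin.succ i) j := by
  change ((1 + Matrix.of fun i j : Fin (n + 1) =>
    if i = 0 then (Fin.cons 0 c : Fin (n + 1) → A) j else 0) * g.1) 0 j = _
  rw [Matrix.add_mul, Matrix.one_mul, Matrix.add_apply, Matrix.mul_apply, Fin.sum_univ_succ]
  simp

lemma rowSL_mul_apply_succ (c : Fin n → A) (g : Matrix.SpecialLinearGroup (Fin (n + 1)) A)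
    (i : Fin n) (j : Fin (n + 1)) :
    (rowSL n A (.ofAdd c) * g).1 i.succ j = g.1 i.succ j := by
  change ((1 + Matrix.of fun i j : Fin (n + 1) =>
    if i = 0 then (Fin.cons 0 c : Fin (n + 1) → A) j else 0) * g.1) i.succ j = _
  rw [Matrix.add_mul, Matrix.one_mul, Matrix.add_apply, Matrix.mul_apply, Fin.sum_univ_succ]
  simp [Fin.succ_ne_zero]

/-- Adding a row and a column of the identity matrix. -/
def cornerMat (g : Matrix (Fin n) (Fin n) A) : Matrix (Fin (n + 1)) (Fin (n + 1)) A :=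
  Matrix.of (Fin.cons (Fin.cons 1 0) fun i => Fin.cons 0 (g i))

lemma cornerMat_mul (g h : Matrix (Fin n) (Fin n) A) :
    cornerMat (g * h) = cornerMat g * cornerMat h := by
  ext i j
  rw [Matrix.mul_apply, Fin.sum_univ_succ]
  refine Fin.cases ?_ (fun i => ?_) i <;> refine Fin.cases ?_ (fun j => ?_) j <;>
  simp [cornerMat, Matrix.mul_apply]

/-- The lower right corner embedding. -/
def cornerSL (n : ℕ) (A : Type*) [CommRing A] :
    Matrix.SpecialLinearGroup (Fin n) A →* Matrix.SpecialLinearGroup (Fin (n + 1)) A where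
  toFun g := ⟨cornerMat g.1, by
    rw [cornerMat]
    rw [Matrix.det_succ_column_zero, Fin.sum_univ_succ]
    simp only [Matrix.of_apply, Fin.cons_zero, Fin.cons_succ, mul_zero, zero_mul,
      Finset.sum_const_zero, add_zero, Fin.val_zero, pow_zero, one_mul]
    exact g.2⟩
  map_one' := by
    ext i j
    refine Fin.cases ?_ (fun i => ?_) i <;> refine Fin.cases ?_ (fun j => ?_) j <;>
    simp [cornerMat, Matrix.one_apply, Fin.succ_ne_zero, (Fin.succ_ne_zero _).symm]
  map_mul' g h := Subtype.ext (cornerMat_mul g.1 h.1)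

lemma cornerSL_zero_zero (g : Matrix.SpecialLinearGroup (Fin n) A) :
    (cornerSL n A g).1 0 0 = 1 := rfl

lemma cornerSL_zero_succ (g : Matrix.SpecialLinearGroup (Fin n) A) (j : Fin n) :
    (cornerSL n A g).1 0 j.succ = 0 := rfl

lemma cornerSL_succ_zero (g : Matrix.SpecialLinearGroup (Fin n) A) (i : Fin n) :
    (cornerSL n A g).1 i.succ 0 = 0 := rfl

lemma cornerSL_succ_succ (g : Matrix.SpecialLinearGroup (Fin n) A) (i j : Fin n) :
    (cornerSL n A g).1 i.succ j.succ = g.1 i j := rfl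

lemma elemSL_le_comap_cornerSL : elemSL n A ≤ (elemSL (n + 1) A).comap (cornerSL n A) := by
  rw [elemSL, Subgroup.closure_le]
  rintro _ ⟨i, j, h, t, rfl⟩
  refine (congrArg (· ∈ elemSL (n + 1) A) ?_).mpr
    (elemMat_mem i.succ j.succ ((Fin.succ_injective n).ne h) t)
  ext a b
  rw [elemMat_apply]
  refine Fin.cases ?_ (fun a => ?_) a <;> refine Fin.cases ?_ (fun b => ?_) b
  · simp [cornerSL_zero_zero, Fin.succ_ne_zero]
  · simp [cornerSL_zero_succ, Fin.succ_ne_zero, (Fin.succ_ne_zero _).symm]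
  · simp [cornerSL_succ_zero, Fin.succ_ne_zero]
  · rw [cornerSL_succ_succ, elemMat_apply]
    simp

end ElementarySL

section StableRange

lemma exists_add_mul_notMem {R : Type*} [CommRing R] [IsDedekindDomain R] {a : R} (ha : a ≠ 0)
    (b c : R) : ∃ t, ∀ M : Ideal R, M.IsMaximal → a ∈ M → b + t * c ∈ M → b ∈ M ∧ c ∈ M := by
  classical
  set S := {v : IsDedekindDomain.HeightOneSpectrum R | v.asIdeal ∣ Ideal.span {a}}
  have hS : S.Finite := Ideal.finite_factors (by simpa using ha)
  have : Finite S := hS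
  obtain ⟨t, ht⟩ := Ideal.exists_forall_sub_mem_ideal (I := fun v : S => v.1.asIdeal)
    (fun v w hvw => Ideal.isCoprime_iff_sup_eq.2 (v.1.isMaximal.coprime_of_ne w.1.isMaximal
      fun h => hvw (Subtype.ext (IsDedekindDomain.HeightOneSpectrum.ext h))))
    (fun v => if b ∈ v.1.asIdeal then 1 else 0)
  refine ⟨t, fun M hM haM hbt => ?_⟩
  have hM0 : M ≠ ⊥ := fun h => ha (by simpa [h] using haM)
  have h1 := ht ⟨⟨M, hM.isPrime, hM0⟩, Ideal.dvd_span_singleton.2 haM⟩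
  simp only at h1
  by_cases hb : b ∈ M
  · rw [if_pos hb] at h1
    have h2 : t * c ∈ M := (M.add_mem_iff_right hb).1 hbt
    refine ⟨hb, ?_⟩
    have := M.sub_mem h2 (M.mul_mem_right c h1)
    convert this using 1
    ring
  · rw [if_neg hb, sub_zero] at h1
    exact absurd ((M.add_mem_iff_left (M.mul_mem_right c h1)).1 hbt) hb

lemma exists_isCoprime_add_mul {R : Type*} [CommRing R] [IsDedekindDomain R] {a b m : R}
    (hm : m ≠ 0) (h : IsCoprime a b) : ∃ t, IsCoprime m (b + t * a) := by
  obtain ⟨t, ht⟩ := exists_add_mul_notMem hm b a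
  refine ⟨t, ?_⟩
  rw [← Ideal.isCoprime_span_singleton_iff, Ideal.isCoprime_iff_sup_eq]
  by_contra hne
  obtain ⟨M, hM, hle⟩ := Ideal.exists_le_maximal _ hne
  obtain ⟨h1, h2⟩ := ht M hM (hle (Ideal.mem_sup_left (Ideal.mem_span_singleton_self _)))
    (hle (Ideal.mem_sup_right (Ideal.mem_span_singleton_self _)))
  obtain ⟨x, y, hxy⟩ := h
  exact hM.ne_top (M.eq_top_of_isUnit_mem (hxy ▸ M.add_mem (M.mul_mem_left x h2)
    (M.mul_mem_left y h1)) isUnit_one)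

lemma exists_unimodular_shift {R : Type*} [CommRing R] [IsDedekindDomain R] {n : ℕ} (hn : 2 ≤ n)
    (x : R) (a : Fin n → R) (h : ∀ M : Ideal R, M.IsMaximal → x ∈ M → ¬ ∀ i, a i ∈ M) :
    ∃ t c : Fin n → R, x + ∑ i, c i * (a i + t i * x) = 1 := by
  suffices hs : ∃ t : Fin n → R, ∀ M : Ideal R, M.IsMaximal → ¬ ∀ i, a i + t i * x ∈ M by
    obtain ⟨t, ht⟩ := hs
    have h1 : Ideal.span (Set.range fun i => a i + t i * x) = ⊤ := by
      by_contra hne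
      obtain ⟨M, hM, hle⟩ := Ideal.exists_le_maximal _ hne
      exact ht M hM fun i => hle (Ideal.subset_span ⟨i, rfl⟩)
    have h2 : 1 - x ∈ Ideal.span (Set.range fun i => a i + t i * x) := h1 ▸ Submodule.mem_top
    obtain ⟨c, hc⟩ := Ideal.mem_span_range_iff_exists_fun.1 h2
    exact ⟨t, c, by rw [hc]; ring⟩
  by_cases hx : x = 0
  · refine ⟨0, fun M hM hall => h M hM (hx ▸ M.zero_mem) fun i => ?_⟩
    simpa using hall i
  obtain ⟨s, hs⟩ : ∃ s : R, a ⟨0, by omega⟩ + s * x ≠ 0 := by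
    by_cases h0 : a ⟨0, by omega⟩ = 0
    · exact ⟨1, by simpa [h0] using hx⟩
    · exact ⟨0, by simpa using h0⟩
  obtain ⟨u, hu⟩ := exists_add_mul_notMem hs (a ⟨1, by omega⟩) x
  refine ⟨fun i => if i.val = 0 then s else if i.val = 1 then u else 0, fun M hM hall => ?_⟩
  have h0 := hall ⟨0, by omega⟩
  have h1 := hall ⟨1, by omega⟩
  simp only [if_true, one_ne_zero, if_false] at h0 h1
  have hxM := (hu M hM h0 h1).2
  exact h M hM hxM fun i => (M.add_mem_iff_left (M.mul_mem_left _ hxM)).1 (hall i)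

end StableRange

section Reduction

variable {A : Type*} [CommRing A]

lemma exists_elemSL_mul_cornerSL [IsDedekindDomain A] {n : ℕ} (hn : 2 ≤ n)
    (g : Matrix.SpecialLinearGroup (Fin (n + 1)) A) :
    ∃ u ∈ elemSL (n + 1) A, ∃ g', g = u * cornerSL n A g' := by
  obtain ⟨t, c, htc⟩ := exists_unimodular_shift hn (g.1 0 0) (fun i => g.1 (Fin.succ i) 0)
    (fun M hM h0 hall => by
      refine hM.ne_top (M.eq_top_of_isUnit_mem ?_ (isUnit_one : IsUnit (1 : A)))
      rw [← g.2, Matrix.det_succ_column_zero]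
      refine M.sum_mem fun i _ => M.mul_mem_right _ (M.mul_mem_left _ ?_)
      exact Fin.cases h0 hall i)
  set g1 := colSL n A (.ofAdd t) * g
  set g2 := rowSL n A (.ofAdd c) * g1
  have h2 : g2.1 0 0 = 1 := by
    refine (rowSL_mul_apply_zero c g1 0).trans ?_
    rw [colSL_mul_apply_zero]
    refine Eq.trans ?_ htc
    congr 1
    exact Finset.sum_congr rfl fun i _ => congrArg (c i * ·) (colSL_mul_apply_succ t g i 0)
  set g3 := colSL n A (.ofAdd fun i => - g2.1 (Fin.succ i) 0) * g2
  have h3 : g3.1 0 0 = 1 := (colSL_mul_apply_zero _ g2 0).trans h2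
  have h3' : ∀ i : Fin n, g3.1 i.succ 0 = 0 := fun i => by
    refine (colSL_mul_apply_succ _ g2 i 0).trans ?_
    rw [h2]; ring
  have hdet : (g3.1.submatrix Fin.succ Fin.succ).det = 1 := by
    have h := g3.2
    rw [Matrix.det_succ_column_zero, Fin.sum_univ_succ] at h
    simp only [h3, h3', Fin.val_zero, pow_zero, mul_zero, zero_mul, Finset.sum_const_zero,
      add_zero, one_mul] at h
    exact h
  let g' : Matrix.SpecialLinearGroup (Fin n) A := ⟨g3.1.submatrix Fin.succ Fin.succ, hdet⟩
  let s : Fin n → A := Matrix.vecMul (fun j => g3.1 0 (Fin.succ j)) (g'⁻¹).1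
  have hs : Matrix.vecMul s g'.1 = fun j => g3.1 0 (Fin.succ j) := by
    rw [Matrix.vecMul_vecMul]
    have : (g'⁻¹).1 * g'.1 = 1 := congrArg Subtype.val (inv_mul_cancel g')
    rw [this, Matrix.vecMul_one]
  have h4 : g3 = rowSL n A (.ofAdd s) * cornerSL n A g' := by
    ext i j
    refine Fin.cases ?_ (fun i => ?_) i
    · refine Eq.trans ?_ (rowSL_mul_apply_zero s _ j).symm
      refine Fin.cases ?_ (fun j => ?_) j
      · simp [cornerSL_zero_zero, cornerSL_succ_zero, h3]
      · simp only [cornerSL_zero_succ, cornerSL_succ_succ, zero_add]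
        exact (congrFun hs j).symm
    · refine Eq.trans ?_ (rowSL_mul_apply_succ s _ i j).symm
      refine Fin.cases ?_ (fun j => ?_) j
      · exact h3' i
      · rfl
  refine ⟨(colSL n A (.ofAdd t))⁻¹ * (rowSL n A (.ofAdd c))⁻¹ *
    (colSL n A (.ofAdd fun i => - g2.1 (Fin.succ i) 0))⁻¹ * rowSL n A (.ofAdd s), ?_, g', ?_⟩
  · exact mul_mem (mul_mem (mul_mem (inv_mem (colSL_mem _)) (inv_mem (rowSL_mem _)))
      (inv_mem (colSL_mem _))) (rowSL_mem _)
  · rw [mul_assoc, ← h4]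
    simp [g3, g2, g1, mul_assoc]

lemma Subgroup.FiniteIndex.of_cover {G G' : Type*} [Group G] [Group G'] (f : G' →* G)
    (H : Subgroup G) (H' : Subgroup G') [H'.FiniteIndex] (hle : H' ≤ H.comap f)
    (hcov : ∀ g, ∃ u ∈ H, ∃ g', g = u * f g') : H.FiniteIndex := by
  let φ : G' ⧸ H' → G ⧸ H := Quotient.map' f fun a b hab => by
    rw [QuotientGroup.leftRel_apply] at hab ⊢
    simpa using hle hab
  have hφ : Function.Surjective φ := fun q => by
    induction q using QuotientGroup.induction_on with
    | H g =>
      obtain ⟨u, hu, g', hg⟩ := hcov g⁻¹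
      refine ⟨(g'⁻¹ : G'), ?_⟩
      refine (QuotientGroup.eq (s := H)).2 ?_
      have : (f g'⁻¹)⁻¹ * g = u⁻¹ := by
        rw [inv_eq_iff_eq_inv.1 hg]
        simp
      rw [this]
      exact inv_mem hu
  have : Finite (G ⧸ H) := Finite.of_surjective φ hφ
  exact Subgroup.finiteIndex_of_finite_quotient

lemma elemSL_finiteIndex_succ [IsDedekindDomain A] {n : ℕ} (hn : 2 ≤ n)
    [(elemSL n A).FiniteIndex] : (elemSL (n + 1) A).FiniteIndex :=
  Subgroup.FiniteIndex.of_cover (cornerSL n A) _ (elemSL n A) elemSL_le_comap_cornerSL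
    (exists_elemSL_mul_cornerSL hn)

end Reduction

section MennickeSymbols

variable {A : Type*} [CommRing A]

/-- A matrix of determinant one with given entries. -/
def mkSL2 (a b c d : A) (h : a * d - b * c = 1) : Matrix.SpecialLinearGroup (Fin 2) A :=
  ⟨!![a, b; c, d], by rw [Matrix.det_fin_two_of, h]⟩

lemma SL2_det (g : Matrix.SpecialLinearGroup (Fin 2) A) :
    g.1 0 0 * g.1 1 1 - g.1 0 1 * g.1 1 0 = 1 := by
  have := g.2
  rwa [Matrix.det_fin_two] at this

lemma SL2_ext {g h : Matrix.SpecialLinearGroup (Fin 2) A} (h1 : g.1 0 0 = h.1 0 0)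
    (h2 : g.1 0 1 = h.1 0 1) (h3 : g.1 1 0 = h.1 1 0) (h4 : g.1 1 1 = h.1 1 1) : g = h := by
  ext i j
  fin_cases i <;> fin_cases j
  exacts [h1, h2, h3, h4]

lemma SL2_mul_apply (g h : Matrix.SpecialLinearGroup (Fin 2) A) (i j : Fin 2) :
    (g * h).1 i j = g.1 i 0 * h.1 0 j + g.1 i 1 * h.1 1 j :=
  (Matrix.mul_apply).trans (Fin.sum_univ_two _)

/-- Upper unipotent matrices. -/
abbrev upSL (t : A) : Matrix.SpecialLinearGroup (Fin 2) A := elemMat 0 1 zero_ne_one t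

/-- Lower unipotent matrices. -/
abbrev loSL (t : A) : Matrix.SpecialLinearGroup (Fin 2) A := elemMat 1 0 one_ne_zero t

lemma upSL_coe (t : A) : (upSL t).1 = !![1, t; 0, 1] := by
  ext i j
  fin_cases i <;> fin_cases j <;> simp [elemMat, Matrix.transvection]

lemma loSL_coe (t : A) : (loSL t).1 = !![1, 0; t, 1] := by
  ext i j
  fin_cases i <;> fin_cases j <;> simp [elemMat, Matrix.transvection]

lemma upSL_mem (t : A) : upSL t ∈ elemSL 2 A := elemMat_mem _ _ _ _

lemma loSL_mem (t : A) : loSL t ∈ elemSL 2 A := elemMat_mem _ _ _ _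

lemma eq_loSL_mul {g h : Matrix.SpecialLinearGroup (Fin 2) A} (h0 : g.1 0 0 = h.1 0 0)
    (h1 : g.1 0 1 = h.1 0 1) : g = loSL (g.1 1 0 * h.1 1 1 - g.1 1 1 * h.1 1 0) * h := by
  have hg := SL2_det g
  have hh := SL2_det h
  rw [h0, h1] at hg
  refine SL2_ext ?_ ?_ ?_ ?_ <;> rw [SL2_mul_apply, loSL_coe]
  · simpa using h0
  · simpa using h1
  · simp only [Matrix.of_apply, Matrix.cons_val', Matrix.cons_val_zero, Matrix.cons_val_one,
      Matrix.cons_val_fin_one]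
    linear_combination (-g.1 1 0) * hh + h.1 1 0 * hg
  · simp only [Matrix.of_apply, Matrix.cons_val', Matrix.cons_val_zero, Matrix.cons_val_one,
      Matrix.cons_val_fin_one]
    linear_combination (-g.1 1 1) * hh + h.1 1 1 * hg

lemma elemMat_eq_commutator {n : ℕ} {i j k : Fin n} (hij : i ≠ j) (hik : i ≠ k) (hkj : k ≠ j)
    (t : A) : elemMat i j hij t = elemMat i k hik t * elemMat k j hkj 1 * elemMat i k hik (-t) *
      elemMat k j hkj (-1) := by
  refine Subtype.ext ?_
  change Matrix.transvection i j t = Matrix.transvection i k t * Matrix.transvection k j 1 *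
    Matrix.transvection i k (-t) * Matrix.transvection k j (-1)
  have hneg : ∀ (a b : Fin n) (s : A), Matrix.single a b (-s) = -Matrix.single a b s :=
    fun a b s => map_neg (Matrix.singleAddMonoidHom a b) s
  simp only [Matrix.transvection, hneg, add_mul, mul_add, one_mul, mul_one,
    Matrix.single_mul_single_same, Matrix.single_mul_single_of_ne _ _ _ _ hij.symm,
    Matrix.single_mul_single_of_ne _ _ _ _ hik.symm,
    Matrix.single_mul_single_of_ne _ _ _ _ hkj.symm, zero_mul,
    mul_neg, neg_mul]
  abel

lemma colSL_apply_zero {n : ℕ} (c : Fin n → A) (j : Fin (n + 1)) :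
    (colSL n A (.ofAdd c)).1 0 j = (1 : Matrix (Fin (n + 1)) (Fin (n + 1)) A) 0 j := by
  have := colSL_mul_apply_zero c 1 j
  rwa [mul_one] at this

lemma colSL_apply_succ {n : ℕ} (c : Fin n → A) (i : Fin n) (j : Fin (n + 1)) :
    (colSL n A (.ofAdd c)).1 i.succ j =
      (1 : Matrix (Fin (n + 1)) (Fin (n + 1)) A) i.succ j + c i * (1 : Matrix (Fin (n + 1)) (Fin (n + 1)) A) 0 j := by
  have := colSL_mul_apply_succ c 1 i j
  rwa [mul_one] at this

lemma rowSL_apply_zero {n : ℕ} (c : Fin n → A) (j : Fin (n + 1)) :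
    (rowSL n A (.ofAdd c)).1 0 j =
      (1 : Matrix (Fin (n + 1)) (Fin (n + 1)) A) 0 j + ∑ i, c i * (1 : Matrix (Fin (n + 1)) (Fin (n + 1)) A) (Fin.succ i) j := by
  have := rowSL_mul_apply_zero c 1 j
  rwa [mul_one] at this

lemma rowSL_apply_succ {n : ℕ} (c : Fin n → A) (i : Fin n) (j : Fin (n + 1)) :
    (rowSL n A (.ofAdd c)).1 i.succ j = (1 : Matrix (Fin (n + 1)) (Fin (n + 1)) A) i.succ j := by
  have := rowSL_mul_apply_succ c 1 i j
  rwa [mul_one] at this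

lemma cornerSL_conj_col {n : ℕ} (g : Matrix.SpecialLinearGroup (Fin n) A) (c : Fin n → A) :
    cornerSL n A g * colSL n A (.ofAdd c) =
      colSL n A (.ofAdd (Matrix.mulVec g.1 c)) * cornerSL n A g := by
  ext i j
  have h := Matrix.mul_apply (M := (cornerSL n A g).1) (N := (colSL n A (.ofAdd c)).1) (i := i) (k := j)
  refine h.trans ?_
  rw [Fin.sum_univ_succ]
  refine Fin.cases ?_ (fun i => ?_) i
  · refine Eq.trans ?_ (colSL_mul_apply_zero _ _ _).symm
    refine Fin.cases ?_ (fun j => ?_) j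
    · simp [cornerSL_zero_zero, cornerSL_zero_succ, colSL_apply_zero, colSL_apply_succ]
    · simp [cornerSL_zero_zero, cornerSL_zero_succ, colSL_apply_zero, colSL_apply_succ, Matrix.one_apply, (Fin.succ_ne_zero _).symm]
  · refine Eq.trans ?_ (colSL_mul_apply_succ _ _ _ _).symm
    refine Fin.cases ?_ (fun j => ?_) j
    · simp [cornerSL_zero_zero, cornerSL_succ_zero, cornerSL_succ_succ, colSL_apply_zero, colSL_apply_succ, Fin.succ_ne_zero, Matrix.mulVec, dotProduct]
    · simp [cornerSL_zero_succ, cornerSL_succ_zero, cornerSL_succ_succ, colSL_apply_zero, colSL_apply_succ, Matrix.one_apply,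
        (Fin.succ_ne_zero _).symm]

lemma cornerSL_conj_row {n : ℕ} (g : Matrix.SpecialLinearGroup (Fin n) A) (c : Fin n → A) :
    cornerSL n A g * rowSL n A (.ofAdd (Matrix.vecMul c g.1)) =
      rowSL n A (.ofAdd c) * cornerSL n A g := by
  ext i j
  have h := Matrix.mul_apply (M := (cornerSL n A g).1)
    (N := (rowSL n A (.ofAdd (Matrix.vecMul c g.1))).1) (i := i) (k := j)
  refine h.trans ?_
  rw [Fin.sum_univ_succ]
  refine Fin.cases ?_ (fun i => ?_) i
  · refine Eq.trans ?_ (rowSL_mul_apply_zero _ _ _).symm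
    refine Fin.cases ?_ (fun j => ?_) j
    · simp [cornerSL_zero_zero, cornerSL_zero_succ, cornerSL_succ_zero, rowSL_apply_zero, rowSL_apply_succ, Fin.succ_ne_zero]
    · simp [cornerSL_zero_zero, cornerSL_zero_succ, cornerSL_succ_succ, rowSL_apply_zero, rowSL_apply_succ,
        Matrix.one_apply, (Fin.succ_ne_zero _).symm, Matrix.vecMul, dotProduct]
  · refine Eq.trans ?_ (rowSL_mul_apply_succ _ _ _ _).symm
    refine Fin.cases ?_ (fun j => ?_) j
    · simp [cornerSL_succ_zero, cornerSL_succ_succ, rowSL_apply_zero, rowSL_apply_succ, Fin.succ_ne_zero]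
    · simp [cornerSL_succ_zero, cornerSL_succ_succ, rowSL_apply_zero, rowSL_apply_succ,
        Matrix.one_apply]

lemma elemMat_succ_zero {n : ℕ} (i : Fin n) (h : i.succ ≠ 0) (t : A) :
    elemMat i.succ 0 h t = colSL n A (.ofAdd (Pi.single i t)) := by
  ext a b
  rw [elemMat_apply]
  refine congrArg₂ (fun x y : A => x + y) Matrix.one_apply.symm ?_
  refine Fin.cases ?_ (fun a => ?_) a <;> refine Fin.cases ?_ (fun b => ?_) b <;>
  simp [Fin.succ_ne_zero, (Fin.succ_ne_zero _).symm, Pi.single_apply, eq_comm]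

lemma elemMat_zero_succ {n : ℕ} (i : Fin n) (h : 0 ≠ i.succ) (t : A) :
    elemMat 0 i.succ h t = rowSL n A (.ofAdd (Pi.single i t)) := by
  ext a b
  rw [elemMat_apply]
  refine congrArg₂ (fun x y : A => x + y) Matrix.one_apply.symm ?_
  refine Fin.cases ?_ (fun a => ?_) a <;> refine Fin.cases ?_ (fun b => ?_) b <;>
  simp [Fin.succ_ne_zero, (Fin.succ_ne_zero _).symm, Pi.single_apply, eq_comm]

lemma cornerSL_conj_mem {n : ℕ} (g : Matrix.SpecialLinearGroup (Fin n) A)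
    {x : Matrix.SpecialLinearGroup (Fin (n + 1)) A} (hx : x ∈ elemSL (n + 1) A) :
    cornerSL n A g * x * (cornerSL n A g)⁻¹ ∈ elemSL (n + 1) A := by
  have hcol : ∀ (i : Fin n) (h : i.succ ≠ 0) (t : A),
      elemMat i.succ 0 h t ∈ (elemSL (n + 1) A).comap (MulAut.conj (cornerSL n A g)).toMonoidHom :=
    fun i h t => by
      change cornerSL n A g * elemMat i.succ 0 h t * (cornerSL n A g)⁻¹ ∈ elemSL (n + 1) A
      rw [elemMat_succ_zero, cornerSL_conj_col, mul_inv_cancel_right]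
      exact colSL_mem _
  have hrow : ∀ (i : Fin n) (h : 0 ≠ i.succ) (t : A),
      elemMat 0 i.succ h t ∈ (elemSL (n + 1) A).comap (MulAut.conj (cornerSL n A g)).toMonoidHom :=
    fun i h t => by
      change cornerSL n A g * elemMat 0 i.succ h t * (cornerSL n A g)⁻¹ ∈ elemSL (n + 1) A
      have h1 : (g⁻¹).1 * g.1 = 1 := congrArg Subtype.val (inv_mul_cancel g)
      have h2 := cornerSL_conj_row g (Matrix.vecMul (Pi.single i t) (g⁻¹).1)
      rw [Matrix.vecMul_vecMul, h1, Matrix.vecMul_one] at h2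
      rw [elemMat_zero_succ, h2, mul_inv_cancel_right]
      exact rowSL_mem _
  refine (Subgroup.closure_le (K := (elemSL (n + 1) A).comap
    (MulAut.conj (cornerSL n A g)).toMonoidHom)).2 ?_ hx
  rintro _ ⟨i, j, h, t, rfl⟩
  revert h
  refine Fin.cases ?_ (fun i => ?_) i <;> refine Fin.cases ?_ (fun j => ?_) j
  · exact fun h => absurd rfl h
  · exact fun h => hrow j h t
  · exact fun h => hcol i h t
  · intro h
    rw [elemMat_eq_commutator h (Fin.succ_ne_zero i) (Fin.succ_ne_zero j).symm t]
    exact mul_mem (mul_mem (mul_mem (hcol _ _ _) (hrow _ _ _)) (hcol _ _ _)) (hrow _ _ _)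

lemma elemSL_normal [IsDedekindDomain A] {n : ℕ} (hn : 2 ≤ n) : (elemSL (n + 1) A).Normal := by
  refine ⟨fun x hx g => ?_⟩
  obtain ⟨u, hu, g', rfl⟩ := exists_elemSL_mul_cornerSL hn g
  have := mul_mem (mul_mem hu (cornerSL_conj_mem g' hx)) (inv_mem hu)
  simpa [mul_assoc] using this

end MennickeSymbols

section MennickeFinite

variable {A : Type*} [CommRing A]

lemma elemMat_inv {n : ℕ} (i j : Fin n) (h : i ≠ j) (t : A) :
    (elemMat i j h t)⁻¹ = elemMat i j h (-t) := by
  refine inv_eq_of_mul_eq_one_right (Subtype.ext ?_)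
  change Matrix.transvection i j t * Matrix.transvection i j (-t) = 1
  rw [Matrix.transvection_mul_transvection_same _ _ h, add_neg_cancel, Matrix.transvection_zero]

/-- The Weyl element of `SL_2`. -/
def weylSL : Matrix.SpecialLinearGroup (Fin 2) A := mkSL2 0 (-1) 1 0 (by ring)

lemma weylSL_mem : (weylSL : Matrix.SpecialLinearGroup (Fin 2) A) ∈ elemSL 2 A := by
  have h : (weylSL : Matrix.SpecialLinearGroup (Fin 2) A) = upSL (-1) * loSL 1 * upSL (-1) := by
    refine Subtype.ext ?_
    change _ = (upSL (-1)).1 * (loSL 1).1 * (upSL (-1)).1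
    rw [upSL_coe, loSL_coe]
    simp [weylSL, mkSL2]
  rw [h]
  exact mul_mem (mul_mem (upSL_mem _) (loSL_mem _)) (upSL_mem _)

lemma cornerSL_two_coe (g : Matrix.SpecialLinearGroup (Fin 2) A) :
    (cornerSL 2 A g).1 = !![1, 0, 0; 0, g.1 0 0, g.1 0 1; 0, g.1 1 0, g.1 1 1] := by
  ext i j
  fin_cases i <;> fin_cases j <;> rfl

/-- The cyclic permutation matrix. -/
def cycSL : Matrix.SpecialLinearGroup (Fin 3) A :=
  ⟨!![0, 1, 0; 0, 0, 1; 1, 0, 0], by simp [Matrix.det_fin_three]⟩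

lemma cycSL_mem : (cycSL : Matrix.SpecialLinearGroup (Fin 3) A) ∈ elemSL 3 A := by
  have h : (cycSL : Matrix.SpecialLinearGroup (Fin 3) A) =
      elemMat 1 2 (by decide) 1 * elemMat 2 1 (by decide) (-1) * elemMat 1 2 (by decide) 1 *
      (elemMat 0 1 (by decide) 1 * elemMat 1 0 (by decide) (-1) * elemMat 0 1 (by decide) 1) := by
    refine Subtype.ext ?_
    change !![0, 1, 0; 0, 0, 1; 1, 0, 0] = Matrix.transvection 1 2 1 * Matrix.transvection 2 1 (-1) *
      Matrix.transvection 1 2 1 * (Matrix.transvection 0 1 1 * Matrix.transvection 1 0 (-1) *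
      Matrix.transvection 0 1 1)
    ext i j
    fin_cases i <;> fin_cases j <;>
      simp [Matrix.mul_apply, Fin.sum_univ_three, Matrix.transvection, Matrix.single_apply]
  rw [h]
  exact mul_mem (mul_mem (mul_mem (elemMat_mem _ _ _ _) (elemMat_mem _ _ _ _)) (elemMat_mem _ _ _ _))
    (mul_mem (mul_mem (elemMat_mem _ _ _ _) (elemMat_mem _ _ _ _)) (elemMat_mem _ _ _ _))

lemma mennicke_identity (a b₁ c₁ d₁ b₂ r s : A) (h₁ : a * d₁ - b₁ * c₁ = 1)
    (h₂ : b₂ * s - a * r = 1) :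
    cornerSL 2 A weylSL * elemMat 2 1 (by decide) (-s) * cycSL *
      cornerSL 2 A (mkSL2 a b₁ c₁ d₁ h₁) * cycSL⁻¹ * cornerSL 2 A (mkSL2 b₂ a r s h₂) *
      elemMat 0 2 (by decide) (-b₁) * elemMat 2 0 (by decide) (-c₁) *
      elemMat 2 1 (by decide) (-(d₁ * b₂)) =
    cycSL * cornerSL 2 A (mkSL2 a (b₁ * b₂) (s * c₁) (s * d₁ * b₂ - r)
      (by linear_combination (s * b₂) * h₁ + h₂)) * cycSL⁻¹ := by
  have hinv : (cycSL : Matrix.SpecialLinearGroup (Fin 3) A)⁻¹ =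
      ⟨!![0, 0, 1; 1, 0, 0; 0, 1, 0], by simp [Matrix.det_fin_three]⟩ := by
    refine inv_eq_of_mul_eq_one_right (Subtype.ext ?_)
    change !![0, 1, 0; 0, 0, 1; 1, 0, 0] * !![0, 0, 1; 1, 0, 0; 0, 1, 0] = (1 : Matrix _ _ A)
    ext i j
    fin_cases i <;> fin_cases j <;> simp
  have t21 : ∀ t : A, Matrix.transvection (2 : Fin 3) 1 t = !![1, 0, 0; 0, 1, 0; 0, t, 1] := by
    intro t
    ext i j
    fin_cases i <;> fin_cases j <;> simp [Matrix.transvection]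
  have t20 : ∀ t : A, Matrix.transvection (2 : Fin 3) 0 t = !![1, 0, 0; 0, 1, 0; t, 0, 1] := by
    intro t
    ext i j
    fin_cases i <;> fin_cases j <;> simp [Matrix.transvection]
  have t02 : ∀ t : A, Matrix.transvection (0 : Fin 3) 2 t = !![1, 0, t; 0, 1, 0; 0, 0, 1] := by
    intro t
    ext i j
    fin_cases i <;> fin_cases j <;> simp [Matrix.transvection]
  rw [hinv]
  refine Subtype.ext ?_
  change (cornerSL 2 A weylSL).1 * Matrix.transvection 2 1 (-s) * !![0, 1, 0; 0, 0, 1; 1, 0, 0] *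
      (cornerSL 2 A (mkSL2 a b₁ c₁ d₁ h₁)).1 * !![0, 0, 1; 1, 0, 0; 0, 1, 0] *
      (cornerSL 2 A (mkSL2 b₂ a r s h₂)).1 * Matrix.transvection 0 2 (-b₁) *
      Matrix.transvection 2 0 (-c₁) * Matrix.transvection 2 1 (-(d₁ * b₂)) =
    !![0, 1, 0; 0, 0, 1; 1, 0, 0] * (cornerSL 2 A (mkSL2 a (b₁ * b₂) (s * c₁) (s * d₁ * b₂ - r) _)).1 *
      !![0, 0, 1; 1, 0, 0; 0, 1, 0]
  have ew : (weylSL : Matrix.SpecialLinearGroup (Fin 2) A).1 = !![0, -1; 1, 0] := rfl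
  have em : ∀ x y z w (h : x * w - y * z = (1 : A)), (mkSL2 x y z w h).1 = !![x, y; z, w] :=
    fun _ _ _ _ _ => rfl
  simp only [cornerSL_two_coe, t21, t20, t02, ew, em, Matrix.of_apply, Matrix.cons_val',
    Matrix.cons_val_zero, Matrix.cons_val_one, Matrix.cons_val_fin_one]
  iterate 10
    rw [Matrix.mul_fin_three]
    simp only [mul_zero, zero_mul, mul_one, one_mul, add_zero, zero_add]
  have e0 : a * -b₁ + b₁ * a = 0 := by ring
  have e1 : c₁ * -b₁ + d₁ * a = 1 := by linear_combination h₁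
  have e2 : -1 * -s * c₁ * -b₁ + (-1 * -s * d₁ * a + -1 * s) = 0 := by linear_combination s * h₁
  simp only [e0, e1, e2, zero_mul, add_zero, one_mul]
  have e3 : c₁ + -c₁ = 0 := by ring
  have e4 : d₁ * b₂ + -(d₁ * b₂) = 0 := by ring
  have e5 : -1 * -s * d₁ * b₂ + -1 * r = s * d₁ * b₂ - r := by ring
  have e6 : -1 * -s * c₁ = s * c₁ := by ring
  rw [e3, e4, e5, e6]

end MennickeFinite

section MennickeGroup

variable {A : Type*} [CommRing A] [IsDomain A] [IsDedekindDomain A] [Ring.HasFiniteQuotients A]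

lemma mennicke_comm_torsion {Q : Type*} [Group Q] (S : A → A → Q)
    (hS1 : S 1 0 = 1)
    (hup : ∀ a b t, IsCoprime a b → S a (b + a * t) = S a b)
    (hlo : ∀ a b t, IsCoprime a b → S (a + b * t) b = S a b)
    (hmul : ∀ a b₁ b₂, IsCoprime a b₁ → IsCoprime a b₂ → S a b₁ * S b₂ a = S a (b₁ * b₂)) :
    (∀ a₁ b₁ a₂ b₂, IsCoprime a₁ b₁ → IsCoprime a₂ b₂ → S a₁ b₁ * S a₂ b₂ = S a₂ b₂ * S a₁ b₁) ∧
      ∀ a b, IsCoprime a b → ∃ k, 0 < k ∧ S a b ^ k = 1 := by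
  have h1 : ∀ a, S a 1 = 1 := by
    intro a
    have e1 := hlo a 1 (1 - a) isCoprime_one_right
    have e2 := hup 1 1 (-1) isCoprime_one_right
    rw [one_mul, add_sub_cancel] at e1
    rw [one_mul, add_neg_cancel, hS1] at e2
    rw [← e1, ← e2]
  have hsym : ∀ a b, IsCoprime a b → S b a = S a b := by
    intro a b h
    have := hmul a 1 b isCoprime_one_right h
    rwa [h1, one_mul, one_mul] at this
  have hmul' : ∀ a b₁ b₂, IsCoprime a b₁ → IsCoprime a b₂ → S a b₁ * S a b₂ = S a (b₁ * b₂) := by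
    intro a b₁ b₂ h₁ h₂
    rw [← hmul a b₁ b₂ h₁ h₂, hsym a b₂ h₂]
  constructor
  · have key : ∀ a₁ b₁ a₂ b₂, IsCoprime a₁ b₁ → IsCoprime a₂ b₂ → b₁ ≠ 0 →
        S a₁ b₁ * S a₂ b₂ = S a₂ b₂ * S a₁ b₁ := by
      intro a₁ b₁ a₂ b₂ h₁ h₂ hb
      obtain ⟨t, u, v, huv⟩ := exists_isCoprime_add_mul hb h₂
      set b := b₂ + t * a₂ with hbdef
      have h₂' : IsCoprime a₂ b := by
        rw [hbdef]
        exact IsCoprime.add_mul_right_right h₂ t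
      have e2 : S a₂ b₂ = S a₂ b := by
        rw [hbdef, mul_comm t, hup _ _ _ h₂]
      have f1 := hlo a₁ b₁ (u * (a₂ - a₁)) h₁
      have f2 := hlo a₂ b (v * (a₁ - a₂)) h₂'
      have c1 := IsCoprime.add_mul_left_left h₁ (u * (a₂ - a₁))
      have c2 := IsCoprime.add_mul_left_left h₂' (v * (a₁ - a₂))
      have ea : a₁ + b₁ * (u * (a₂ - a₁)) = a₂ + b * (v * (a₁ - a₂)) := by
        linear_combination (a₂ - a₁) * huv
      rw [← ea] at f2 c2
      rw [e2, ← f1, ← f2, hmul' _ _ _ c1 c2, hmul' _ _ _ c2 c1, mul_comm b]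
    intro a₁ b₁ a₂ b₂ h₁ h₂
    by_cases hb : b₁ = 0
    · have ha : a₁ ≠ 0 := by
        rintro rfl
        rw [hb, isCoprime_zero_left] at h₁
        exact not_isUnit_zero h₁
      rw [← hup a₁ b₁ 1 h₁]
      refine key _ _ _ _ (IsCoprime.add_mul_left_right h₁ 1) h₂ ?_
      rwa [hb, zero_add, mul_one]
    · exact key _ _ _ _ h₁ h₂ hb
  · have key : ∀ a b, IsCoprime a b → a ≠ 0 → ∃ k, 0 < k ∧ S a b ^ k = 1 := by
      intro a b h ha
      have hpow : ∀ k, S a (b ^ k) = S a b ^ k := by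
        intro k
        induction k with
        | zero => rw [pow_zero, pow_zero, h1]
        | succ k ih => rw [pow_succ, pow_succ, ← hmul' _ _ _ (h.pow_right) h, ih]
      have hfin : Finite (A ⧸ Ideal.span {a}) :=
        Ring.HasFiniteQuotients.finiteQuotient (by rwa [Ne, Ideal.span_singleton_eq_bot])
      have hu : IsUnit (Ideal.Quotient.mk (Ideal.span {a}) b) := by
        obtain ⟨u, v, huv⟩ := h
        refine IsUnit.of_mul_eq_one (Ideal.Quotient.mk _ v) ?_
        rw [← map_mul, ← map_one (Ideal.Quotient.mk (Ideal.span {a})), Ideal.Quotient.eq,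
          Ideal.mem_span_singleton]
        exact ⟨-u, by linear_combination huv⟩
      obtain ⟨u, hu⟩ := hu
      obtain ⟨k, hk, hk1⟩ := isOfFinOrder_iff_pow_eq_one.1 (isOfFinOrder_of_finite u)
      refine ⟨k, hk, ?_⟩
      have := congrArg Units.val hk1
      rw [Units.val_pow_eq_pow_val, hu, Units.val_one, ← map_pow,
        ← map_one (Ideal.Quotient.mk (Ideal.span {a})), Ideal.Quotient.eq,
        Ideal.mem_span_singleton] at this
      obtain ⟨t, ht⟩ := this
      have e := hup a 1 t isCoprime_one_right
      rw [← ht, add_sub_cancel, h1, hpow] at e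
      exact e
    intro a b h
    by_cases ha : a = 0
    · have hb : b ≠ 0 := by
        rintro rfl
        rw [ha, isCoprime_zero_left] at h
        exact not_isUnit_zero h
      obtain ⟨k, hk, e⟩ := key _ _ (IsCoprime.add_mul_left_left h 1) (by rwa [ha, zero_add, mul_one])
      exact ⟨k, hk, by rwa [hlo a b 1 h] at e⟩
    · exact key a b h ha

variable (A) in
theorem elemSL_three_finiteIndex [Group.FG (Matrix.SpecialLinearGroup (Fin 3) A)] :
    (elemSL 3 A).FiniteIndex := by
  have hN : (elemSL 3 A).Normal := elemSL_normal le_rfl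
  let π := QuotientGroup.mk' (elemSL 3 A)
  have hπ : ∀ g ∈ elemSL 3 A, π g = 1 := fun g hg => (QuotientGroup.eq_one_iff g).2 hg
  let κ := π.comp (cornerSL 2 A)
  have hκ : ∀ g ∈ elemSL 2 A, κ g = 1 := fun g hg => hπ _ (elemSL_le_comap_cornerSL hg)
  have hsurj : Function.Surjective κ := by
    intro x
    obtain ⟨g, rfl⟩ := QuotientGroup.mk'_surjective _ x
    obtain ⟨u, hu, g', rfl⟩ := exists_elemSL_mul_cornerSL le_rfl g
    exact ⟨g', by rw [map_mul]; exact (congrArg (· * _) (hπ u hu)).trans (one_mul _) |>.symm⟩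
  have hrow : ∀ g h : Matrix.SpecialLinearGroup (Fin 2) A, g.1 0 0 = h.1 0 0 →
      g.1 0 1 = h.1 0 1 → κ g = κ h := by
    intro g h h0 h1
    rw [eq_loSL_mul h0 h1, map_mul, hκ _ (loSL_mem _), one_mul]
  classical
  let S : A → A → Matrix.SpecialLinearGroup (Fin 3) A ⧸ elemSL 3 A := fun a b =>
    if h : ∃ g : Matrix.SpecialLinearGroup (Fin 2) A, g.1 0 0 = a ∧ g.1 0 1 = b then
      κ h.choose else 1
  have hS : ∀ g, S (g.1 0 0) (g.1 0 1) = κ g := by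
    intro g
    have h : ∃ g' : Matrix.SpecialLinearGroup (Fin 2) A, g'.1 0 0 = g.1 0 0 ∧ g'.1 0 1 = g.1 0 1 :=
      ⟨g, rfl, rfl⟩
    change dite _ _ _ = _
    rw [dif_pos h]
    exact hrow _ _ h.choose_spec.1 h.choose_spec.2
  have hS' : ∀ a b c d h, S a b = κ (mkSL2 a b c d h) := fun a b c d h => hS (mkSL2 a b c d h)
  have hco : ∀ a b : A, IsCoprime a b → ∃ c d, a * d - b * c = 1 := by
    rintro a b ⟨u, v, h⟩
    exact ⟨-v, u, by linear_combination h⟩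
  obtain ⟨hcomm, htors⟩ := mennicke_comm_torsion S
    (by rw [hS' 1 0 0 1 (by ring)]; 
        have h1 : mkSL2 (1 : A) 0 0 1 (by ring) = 1 := by
          ext i j
          fin_cases i <;> fin_cases j <;> simp [mkSL2]
        rw [h1, map_one])
    (by
      intro a b t hab
      obtain ⟨c, d, h⟩ := hco a b hab
      rw [hS' a b c d h, hS' a (b + a * t) c (d + c * t) (by linear_combination h)]
      have : mkSL2 a (b + a * t) c (d + c * t) (by linear_combination h) =
        mkSL2 a b c d h * upSL t := by
        refine SL2_ext ?_ ?_ ?_ ?_ <;> rw [SL2_mul_apply, upSL_coe] <;> simp [mkSL2, add_comm]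
      rw [this, map_mul, hκ _ (upSL_mem _), mul_one])
    (by
      intro a b t hab
      obtain ⟨c, d, h⟩ := hco a b hab
      rw [hS' a b c d h, hS' (a + b * t) b (c + d * t) d (by linear_combination h)]
      have : mkSL2 (a + b * t) b (c + d * t) d (by linear_combination h) =
        mkSL2 a b c d h * loSL t := by
        refine SL2_ext ?_ ?_ ?_ ?_ <;> rw [SL2_mul_apply, loSL_coe] <;> simp [mkSL2, add_comm]
      rw [this, map_mul, hκ _ (loSL_mem _), mul_one])
    (by
      intro a b₁ b₂ hab₁ hab₂
      obtain ⟨c₁, d₁, h₁⟩ := hco a b₁ hab₁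
      obtain ⟨r, s, h₂⟩ := hco b₂ a hab₂.symm
      rw [hS' a b₁ c₁ d₁ h₁, hS' b₂ a r s h₂, hS' a (b₁ * b₂) (s * c₁) (s * d₁ * b₂ - r)
        (by linear_combination (s * b₂) * h₁ + h₂)]
      have := congrArg π (mennicke_identity a b₁ c₁ d₁ b₂ r s h₁ h₂)
      simp only [map_mul, map_inv, hπ _ cycSL_mem, hπ _ (elemMat_mem _ _ _ _), mul_one, inv_one,
        one_mul, hπ _ (elemSL_le_comap_cornerSL weylSL_mem)] at this
      exact this)
  have hco' : ∀ g : Matrix.SpecialLinearGroup (Fin 2) A, IsCoprime (g.1 0 0) (g.1 0 1) := fun g =>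
    ⟨g.1 1 1, -g.1 1 0, by linear_combination SL2_det g⟩
  let _ : CommGroup (Matrix.SpecialLinearGroup (Fin 3) A ⧸ elemSL 3 A) :=
    { (inferInstance : Group (Matrix.SpecialLinearGroup (Fin 3) A ⧸ elemSL 3 A)) with
      mul_comm := by
        intro x y
        obtain ⟨g, rfl⟩ := hsurj x
        obtain ⟨h, rfl⟩ := hsurj y
        rw [← hS, ← hS]
        exact hcomm _ _ _ _ (hco' g) (hco' h) }
  have ht : IsMulTorsion (Matrix.SpecialLinearGroup (Fin 3) A ⧸ elemSL 3 A) := by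
    intro x
    obtain ⟨g, rfl⟩ := hsurj x
    rw [← hS]
    exact isOfFinOrder_iff_pow_eq_one.2 (htors _ _ (hco' g))
  have hfg : Group.FG (Matrix.SpecialLinearGroup (Fin 3) A ⧸ elemSL 3 A) :=
    QuotientGroup.fg _
  have := CommGroup.finite_of_fg_isMulTorsion _ ht
  exact Subgroup.finiteIndex_of_finite_quotient

theorem elemSL_finiteIndex_of_three_le [Group.FG (Matrix.SpecialLinearGroup (Fin 3) A)] {n : ℕ}
    (hn : 3 ≤ n) : (elemSL n A).FiniteIndex := by
  induction n, hn using Nat.le_induction with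
  | base => exact elemSL_three_finiteIndex A
  | succ n hn ih => exact elemSL_finiteIndex_succ (by omega)

end MennickeGroup

section CyclicQuotients

open NumberField Polynomial

lemma intCast_eval {R : Type*} [CommRing R] (p : ℤ[X]) (m : ℤ) :
    ((p.eval m : ℤ) : R) = (p.map (algebraMap ℤ R)).eval (m : R) := by
  rw [eval_map, ← eq_intCast (algebraMap ℤ R), ← eq_intCast (algebraMap ℤ R) m, eval₂_at_apply]

variable {K : Type*} [Field K] [NumberField K]

lemma exists_dvd_natCast {a : 𝓞 K} (ha : a ≠ 0) : ∃ n : ℕ, n ≠ 0 ∧ a ∣ (n : 𝓞 K) := by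
  refine ⟨Ideal.absNorm (Ideal.span {a}), ?_, Ideal.mem_span_singleton.1 (Ideal.absNorm_mem _)⟩
  rwa [Ne, Ideal.absNorm_eq_zero_iff, Ideal.span_singleton_eq_bot]

lemma exists_natCast_mul_mem_adjoin {θ : 𝓞 K} (hθ : IntermediateField.adjoin ℚ {(θ : K)} = ⊤) :
    ∃ f : ℕ, f ≠ 0 ∧ ∀ y : 𝓞 K, ∃ p : ℤ[X], (f : 𝓞 K) * y = aeval θ p := by
  have hint : IsIntegral ℚ (θ : K) := Algebra.IsIntegral.isIntegral _
  have htop : Algebra.adjoin ℚ {(θ : K)} = ⊤ := by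
    rw [← IntermediateField.adjoin_simple_toSubalgebra_of_isAlgebraic hint.isAlgebraic, hθ]
    rfl
  set B := PowerBasis.ofAdjoinEqTop hint htop
  have hgen : B.gen = (θ : K) := PowerBasis.ofAdjoinEqTop_gen hint htop
  have hBi : IsIntegral ℤ B.gen := by
    rw [hgen]
    exact RingOfIntegers.isIntegral_coe θ
  have hd : IsIntegral ℤ (Algebra.discr ℚ B.basis) := by
    refine Algebra.discr_isIntegral (L := K) ℚ fun i => ?_
    rw [B.coe_basis]
    exact hBi.pow _
  obtain ⟨D, hD⟩ := IsIntegrallyClosed.isIntegral_iff.1 hd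
  have hD0 : D ≠ 0 := by
    rintro rfl
    exact Algebra.discr_not_zero_of_basis ℚ B.basis (by rw [← hD, map_zero])
  refine ⟨D.natAbs, Int.natAbs_ne_zero.2 hD0, fun y => ?_⟩
  have key : ∃ p : ℤ[X], (D : 𝓞 K) * y = aeval θ p := by
    have := Algebra.discr_mul_isIntegral_mem_adjoin ℚ hBi (RingOfIntegers.isIntegral_coe y)
    rw [hgen, Algebra.adjoin_singleton_eq_range_aeval] at this
    obtain ⟨p, hp⟩ := this
    refine ⟨p, RingOfIntegers.ext ?_⟩
    have h1 : ((aeval θ p : 𝓞 K) : K) = aeval (θ : K) p := (aeval_algebraMap_apply K θ p).symm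
    rw [h1]
    refine Eq.trans ?_ hp.symm
    rw [← hD, Algebra.smul_def]
    simp
  obtain ⟨p, hp⟩ := key
  rcases Int.natAbs_eq D with h | h
  · refine ⟨p, ?_⟩
    rw [← hp]
    congr 1
    conv_rhs => rw [h]
    simp
  · refine ⟨-p, ?_⟩
    rw [map_neg, ← hp, ← neg_mul]
    congr 1
    conv_rhs => rw [h]
    simp

lemma exists_add_mul_adjoin_eq_top (θ B : 𝓞 K) (hB : B ≠ 0) :
    ∃ s : 𝓞 K, IntermediateField.adjoin ℚ {((θ + B * s : 𝓞 K) : K)} = ⊤ := by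
  classical
  obtain ⟨α, hα⟩ := Field.exists_primitive_element ℚ K
  have hal : IsAlgebraic ℤ α := by
    rw [IsFractionRing.isAlgebraic_iff ℤ ℚ K]
    exact Algebra.IsAlgebraic.isAlgebraic α
  obtain ⟨c, hc, hcα⟩ := hal.exists_integral_multiple
  set γ : 𝓞 K := ⟨c • α, hcα⟩
  have hsplit : ∀ x : K, ((minpoly ℚ x).map (algebraMap ℚ ℂ)).Splits :=
    fun x => IsAlgClosed.splits _
  have hγ : ∀ φ ψ : K →ₐ[ℚ] ℂ, φ γ = ψ γ → φ = ψ := by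
    intro φ ψ h
    refine (Field.primitive_element_iff_algHom_eq_of_eval ℚ ℂ hsplit α φ).1 hα ψ ?_
    have e : (γ : K) = (c : K) * α := zsmul_eq_mul α c
    rw [e, map_mul, map_mul, map_intCast, map_intCast] at h
    exact mul_left_cancel₀ (Int.cast_ne_zero.2 hc) h
  obtain ⟨N, hN, B', hNB⟩ := exists_dvd_natCast hB
  have hbad : (⋃ p : {p : (K →ₐ[ℚ] ℂ) × (K →ₐ[ℚ] ℂ) // p.1 ≠ p.2}, {t : ℕ |
      p.1.1 θ + N * t * p.1.1 γ = p.1.2 θ + N * t * p.1.2 γ}).Finite := by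
    refine Set.finite_iUnion fun p => Set.Subsingleton.finite fun t ht t' ht' => ?_
    have ht : p.1.1 θ + N * t * p.1.1 γ = p.1.2 θ + N * t * p.1.2 γ := ht
    have ht' : p.1.1 θ + N * t' * p.1.1 γ = p.1.2 θ + N * t' * p.1.2 γ := ht'
    have h0 : p.1.1 γ - p.1.2 γ ≠ 0 := fun h => p.2 (hγ _ _ (sub_eq_zero.1 h))
    have h1 : (N : ℂ) * (p.1.1 γ - p.1.2 γ) ≠ 0 := mul_ne_zero (Nat.cast_ne_zero.2 hN) h0
    have h2 : (t : ℂ) = t' := by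
      refine mul_left_cancel₀ h1 ?_
      linear_combination ht - ht'
    exact_mod_cast h2
  obtain ⟨t, ht⟩ := hbad.exists_notMem
  refine ⟨B' * (t * γ), ?_⟩
  have e : ∀ φ : K →ₐ[ℚ] ℂ, φ ((θ + B * (B' * (t * γ)) : 𝓞 K) : K) = φ θ + N * t * φ γ := by
    intro φ
    rw [← mul_assoc, ← hNB]
    simp [mul_assoc]
  refine (Field.primitive_element_iff_algHom_eq_of_eval' ℚ ℂ hsplit _).2 fun φ ψ h => ?_
  by_contra hne
  refine ht (Set.mem_iUnion.2 ⟨⟨(φ, ψ), hne⟩, ?_⟩)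
  change φ _ = ψ _ at h
  rw [e, e] at h
  exact h

lemma exists_isCoprime_cyclic_shift {a b : 𝓞 K} (ha : a ≠ 0) (h : IsCoprime a b) {M : ℕ}
    (hM : M ≠ 0) : ∃ x, IsCoprime (M : 𝓞 K) (b + x * a) ∧
      ∀ y : 𝓞 K, ∃ t : ℤ, b + x * a ∣ y - t := by
  classical
  set d := Module.finrank ℤ (𝓞 K)
  obtain ⟨n, hn, hna⟩ := exists_dvd_natCast ha
  set B : ℕ := n * d.factorial * M with hBdef
  have hB : B ≠ 0 := mul_ne_zero (mul_ne_zero hn (Nat.factorial_ne_zero d)) hM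
  have hB' : (B : 𝓞 K) ≠ 0 := Nat.cast_ne_zero.2 hB
  have haB : a ∣ (B : 𝓞 K) := by
    rw [hBdef, Nat.cast_mul, Nat.cast_mul, mul_assoc]
    exact hna.mul_right _
  obtain ⟨t₀, ht₀⟩ := exists_isCoprime_add_mul hB' h
  obtain ⟨s, hs⟩ := exists_add_mul_adjoin_eq_top (b + t₀ * a) (B : 𝓞 K) hB'
  set θ := b + t₀ * a + B * s with hθ
  have hθB : IsCoprime (B : 𝓞 K) θ := IsCoprime.add_mul_left_right ht₀ s
  obtain ⟨f, hf, hfθ⟩ := exists_natCast_mul_mem_adjoin hs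
  set χ := minpoly ℤ θ
  have hχm : χ.Monic := minpoly.monic (Algebra.IsIntegral.isIntegral θ)
  have hχd : χ.natDegree ≤ d := minpoly.natDegree_le θ
  have hχ0 : aeval θ χ = 0 := minpoly.aeval ℤ θ
  set P := f.primeFactors.filter fun p => ¬ p ∣ B with hP
  have hk : ∀ p ∈ P, ∃ k : ℕ, ¬ (p : ℤ) ∣ χ.eval (-(B * k : ℤ)) := by
    intro p hp
    obtain ⟨hpf, hpB⟩ := Finset.mem_filter.1 hp
    have hpp : p.Prime := Nat.prime_of_mem_primeFactors hpf
    have : Fact p.Prime := ⟨hpp⟩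
    have hdp : d < p := by
      by_contra! hle
      refine hpB ?_
      rw [hBdef]
      exact ((hpp.dvd_factorial.2 hle).mul_left _).mul_right _
    have hm := hχm.map (Int.castRingHom (ZMod p))
    obtain ⟨r, hr⟩ := Polynomial.exists_eval_ne_zero_of_natDegree_lt_card
      (χ.map (Int.castRingHom (ZMod p))) hm.ne_zero (by
        rw [Cardinal.mk_fintype, ZMod.card, hχm.natDegree_map]
        exact_mod_cast hχd.trans_lt hdp)
    have hB0 : (B : ZMod p) ≠ 0 := by
      rwa [Ne, ZMod.natCast_eq_zero_iff]
    refine ⟨(-r / B : ZMod p).val, fun hdvd => hr ?_⟩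
    rw [← ZMod.intCast_zmod_eq_zero_iff_dvd, intCast_eval] at hdvd
    rw [← hdvd]
    congr 1
    rw [Int.cast_neg, Int.cast_mul, Int.cast_natCast, Int.cast_natCast, ZMod.natCast_zmod_val,
      mul_div_cancel₀ _ hB0, neg_neg]
  choose! κ hκ using hk
  obtain ⟨k, hk⟩ := Nat.chineseRemainderOfFinset κ id P
    (fun p hp => (Nat.prime_of_mem_primeFactors (Finset.mem_filter.1 hp).1).ne_zero)
    (fun p hp q hq hpq => (Nat.coprime_primes
      (Nat.prime_of_mem_primeFactors (Finset.mem_filter.1 hp).1)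
      (Nat.prime_of_mem_primeFactors (Finset.mem_filter.1 hq).1)).2 hpq)
  have hk' : ∀ p ∈ P, ¬ (p : ℤ) ∣ χ.eval (-(B * k : ℤ)) := by
    intro p hp hdvd
    refine hκ p hp ?_
    have e1 : (-(B * κ p : ℤ)) - (-(B * k : ℤ)) ∣ χ.eval (-(B * κ p : ℤ)) - χ.eval (-(B * k : ℤ)) :=
      Polynomial.sub_dvd_eval_sub _ _ _
    have e2 : (p : ℤ) ∣ (-(B * κ p : ℤ)) - (-(B * k : ℤ)) := by
      have : (p : ℤ) ∣ (k : ℤ) - κ p := (Nat.modEq_iff_dvd.1 (hk p hp).symm)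
      obtain ⟨w, hw⟩ := this
      exact ⟨B * w, by linear_combination (B : ℤ) * hw⟩
    have := (e2.trans e1).add hdvd
    rwa [sub_add_cancel] at this
  set ϑ := θ + B * k with hϑ
  have hco : IsCoprime ((f * B : ℕ) : 𝓞 K) ϑ := by
    rw [← Ideal.isCoprime_span_singleton_iff, Ideal.isCoprime_iff_sup_eq]
    by_contra hne
    obtain ⟨Q, hQ, hle⟩ := Ideal.exists_le_maximal _ hne
    have h1 : ((f * B : ℕ) : 𝓞 K) ∈ Q := hle (Ideal.mem_sup_left (Ideal.mem_span_singleton_self _))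
    have h2 : ϑ ∈ Q := hle (Ideal.mem_sup_right (Ideal.mem_span_singleton_self _))
    have hnt : ∀ {x y : 𝓞 K}, IsCoprime x y → x ∈ Q → y ∈ Q → False := by
      rintro x y ⟨u, v, huv⟩ hx hy
      exact hQ.ne_top (Q.eq_top_of_isUnit_mem (huv ▸ Q.add_mem (Q.mul_mem_left u hx)
        (Q.mul_mem_left v hy)) isUnit_one)
    by_cases hBQ : (B : 𝓞 K) ∈ Q
    · refine hnt hθB hBQ ?_
      rw [hϑ] at h2
      exact (Q.add_mem_iff_left (Q.mul_mem_right _ hBQ)).1 h2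
    · rw [Nat.cast_mul] at h1
      have hfQ := (hQ.isPrime.mem_or_mem h1).resolve_right hBQ
      have : ∃ p ∈ f.primeFactors, (p : 𝓞 K) ∈ Q := by
        by_contra! hall
        refine absurd hfQ ?_
        rw [← Nat.prod_factorization_pow_eq_self hf, Finsupp.prod, Nat.cast_prod]
        intro hmem
        obtain ⟨p, hp, hpQ⟩ := (hQ.isPrime.prod_mem_iff).1 hmem
        rw [Nat.cast_pow] at hpQ
        exact hall p hp (hQ.isPrime.mem_of_pow_mem _ hpQ)
      obtain ⟨p, hp, hpQ⟩ := this
      have hpp := Nat.prime_of_mem_primeFactors hp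
      have hpB : ¬ p ∣ B := by
        rintro ⟨w, hw⟩
        refine hBQ ?_
        rw [hw, Nat.cast_mul]
        exact Q.mul_mem_right _ hpQ
      have hco := (Int.isCoprime_iff_gcd_eq_one.2 ((Nat.Prime.coprime_iff_not_dvd hpp).2
        (fun h => hk' p (Finset.mem_filter.2 ⟨hp, hpB⟩) (Int.natCast_dvd.2 h))) :
        IsCoprime (p : ℤ) (χ.eval (-(B * k : ℤ))))
      refine hnt (hco.map (Int.castRingHom (𝓞 K))) (by simpa using hpQ) ?_
      have e1 : aeval θ χ - aeval (-(B * k : 𝓞 K)) χ ∈ Q := by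
        have := Polynomial.sub_dvd_eval_sub θ (-(B * k : 𝓞 K)) (χ.map (algebraMap ℤ (𝓞 K)))
        rw [Polynomial.eval_map_algebraMap, Polynomial.eval_map_algebraMap] at this
        obtain ⟨w, hw⟩ := this
        rw [hw, sub_neg_eq_add]
        exact Q.mul_mem_right _ h2
      rw [hχ0, zero_sub, neg_mem_iff] at e1
      convert e1 using 1
      rw [eq_intCast, intCast_eval, ← Polynomial.eval_map_algebraMap]
      simp
  obtain ⟨c, hc⟩ := haB
  refine ⟨t₀ + c * (s + k), ?_⟩
  have e : b + (t₀ + c * (s + k)) * a = ϑ := by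
    rw [hϑ, hθ, hc]
    ring
  rw [e]
  constructor
  · refine hco.of_isCoprime_of_dvd_left ?_
    rw [hBdef]
    exact Nat.cast_dvd_cast ⟨f * (n * d.factorial), by ring⟩
  · intro y
    obtain ⟨u, v, huv⟩ := hco
    obtain ⟨p, hp⟩ := hfθ (u * B * y)
    refine ⟨p.eval (-(B * k : ℤ)), ?_⟩
    have h1 := Polynomial.sub_dvd_eval_sub θ (-(B * k : 𝓞 K)) (p.map (algebraMap ℤ (𝓞 K)))
    have h2 : (p.map (algebraMap ℤ (𝓞 K))).eval (-(B * k : 𝓞 K)) =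
        ((p.eval (-(B * k : ℤ)) : ℤ) : 𝓞 K) := by
      rw [intCast_eval]
      simp
    rw [h2, Polynomial.eval_map_algebraMap, ← hp, sub_neg_eq_add] at h1
    have h3 : y - ((p.eval (-(B * k : ℤ)) : ℤ) : 𝓞 K) =
        (f * (u * B * y) - ((p.eval (-(B * k : ℤ)) : ℤ) : 𝓞 K)) + ϑ * (v * y) := by
      push_cast at huv
      linear_combination (-y) * huv
    rw [h3]
    exact h1.add (Dvd.intro _ rfl)

end CyclicQuotients

section UnitExponents

open NumberField

variable {K : Type*} [Field K] [NumberField K]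

lemma not_isUnit_natCast {M : ℕ} (hM : 2 ≤ M) : ¬ IsUnit (M : 𝓞 K) := by
  intro h
  have h1 : Ideal.absNorm (Ideal.span {(M : 𝓞 K)}) = 1 := by
    rw [Ideal.span_singleton_eq_top.2 h, Ideal.absNorm_top]
  rw [Ideal.absNorm_span_natCast] at h1
  have h2 : 0 < Module.finrank ℤ (𝓞 K) := Module.finrank_pos
  have := Nat.one_lt_pow h2.ne' hM
  omega

lemma exists_unit_pow_sub_one_dvd (v : (𝓞 K)ˣ) {r : ℕ} (hr : r.Prime) :
    ∃ j : ℕ, (r : 𝓞 K) ∣ (v : 𝓞 K) ^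
      ((r ^ (Module.finrank ℤ (𝓞 K)).factorial - 1) * r ^ j) - 1 := by
  set d := Module.finrank ℤ (𝓞 K)
  set x : 𝓞 K := (v : 𝓞 K) ^ (r ^ d.factorial - 1) - 1 with hx
  have hr0 : (r : 𝓞 K) ≠ 0 := Nat.cast_ne_zero.2 hr.ne_zero
  have hrad : x ∈ (Ideal.span {(r : 𝓞 K)}).radical := by
    rw [Ideal.radical_eq_sInf, Submodule.mem_sInf]
    intro (P : Ideal (𝓞 K)) hPJ
    obtain ⟨hle, hP⟩ := hPJ
    have hrP : (r : 𝓞 K) ∈ P := hle (Ideal.mem_span_singleton_self _)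
    have hP0 : P ≠ ⊥ := by
      rintro rfl
      exact hr0 hrP
    have hPm : P.IsMaximal := Ideal.IsPrime.isMaximal hP hP0
    let _ : Field (𝓞 K ⧸ P) := Ideal.Quotient.field P
    have hfin : Finite (𝓞 K ⧸ P) := Ring.HasFiniteQuotients.finiteQuotient hP0
    have := Fintype.ofFinite (𝓞 K ⧸ P)
    have hdvd : Ideal.absNorm P ∣ r ^ d := by
      rw [← Ideal.absNorm_span_natCast (S := 𝓞 K)]
      exact Ideal.absNorm_dvd_absNorm_of_le hle
    obtain ⟨f, hf, hPf⟩ := (Nat.dvd_prime_pow hr).1 hdvd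
    have hf0 : 0 < f := by
      by_contra h0
      obtain rfl : f = 0 := by omega
      rw [pow_zero, Ideal.absNorm_eq_one_iff] at hPf
      exact hPm.ne_top hPf
    have hcard : Fintype.card (𝓞 K ⧸ P) = r ^ f := by
      rw [← hPf, Ideal.absNorm_apply, Submodule.cardQuot_apply, Nat.card_eq_fintype_card]
    obtain ⟨e, he⟩ := Nat.dvd_factorial hf0 hf
    have hpow := FiniteField.pow_card_pow (K := 𝓞 K ⧸ P) e (Ideal.Quotient.mk P v)
    rw [hcard, ← pow_mul, ← he] at hpow
    have hv0 : Ideal.Quotient.mk P (v : 𝓞 K) ≠ 0 := by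
      intro h0
      exact hPm.ne_top (P.eq_top_of_isUnit_mem (Ideal.Quotient.eq_zero_iff_mem.1 h0) v.isUnit)
    have hs : r ^ d.factorial = (r ^ d.factorial - 1) + 1 :=
      (Nat.sub_add_cancel (Nat.one_le_pow _ _ hr.pos)).symm
    rw [hs, pow_succ] at hpow
    have h1 := mul_right_cancel₀ hv0 (hpow.trans (one_mul _).symm)
    rw [← Ideal.Quotient.eq_zero_iff_mem, hx, map_sub, map_pow, h1, map_one, sub_self]
  obtain ⟨n, hn⟩ := hrad
  refine ⟨n, ?_⟩
  have : Fact r.Prime := ⟨hr⟩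
  have hprime : CharP (𝓞 K ⧸ Ideal.span {(r : 𝓞 K)}) r := by
    have hnt : Nontrivial (𝓞 K ⧸ Ideal.span {(r : 𝓞 K)}) := by
      rw [Ideal.Quotient.nontrivial_iff, Ne, Ideal.span_singleton_eq_top]
      exact not_isUnit_natCast hr.two_le
    refine (CharP.charP_iff_prime_eq_zero hr).2 ?_
    rw [← map_natCast (Ideal.Quotient.mk _), Ideal.Quotient.eq_zero_iff_mem]
    exact Ideal.mem_span_singleton_self _
  have hpow : (Ideal.Quotient.mk (Ideal.span {(r : 𝓞 K)}) x) ^ r ^ n = 0 := by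
    obtain ⟨w, hw⟩ := pow_dvd_pow (Ideal.Quotient.mk (Ideal.span {(r : 𝓞 K)}) x)
      (Nat.lt_pow_self (n := n) hr.one_lt).le
    rw [hw, ← map_pow, Ideal.Quotient.eq_zero_iff_mem.2 hn, zero_mul]
  rw [← Ideal.mem_span_singleton, ← Ideal.Quotient.eq_zero_iff_mem, pow_mul]
  have e : (v : 𝓞 K) ^ (r ^ d.factorial - 1) = x + 1 := by rw [hx]; ring
  rw [e, map_sub, map_pow, map_add, map_one, add_pow_char_pow, hpow, one_pow, zero_add, sub_self]

lemma exists_int_representatives {q a b : 𝓞 K} (hq : q ≠ 0) (ha0 : a ≠ 0) (ha : q ^ 2 ∣ a - 1)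
    (hb : q ∣ b) (hab : IsCoprime a b) {L : ℕ} (hL : L ≠ 0) :
    ∃ x : 𝓞 K, ∃ n z : ℕ, n ≠ 0 ∧ L ∣ n ∧ z.Coprime n ∧ z ≡ 1 [MOD L] ∧
      ∀ Z : ℕ, Z ≡ z [MOD n] → ∃ y, a + q * y * (b + q * x * a) = Z := by
  obtain ⟨b₁, rfl⟩ := hb
  have hab₁ : IsCoprime a b₁ := hab.of_mul_right_right
  obtain ⟨M₀, hM₀, hqM₀⟩ := exists_dvd_natCast (pow_ne_zero 2 hq)
  set M := M₀ * L * 2 with hMdef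
  have hM : M ≠ 0 := mul_ne_zero (mul_ne_zero hM₀ hL) two_ne_zero
  have hqM : q ^ 2 ∣ (M : 𝓞 K) := by
    rw [hMdef, mul_assoc, Nat.cast_mul]
    exact hqM₀.mul_right _
  obtain ⟨x, hco, hcyc⟩ := exists_isCoprime_cyclic_shift ha0 hab₁ hM
  set b₀ := b₁ + x * a with hb₀
  have hb₀0 : b₀ ≠ 0 := by
    intro h0
    rw [h0, isCoprime_zero_right] at hco
    exact not_isUnit_natCast (by have := Nat.mul_pos (Nat.pos_of_ne_zero hM₀) (Nat.pos_of_ne_zero hL); omega) hco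
  obtain ⟨n₀, hn₀⟩ : ∃ n₀ : ℕ, ∀ k : ℕ, b₀ ∣ (k : 𝓞 K) ↔ n₀ ∣ k := by
    refine ⟨ringChar (𝓞 K ⧸ Ideal.span {b₀}), fun k => ?_⟩
    rw [← ringChar.spec, ← Ideal.mem_span_singleton, ← Ideal.Quotient.eq_zero_iff_mem, map_natCast]
  have hn₀z : ∀ k : ℤ, b₀ ∣ (k : 𝓞 K) ↔ (n₀ : ℤ) ∣ k := by
    intro k
    rw [Int.natCast_dvd, ← hn₀]
    rcases Int.natAbs_eq k with h | h <;> conv_lhs => rw [h]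
    · simp
    · simp
  have hn₀0 : n₀ ≠ 0 := by
    rintro rfl
    obtain ⟨k, hk, hk'⟩ := exists_dvd_natCast hb₀0
    exact hk (Nat.eq_zero_of_zero_dvd ((hn₀ k).1 hk'))
  have hcop : ∀ (w : 𝓞 K) (k : ℤ), IsCoprime w b₀ → b₀ ∣ w - k → IsCoprime k (n₀ : ℤ) := by
    rintro w k ⟨s, t, hst⟩ hwk
    obtain ⟨s', hs'⟩ := hcyc s
    have : b₀ ∣ ((s' * k - 1 : ℤ) : 𝓞 K) := by
      have h1 : ((s' * k - 1 : ℤ) : 𝓞 K) = -((s - s') * k) - s * (w - k) - b₀ * t := by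
        push_cast
        linear_combination hst
      rw [h1]
      exact ((dvd_neg.2 (hs'.mul_right _)).sub (hwk.mul_left _)).sub (Dvd.intro _ rfl)
    obtain ⟨t', ht'⟩ := (hn₀z _).1 this
    exact ⟨s', -t', by linear_combination ht'⟩
  have hMn : M.Coprime n₀ := by
    rw [← Nat.isCoprime_iff_coprime]
    exact hcop M M hco (by simp)
  obtain ⟨z₀', hz₀'⟩ := hcyc a
  have hab₀ : IsCoprime a b₀ := by
    rw [hb₀]
    exact IsCoprime.add_mul_right_right hab₁ x
  obtain ⟨z₀, hz₀⟩ : ∃ z₀ : ℕ, b₀ ∣ a - (z₀ : 𝓞 K) := by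
    refine ⟨(z₀' % n₀).toNat, ?_⟩
    have h1 : ((z₀' % n₀).toNat : ℤ) = z₀' % n₀ :=
      Int.toNat_of_nonneg (Int.emod_nonneg _ (by exact_mod_cast hn₀0))
    have h2 : b₀ ∣ ((z₀' - (z₀' % n₀).toNat : ℤ) : 𝓞 K) := by
      rw [hn₀z, h1]
      exact Int.dvd_self_sub_emod
    have := hz₀'.add h2
    rwa [Int.cast_sub, Int.cast_natCast, sub_add_sub_cancel] at this
  obtain ⟨z, hz1, hz2⟩ := Nat.chineseRemainder hMn 1 z₀
  have hzn : z.Coprime n₀ := by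
    have h1 : z₀.Coprime n₀ := by
      rw [← Nat.isCoprime_iff_coprime]
      exact hcop a z₀ hab₀ (by simpa using hz₀)
    exact (Nat.ModEq.gcd_eq hz2).trans h1
  have hzM : z.Coprime M := (Nat.ModEq.gcd_eq hz1).trans (Nat.gcd_one_left M)
  have hLM : L ∣ M := ⟨M₀ * 2, by rw [hMdef]; ring⟩
  refine ⟨x, M * n₀, z, mul_ne_zero hM hn₀0, hLM.mul_right _, Nat.Coprime.mul_right hzM hzn,
    hz1.of_dvd hLM, fun Z hZ => ?_⟩
  have h1 : q ^ 2 ∣ (Z : 𝓞 K) - a := by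
    have h2 : (M : ℤ) ∣ (Z : ℤ) - 1 := by
      have := Nat.modEq_iff_dvd.1 (((hZ.of_dvd (Dvd.intro _ rfl)).trans hz1).symm)
      exact_mod_cast this
    have h3 : (M : 𝓞 K) ∣ (Z : 𝓞 K) - 1 := by
      have := map_dvd (Int.castRingHom (𝓞 K)) h2
      simpa using this
    have := (hqM.trans h3).sub ha
    rwa [sub_sub_sub_cancel_right] at this
  have h2 : b₀ ∣ (Z : 𝓞 K) - a := by
    have h3 : (n₀ : ℤ) ∣ (Z : ℤ) - z₀ :=
      Nat.modEq_iff_dvd.1 (((hZ.of_dvd (Dvd.intro_left _ rfl)).trans hz2).symm)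
    have h4 := (hn₀z _).2 h3
    have := h4.sub hz₀
    rw [Int.cast_sub, Int.cast_natCast, Int.cast_natCast] at this
    convert this using 1
    ring
  have h3 : IsCoprime (q ^ 2) b₀ := hco.of_isCoprime_of_dvd_left hqM
  obtain ⟨y, hy⟩ := h3.mul_dvd h1 h2
  exact ⟨y, by rw [hb₀] at hy; linear_combination -hy⟩

end UnitExponents

lemma Nat.exists_ne_zero_forall_prime_dvd_mul {D : ℕ} (hD : D ≠ 0) :
    ∃ m : ℕ, m ≠ 0 ∧ ∀ ℓ : ℕ, ℓ.Prime → ∃ L g : ℕ, L ≠ 0 ∧ g.Coprime L ∧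
      ∀ r₁ r₂ : ℕ, 2 ≤ r₁ → 2 ≤ r₂ → r₁ ≡ g [MOD L] → r₂ * r₁ ≡ 1 [MOD L] → ∀ j₁ j₂ : ℕ,
        ∃ j : ℕ, ¬ ℓ ∣ j ∧ (r₁ ^ D - 1) * r₁ ^ j₁ * ((r₂ ^ D - 1) * r₂ ^ j₂) ∣ m * j := by
  set C := 3 ^ D with hC
  refine ⟨C.factorial ^ (2 * C), pow_ne_zero _ (Nat.factorial_ne_zero _), fun ℓ hℓ => ?_⟩
  obtain ⟨g, hg2, hg3, hgℓ⟩ : ∃ g : ℕ, 2 ≤ g ∧ g ≤ 3 ∧ g.Coprime ℓ := by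
    by_cases h2 : ℓ = 2
    · exact ⟨3, by norm_num, le_rfl, by rw [h2]; norm_num⟩
    · exact ⟨2, le_rfl, by norm_num, (Nat.coprime_primes Nat.prime_two hℓ).2 (Ne.symm h2)⟩
  obtain ⟨e, he0, hCe, hm⟩ : ∃ e : ℕ, e ≠ 0 ∧ C < ℓ ^ e ∧
      ∀ v < 2 * e - 1, ℓ ^ v ∣ C.factorial ^ (2 * C) := by
    by_cases h : C < ℓ
    · refine ⟨1, one_ne_zero, by rwa [pow_one], fun v hv => ?_⟩
      obtain rfl : v = 0 := by omega
      exact one_dvd _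
    · refine ⟨C, by positivity, lt_of_lt_of_le Nat.lt_two_pow_self
        (Nat.pow_le_pow_left hℓ.two_le C), fun v hv => ?_⟩
      exact (pow_dvd_pow ℓ (by omega)).trans
        (pow_dvd_pow_of_dvd ((Nat.Prime.dvd_factorial hℓ).2 (not_lt.1 h)) _)
  have : Fact ℓ.Prime := ⟨hℓ⟩
  refine ⟨ℓ ^ e, g, pow_ne_zero _ hℓ.ne_zero, hgℓ.pow_right e, ?_⟩
  intro r₁ r₂ h₁ h₂ hr₁ hr₂ j₁ j₂
  have hg1 : ¬ g ^ D ≡ 1 [MOD ℓ ^ e] := by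
    intro h
    have hlt : g ^ D < ℓ ^ e := (Nat.pow_le_pow_left hg3 D).trans_lt hCe
    have h1 : 1 < g ^ D := Nat.one_lt_pow hD hg2
    have := Nat.ModEq.eq_of_lt_of_lt h hlt (h1.trans hlt)
    omega
  have key : ∀ r : ℕ, 2 ≤ r → r.Coprime ℓ → ¬ r ^ D ≡ 1 [MOD ℓ ^ e] → ∀ j,
      (r ^ D - 1) * r ^ j ≠ 0 ∧ padicValNat ℓ ((r ^ D - 1) * r ^ j) < e := by
    intro r hr hrℓ hne j
    have h1 : 1 < r ^ D := Nat.one_lt_pow hD hr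
    have h2 : r ^ D - 1 ≠ 0 := by omega
    have h3 : r ^ j ≠ 0 := pow_ne_zero _ (by omega)
    refine ⟨mul_ne_zero h2 h3, ?_⟩
    rw [padicValNat.mul h2 h3, padicValNat.eq_zero_of_not_dvd (n := r ^ j), add_zero]
    · by_contra hle
      rw [not_lt, ← padicValNat_dvd_iff_le h2] at hle
      exact hne ((Nat.modEq_iff_dvd' h1.le).2 hle).symm
    · intro hd
      have := Nat.Coprime.eq_one_of_dvd (hrℓ.symm.pow_right j) hd
      exact hℓ.one_lt.ne' this
  have hc : ∀ r s : ℕ, r * s ≡ 1 [MOD ℓ ^ e] → r.Coprime ℓ := by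
    intro r s h
    have h1 : (r * s).Coprime (ℓ ^ e) := (Nat.ModEq.gcd_eq h).trans (Nat.gcd_one_left _)
    exact (Nat.coprime_pow_right_iff (Nat.pos_of_ne_zero he0) _ _).1 (Nat.Coprime.coprime_mul_right h1)
  obtain ⟨k1, v1⟩ := key r₁ h₁ (hc r₁ r₂ (by rwa [mul_comm])) (fun h =>
    hg1 ((hr₁.pow D).symm.trans h)) j₁
  obtain ⟨k2, v2⟩ := key r₂ h₂ (hc r₂ r₁ hr₂) (fun h => by
    have h3 := hr₂.pow D
    rw [mul_pow, one_pow] at h3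
    have h4 := (h.mul_right (r₁ ^ D)).symm.trans h3
    rw [one_mul] at h4
    exact hg1 ((hr₁.pow D).symm.trans h4)) j₂
  obtain ⟨v, j, hj, hk⟩ := Nat.exists_eq_pow_mul_and_not_dvd (mul_ne_zero k1 k2) ℓ hℓ.ne_one
  refine ⟨j, hj, ?_⟩
  rw [hk]
  refine mul_dvd_mul (hm v ?_) dvd_rfl
  have hv : v = padicValNat ℓ (ℓ ^ v * j) := by
    have hj0 : j ≠ 0 := fun h => hj (h ▸ dvd_zero _)
    rw [padicValNat.mul (pow_ne_zero _ hℓ.ne_zero) hj0, padicValNat.prime_pow,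
      padicValNat.eq_zero_of_not_dvd hj, add_zero]
  rw [hv, ← hk, padicValNat.mul k1 k2]
  omega

section UnitExponents

open NumberField

variable {K : Type*} [Field K] [NumberField K]

lemma exists_prime_modEq {n z : ℕ} (hn : n ≠ 0) (hz : z.Coprime n) (B : ℕ) :
    ∃ r : ℕ, B < r ∧ r.Prime ∧ r ≡ z [MOD n] := by
  obtain ⟨p, hp1, hp2, hp3⟩ := Nat.forall_exists_prime_gt_and_modEq B hn hz
  exact ⟨p, hp1, hp2, hp3⟩

lemma exists_unit_exponent (u : (𝓞 K)ˣ) : ∃ m : ℕ, m ≠ 0 ∧ ∀ q a b : 𝓞 K, q ≠ 0 → a ≠ 0 →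
    q ^ 2 ∣ a - 1 → q ∣ b → IsCoprime a b → ∀ ℓ : ℕ, ℓ.Prime → ∃ x y : 𝓞 K, ∃ Z j : ℕ,
      Z ≠ 0 ∧ a + q * y * (b + q * x * a) = Z ∧ ¬ ℓ ∣ j ∧
        (Z : 𝓞 K) ∣ ((u : 𝓞 K) ^ m) ^ j - 1 := by
  set D := (Module.finrank ℤ (𝓞 K)).factorial with hD
  obtain ⟨m, hm, hex⟩ := Nat.exists_ne_zero_forall_prime_dvd_mul (Nat.factorial_ne_zero _ : D ≠ 0)
  refine ⟨m, hm, fun q a b hq ha0 ha hb hab ℓ hℓ => ?_⟩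
  obtain ⟨L, g, hL, hg, hLg⟩ := hex ℓ hℓ
  obtain ⟨x, n, z, hn, hLn, hzn, hz1, hZ⟩ := exists_int_representatives hq ha0 ha hb hab hL
  obtain ⟨r₁, hr₁n, hr₁, hr₁g⟩ := exists_prime_modEq hL hg n
  have hr₁n' : r₁.Coprime n :=
    (Nat.Prime.coprime_iff_not_dvd hr₁).2 fun h =>
      absurd (Nat.le_of_dvd (Nat.pos_of_ne_zero hn) h) (not_le.2 hr₁n)
  obtain ⟨s, hs⟩ : ∃ s : ℕ, s * r₁ ≡ z [MOD n] := by
    have : NeZero n := ⟨hn⟩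
    refine ⟨((z : ZMod n) * (r₁ : ZMod n)⁻¹).val, ?_⟩
    rw [← ZMod.natCast_eq_natCast_iff]
    push_cast
    rw [ZMod.natCast_zmod_val, mul_assoc, mul_comm _ (r₁ : ZMod n),
      ZMod.coe_mul_inv_eq_one _ hr₁n', mul_one]
  have hsn : s.Coprime n :=
    Nat.Coprime.coprime_mul_right ((Nat.ModEq.gcd_eq hs).trans hzn)
  obtain ⟨r₂, hr₂r, hr₂, hr₂s⟩ := exists_prime_modEq hn hsn r₁
  have hrz : r₂ * r₁ ≡ z [MOD n] := (hr₂s.mul_right r₁).trans hs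
  obtain ⟨y, hy⟩ := hZ _ hrz
  obtain ⟨j₁, hj₁⟩ := exists_unit_pow_sub_one_dvd u hr₁
  obtain ⟨j₂, hj₂⟩ := exists_unit_pow_sub_one_dvd u hr₂
  obtain ⟨j, hj, hk⟩ := hLg r₁ r₂ hr₁.two_le hr₂.two_le hr₁g ((hrz.of_dvd hLn).trans hz1) j₁ j₂
  refine ⟨x, y, r₂ * r₁, j, mul_ne_zero hr₂.ne_zero hr₁.ne_zero, hy, hj, ?_⟩
  have hcop : IsCoprime (r₂ : 𝓞 K) (r₁ : 𝓞 K) :=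
    ((Nat.coprime_primes hr₂ hr₁).2 hr₂r.ne').cast
  rw [Nat.cast_mul, ← pow_mul]
  have hdvd : ∀ k c : ℕ, k ∣ c → (u : 𝓞 K) ^ k - 1 ∣ (u : 𝓞 K) ^ c - 1 := by
    rintro k _ ⟨c, rfl⟩
    rw [pow_mul]
    simpa using sub_dvd_pow_sub_pow ((u : 𝓞 K) ^ k) 1 c
  exact hcop.mul_dvd (hj₂.trans (hdvd _ _ ((Dvd.intro_left _ rfl).trans hk)))
    (hj₁.trans (hdvd _ _ ((Dvd.intro _ rfl).trans hk)))

lemma exists_prime_representative {q a b : 𝓞 K} (hq : q ≠ 0) (ha0 : a ≠ 0) (ha : q ^ 2 ∣ a - 1)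
    (hb : q ∣ b) (hab : IsCoprime a b) : ∃ x y : 𝓞 K, ∃ r : ℕ, r.Prime ∧ r % 4 = 1 ∧
      a + q * y * (b + q * x * a) = r := by
  obtain ⟨x, n, z, hn, hLn, hzn, hz1, hZ⟩ :=
    exists_int_representatives hq ha0 ha hb hab (by norm_num : (4 : ℕ) ≠ 0)
  obtain ⟨r, -, hr, hrz⟩ := exists_prime_modEq hn hzn 0
  obtain ⟨y, hy⟩ := hZ _ hrz
  exact ⟨x, y, r, hr, (hrz.of_dvd hLn).trans hz1, hy⟩

end UnitExponents

section CongruenceSubgroups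

variable {A : Type*} [CommRing A]

lemma upSL_apply (t : A) (i j : Fin 2) : (upSL t).1 i j = !![1, t; 0, 1] i j := by rw [upSL_coe]

lemma loSL_apply (t : A) (i j : Fin 2) : (loSL t).1 i j = !![1, 0; t, 1] i j := by rw [loSL_coe]

lemma mkSL2_apply (a b c d : A) (h : a * d - b * c = 1) (i j : Fin 2) :
    (mkSL2 a b c d h).1 i j = !![a, b; c, d] i j := rfl

lemma weylSL_apply (i j : Fin 2) :
    (weylSL : Matrix.SpecialLinearGroup (Fin 2) A).1 i j = !![0, -1; 1, 0] i j := rfl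

lemma SL2_inv_apply (g : Matrix.SpecialLinearGroup (Fin 2) A) (i j : Fin 2) :
    (g⁻¹).1 i j = !![g.1 1 1, -g.1 0 1; -g.1 1 0, g.1 0 0] i j := by
  rw [Matrix.SpecialLinearGroup.SL2_inv_expl]
  rfl

lemma SL2_one_apply (i j : Fin 2) :
    (1 : Matrix.SpecialLinearGroup (Fin 2) A).1 i j = !![1, 0; 0, 1] i j :=
  congrFun (congrFun Matrix.one_fin_two i) j

/-- Diagonal matrices in `SL_2`. -/
def diagSL : Aˣ →* Matrix.SpecialLinearGroup (Fin 2) A where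
  toFun u := mkSL2 u 0 0 ↑u⁻¹ (by simp)
  map_one' := by
    refine SL2_ext ?_ ?_ ?_ ?_ <;> simp [mkSL2]
  map_mul' u v := by
    refine SL2_ext ?_ ?_ ?_ ?_ <;> rw [SL2_mul_apply] <;> simp [mkSL2, mul_comm]

lemma diagSL_apply (u : Aˣ) (i j : Fin 2) :
    (diagSL u).1 i j = !![(u : A), 0; 0, ↑u⁻¹] i j := rfl

lemma diagSL_mem (u : Aˣ) : diagSL u ∈ elemSL 2 A := by
  have h : diagSL u = upSL (u : A) * loSL (-↑u⁻¹ : A) * upSL (u : A) * weylSL := by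
    refine SL2_ext ?_ ?_ ?_ ?_ <;>
    simp only [SL2_mul_apply, upSL_apply, loSL_apply, weylSL_apply, diagSL_apply] <;> simp
  rw [h]
  exact mul_mem (mul_mem (mul_mem (upSL_mem _) (loSL_mem _)) (upSL_mem _)) weylSL_mem

lemma diagSL_mul_upSL (u : Aˣ) (t : A) :
    diagSL u * upSL t * (diagSL u)⁻¹ = upSL ((u : A) ^ 2 * t) := by
  rw [mul_inv_eq_iff_eq_mul]
  refine SL2_ext ?_ ?_ ?_ ?_ <;>
  simp only [SL2_mul_apply, upSL_apply, diagSL_apply] <;> simp [pow_two]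
  rw [mul_assoc, mul_right_comm, mul_assoc]
  simp

lemma diagSL_mul_loSL (u : Aˣ) (t : A) :
    diagSL u * loSL t * (diagSL u)⁻¹ = loSL ((↑u⁻¹ : A) ^ 2 * t) := by
  rw [mul_inv_eq_iff_eq_mul]
  refine SL2_ext ?_ ?_ ?_ ?_ <;>
  simp only [SL2_mul_apply, loSL_apply, diagSL_apply] <;> simp [pow_two]
  rw [mul_assoc, mul_right_comm, mul_assoc]
  simp

lemma weylSL_mul_upSL (t : A) : weylSL * upSL t * weylSL⁻¹ = loSL (-t) := by
  rw [mul_inv_eq_iff_eq_mul]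
  refine SL2_ext ?_ ?_ ?_ ?_ <;>
  simp only [SL2_mul_apply, upSL_apply, loSL_apply, weylSL_apply] <;> simp

lemma upSL_add (s t : A) : upSL (s + t) = upSL s * upSL t := by
  refine SL2_ext ?_ ?_ ?_ ?_ <;> simp only [SL2_mul_apply, upSL_apply] <;> simp [add_comm]

lemma diagSL_conj_eq (v : Aˣ) (h : Matrix.SpecialLinearGroup (Fin 2) A) (β : A)
    (hβ : h.1 0 0 * β = (v : A) ^ 2 - 1) :
    diagSL v * h * (diagSL v)⁻¹ =
      loSL (-(h.1 1 0 * β * (↑v⁻¹ : A) ^ 2)) * h * upSL (h.1 0 1 * β) := by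
  have hv : (v : A) * ↑v⁻¹ = 1 := v.mul_inv
  rw [mul_inv_eq_iff_eq_mul]
  refine SL2_ext ?_ ?_ ?_ ?_ <;>
  simp only [SL2_mul_apply, upSL_apply, loSL_apply, diagSL_apply] <;>
  simp only [Matrix.of_apply, Matrix.cons_val', Matrix.cons_val_zero, Matrix.cons_val_one,
      Matrix.cons_val_fin_one]
  · ring
  · linear_combination (-h.1 0 1 * (↑v⁻¹ : A)) * hβ - (v : A) * h.1 0 1 * hv
  · linear_combination (h.1 1 0 * (↑v⁻¹ : A) ^ 2 * v) * hβ +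
      h.1 1 0 * ((v : A) * ((v : A) * (↑v⁻¹ : A) + 1) - (↑v⁻¹ : A)) * hv
  · linear_combination ((↑v⁻¹ : A) ^ 3 * h.1 1 0 * h.1 0 1 * β) * hβ +
      (↑v⁻¹ : A) * h.1 1 0 * h.1 0 1 * β * ((v : A) * (↑v⁻¹ : A) + 1) * hv

/-- Principal congruence subgroups of `SL_2`. -/
def congSL (N : A) : Subgroup (Matrix.SpecialLinearGroup (Fin 2) A) :=
  (Matrix.SpecialLinearGroup.map (Ideal.Quotient.mk (Ideal.span {N}))).ker

instance (N : A) : (congSL N).Normal := by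
  unfold congSL
  infer_instance

lemma mem_congSL {N : A} {g : Matrix.SpecialLinearGroup (Fin 2) A} :
    g ∈ congSL N ↔ N ∣ g.1 0 0 - 1 ∧ N ∣ g.1 0 1 ∧ N ∣ g.1 1 0 ∧ N ∣ g.1 1 1 - 1 := by
  have h : ∀ i j, (Matrix.SpecialLinearGroup.map (Ideal.Quotient.mk (Ideal.span {N})) g).1 i j =
    Ideal.Quotient.mk (Ideal.span {N}) (g.1 i j) := fun _ _ => rfl
  have e : ∀ x : A, N ∣ x ↔ Ideal.Quotient.mk (Ideal.span {N}) x = 0 := fun x => by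
    rw [Ideal.Quotient.eq_zero_iff_mem, Ideal.mem_span_singleton]
  rw [congSL, MonoidHom.mem_ker]
  simp only [e, map_sub, map_one, sub_eq_zero]
  constructor
  · intro hg
    rw [← h, ← h, ← h, ← h, hg]
    simp
  · rintro ⟨h1, h2, h3, h4⟩
    refine SL2_ext ?_ ?_ ?_ ?_ <;> rw [h] <;> simpa

lemma upSL_mem_congSL {N t : A} (h : N ∣ t) : upSL t ∈ congSL N := by
  simp only [mem_congSL, upSL_apply]
  simpa

lemma loSL_mem_congSL {N t : A} (h : N ∣ t) : loSL t ∈ congSL N := by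
  simp only [mem_congSL, loSL_apply]
  simpa

lemma congSL_le {M N : A} (h : M ∣ N) : congSL N ≤ congSL M := by
  intro g
  simp only [mem_congSL]
  exact fun ⟨h1, h2, h3, h4⟩ => ⟨h.trans h1, h.trans h2, h.trans h3, h.trans h4⟩

lemma congSL_finiteIndex (N : A) [Finite (A ⧸ Ideal.span {N})] : (congSL N).FiniteIndex := by
  have : Finite (Matrix.SpecialLinearGroup (Fin 2) (A ⧸ Ideal.span {N})) := by
    have : Finite (Matrix (Fin 2) (Fin 2) (A ⧸ Ideal.span {N})) := by
      unfold Matrix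
      infer_instance
    exact Finite.of_injective _ Subtype.val_injective
  unfold congSL
  infer_instance

/-- The subgroup generated by elementary matrices with entries divisible by `q`. -/
def elemCongSL (q : A) : Subgroup (Matrix.SpecialLinearGroup (Fin 2) A) :=
  Subgroup.closure {g | ∃ t, g = upSL (q * t) ∨ g = loSL (q * t)}

lemma upSL_mem_elemCongSL (q t : A) : upSL (q * t) ∈ elemCongSL q :=
  Subgroup.subset_closure ⟨t, .inl rfl⟩

lemma loSL_mem_elemCongSL (q t : A) : loSL (q * t) ∈ elemCongSL q :=
  Subgroup.subset_closure ⟨t, .inr rfl⟩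

lemma elemCongSL_le_iff {q : A} {H : Subgroup (Matrix.SpecialLinearGroup (Fin 2) A)} :
    elemCongSL q ≤ H ↔ ∀ t, upSL (q * t) ∈ H ∧ loSL (q * t) ∈ H := by
  refine ⟨fun h t => ⟨h (upSL_mem_elemCongSL q t), h (loSL_mem_elemCongSL q t)⟩, fun h => ?_⟩
  rw [elemCongSL, Subgroup.closure_le]
  rintro g ⟨t, rfl | rfl⟩
  exacts [(h t).1, (h t).2]

lemma diagSL_conj_mem_elemCongSL (u : Aˣ) {q : A} {g : Matrix.SpecialLinearGroup (Fin 2) A}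
    (hg : g ∈ elemCongSL q) : diagSL u * g * (diagSL u)⁻¹ ∈ elemCongSL q := by
  have : elemCongSL q ≤ (elemCongSL q).comap (MulAut.conj (diagSL u)).toMonoidHom := by
    rw [elemCongSL_le_iff]
    refine fun t => ⟨?_, ?_⟩ <;> rw [Subgroup.mem_comap]
    · change diagSL u * upSL (q * t) * (diagSL u)⁻¹ ∈ elemCongSL q
      rw [diagSL_mul_upSL, mul_left_comm]
      exact upSL_mem_elemCongSL _ _
    · change diagSL u * loSL (q * t) * (diagSL u)⁻¹ ∈ elemCongSL q
      rw [diagSL_mul_loSL, mul_left_comm]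
      exact loSL_mem_elemCongSL _ _
  exact this hg

/-- The subgroup generated by the `H`-conjugates of upper unipotents divisible by `q`. -/
def unipClosure (H : Subgroup (Matrix.SpecialLinearGroup (Fin 2) A)) (q : A) :
    Subgroup (Matrix.SpecialLinearGroup (Fin 2) A) :=
  Subgroup.closure {g | ∃ h ∈ H, ∃ t, g = h * upSL (q * t) * h⁻¹}

lemma conj_upSL_mem_unipClosure {H : Subgroup (Matrix.SpecialLinearGroup (Fin 2) A)}
    {h : Matrix.SpecialLinearGroup (Fin 2) A} (hh : h ∈ H) (q t : A) :
    h * upSL (q * t) * h⁻¹ ∈ unipClosure H q :=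
  Subgroup.subset_closure ⟨h, hh, t, rfl⟩

lemma conj_mem_unipClosure {H : Subgroup (Matrix.SpecialLinearGroup (Fin 2) A)} {q : A}
    {h x : Matrix.SpecialLinearGroup (Fin 2) A} (hh : h ∈ H) (hx : x ∈ unipClosure H q) :
    h * x * h⁻¹ ∈ unipClosure H q := by
  have : unipClosure H q ≤ (unipClosure H q).comap (MulAut.conj h).toMonoidHom := by
    rw [unipClosure, Subgroup.closure_le]
    rintro _ ⟨k, hk, t, rfl⟩
    change h * (k * upSL (q * t) * k⁻¹) * h⁻¹ ∈ unipClosure H q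
    have e : h * (k * upSL (q * t) * k⁻¹) * h⁻¹ = (h * k) * upSL (q * t) * (h * k)⁻¹ := by group
    rw [e]
    exact conj_upSL_mem_unipClosure (H.mul_mem hh hk) _ _
  exact this hx

instance (q : A) : (unipClosure ⊤ q).Normal :=
  ⟨fun _ hx h => conj_mem_unipClosure (Subgroup.mem_top h) hx⟩

lemma unipClosure_mono {H H' : Subgroup (Matrix.SpecialLinearGroup (Fin 2) A)} (h : H ≤ H')
    (q : A) : unipClosure H q ≤ unipClosure H' q :=
  Subgroup.closure_mono fun _ ⟨x, hx, t, e⟩ => ⟨x, h hx, t, e⟩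

lemma elemCongSL_le_unipClosure {H : Subgroup (Matrix.SpecialLinearGroup (Fin 2) A)}
    (hw : weylSL ∈ H) (q : A) : elemCongSL q ≤ unipClosure H q := by
  rw [elemCongSL_le_iff]
  refine fun t => ⟨?_, ?_⟩
  · simpa using conj_upSL_mem_unipClosure H.one_mem q t
  · have := conj_upSL_mem_unipClosure hw q (-t)
    rwa [weylSL_mul_upSL, mul_neg, neg_neg] at this

lemma unipClosure_elemSL_le (q : A) : unipClosure (elemSL 2 A) q ≤ elemSL 2 A := by
  rw [unipClosure, Subgroup.closure_le]
  rintro _ ⟨h, hh, t, rfl⟩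
  exact mul_mem (mul_mem hh (upSL_mem _)) (inv_mem hh)

end CongruenceSubgroups

lemma Int.addSubgroup_eq_top_of_forall_prime (H : AddSubgroup ℤ)
    (h : ∀ ℓ : ℕ, ℓ.Prime → ∃ j ∈ H, ¬ (ℓ : ℤ) ∣ j) : H = ⊤ := by
  obtain ⟨a, ha⟩ := Int.subgroup_cyclic H
  have hmem : ∀ j, j ∈ H ↔ a ∣ j := fun j => by
    rw [ha, ← AddSubgroup.zmultiples_eq_closure, Int.mem_zmultiples_iff]
  have h1 : a.natAbs = 1 := by
    by_contra hne
    obtain ⟨ℓ, hℓ, hd⟩ := Nat.exists_prime_and_dvd hne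
    obtain ⟨j, hj, hnd⟩ := h ℓ hℓ
    exact hnd ((Int.natCast_dvd.2 hd).trans ((hmem j).1 hj))
  rw [AddSubgroup.eq_top_iff']
  exact fun j => (hmem j).2 ((Int.isUnit_iff_natAbs_eq.2 h1).dvd)

section StrongApproximation

variable {A : Type*} [CommRing A]

lemma mul_inv_mem_congSL {N : A} {x y : Matrix.SpecialLinearGroup (Fin 2) A}
    (h1 : N ∣ x.1 0 0 - y.1 0 0) (h2 : N ∣ x.1 0 1 - y.1 0 1) (h3 : N ∣ x.1 1 0 - y.1 1 0)
    (h4 : N ∣ x.1 1 1 - y.1 1 1) : x * y⁻¹ ∈ congSL N := by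
  rw [congSL, MonoidHom.mem_ker, map_mul, map_inv, mul_inv_eq_one]
  have key : ∀ i j, N ∣ x.1 i j - y.1 i j →
    (Matrix.SpecialLinearGroup.map (Ideal.Quotient.mk (Ideal.span {N})) x).1 i j =
    (Matrix.SpecialLinearGroup.map (Ideal.Quotient.mk (Ideal.span {N})) y).1 i j := fun i j h =>
    Ideal.Quotient.eq.2 (Ideal.mem_span_singleton.2 h)
  exact SL2_ext (key _ _ h1) (key _ _ h2) (key _ _ h3) (key _ _ h4)

lemma exists_unipClosure_mul_congSL [IsDomain A] [IsDedekindDomain A] {q N : A} (hN : N ≠ 0)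
    {g : Matrix.SpecialLinearGroup (Fin 2) A} (hg : g ∈ congSL q) :
    ∃ f ∈ unipClosure (elemSL 2 A) q, ∃ γ ∈ congSL N, g = f * γ := by
  have hle := elemCongSL_le_unipClosure (weylSL_mem (A := A)) q
  obtain ⟨ha, hb, hc, hd⟩ := mem_congSL.1 hg
  have hdet := SL2_det g
  have hqa : IsCoprime q (g.1 0 0) := by
    obtain ⟨s, hs⟩ := ha
    exact ⟨-s, 1, by linear_combination hs⟩
  have hba : IsCoprime (g.1 0 1) (g.1 0 0) :=
    ⟨-g.1 1 0, g.1 1 1, by linear_combination hdet⟩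
  obtain ⟨t, ht⟩ := exists_isCoprime_add_mul hN (hba.mul_left hqa)
  obtain ⟨g₁, hg₁, h₁⟩ : ∃ g₁ ∈ congSL q, IsCoprime N (g₁.1 0 0) ∧
      ∃ e ∈ unipClosure (elemSL 2 A) q, g₁ = g * e := by
    refine ⟨g * loSL (q * t), mul_mem hg (loSL_mem_congSL (Dvd.intro _ rfl)), ?_,
      loSL (q * t), hle (loSL_mem_elemCongSL q t), rfl⟩
    rw [SL2_mul_apply]
    simp only [loSL_apply]
    convert ht using 1
    simp
    ring
  obtain ⟨hco, e₁, he₁, hge₁⟩ := h₁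
  obtain ⟨⟨x, hx⟩, ⟨b, hb⟩, ⟨c, hc⟩, hd⟩ := mem_congSL.1 hg₁
  have hdet₁ := SL2_det g₁
  obtain ⟨m, a', hma⟩ := hco
  set g₂ := loSL (q * (a' * (-x ^ 2 - c))) * g₁ * upSL (q * (a' * (1 - b))) with hg₂
  set f := loSL (-x) * upSL (q * 1) * (loSL (-x))⁻¹ with hf
  have hfmem : f ∈ unipClosure (elemSL 2 A) q := conj_upSL_mem_unipClosure (loSL_mem _) _ _
  have e00 : f.1 0 0 - (1 + q * x) = 0 := by
    rw [hf, elemMat_inv]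
    simp only [SL2_mul_apply, upSL_apply, loSL_apply]
    simp
  have e01 : f.1 0 1 - q = 0 := by
    rw [hf, elemMat_inv]
    simp only [SL2_mul_apply, upSL_apply, loSL_apply]
    simp
  have e10 : f.1 1 0 + q * x ^ 2 = 0 := by
    rw [hf, elemMat_inv]
    simp only [SL2_mul_apply, upSL_apply, loSL_apply]
    simp
    ring
  have e11 : f.1 1 1 - (1 - q * x) = 0 := by
    rw [hf, elemMat_inv]
    simp only [SL2_mul_apply, upSL_apply, loSL_apply]
    simp
    ring
  have g00 : g₂.1 0 0 = g₁.1 0 0 := by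
    rw [hg₂]
    simp only [SL2_mul_apply, upSL_apply, loSL_apply]
    simp
  have g01 : g₂.1 0 1 = g₁.1 0 0 * (q * (a' * (1 - b))) + g₁.1 0 1 := by
    rw [hg₂]
    simp only [SL2_mul_apply, upSL_apply, loSL_apply]
    simp
  have g10 : g₂.1 1 0 = (q * (a' * (-x ^ 2 - c))) * g₁.1 0 0 + g₁.1 1 0 := by
    rw [hg₂]
    simp only [SL2_mul_apply, upSL_apply, loSL_apply]
    simp
  have hdet₂ := SL2_det g₂
  have d01 : N ∣ g₂.1 0 1 - q :=
    ⟨-(m * q * (1 - b)), by rw [g01, hb]; linear_combination (q * (1 - b)) * hma⟩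
  have d10 : N ∣ g₂.1 1 0 + q * x ^ 2 :=
    ⟨-(m * q * (-x ^ 2 - c)), by rw [g10, hc]; linear_combination (q * (-x ^ 2 - c)) * hma⟩
  have d11 : N ∣ g₂.1 1 1 - (1 - q * x) := by
    obtain ⟨s, hs⟩ := d01
    obtain ⟨r, hr⟩ := d10
    rw [g00] at hdet₂
    have h3 : N ∣ g₁.1 0 0 * (g₂.1 1 1 - (1 - q * x)) :=
      ⟨s * g₂.1 1 0 + q * r, by
        linear_combination hdet₂ + g₂.1 1 0 * hs + q * hr - (1 - q * x) * hx⟩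
    obtain ⟨w, hw⟩ := h3
    exact ⟨a' * w + m * (g₂.1 1 1 - (1 - q * x)), by
      linear_combination a' * hw - (g₂.1 1 1 - (1 - q * x)) * hma⟩
  have hγ : g₂ * f⁻¹ ∈ congSL N := by
    refine mul_inv_mem_congSL ?_ ?_ ?_ ?_
    · refine ⟨0, by rw [g00]; linear_combination hx - e00⟩
    · rwa [show f.1 0 1 = q by linear_combination e01]
    · rwa [show f.1 1 0 = -(q * x ^ 2) by linear_combination e10, sub_neg_eq_add]
    · rwa [show f.1 1 1 = 1 - q * x by linear_combination e11]
  set l := loSL (q * (a' * (-x ^ 2 - c))) with hl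
  set r := upSL (q * (a' * (1 - b))) with hr
  have hlm : l ∈ unipClosure (elemSL 2 A) q := hle (loSL_mem_elemCongSL q _)
  have hrm : r ∈ unipClosure (elemSL 2 A) q := hle (upSL_mem_elemCongSL q _)
  refine ⟨l⁻¹ * (f * r⁻¹ * e₁⁻¹), mul_mem (inv_mem hlm) (mul_mem (mul_mem hfmem (inv_mem hrm))
    (inv_mem he₁)), (f * r⁻¹ * e₁⁻¹)⁻¹ * (g₂ * f⁻¹) * (f * r⁻¹ * e₁⁻¹)⁻¹⁻¹,
    (inferInstance : (congSL N).Normal).conj_mem _ hγ _, ?_⟩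
  rw [hg₂, hge₁]
  group

/-- A unit for which conjugation by powers of the associated diagonal matrix is controlled by
elementary matrices. -/
def IsGoodUnit (U : Aˣ) : Prop :=
  ∀ q a b : A, q ≠ 0 → a ≠ 0 → q ^ 2 ∣ a - 1 → q ∣ b → IsCoprime a b → ∀ ℓ : ℕ, ℓ.Prime →
    ∃ x y : A, ∃ Z j : ℕ, Z ≠ 0 ∧ a + q * y * (b + q * x * a) = Z ∧ ¬ ℓ ∣ j ∧
      (Z : A) ∣ (U : A) ^ j - 1

lemma ne_zero_of_dvd_sub_one {q a : A} (hq : ¬ IsUnit q) (h : q ^ 2 ∣ a - 1) : a ≠ 0 := by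
  rintro rfl
  rw [zero_sub, dvd_neg] at h
  exact hq (isUnit_of_dvd_one ((dvd_pow_self q two_ne_zero).trans h))

lemma IsGoodUnit.exists_conj_eq {U : Aˣ} (hU : IsGoodUnit U) {q : A} (hq : q ≠ 0)
    (hqu : ¬ IsUnit q) {g : Matrix.SpecialLinearGroup (Fin 2) A} (hg : g ∈ congSL (q ^ 2)) (k : ℤ) :
    ∃ e ∈ elemCongSL q, ∃ f ∈ elemCongSL q,
      diagSL (U ^ k) * g * (diagSL (U ^ k))⁻¹ = e * g * f := by
  let H : AddSubgroup ℤ :=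
    { carrier := {k | ∃ e ∈ elemCongSL q, ∃ f ∈ elemCongSL q,
        diagSL (U ^ k) * g * (diagSL (U ^ k))⁻¹ = e * g * f}
      zero_mem' := ⟨1, one_mem _, 1, one_mem _, by simp⟩
      add_mem' := by
        rintro k l ⟨e, he, f, hf, h⟩ ⟨e', he', f', hf', h'⟩
        refine ⟨_, mul_mem (diagSL_conj_mem_elemCongSL (U ^ k) he') he, _,
          mul_mem hf (diagSL_conj_mem_elemCongSL (U ^ k) hf'), ?_⟩
        have e1 : diagSL (U ^ (k + l)) * g * (diagSL (U ^ (k + l)))⁻¹ =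
            diagSL (U ^ k) * (diagSL (U ^ l) * g * (diagSL (U ^ l))⁻¹) * (diagSL (U ^ k))⁻¹ := by
          rw [zpow_add, map_mul]
          group
        rw [e1, h']
        have e2 : diagSL (U ^ k) * (e' * g * f') * (diagSL (U ^ k))⁻¹ =
          (diagSL (U ^ k) * e' * (diagSL (U ^ k))⁻¹) *
          (diagSL (U ^ k) * g * (diagSL (U ^ k))⁻¹) *
          (diagSL (U ^ k) * f' * (diagSL (U ^ k))⁻¹) := by group
        rw [e2, h]
        group
      neg_mem' := by
        rintro k ⟨e, he, f, hf, h⟩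
        refine ⟨_, diagSL_conj_mem_elemCongSL (U ^ (-k)) (inv_mem he), _,
          diagSL_conj_mem_elemCongSL (U ^ (-k)) (inv_mem hf), ?_⟩
        rw [zpow_neg, map_inv, inv_inv]
        have e1 : g = (diagSL (U ^ k))⁻¹ * (e * g * f) * diagSL (U ^ k) := by
          rw [← h]
          group
        have e2 : (diagSL (U ^ k))⁻¹ * g * diagSL (U ^ k) =
            (diagSL (U ^ k))⁻¹ * (e⁻¹ * (e * g * f) * f⁻¹) * diagSL (U ^ k) := by group
        rw [e2, ← h]
        group }
  have hH : H = ⊤ := by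
    refine Int.addSubgroup_eq_top_of_forall_prime H fun ℓ hℓ => ?_
    obtain ⟨ha, hb, hc, hd⟩ := mem_congSL.1 hg
    obtain ⟨x, y, Z, j, -, hZ, hℓj, β, hβ⟩ := hU q _ _ hq (ne_zero_of_dvd_sub_one hqu ha) ha
      ((dvd_pow_self q two_ne_zero).trans hb)
      ⟨g.1 1 1, -g.1 1 0, by linear_combination SL2_det g⟩ ℓ hℓ
    refine ⟨j, ?_, by exact_mod_cast hℓj⟩
    set f := upSL (q * x) * loSL (q * y) with hf
    have hfm : f ∈ elemCongSL q := mul_mem (upSL_mem_elemCongSL _ _) (loSL_mem_elemCongSL _ _)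
    have hfc : f ∈ congSL q := mul_mem (upSL_mem_congSL (Dvd.intro _ rfl))
      (loSL_mem_congSL (Dvd.intro _ rfl))
    have hgf : g * f ∈ congSL q := mul_mem (congSL_le (dvd_pow_self q two_ne_zero) hg) hfc
    have h00 : (g * f).1 0 0 = Z := by
      rw [← hZ, hf]
      simp only [SL2_mul_apply, upSL_apply, loSL_apply]
      simp
      ring
    obtain ⟨-, ⟨b, hb'⟩, ⟨c, hc'⟩, -⟩ := mem_congSL.1 hgf
    have key := diagSL_conj_eq (U ^ j) (g * f) (β * ((U : A) ^ j + 1)) (by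
      rw [h00, Units.val_pow_eq_pow_val]
      linear_combination -((U : A) ^ j + 1) * hβ)
    set x₁ := -((g * f).1 1 0 * (β * ((U : A) ^ j + 1)) * (↑(U ^ j)⁻¹ : A) ^ 2)
    set x₂ := (g * f).1 0 1 * (β * ((U : A) ^ j + 1))
    have hx₁ : loSL x₁ ∈ elemCongSL q := by
      have : x₁ = q * (-(c * (β * ((U : A) ^ j + 1)) * (↑(U ^ j)⁻¹ : A) ^ 2)) := by
        simp only [x₁, hc']
        ring
      rw [this]
      exact loSL_mem_elemCongSL _ _
    have hx₂ : upSL x₂ ∈ elemCongSL q := by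
      have : x₂ = q * (b * (β * ((U : A) ^ j + 1))) := by
        simp only [x₂, hb']
        ring
      rw [this]
      exact upSL_mem_elemCongSL _ _
    refine ⟨_, hx₁, _, mul_mem (mul_mem hfm hx₂)
      (inv_mem (diagSL_conj_mem_elemCongSL (U ^ j) hfm)), ?_⟩
    rw [zpow_natCast]
    have e1 : diagSL (U ^ j) * g * (diagSL (U ^ j))⁻¹ =
      (diagSL (U ^ j) * (g * f) * (diagSL (U ^ j))⁻¹) *
        (diagSL (U ^ j) * f * (diagSL (U ^ j))⁻¹)⁻¹ := by group
    rw [e1, key]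
    group
  exact (hH ▸ AddSubgroup.mem_top k : k ∈ H)

end StrongApproximation

section ConjugateUnipotents

variable {A : Type*} [CommRing A]

lemma upSL_inv (t : A) : (upSL t)⁻¹ = upSL (-t) := elemMat_inv _ _ _ _

lemma conj_mul_conj (U : Aˣ) (g : Matrix.SpecialLinearGroup (Fin 2) A) (k l : ℤ) (s t : A) :
    g * upSL t * diagSL (U ^ k) * g⁻¹ * (g * upSL s * diagSL (U ^ l) * g⁻¹) =
      g * upSL (t + ((U ^ k : Aˣ) : A) ^ 2 * s) * diagSL (U ^ (k + l)) * g⁻¹ := by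
  rw [upSL_add, ← diagSL_mul_upSL, zpow_add, map_mul]
  group

/-- The translations along a conjugate of the upper unipotent group which are elementary. -/
def unipAddSubgroup (g : Matrix.SpecialLinearGroup (Fin 2) A) : AddSubgroup A where
  carrier := {t | g * upSL t * g⁻¹ ∈ elemSL 2 A}
  zero_mem' := by
    have : (upSL 0 : Matrix.SpecialLinearGroup (Fin 2) A) = 1 := by
      refine SL2_ext ?_ ?_ ?_ ?_ <;> rw [upSL_apply] <;> simp
    change g * upSL 0 * g⁻¹ ∈ elemSL 2 A
    rw [this, mul_one, mul_inv_cancel]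
    exact one_mem _
  add_mem' := by
    intro s t hs ht
    have : g * upSL (s + t) * g⁻¹ = (g * upSL s * g⁻¹) * (g * upSL t * g⁻¹) := by
      rw [upSL_add]
      group
    change g * upSL (s + t) * g⁻¹ ∈ elemSL 2 A
    rw [this]
    exact mul_mem hs ht
  neg_mem' := by
    intro t ht
    have : g * upSL (-t) * g⁻¹ = (g * upSL t * g⁻¹)⁻¹ := by
      rw [← upSL_inv]
      group
    change g * upSL (-t) * g⁻¹ ∈ elemSL 2 A
    rw [this]
    exact inv_mem ht

lemma mem_unipAddSubgroup {g : Matrix.SpecialLinearGroup (Fin 2) A} {t : A} :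
    t ∈ unipAddSubgroup g ↔ g * upSL t * g⁻¹ ∈ elemSL 2 A := Iff.rfl

variable {U : Aˣ} {g : Matrix.SpecialLinearGroup (Fin 2) A}

lemma sub_mem_unipAddSubgroup {k : ℤ} {s t : A}
    (hs : g * upSL s * diagSL (U ^ k) * g⁻¹ ∈ elemSL 2 A)
    (ht : g * upSL t * diagSL (U ^ k) * g⁻¹ ∈ elemSL 2 A) : s - t ∈ unipAddSubgroup g := by
  rw [mem_unipAddSubgroup]
  have : g * upSL (s - t) * g⁻¹ =
      (g * upSL s * diagSL (U ^ k) * g⁻¹) * (g * upSL t * diagSL (U ^ k) * g⁻¹)⁻¹ := by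
    rw [sub_eq_add_neg, upSL_add, ← upSL_inv]
    group
  rw [this]
  exact mul_mem hs (inv_mem ht)

lemma mul_mem_unipAddSubgroup {k : ℤ} {s t : A}
    (hs : g * upSL s * diagSL (U ^ k) * g⁻¹ ∈ elemSL 2 A) (ht : t ∈ unipAddSubgroup g) :
    ((U ^ k : Aˣ) : A) ^ 2 * t ∈ unipAddSubgroup g := by
  rw [mem_unipAddSubgroup] at ht ⊢
  have h1 := mul_mem (mul_mem hs ht) (inv_mem hs)
  have : g * upSL (((U ^ k : Aˣ) : A) ^ 2 * t) * g⁻¹ =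
      g * upSL s * diagSL (U ^ k) * g⁻¹ * (g * upSL t * g⁻¹) *
        (g * upSL s * diagSL (U ^ k) * g⁻¹)⁻¹ := by
    have e : g * upSL s * diagSL (U ^ k) * g⁻¹ * (g * upSL t * g⁻¹) *
        (g * upSL s * diagSL (U ^ k) * g⁻¹)⁻¹ =
        g * (upSL s * (diagSL (U ^ k) * upSL t * (diagSL (U ^ k))⁻¹) * (upSL s)⁻¹) * g⁻¹ := by
      group
    rw [e, diagSL_mul_upSL, ← upSL_add, elemMat_inv, ← upSL_add, add_neg_cancel_comm]
  rwa [this]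

lemma conj_nsmul_mem {j : ℤ} {a b β : A} (h : a * β = ((U ^ j : Aˣ) : A) ^ 2 - 1)
    (hm : g * upSL (b * β) * diagSL (U ^ j) * g⁻¹ ∈ elemSL 2 A) (m : ℕ) :
    ∃ γ, a * γ = ((U ^ (m * j) : Aˣ) : A) ^ 2 - 1 ∧
      g * upSL (b * γ) * diagSL (U ^ (m * j)) * g⁻¹ ∈ elemSL 2 A := by
  induction m with
  | zero =>
    refine ⟨0, by simp, ?_⟩
    rw [mul_zero, Nat.cast_zero, zero_mul, zpow_zero, map_one, mul_one]
    exact (unipAddSubgroup g).zero_mem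
  | succ m ih =>
    obtain ⟨γ, hγ, hγm⟩ := ih
    refine ⟨γ + ((U ^ (m * j) : Aˣ) : A) ^ 2 * β, ?_, ?_⟩
    · have e : ((U ^ (((m + 1 : ℕ) : ℤ) * j) : Aˣ) : A) =
          ((U ^ (m * j) : Aˣ) : A) * ((U ^ j : Aˣ) : A) := by
        rw [← Units.val_mul, ← zpow_add, Nat.cast_succ, add_one_mul]
      rw [e]
      linear_combination hγ + ((U ^ (m * j) : Aˣ) : A) ^ 2 * h
    · have := mul_mem hγm hm
      rwa [conj_mul_conj, show (m * j + j : ℤ) = ((m + 1 : ℕ) : ℤ) * j by push_cast; ring,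
        show b * γ + ((U ^ (m * j) : Aˣ) : A) ^ 2 * (b * β) =
          b * (γ + ((U ^ (m * j) : Aˣ) : A) ^ 2 * β) by ring] at this

lemma conj_neg_mem {k : ℤ} {t : A} (h : g * upSL t * diagSL (U ^ k) * g⁻¹ ∈ elemSL 2 A) :
    ∃ s, g * upSL s * diagSL (U ^ (-k)) * g⁻¹ ∈ elemSL 2 A := by
  refine ⟨((U ^ (-k) : Aˣ) : A) ^ 2 * -t, ?_⟩
  rw [← diagSL_mul_upSL, ← upSL_inv]
  have e : g * (diagSL (U ^ (-k)) * (upSL t)⁻¹ * (diagSL (U ^ (-k)))⁻¹) * diagSL (U ^ (-k)) * g⁻¹ =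
      (g * upSL t * diagSL (U ^ k) * g⁻¹)⁻¹ := by
    rw [zpow_neg, map_inv]
    group
  rw [e]
  exact inv_mem h

lemma IsGoodUnit.exists_int_row [IsDomain A] [IsDedekindDomain A] (hU : IsGoodUnit U)
    (g : Matrix.SpecialLinearGroup (Fin 2) A) {q : A} (hq : q ≠ 0) (hqu : ¬ IsUnit q) (y₀ : A)
    {ℓ : ℕ} (hℓ : ℓ.Prime) : ∃ (j a : ℕ) (b β : A), ¬ ℓ ∣ j ∧ q ∣ (a : A) - 1 ∧ q ∣ b - y₀ ∧
      (a : A) * β = ((U ^ (j : ℤ) : Aˣ) : A) ^ 2 - 1 ∧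
      g * upSL (b * β) * diagSL (U ^ (j : ℤ)) * g⁻¹ ∈ elemSL 2 A := by
  obtain ⟨e, he, γ, hγ, hg⟩ := exists_unipClosure_mul_congSL (q := 1) (pow_ne_zero 2 hq)
    (g := g * (upSL y₀)⁻¹) (mem_congSL.2 ⟨one_dvd _, one_dvd _, one_dvd _, one_dvd _⟩)
  replace he := unipClosure_elemSL_le 1 he
  set h₀ := γ * upSL y₀ with hh₀
  have hgh₀ : e⁻¹ * g = h₀ := by
    rw [hh₀, inv_mul_eq_iff_eq_mul, ← mul_assoc, ← hg]
    group
  obtain ⟨⟨w₁, h1⟩, ⟨w₂, h2⟩, ⟨w₃, h3⟩, ⟨w₄, h4⟩⟩ := mem_congSL.1 hγ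
  have e00 : h₀.1 0 0 = γ.1 0 0 := by
    rw [hh₀, SL2_mul_apply]
    simp only [upSL_apply]
    simp
  have e10 : h₀.1 1 0 = γ.1 1 0 := by
    rw [hh₀, SL2_mul_apply]
    simp only [upSL_apply]
    simp
  have e01 : h₀.1 0 1 = γ.1 0 0 * y₀ + γ.1 0 1 := by
    rw [hh₀, SL2_mul_apply]
    simp only [upSL_apply]
    simp
  have ha : q ^ 2 ∣ h₀.1 0 0 - 1 := ⟨w₁, by rw [e00, h1]⟩
  obtain ⟨x, y, Z, j, hZ0, hZ, hℓj, β, hβ⟩ := hU q (h₀.1 0 0) (h₀.1 1 0) hq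
    (ne_zero_of_dvd_sub_one hqu ha) ha ⟨q * w₃, by rw [e10, h3]; ring⟩
    ⟨h₀.1 1 1, -h₀.1 0 1, by linear_combination SL2_det h₀⟩ ℓ hℓ
  set h := upSL (q * y) * loSL (q * x) * h₀ with hh
  have h00 : h.1 0 0 = Z := by
    rw [← hZ, hh]
    simp only [SL2_mul_apply, upSL_apply, loSL_apply]
    simp
    ring
  have h01 : h.1 0 1 = h₀.1 0 1 + q * y * (h₀.1 1 1 + q * x * h₀.1 0 1) := by
    rw [hh]
    simp only [SL2_mul_apply, upSL_apply, loSL_apply]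
    simp
    ring
  have hβ' : h.1 0 0 * (β * ((U : A) ^ j + 1)) = ((U ^ (j : ℤ) : Aˣ) : A) ^ 2 - 1 := by
    rw [h00, zpow_natCast, Units.val_pow_eq_pow_val]
    linear_combination -((U : A) ^ j + 1) * hβ
  refine ⟨j, Z, h.1 0 1, β * ((U : A) ^ j + 1), hℓj, ?_, ?_, by rw [← h00, hβ'], ?_⟩
  · refine ⟨q * w₁ + y * (h₀.1 1 0 + q * x * h₀.1 0 0), ?_⟩
    rw [← hZ]
    linear_combination h1 + e00
  · refine ⟨q * w₁ * y₀ + q * w₂ + y * (h₀.1 1 1 + q * x * h₀.1 0 1), ?_⟩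
    rw [h01]
    linear_combination e01 + y₀ * h1 + h2
  · set p := upSL (q * y) * loSL (q * x) * e⁻¹ with hp
    have hpm : p ∈ elemSL 2 A :=
      mul_mem (mul_mem (upSL_mem _) (loSL_mem _)) (inv_mem he)
    have hpg : h = p * g := by
      rw [hh, hp, ← hgh₀]
      group
    have key := diagSL_conj_eq (U ^ (j : ℤ)) h _ hβ'
    set s := -(h.1 1 0 * (β * ((U : A) ^ j + 1)) * (↑(U ^ (j : ℤ))⁻¹ : A) ^ 2)
    set r := upSL (h.1 0 1 * (β * ((U : A) ^ j + 1)))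
    have e1 : g * r * diagSL (U ^ (j : ℤ)) * g⁻¹ =
        p⁻¹ * ((loSL s)⁻¹ * (loSL s * h * r) * diagSL (U ^ (j : ℤ)) * h⁻¹) * p := by
      rw [hpg]
      group
    rw [e1, ← key]
    have e2 : p⁻¹ * ((loSL s)⁻¹ * (diagSL (U ^ (j : ℤ)) * h * (diagSL (U ^ (j : ℤ)))⁻¹) *
        diagSL (U ^ (j : ℤ)) * h⁻¹) * p = p⁻¹ * ((loSL s)⁻¹ * diagSL (U ^ (j : ℤ))) * p := by
      group
    rw [e2]
    exact mul_mem (mul_mem (inv_mem hpm) (mul_mem (inv_mem (loSL_mem _)) (diagSL_mem _))) hpm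

lemma IsGoodUnit.exists_conj_mem [IsDomain A] [IsDedekindDomain A] (hU : IsGoodUnit U)
    (g : Matrix.SpecialLinearGroup (Fin 2) A) {q : A} (hq : q ≠ 0) (hqu : ¬ IsUnit q) (k : ℤ) :
    ∃ s, g * upSL s * diagSL (U ^ k) * g⁻¹ ∈ elemSL 2 A := by
  let H : AddSubgroup ℤ :=
    { carrier := {k | ∃ s, g * upSL s * diagSL (U ^ k) * g⁻¹ ∈ elemSL 2 A}
      zero_mem' := ⟨0, by
        rw [zpow_zero, map_one, mul_one]
        exact (unipAddSubgroup g).zero_mem⟩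
      add_mem' := by
        rintro k l ⟨s, hs⟩ ⟨t, ht⟩
        have := mul_mem hs ht
        rw [conj_mul_conj] at this
        exact ⟨_, this⟩
      neg_mem' := by
        rintro k ⟨s, hs⟩
        exact conj_neg_mem hs }
  have hH : H = ⊤ := by
    refine Int.addSubgroup_eq_top_of_forall_prime H fun ℓ hℓ => ?_
    obtain ⟨j, a, b, β, hj, -, -, -, h⟩ := hU.exists_int_row g hq hqu 0 hℓ
    exact ⟨j, ⟨_, h⟩, by exact_mod_cast hj⟩
  exact (hH ▸ AddSubgroup.mem_top k : k ∈ H)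

lemma IsGoodUnit.exists_mem_unipAddSubgroup [IsDomain A] [IsDedekindDomain A] [CharZero A]
    (hU : IsGoodUnit U) (g : Matrix.SpecialLinearGroup (Fin 2) A) {n : ℕ} (hn : n ≠ 0)
    (hnu : ¬ IsUnit (n : A)) (y₀ : A) :
    ∃ t ∈ unipAddSubgroup g, (n : A) ∣ ((U : A) ^ 2 - 1) * y₀ - t := by
  have hq : (n : A) ≠ 0 := Nat.cast_ne_zero.2 hn
  let H : AddSubgroup ℤ :=
    { carrier := {k | ∃ t ∈ unipAddSubgroup g,
        (n : A) ∣ (((U ^ k : Aˣ) : A) ^ 2 - 1) * y₀ - t}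
      zero_mem' := ⟨0, zero_mem _, by simp⟩
      add_mem' := by
        rintro k l ⟨s, hs, hs'⟩ ⟨t, ht, ht'⟩
        obtain ⟨r, hr⟩ := hU.exists_conj_mem g hq hnu k
        refine ⟨_, add_mem hs (mul_mem_unipAddSubgroup hr ht), ?_⟩
        rw [zpow_add, Units.val_mul]
        convert hs'.add (ht'.mul_left (((U ^ k : Aˣ) : A) ^ 2)) using 1
        ring
      neg_mem' := by
        rintro k ⟨t, ht, ht'⟩
        obtain ⟨r, hr⟩ := hU.exists_conj_mem g hq hnu (-k)
        refine ⟨_, neg_mem (mul_mem_unipAddSubgroup hr ht), ?_⟩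
        convert (ht'.mul_left (((U ^ (-k) : Aˣ) : A) ^ 2)).neg_right using 1
        have : ((U ^ (-k) : Aˣ) : A) * ((U ^ k : Aˣ) : A) = 1 := by
          rw [← Units.val_mul, ← zpow_add, neg_add_cancel, zpow_zero, Units.val_one]
        linear_combination (y₀ * (((U ^ (-k) : Aˣ) : A) * ((U ^ k : Aˣ) : A) + 1)) * this }
  have hH : H = ⊤ := by
    refine Int.addSubgroup_eq_top_of_forall_prime H fun ℓ hℓ => ?_
    obtain ⟨j, a, b, β, hj, ⟨a₁, ha⟩, ⟨b₁, hb⟩, hβ, h⟩ := hU.exists_int_row g hq hnu y₀ hℓ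
    obtain ⟨j', a', b', β', hj', ⟨a₁', ha'⟩, ⟨b₁', hb'⟩, hβ', h'⟩ :=
      hU.exists_int_row g hq hnu 0 hℓ
    obtain ⟨γ, hγ, hm⟩ := conj_nsmul_mem hβ h j'
    obtain ⟨γ', hγ', hm'⟩ := conj_nsmul_mem hβ' h' j
    rw [mul_comm (j : ℤ)] at hγ' hm'
    refine ⟨(j' * j : ℤ), ⟨(a * a') • (b * γ - b' * γ'),
      AddSubgroup.nsmul_mem _ (sub_mem_unipAddSubgroup hm hm') _, ?_⟩, ?_⟩
    · set W := ((U ^ (j' * j : ℤ) : Aˣ) : A) ^ 2 - 1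
      refine ⟨-(W * (a' * b₁ + y₀ * a₁' - a * b₁')), ?_⟩
      rw [nsmul_eq_mul]
      push_cast
      linear_combination (-a' * b) * hγ + a * b' * hγ' - W * a' * hb - W * y₀ * ha' + W * a * hb'
    · intro hd
      have : ℓ ∣ j' * j := by exact_mod_cast hd
      exact (hℓ.dvd_mul.1 this).elim hj' hj
  have h1 : (1 : ℤ) ∈ H := hH ▸ AddSubgroup.mem_top _
  obtain ⟨t, ht, htn⟩ := h1
  exact ⟨t, ht, by rwa [zpow_one] at htn⟩

lemma AddSubgroup.mem_of_forall_nsmul {M : Type*} [AddCommGroup M] [AddGroup.FG M]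
    (L : AddSubgroup M) {x : M} (h : ∀ n : ℕ, n ≠ 0 → ∃ y, x - n • y ∈ L) : x ∈ L := by
  have hfin : Module.Finite ℤ (M ⧸ L) := by
    rw [Module.Finite.iff_addGroup_fg]
    infer_instance
  have key : ∀ n : ℕ, n ≠ 0 → ∃ y : M ⧸ L, (x : M ⧸ L) = (n : ℤ) • y := by
    intro n hn
    obtain ⟨y, hy⟩ := h n hn
    refine ⟨(y : M ⧸ L), ?_⟩
    rw [natCast_zsmul, ← QuotientAddGroup.mk_nsmul, eq_comm, QuotientAddGroup.eq, neg_add_eq_sub]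
    exact hy
  have krull : ∀ c : ℕ, c ≠ 0 → ∃ s : ℤ, (c * s : ℤ) • (x : M ⧸ L) = x := by
    intro c hc
    have hx : (x : M ⧸ L) ∈
        (⨅ i : ℕ, (Ideal.span {(c : ℤ)}) ^ i • ⊤ : Submodule ℤ (M ⧸ L)) := by
      rw [Submodule.mem_iInf]
      intro i
      obtain ⟨y, hy⟩ := key (c ^ i) (pow_ne_zero _ hc)
      rw [hy]
      refine Submodule.smul_mem_smul ?_ trivial
      rw [Ideal.span_singleton_pow, Ideal.mem_span_singleton]
      push_cast
      rfl
    rw [Ideal.mem_iInf_smul_pow_eq_bot_iff] at hx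
    obtain ⟨⟨r, hr⟩, hrx⟩ := hx
    obtain ⟨s, rfl⟩ := Ideal.mem_span_singleton.1 hr
    exact ⟨s, hrx⟩
  obtain ⟨s, hs⟩ := krull 2 two_ne_zero
  have h0 : (1 - 2 * s : ℤ) • (x : M ⧸ L) = 0 := by
    rw [sub_smul, one_smul, sub_eq_zero]
    exact hs.symm
  obtain ⟨r, hr⟩ := krull (1 - 2 * s : ℤ).natAbs (by omega)
  rw [← QuotientAddGroup.eq_zero_iff, ← hr]
  obtain ⟨w, hw⟩ : (1 - 2 * s : ℤ) ∣ ((1 - 2 * s : ℤ).natAbs * r : ℤ) :=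
    (Int.dvd_natAbs.2 dvd_rfl).mul_right r
  rw [hw, mul_comm, mul_smul, h0, smul_zero]

end ConjugateUnipotents

section

variable {A : Type*} [CommRing A]

theorem IsGoodUnit.unipClosure_le [IsDomain A] [IsDedekindDomain A] [CharZero A] [AddGroup.FG A]
    {U : Aˣ} (hU : IsGoodUnit U) (hA : ∀ n : ℕ, 2 ≤ n → ¬ IsUnit (n : A)) :
    unipClosure ⊤ ((U : A) ^ 2 - 1) ≤ elemSL 2 A := by
  rw [unipClosure, Subgroup.closure_le]
  rintro _ ⟨g, -, y₀, rfl⟩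
  refine AddSubgroup.mem_of_forall_nsmul (unipAddSubgroup g) fun n hn => ?_
  obtain ⟨t, ht, w, hw⟩ := hU.exists_mem_unipAddSubgroup g (n := 2 * n) (by omega)
    (hA _ (by omega)) y₀
  refine ⟨2 * w, ?_⟩
  convert ht using 1
  rw [nsmul_eq_mul]
  push_cast at hw
  linear_combination hw

end

section RationalConjugation

variable {A : Type*} [CommRing A] {K : Type*} [Field K] [Algebra A K]

variable (A K) in
/-- The inclusion of integral matrices in rational matrices. -/
abbrev ratSL : Matrix.SpecialLinearGroup (Fin 2) A →* Matrix.SpecialLinearGroup (Fin 2) K :=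
  Matrix.SpecialLinearGroup.map (algebraMap A K)

lemma ratSL_apply (g : Matrix.SpecialLinearGroup (Fin 2) A) (i j : Fin 2) :
    (ratSL A K g).1 i j = algebraMap A K (g.1 i j) := rfl

lemma ratSL_injective [IsDomain A] [IsFractionRing A K] : Function.Injective (ratSL A K) := by
  intro g h hgh
  have key : ∀ i j, g.1 i j = h.1 i j := fun i j => by
    apply IsFractionRing.injective A K
    rw [← ratSL_apply, hgh, ratSL_apply]
  exact SL2_ext (key _ _) (key _ _) (key _ _) (key _ _)

lemma ratSL_upSL (t : A) : ratSL A K (upSL t) = upSL (algebraMap A K t) := by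
  refine SL2_ext ?_ ?_ ?_ ?_ <;> simp only [ratSL_apply, upSL_apply] <;> simp

lemma ratSL_loSL (t : A) : ratSL A K (loSL t) = loSL (algebraMap A K t) := by
  refine SL2_ext ?_ ?_ ?_ ?_ <;> simp only [ratSL_apply, loSL_apply] <;> simp

lemma ratSL_diagSL (u : Aˣ) :
    ratSL A K (diagSL u) = diagSL (Units.map (algebraMap A K).toMonoidHom u) := by
  refine SL2_ext ?_ ?_ ?_ ?_ <;> simp only [ratSL_apply, diagSL_apply] <;> simp

lemma ratSL_weylSL : ratSL A K weylSL = weylSL := by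
  refine SL2_ext ?_ ?_ ?_ ?_ <;> simp only [ratSL_apply, weylSL_apply] <;> simp

lemma exists_congSL_conj_upSL {D y M : A} {s : K} (hs : algebraMap A K D * s = algebraMap A K y)
    {g : Matrix.SpecialLinearGroup (Fin 2) A} (hg : g ∈ congSL (D ^ 2 * M)) :
    ∃ γ ∈ congSL M, upSL s * ratSL A K g * (upSL s)⁻¹ = ratSL A K γ := by
  obtain ⟨⟨a, ha⟩, ⟨b, hb⟩, ⟨c, hc⟩, ⟨d, hd⟩⟩ := mem_congSL.1 hg
  have hdet := SL2_det g
  have ha' : g.1 0 0 = 1 + D ^ 2 * M * a := by linear_combination ha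
  have hd' : g.1 1 1 = 1 + D ^ 2 * M * d := by linear_combination hd
  rw [ha', hb, hc, hd'] at hdet
  refine ⟨mkSL2 (1 + D ^ 2 * M * a + y * D * M * c)
    (D ^ 2 * M * b + y * D * M * (d - a) - y ^ 2 * M * c) (D ^ 2 * M * c)
    (1 + D ^ 2 * M * d - y * D * M * c) (by linear_combination hdet), ?_, ?_⟩
  · refine mem_congSL.2 ⟨⟨D ^ 2 * a + y * D * c, ?_⟩,
      ⟨D ^ 2 * b + y * D * (d - a) - y ^ 2 * c, ?_⟩, ⟨D ^ 2 * c, ?_⟩,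
      ⟨D ^ 2 * d - y * D * c, ?_⟩⟩ <;>
    simp only [mkSL2_apply] <;> simp <;> ring
  · rw [mul_inv_eq_iff_eq_mul]
    refine SL2_ext ?_ ?_ ?_ ?_ <;>
    simp only [SL2_mul_apply, upSL_apply, mkSL2_apply, ratSL_apply, ha', hb, hc, hd'] <;>
    simp [← hs] <;> ring

lemma exists_unipClosure_conj_upSL {D y q : A} {s : K} (hco : IsCoprime y D)
    (hs : algebraMap A K D * s = algebraMap A K y) {e : Matrix.SpecialLinearGroup (Fin 2) A}
    (he : e ∈ elemCongSL (q * D ^ 2)) :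
    ∃ γ ∈ unipClosure ⊤ q, upSL s * ratSL A K e * (upSL s)⁻¹ = ratSL A K γ := by
  have hle : elemCongSL (q * D ^ 2) ≤ (((unipClosure ⊤ q).map (ratSL A K)).comap
      (MulAut.conj (upSL s)).toMonoidHom).comap (ratSL A K) := by
    rw [elemCongSL_le_iff]
    refine fun t => ⟨?_, ?_⟩ <;> rw [Subgroup.mem_comap, Subgroup.mem_comap, Subgroup.mem_map]
    · refine ⟨upSL (q * (D ^ 2 * t)), elemCongSL_le_unipClosure (Subgroup.mem_top _) _
        (upSL_mem_elemCongSL _ _), ?_⟩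
      change _ = upSL s * ratSL A K (upSL (q * D ^ 2 * t)) * (upSL s)⁻¹
      rw [ratSL_upSL, ratSL_upSL, eq_mul_inv_iff_mul_eq, ← upSL_add, ← upSL_add, add_comm,
        mul_assoc]
    · obtain ⟨a, b, hab⟩ := hco
      set σ := mkSL2 y (-b) D a (by linear_combination hab)
      refine ⟨σ * upSL (q * -t) * σ⁻¹, conj_upSL_mem_unipClosure (Subgroup.mem_top _) _ _, ?_⟩
      change _ = upSL s * ratSL A K (loSL (q * D ^ 2 * t)) * (upSL s)⁻¹
      rw [ratSL_loSL, eq_mul_inv_iff_mul_eq]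
      have e : σ * upSL (q * -t) * σ⁻¹ = mkSL2 (1 + q * t * y * D) (-(q * t * y ^ 2))
          (q * t * D ^ 2) (1 - q * t * y * D) (by ring) := by
        rw [mul_inv_eq_iff_eq_mul]
        refine SL2_ext ?_ ?_ ?_ ?_ <;> simp only [SL2_mul_apply, upSL_apply, mkSL2_apply, σ] <;>
        simp
        · ring
        · linear_combination (q * t * y) * hab
        · ring
        · linear_combination (q * t * D) * hab
      rw [e]
      refine SL2_ext ?_ ?_ ?_ ?_ <;>
      simp only [SL2_mul_apply, upSL_apply, loSL_apply, mkSL2_apply, ratSL_apply] <;>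
      simp [← hs] <;> ring
  obtain ⟨γ, hγ, h⟩ := Subgroup.mem_map.1 (Subgroup.mem_comap.1 (Subgroup.mem_comap.1 (hle he)))
  exact ⟨γ, hγ, h.symm⟩

/-- Rational matrices acting trivially by conjugation, modulo `unipClosure ⊤ q`, on deep enough
congruence subgroups. -/
def IsNearlyCentral (q : A) (h : Matrix.SpecialLinearGroup (Fin 2) K) : Prop :=
  ∀ N₁ : A, N₁ ≠ 0 → ∃ N : A, N ≠ 0 ∧ ∀ g ∈ congSL N, ∃ γ ∈ congSL N₁,
    h * ratSL A K g * h⁻¹ = ratSL A K γ ∧ g⁻¹ * γ ∈ unipClosure ⊤ q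

lemma IsNearlyCentral.mul {q : A} {h₁ h₂ : Matrix.SpecialLinearGroup (Fin 2) K}
    (H₁ : IsNearlyCentral q h₁) (H₂ : IsNearlyCentral q h₂) : IsNearlyCentral q (h₁ * h₂) := by
  intro N₁ hN₁
  obtain ⟨N₂, hN₂, K₁⟩ := H₁ N₁ hN₁
  obtain ⟨N₃, hN₃, K₂⟩ := H₂ N₂ hN₂
  refine ⟨N₃, hN₃, fun g hg => ?_⟩
  obtain ⟨γ, hγ, e, hF⟩ := K₂ g hg
  obtain ⟨γ', hγ', e', hF'⟩ := K₁ γ hγ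
  refine ⟨γ', hγ', ?_, ?_⟩
  · rw [← e', ← e]
    group
  · have := mul_mem hF hF'
    rwa [mul_assoc, mul_inv_cancel_left] at this

lemma IsNearlyCentral.conj {q : A} {h : Matrix.SpecialLinearGroup (Fin 2) K}
    (H : IsNearlyCentral q h) (σ : Matrix.SpecialLinearGroup (Fin 2) A) :
    IsNearlyCentral q (ratSL A K σ * h * (ratSL A K σ)⁻¹) := by
  intro N₁ hN₁
  obtain ⟨N, hN, hc⟩ := H N₁ hN₁
  refine ⟨N, hN, fun g hg => ?_⟩
  obtain ⟨γ, hγ, e, hF⟩ := hc (σ⁻¹ * g * σ)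
    (by simpa using (inferInstance : (congSL N).Normal).conj_mem _ hg σ⁻¹)
  refine ⟨σ * γ * σ⁻¹, (inferInstance : (congSL N₁).Normal).conj_mem _ hγ _, ?_, ?_⟩
  · rw [map_mul, map_mul, ← e, map_mul, map_mul, map_inv]
    group
  · have := conj_mem_unipClosure (Subgroup.mem_top σ) hF
    convert this using 1
    group

lemma IsGoodUnit.isNearlyCentral_upSL [IsDomain A] [IsFractionRing A K] {U : Aˣ}
    (hU : IsGoodUnit U) {q : A} (hq : q ≠ 0) (hqu : ¬ IsUnit q) {D y : A} (hD : D ≠ 0)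
    (hco : IsCoprime y D) {s : K} (hs : algebraMap A K D * s = algebraMap A K y) :
    IsNearlyCentral q (upSL (algebraMap A K ((U : A) ^ 2 - 1) * s)) := by
  intro N₁ hN₁
  have hQ : q * D ^ 2 ≠ 0 := mul_ne_zero hq (pow_ne_zero 2 hD)
  have hQu : ¬ IsUnit (q * D ^ 2) := fun h => hqu (isUnit_of_mul_isUnit_left h)
  refine ⟨D ^ 2 * ((q * D ^ 2) ^ 2 * N₁), mul_ne_zero (pow_ne_zero 2 hD)
    (mul_ne_zero (pow_ne_zero 2 hQ) hN₁), fun g hg => ?_⟩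
  obtain ⟨γ, hγ, hγe⟩ := exists_congSL_conj_upSL (K := K) (D := D) (y := ((U : A) ^ 2 - 1) * y)
    (M := N₁) (s := algebraMap A K ((U : A) ^ 2 - 1) * s)
    (by rw [map_mul, ← hs]; ring) (congSL_le (mul_dvd_mul_left _ (Dvd.intro_left _ rfl)) hg)
  refine ⟨γ, hγ, hγe, ?_⟩
  obtain ⟨G, hG, hGe⟩ := exists_congSL_conj_upSL (K := K) (D := D) (y := -y)
    (M := (q * D ^ 2) ^ 2) (s := -s) (by rw [map_neg, ← hs]; ring)
    (congSL_le (mul_dvd_mul_left _ (Dvd.intro _ rfl)) hg)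
  obtain ⟨e, he, f, hf, hef⟩ := hU.exists_conj_eq hQ hQu hG (-1)
  obtain ⟨e', he', f', hf', hef'⟩ := hU.exists_conj_eq hq hqu (congSL_le
    (((pow_dvd_pow_of_dvd (Dvd.intro _ rfl) 2).mul_right _).mul_left _) hg) 1
  obtain ⟨e₁, he₁, hee₁⟩ := exists_unipClosure_conj_upSL hco hs he
  obtain ⟨f₁, hf₁, hff₁⟩ := exists_unipClosure_conj_upSL hco hs hf
  rw [zpow_one] at hef'
  rw [zpow_neg_one, map_inv, inv_inv] at hef
  set T := diagSL U
  have hX : upSL (algebraMap A K ((U : A) ^ 2 - 1) * s) =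
      ratSL A K T * upSL s * (ratSL A K T)⁻¹ * (upSL s)⁻¹ := by
    rw [ratSL_diagSL, diagSL_mul_upSL, upSL_inv, ← upSL_add]
    congr 1
    simp
    ring
  have hγ' : γ = (T * e₁ * T⁻¹) * e' * g * (f' * (T * f₁ * T⁻¹)) := by
    apply ratSL_injective (K := K)
    have e1 : (T * e₁ * T⁻¹) * e' * g * (f' * (T * f₁ * T⁻¹)) =
      T * e₁ * T⁻¹ * (e' * g * f') * (T * f₁ * T⁻¹) := by group
    rw [e1, ← hef', ← hγe, hX]
    have e2 : T * e₁ * T⁻¹ * (T * g * T⁻¹) * (T * f₁ * T⁻¹) = T * e₁ * g * f₁ * T⁻¹ := by group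
    rw [e2]
    simp only [map_mul, map_inv]
    rw [← hee₁, ← hff₁]
    have e3 : ratSL A K T * upSL s * (ratSL A K T)⁻¹ * (upSL s)⁻¹ * ratSL A K g *
        (ratSL A K T * upSL s * (ratSL A K T)⁻¹ * (upSL s)⁻¹)⁻¹ =
        ratSL A K T * upSL s * ((ratSL A K T)⁻¹ * ((upSL s)⁻¹ * ratSL A K g * (upSL s)⁻¹⁻¹) *
        ratSL A K T) * (upSL s)⁻¹ * (ratSL A K T)⁻¹ := by group
    have e4 := congrArg (ratSL A K) hef
    simp only [map_mul, map_inv] at e4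
    rw [← hGe, ← upSL_inv] at e4
    rw [e3, e4]
    group
  have hn : (unipClosure (⊤ : Subgroup (Matrix.SpecialLinearGroup (Fin 2) A)) q).Normal :=
    inferInstance
  have hle := elemCongSL_le_unipClosure (Subgroup.mem_top (weylSL (A := A))) q
  have h1 := mul_mem (hn.conj_mem _ (mul_mem (conj_mem_unipClosure (Subgroup.mem_top T) he₁)
    (hle he')) g⁻¹) (mul_mem (hle hf') (conj_mem_unipClosure (Subgroup.mem_top T) hf₁))
  rw [hγ']
  convert h1 using 1
  group

end RationalConjugation

section NearlyCentral

variable {A K : Type*} [CommRing A] [IsDomain A] [Field K] [Algebra A K] [IsFractionRing A K]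

lemma IsGoodUnit.isNearlyCentral_loSL {U : Aˣ} (hU : IsGoodUnit U) {q : A}
    (hq : q ≠ 0) (hqu : ¬ IsUnit q) {D y : A} (hD : D ≠ 0)
    (hco : IsCoprime y D) {s : K} (hs : algebraMap A K D * s = algebraMap A K y) :
    IsNearlyCentral q (loSL (algebraMap A K ((U : A) ^ 2 - 1) * s)) := by
  have h := (hU.isNearlyCentral_upSL hq hqu hD hco.neg_left (s := -s)
    (by rw [mul_neg, hs, map_neg])).conj weylSL
  rwa [ratSL_weylSL, weylSL_mul_upSL, mul_neg, neg_neg] at h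

lemma IsGoodUnit.isNearlyCentral_weylSL {U : Aˣ} (hU : IsGoodUnit U) {q : A}
    (hq : q ≠ 0) (hqu : ¬ IsUnit q) (hz : (U : A) ^ 2 - 1 ≠ 0) :
    IsNearlyCentral q (weylSL : Matrix.SpecialLinearGroup (Fin 2) K) := by
  have hz' : algebraMap A K ((U : A) ^ 2 - 1) ≠ 0 :=
    (map_ne_zero_iff _ (IsFractionRing.injective A K)).2 hz
  have h1 := hU.isNearlyCentral_upSL (K := K) hq hqu hz (y := -1) (isCoprime_one_left.neg_left)
    (s := (algebraMap A K ((U : A) ^ 2 - 1))⁻¹ * -1) (by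
      rw [mul_inv_cancel_left₀ hz', map_neg, map_one])
  have h2 := hU.isNearlyCentral_loSL (K := K) hq hqu hz isCoprime_one_left
    (s := (algebraMap A K ((U : A) ^ 2 - 1))⁻¹) (by rw [mul_inv_cancel₀ hz', map_one])
  rw [mul_inv_cancel_left₀ hz'] at h1
  rw [mul_inv_cancel₀ hz'] at h2
  have e : (weylSL : Matrix.SpecialLinearGroup (Fin 2) K) = upSL (-1) * loSL 1 * upSL (-1) := by
    refine SL2_ext ?_ ?_ ?_ ?_ <;>
    simp only [SL2_mul_apply, upSL_apply, loSL_apply, weylSL_apply] <;> simp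
  rw [e]
  exact (h1.mul h2).mul h1

lemma IsGoodUnit.isNearlyCentral_diagSL {U : Aˣ} (hU : IsGoodUnit U) {q : A}
    (hq : q ≠ 0) (hqu : ¬ IsUnit q) (hz : (U : A) ^ 2 - 1 ≠ 0)
    {x : A} (hx : IsCoprime x ((U : A) ^ 2 - 1)) (v : Kˣ)
    (hv : (v : K) = algebraMap A K x) : IsNearlyCentral q (diagSL v) := by
  have hz' : algebraMap A K ((U : A) ^ 2 - 1) ≠ 0 :=
    (map_ne_zero_iff _ (IsFractionRing.injective A K)).2 hz
  have hx0 : x ≠ 0 := by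
    rintro rfl
    exact v.ne_zero (by rw [hv, map_zero])
  have h1 := hU.isNearlyCentral_upSL (K := K) hq hqu hz hx
    (s := (algebraMap A K ((U : A) ^ 2 - 1))⁻¹ * v) (by
      rw [mul_inv_cancel_left₀ hz', hv])
  have h2 := hU.isNearlyCentral_loSL (K := K) hq hqu (mul_ne_zero hz hx0) (y := -1)
    isCoprime_one_left.neg_left
    (s := (algebraMap A K ((U : A) ^ 2 - 1))⁻¹ * -(v⁻¹ : Kˣ)) (by
      rw [map_mul, ← hv, mul_assoc, mul_left_comm (v : K), mul_inv_cancel_left₀ hz', mul_neg,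
        v.mul_inv, map_neg, map_one])
  rw [mul_inv_cancel_left₀ hz'] at h1 h2
  have e : diagSL v = upSL (v : K) * loSL (-↑v⁻¹ : K) * upSL (v : K) * weylSL := by
    refine SL2_ext ?_ ?_ ?_ ?_ <;>
    simp only [SL2_mul_apply, upSL_apply, loSL_apply, weylSL_apply, diagSL_apply] <;> simp
  rw [e]
  exact ((h1.mul h2).mul h1).mul (hU.isNearlyCentral_weylSL hq hqu hz)

lemma IsGoodUnit.isNearlyCentral_ratSL {U : Aˣ} (hU : IsGoodUnit U) {q : A}
    (hq : q ≠ 0) (hqu : ¬ IsUnit q) (hz : (U : A) ^ 2 - 1 ≠ 0)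
    (hzq : (U : A) ^ 2 - 1 ∣ q)
    {g : Matrix.SpecialLinearGroup (Fin 2) A} (hg : g ∈ congSL q) :
    IsNearlyCentral q (ratSL A K g) := by
  obtain ⟨ha, hb, hc, hd⟩ := mem_congSL.1 hg
  have hdet := SL2_det g
  have ha0 : g.1 0 0 ≠ 0 := by
    intro h
    rw [h, zero_sub, dvd_neg] at ha
    exact hqu (isUnit_of_dvd_one ha)
  obtain ⟨a', ha'⟩ := hzq.trans ha
  obtain ⟨b', hb'⟩ := hzq.trans hb
  obtain ⟨c', hc'⟩ := hzq.trans hc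
  have ha0' : algebraMap A K (g.1 0 0) ≠ 0 :=
    (map_ne_zero_iff _ (IsFractionRing.injective A K)).2 ha0
  have h1 := hU.isNearlyCentral_loSL (K := K) hq hqu ha0 (y := c')
    ⟨-(((U : A) ^ 2 - 1) * g.1 0 1), g.1 1 1, by rw [hc'] at hdet; linear_combination hdet⟩
    (s := (algebraMap A K (g.1 0 0))⁻¹ * algebraMap A K c') (by rw [mul_inv_cancel_left₀ ha0'])
  have h2 := hU.isNearlyCentral_diagSL (K := K) hq hqu hz (x := g.1 0 0)
    ⟨1, -a', by linear_combination ha'⟩ (Units.mk0 _ ha0') rfl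
  have h3 := hU.isNearlyCentral_upSL (K := K) hq hqu ha0 (y := b')
    ⟨-(((U : A) ^ 2 - 1) * g.1 1 0), g.1 1 1, by rw [hb'] at hdet; linear_combination hdet⟩
    (s := (algebraMap A K (g.1 0 0))⁻¹ * algebraMap A K b') (by rw [mul_inv_cancel_left₀ ha0'])
  rw [mul_left_comm, ← map_mul, ← hc'] at h1
  rw [mul_left_comm, ← map_mul, ← hb'] at h3
  convert (h1.mul h2).mul h3 using 1
  have hdet' := congrArg (algebraMap A K) hdet
  rw [map_sub, map_mul, map_mul, map_one] at hdet'
  refine SL2_ext ?_ ?_ ?_ ?_ <;>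
  simp only [SL2_mul_apply, upSL_apply, loSL_apply, diagSL_apply, ratSL_apply] <;> simp <;>
  field_simp
  linear_combination hdet'

lemma IsNearlyCentral.exists_pow {q : A} [Ring.HasFiniteQuotients A]
    {h : Matrix.SpecialLinearGroup (Fin 2) K} (H : IsNearlyCentral q h)
    {g g' : Matrix.SpecialLinearGroup (Fin 2) A} (e : h * ratSL A K g * h⁻¹ = ratSL A K g') :
    ∃ n : ℕ, n ≠ 0 ∧ ∀ k, (g ^ (n * k))⁻¹ * g' ^ (n * k) ∈ unipClosure ⊤ q := by
  obtain ⟨N, hN, hc⟩ := H 1 one_ne_zero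
  have : Finite (A ⧸ Ideal.span {N}) := Ring.HasFiniteQuotients.finiteQuotient
    (by rwa [Ne, Ideal.span_singleton_eq_bot])
  have := congSL_finiteIndex N
  refine ⟨(congSL N).index, Subgroup.FiniteIndex.index_ne_zero, fun k => ?_⟩
  have hg : g ^ ((congSL N).index * k) ∈ congSL N := by
    rw [pow_mul]
    exact pow_mem (Subgroup.pow_index_mem _ g) k
  obtain ⟨γ, -, hγ, hF⟩ := hc _ hg
  rw [map_pow, ← conj_pow, e, ← map_pow] at hγ
  rwa [ratSL_injective hγ]

lemma IsNearlyCentral.commutator_mem [IsDedekindDomain A] {q : A}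
    {g g' : Matrix.SpecialLinearGroup (Fin 2) A} (H : IsNearlyCentral q (ratSL A K g))
    (hg' : g' ∈ congSL q) :
    (g' * g)⁻¹ * (g * g') ∈ unipClosure ⊤ q := by
  obtain ⟨N, hN, hc⟩ := H 1 one_ne_zero
  obtain ⟨f, hf, γ, hγ, rfl⟩ := exists_unipClosure_mul_congSL hN hg'
  obtain ⟨γ', -, hγ', hF⟩ := hc γ hγ
  rw [← map_inv, ← map_mul, ← map_mul] at hγ'
  rw [← ratSL_injective hγ'] at hF
  have hf' := unipClosure_mono le_top q hf
  have hn : (unipClosure (⊤ : Subgroup (Matrix.SpecialLinearGroup (Fin 2) A)) q).Normal :=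
    inferInstance
  have h1 := hn.conj_mem _ (mul_mem (inv_mem hf') (hn.conj_mem _ hf' g)) (γ * g)⁻¹
  have h2 := hn.conj_mem _ hF g⁻¹
  convert mul_mem h1 h2 using 1
  group

end NearlyCentral

section PrimeSwap

variable {A K : Type*} [CommRing A] [Field K] [Algebra A K]

/-- A matrix with prime upper left entry `r ≡ 1 [MOD 4]` is related to its inverse by conjugation
by rational matrices, up to elementary matrices. -/
lemma exists_diagSL_conj {z q : A} (hzq : z ∣ q) (hqu : ¬ IsUnit q)
    {g : Matrix.SpecialLinearGroup (Fin 2) A} (hg : g ∈ congSL q) {r : ℕ} (hr : r.Prime)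
    (hr4 : r % 4 = 1) (hgr : g.1 0 0 = r) :
    ∃ x : A, IsCoprime x z ∧ x ≠ 0 ∧ ∃ g₃ g₄ : Matrix.SpecialLinearGroup (Fin 2) A,
      g₃ * g⁻¹ ∈ elemCongSL q ∧
      (∀ v : Kˣ, (v : K) = algebraMap A K x →
        diagSL v * ratSL A K g₃ * (diagSL v)⁻¹ = ratSL A K g₄) ∧
      ∃ e ∈ elemCongSL q, ∃ f ∈ elemCongSL q, g₄ = e * (weylSL * g₃⁻¹ * weylSL⁻¹) * f := by
  obtain ⟨⟨w, hw⟩, ⟨b', hb⟩, ⟨c', hc⟩, ⟨d', hd⟩⟩ := mem_congSL.1 hg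
  have hdet := SL2_det g
  rw [hgr] at hw hdet
  obtain ⟨ι, m, hιm⟩ : ∃ ι m : A, ι ^ 2 + 1 = r * m := by
    have := Fact.mk hr
    obtain ⟨y, hy⟩ := ZMod.exists_sq_eq_neg_one_iff.2 (show r % 4 ≠ 3 by omega)
    obtain ⟨k, rfl⟩ := ZMod.natCast_zmod_surjective y
    have h0 : ((k * k + 1 : ℕ) : ZMod r) = 0 := by
      push_cast
      rw [← hy]
      ring
    rw [ZMod.natCast_eq_zero_iff] at h0
    obtain ⟨m, hm⟩ := h0
    refine ⟨k, m, ?_⟩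
    have := congrArg (Nat.cast (R := A)) hm
    push_cast at this
    linear_combination this
  set b := g.1 0 1
  set c := g.1 1 0
  set d := g.1 1 1
  set x : A := r - ι * c with hx
  have hxq : IsCoprime x q := ⟨1, -(w - ι * c'), by rw [hx, hc]; linear_combination hw⟩
  have hx0 : x ≠ 0 := fun h => by
    rw [h, isCoprime_zero_left] at hxq
    exact hqu hxq
  have hrx : IsCoprime (r : A) x :=
    ⟨ι * b + d - m * b * c, -ι * b, by rw [hx]; linear_combination hdet + b * c * hιm⟩
  obtain ⟨u, v, huv⟩ := hrx.pow_right (n := 2)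
  set g₃ := loSL (q * (-c' * u)) * g with hg₃
  have h00 : g₃.1 0 0 = r := by
    rw [hg₃, SL2_mul_apply]
    simp only [loSL_apply]
    simp [hgr]
  have h01 : g₃.1 0 1 = b := by
    rw [hg₃, SL2_mul_apply]
    simp only [loSL_apply]
    simp [b]
  have h10 : g₃.1 1 0 = x ^ 2 * (q * v * c') := by
    rw [hg₃, SL2_mul_apply]
    simp only [loSL_apply, hgr]
    simp
    linear_combination hc - q * c' * huv
  have hdet₃ := SL2_det g₃
  rw [h00, h01, h10] at hdet₃
  refine ⟨x, hxq.of_isCoprime_of_dvd_right hzq, hx0, g₃,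
    mkSL2 r (x ^ 2 * b) (q * v * c') (g₃.1 1 1) (by linear_combination hdet₃), ?_, ?_, ?_⟩
  · rw [hg₃, mul_inv_cancel_right]
    exact loSL_mem_elemCongSL _ _
  · intro y hy
    rw [mul_inv_eq_iff_eq_mul]
    have hy' : (y : K) * (y⁻¹ : Kˣ) = 1 := y.mul_inv
    refine SL2_ext ?_ ?_ ?_ ?_ <;>
    simp only [SL2_mul_apply, diagSL_apply, ratSL_apply, mkSL2_apply, h00, h01, h10] <;>
    simp [← hy] <;> field_simp
  · set H := weylSL * g₃⁻¹ * weylSL⁻¹ with hH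
    have H' : H = mkSL2 (r : A) (x ^ 2 * (q * v * c')) b (g₃.1 1 1) (by linear_combination hdet₃) := by
      rw [hH, mul_inv_eq_iff_eq_mul]
      refine SL2_ext ?_ ?_ ?_ ?_ <;>
      simp only [SL2_mul_apply, weylSL_apply, mkSL2_apply, SL2_inv_apply, h00, h01, h10] <;>
      simp
    have hxb : x ^ 2 * b - c = r * (r * b - 2 * ι * c * b + m * c ^ 2 * b - c * d) := by
      rw [hx]
      linear_combination c ^ 2 * b * hιm + c * hdet
    obtain ⟨k, hk⟩ : ∃ k, x ^ 2 * b = x ^ 2 * (q * v * c') + r * (q * k) :=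
      ⟨r * b' - 2 * ι * c * b' + m * c ^ 2 * b' - c' * d + c' * u, by
        linear_combination hxb + (1 - r * d) * hc - q * c' * huv +
          r * (r - 2 * ι * c + m * c ^ 2) * hb⟩
    refine ⟨_, ?_, upSL (q * k), upSL_mem_elemCongSL _ _,
      (eq_loSL_mul (h := H * upSL (q * k)) ?_ ?_).trans (mul_assoc _ _ _).symm⟩
    · rw [H']
      simp only [SL2_mul_apply, mkSL2_apply, upSL_apply]
      convert loSL_mem_elemCongSL q (v * c' * (b * (q * k) + g₃.1 1 1) - g₃.1 1 1 * b') using 2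
      simp
      linear_combination (-g₃.1 1 1) * hb
    · rw [H']
      simp only [SL2_mul_apply, mkSL2_apply, upSL_apply]
      simp
    · rw [H']
      simp only [SL2_mul_apply, mkSL2_apply, upSL_apply]
      simp [hk]
      ring

end PrimeSwap

section FiniteIndex

open NumberField

variable {K : Type*} [Field K] [NumberField K]

lemma IsGoodUnit.exists_pow_mem_unipClosure {U : (𝓞 K)ˣ} (hU : IsGoodUnit U) {q : 𝓞 K}
    (hq : q ≠ 0) (hqu : ¬ IsUnit q) (hz : (U : 𝓞 K) ^ 2 - 1 ≠ 0) (hzq : (U : 𝓞 K) ^ 2 - 1 ∣ q)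
    {g : Matrix.SpecialLinearGroup (Fin 2) (𝓞 K)} (hg : g ∈ congSL q) :
    ∃ n : ℕ, n ≠ 0 ∧ g ^ n ∈ unipClosure ⊤ q := by
  set F := unipClosure (⊤ : Subgroup (Matrix.SpecialLinearGroup (Fin 2) (𝓞 K))) q with hF
  have hFn : F.Normal := inferInstance
  have hle : elemCongSL q ≤ F := elemCongSL_le_unipClosure (Subgroup.mem_top _) q
  obtain ⟨f, hf, g₁, hg₁, hgf⟩ := exists_unipClosure_mul_congSL (pow_ne_zero 2 hq) hg
  obtain ⟨ha, hb, -, -⟩ := mem_congSL.1 hg₁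
  have hdet := SL2_det g₁
  obtain ⟨x₀, y₀, r, hr, hr4, hr₀⟩ := exists_prime_representative hq
    (ne_zero_of_dvd_sub_one hqu ha) ha ((dvd_pow_self q two_ne_zero).trans hb)
    ⟨g₁.1 1 1, -g₁.1 1 0, by linear_combination hdet⟩
  set g₂ := g₁ * (upSL (q * x₀) * loSL (q * y₀)) with hg₂
  have hg₂q : g₂ ∈ congSL q := mul_mem (congSL_le (dvd_pow_self q two_ne_zero) hg₁)
    (mul_mem (upSL_mem_congSL (Dvd.intro _ rfl)) (loSL_mem_congSL (Dvd.intro _ rfl)))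
  have hg₂r : g₂.1 0 0 = r := by
    rw [← hr₀, hg₂]
    simp only [SL2_mul_apply, upSL_apply, loSL_apply]
    simp
    ring
  obtain ⟨x, hxz, hx0, g₃, g₄, h₃, h₄, e, he, e', he', hge⟩ :=
    exists_diagSL_conj (K := K) hzq hqu hg₂q hr hr4 hg₂r
  have hx0' : algebraMap (𝓞 K) K x ≠ 0 :=
    (map_ne_zero_iff _ (IsFractionRing.injective (𝓞 K) K)).2 hx0
  obtain ⟨n, hn, hpow⟩ := (hU.isNearlyCentral_diagSL (K := K) hq hqu hz hxz
    (Units.mk0 _ hx0') rfl).exists_pow (h₄ _ rfl)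
  obtain ⟨n', hn', hpow'⟩ := (hU.isNearlyCentral_weylSL (K := K) hq hqu hz).exists_pow
    (g := g₃⁻¹) (g' := weylSL * g₃⁻¹ * weylSL⁻¹) (by simp only [map_mul, map_inv, ratSL_weylSL])
  refine ⟨2 * (n * n'), by positivity, ?_⟩
  have h1 := hpow n'
  have h2 := hpow' n
  rw [mul_comm n' n] at h2
  let π := QuotientGroup.mk' F
  have hπ : ∀ {s}, s ∈ F → π s = 1 := fun hs => (QuotientGroup.eq_one_iff _).2 hs
  have e₁ : π g = π g₁ := by rw [hgf, map_mul, hπ (unipClosure_mono le_top q hf), one_mul]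
  have e₂ : π g₂ = π g₁ := by
    rw [hg₂, map_mul, hπ (hle (mul_mem (upSL_mem_elemCongSL _ _) (loSL_mem_elemCongSL _ _))),
      mul_one]
  have e₃ : π g₃ = π g₂ := by
    have := hπ (hle h₃)
    rwa [map_mul, map_inv, mul_inv_eq_one] at this
  have e₄ : π g₄ = π (weylSL * g₃⁻¹ * weylSL⁻¹) := by
    rw [hge, map_mul, map_mul, hπ (hle he), hπ (hle he'), one_mul, mul_one]
  have e₅ : π g₃ ^ (n * n') = π g₄ ^ (n * n') := by
    have := hπ h1
    rwa [map_mul, map_inv, inv_mul_eq_one, map_pow, map_pow] at this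
  have e₆ : (π g₃)⁻¹ ^ (n * n') = π (weylSL * g₃⁻¹ * weylSL⁻¹) ^ (n * n') := by
    have := hπ h2
    rwa [map_mul, map_inv, inv_mul_eq_one, map_pow, map_pow, map_inv] at this
  rw [← e₄, ← e₅, inv_pow, inv_eq_iff_mul_eq_one, ← pow_add, ← two_mul, e₃, e₂, ← e₁] at e₆
  rw [← map_pow] at e₆
  exact (QuotientGroup.eq_one_iff _).1 e₆

lemma IsGoodUnit.unipClosure_finiteIndex {U : (𝓞 K)ˣ} (hU : IsGoodUnit U) {q : 𝓞 K}
    (hq : q ≠ 0) (hqu : ¬ IsUnit q) (hz : (U : 𝓞 K) ^ 2 - 1 ≠ 0) (hzq : (U : 𝓞 K) ^ 2 - 1 ∣ q) :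
    (unipClosure (⊤ : Subgroup (Matrix.SpecialLinearGroup (Fin 2) (𝓞 K))) q).FiniteIndex := by
  set F := unipClosure (⊤ : Subgroup (Matrix.SpecialLinearGroup (Fin 2) (𝓞 K))) q with hF
  have hFn : F.Normal := inferInstance
  let π := QuotientGroup.mk' F
  have hπs : Function.Surjective π := QuotientGroup.mk'_surjective F
  have : Finite (𝓞 K ⧸ Ideal.span {q}) := Ring.HasFiniteQuotients.finiteQuotient
    (by rwa [Ne, Ideal.span_singleton_eq_bot])
  have := congSL_finiteIndex q
  set C := (congSL q).map π with hC
  have hCi : C.index ≠ 0 := fun h => Subgroup.FiniteIndex.index_ne_zero (H := congSL q)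
    (Nat.eq_zero_of_zero_dvd (h ▸ Subgroup.index_map_dvd _ hπs))
  have : Group.FG (Matrix.SpecialLinearGroup (Fin 2) (𝓞 K)) :=
    Group.IsFinitelyPresented.fg _
  have : C.FiniteIndex := ⟨hCi⟩
  have hCfg : Group.FG C := Subgroup.fg_of_index_ne_zero C
  let _ : CommGroup C :=
    { (inferInstance : Group C) with
      mul_comm := by
        rintro ⟨_, g, hg, rfl⟩ ⟨_, g', hg', rfl⟩
        refine Subtype.ext ?_
        have h := (QuotientGroup.eq_one_iff _).2
          ((hU.isNearlyCentral_ratSL (K := K) hq hqu hz hzq hg).commutator_mem hg')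
        change π _ = 1 at h
        rw [map_mul, map_inv, inv_mul_eq_one, map_mul, map_mul] at h
        exact h.symm }
  have hCt : IsMulTorsion C := by
    rintro ⟨_, g, hg, rfl⟩
    obtain ⟨n, hn, h⟩ := hU.exists_pow_mem_unipClosure hq hqu hz hzq hg
    refine isOfFinOrder_iff_pow_eq_one.2 ⟨n, Nat.pos_of_ne_zero hn, Subtype.ext ?_⟩
    change π g ^ n = 1
    rw [← map_pow]
    exact (QuotientGroup.eq_one_iff _).2 h
  have : Finite C := CommGroup.finite_of_fg_isMulTorsion C hCt
  have : Finite (Matrix.SpecialLinearGroup (Fin 2) (𝓞 K) ⧸ F) :=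
    Nat.finite_of_card_ne_zero (by
      rw [← C.card_mul_index]
      exact mul_ne_zero Nat.card_pos.ne' hCi)
  exact Subgroup.finiteIndex_of_finite_quotient

lemma elemSL_two_finiteIndex (u : (𝓞 K)ˣ) (hu : ¬ IsOfFinOrder u) :
    (elemSL 2 (𝓞 K)).FiniteIndex := by
  obtain ⟨m, hm, h⟩ := exists_unit_exponent u
  have hU : IsGoodUnit (u ^ m) := by
    unfold IsGoodUnit
    rwa [Units.val_pow_eq_pow_val]
  have hz : ((u ^ m : (𝓞 K)ˣ) : 𝓞 K) ^ 2 - 1 ≠ 0 := fun h0 => by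
    refine hu (isOfFinOrder_iff_pow_eq_one.2 ⟨m * 2, by positivity, Units.ext ?_⟩)
    rw [pow_mul, Units.val_pow_eq_pow_val, Units.val_one]
    exact sub_eq_zero.1 h0
  set z := ((u ^ m : (𝓞 K)ˣ) : 𝓞 K) ^ 2 - 1 with hz'
  have h2 : ¬ IsUnit ((2 : ℕ) : 𝓞 K) := not_isUnit_natCast le_rfl
  have hfi := hU.unipClosure_finiteIndex (q := z * (2 : ℕ))
    (mul_ne_zero hz (Nat.cast_ne_zero.2 two_ne_zero))
    (fun h => h2 (isUnit_of_mul_isUnit_right h)) hz (Dvd.intro _ rfl)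
  have hle : unipClosure (⊤ : Subgroup (Matrix.SpecialLinearGroup (Fin 2) (𝓞 K))) (z * (2 : ℕ)) ≤
      unipClosure ⊤ z := by
    rw [unipClosure, Subgroup.closure_le]
    rintro _ ⟨k, hk, t, rfl⟩
    rw [mul_assoc z]
    exact conj_upSL_mem_unipClosure hk z _
  exact Subgroup.finiteIndex_of_le
    (hle.trans (hU.unipClosure_le fun n hn => not_isUnit_natCast hn))

end FiniteIndex

section StandardPresentation

variable {A : Type*} [CommRing A] {Q : Type*} [Group Q]

/-- Products `± E x₀ * w * E x₁ * ⋯ * w * E xₖ` with `x₁, …, xₖ` different from `0, 1, -1`. -/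
inductive IsCoreWord (E : A → Q) (w : Q) : Q → Prop
  | base (x : A) : IsCoreWord E w (E x)
  | neg_base (x : A) : IsCoreWord E w (w ^ 2 * E x)
  | step (g : Q) (x : A) (hg : IsCoreWord E w g) (h0 : x ≠ 0) (h1 : x ≠ 1) (h2 : x ≠ -1) :
      IsCoreWord E w (g * w * E x)

/-- Products `± E x₀ * w * E x₁ * ⋯ * w * E xₖ` with `x₁, …, xₖ₋₁` different from `0, 1, -1`. -/
def IsReducedWord (E : A → Q) (w : Q) (g : Q) : Prop :=
  (∃ x, g = E x ∨ g = w ^ 2 * E x) ∨ ∃ h x, IsCoreWord E w h ∧ g = h * w * E x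

lemma IsCoreWord.isReducedWord {E : A → Q} {w g : Q} (h : IsCoreWord E w g) :
    IsReducedWord E w g := by
  cases h with
  | base x => exact .inl ⟨x, .inl rfl⟩
  | neg_base x => exact .inl ⟨x, .inr rfl⟩
  | step g x hg => exact .inr ⟨g, x, hg, rfl⟩

/-- The relations between elementary matrices of size two over an arbitrary ring. -/
structure IsElementaryPair (E : A → Q) (w : Q) : Prop where
  add : ∀ x y, E (x + y) = E x * E y
  pow_four : w ^ 4 = 1
  comm : ∀ x, Commute (w ^ 2) (E x)
  braid : w * E 1 * w = E (-1) * w * E (-1)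

namespace IsElementaryPair

variable {E : A → Q} {w : Q}

lemma zero (H : IsElementaryPair E w) : E 0 = 1 := by
  have := H.add 0 0
  rwa [add_zero, left_eq_mul] at this

lemma neg (H : IsElementaryPair E w) (x : A) : E (-x) = (E x)⁻¹ := by
  rw [eq_inv_iff_mul_eq_one, ← H.add, neg_add_cancel, H.zero]

lemma sq_mul_sq_mul (H : IsElementaryPair E w) (g : Q) : w ^ 2 * (w ^ 2 * g) = g := by
  rw [← mul_assoc, ← pow_add, H.pow_four, one_mul]

lemma braid_neg (H : IsElementaryPair E w) :
    w * E (-1) * w = w ^ 2 * (E 1 * w * E 1) := by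
  have hw : w⁻¹ = w ^ 2 * w := by
    rw [← pow_succ, inv_eq_iff_mul_eq_one, ← pow_succ', H.pow_four]
  have h := congrArg (fun x => x⁻¹) H.braid
  simp only [mul_inv_rev, H.neg, inv_inv] at h
  rw [hw, ← H.neg] at h
  have e1 : w ^ 2 * w * (E (-1) * (w ^ 2 * w)) = w ^ 2 * (w ^ 2 * (w * E (-1) * w)) := by
    have h1 := (H.comm (-1)).eq
    have h2 : w * w ^ 2 = w ^ 2 * w := (Commute.refl w).pow_right 2
    calc _ = w ^ 2 * w * (E (-1) * w ^ 2) * w := by group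
      _ = w ^ 2 * (w * w ^ 2) * E (-1) * w := by rw [← h1]; group
      _ = _ := by rw [h2]; group
  rw [e1, H.sq_mul_sq_mul] at h
  rw [h]
  have h1 := (H.comm 1).eq
  calc _ = (E 1 * w ^ 2) * w * E 1 := by group
    _ = _ := by rw [← h1]; group

lemma commute_core (H : IsElementaryPair E w) {g : Q} (hg : IsCoreWord E w g) :
    Commute (w ^ 2) g := by
  induction hg with
  | base x => exact H.comm x
  | neg_base x => exact (Commute.refl _).mul_right (H.comm x)
  | step g x hg h0 h1 h2 ih =>
    exact (ih.mul_right ((Commute.refl w).pow_left 2)).mul_right (H.comm x)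

lemma core_neg (H : IsElementaryPair E w) {g : Q} (hg : IsCoreWord E w g) :
    IsCoreWord E w (w ^ 2 * g) := by
  induction hg with
  | base x => exact .neg_base x
  | neg_base x =>
    rw [H.sq_mul_sq_mul]
    exact .base x
  | step g x hg h0 h1 h2 ih =>
    rw [← mul_assoc, ← mul_assoc]
    exact .step _ x ih h0 h1 h2

lemma reduced_neg (H : IsElementaryPair E w) {g : Q} (hg : IsReducedWord E w g) :
    IsReducedWord E w (w ^ 2 * g) := by
  obtain ⟨x, rfl | rfl⟩ | ⟨h, x, hh, rfl⟩ := hg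
  · exact .inl ⟨x, .inr rfl⟩
  · exact .inl ⟨x, .inl (H.sq_mul_sq_mul _)⟩
  · exact .inr ⟨_, x, H.core_neg hh, by simp only [mul_assoc]⟩

lemma reduced_mul (H : IsElementaryPair E w) {g : Q} (hg : IsReducedWord E w g) (y : A) :
    IsReducedWord E w (g * E y) := by
  obtain ⟨x, rfl | rfl⟩ | ⟨h, x, hh, rfl⟩ := hg
  · exact .inl ⟨x + y, .inl (H.add _ _).symm⟩
  · exact .inl ⟨x + y, .inr (by rw [H.add, mul_assoc])⟩
  · exact .inr ⟨h, x + y, hh, by rw [H.add, mul_assoc]⟩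

lemma core_mul (H : IsElementaryPair E w) {g : Q} (hg : IsCoreWord E w g) :
    IsReducedWord E w (g * w) :=
  .inr ⟨g, 0, hg, by rw [H.zero, mul_one]⟩

lemma reduced_step (H : IsElementaryPair E w) {g : Q} (hg : IsCoreWord E w g)
    (hr : ∀ y, IsReducedWord E w (g * E y * w)) (t : A) :
    IsReducedWord E w (g * w * E t * w) := by
  by_cases h0 : t = 0
  · rw [h0, H.zero, mul_one, mul_assoc, ← pow_two, ← (H.commute_core hg).eq]
    exact (H.core_neg hg).isReducedWord
  by_cases h1 : t = 1
  · have : g * w * E t * w = g * E (-1) * w * E (-1) := by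
      rw [h1, mul_assoc, mul_assoc, ← mul_assoc w, H.braid]
      group
    rw [this]
    exact H.reduced_mul (hr _) _
  by_cases h2 : t = -1
  · have : g * w * E t * w = w ^ 2 * (g * E 1 * w * E 1) := by
      rw [h2, mul_assoc, mul_assoc, ← mul_assoc w, H.braid_neg, ← mul_assoc,
        ← (H.commute_core hg).eq]
      group
    rw [this]
    exact H.reduced_neg (H.reduced_mul (hr _) _)
  exact H.core_mul (.step g t hg h0 h1 h2)

lemma reduced_core (H : IsElementaryPair E w) {g : Q} (hg : IsCoreWord E w g) :
    ∀ y, IsReducedWord E w (g * E y * w) := by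
  induction hg with
  | base x =>
    intro y
    rw [← H.add]
    exact H.core_mul (.base _)
  | neg_base x =>
    intro y
    rw [mul_assoc (w ^ 2), ← H.add]
    exact H.core_mul (.neg_base _)
  | step g x hg h0 h1 h2 ih =>
    intro y
    rw [mul_assoc (g * w), ← H.add]
    exact H.reduced_step hg ih _

lemma reduced_mul_weyl (H : IsElementaryPair E w) {g : Q} (hg : IsReducedWord E w g) :
    IsReducedWord E w (g * w) := by
  obtain ⟨x, rfl | rfl⟩ | ⟨h, x, hh, rfl⟩ := hg
  · exact H.core_mul (.base x)
  · exact H.core_mul (.neg_base x)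
  · exact H.reduced_step hh (H.reduced_core hh) x

lemma reduced (H : IsElementaryPair E w) (htop : Subgroup.closure (Set.range E ∪ {w}) = ⊤)
    (q : Q) : IsReducedWord E w q := by
  have hq : q ∈ (Subgroup.closure (Set.range E ∪ {w})).toSubmonoid := by
    rw [htop]
    trivial
  rw [Subgroup.closure_toSubmonoid] at hq
  have key : ∀ g, IsReducedWord E w g → IsReducedWord E w (g * q) := by
    induction hq using Submonoid.closure_induction with
    | mem x hx =>
      intro g hg
      obtain (⟨y, rfl⟩ | rfl) | ⟨y, hy⟩ | hx := hx
      · exact H.reduced_mul hg y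
      · exact H.reduced_mul_weyl hg
      · rw [← inv_inv x, ← hy, ← H.neg]
        exact H.reduced_mul hg _
      · have : x = w * w * w := by
          rw [← inv_inv x, Set.mem_singleton_iff.1 hx, inv_eq_iff_mul_eq_one]
          simpa [pow_succ, mul_assoc] using H.pow_four
        rw [this, ← mul_assoc, ← mul_assoc]
        exact H.reduced_mul_weyl (H.reduced_mul_weyl (H.reduced_mul_weyl hg))
    | one => intro g hg; rwa [mul_one]
    | mul x y _ _ hx hy =>
      intro g hg
      rw [← mul_assoc]
      exact hy _ (hx _ hg)
  have := key 1 (.inl ⟨0, .inl H.zero.symm⟩)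
  rwa [one_mul] at this

lemma injective (H : IsElementaryPair E w) (htop : Subgroup.closure (Set.range E ∪ {w}) = ⊤)
    (φ : A →+* ℂ) (hφ : ∀ x, x ≠ 0 → x ≠ 1 → x ≠ -1 → 2 ≤ ‖φ x‖)
    (ρ : Q →* Matrix.SpecialLinearGroup (Fin 2) A) (hE : ∀ x, ρ (E x) = upSL x)
    (hw : ρ w = weylSL) : Function.Injective ρ := by
  have hsq : ∀ i j, (ρ (w ^ 2)).1 i j = !![(-1 : A), 0; 0, -1] i j := by
    rw [map_pow, hw, pow_two]
    have : (weylSL * weylSL : Matrix.SpecialLinearGroup (Fin 2) A) =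
        mkSL2 (-1) 0 0 (-1) (by ring) := by
      refine SL2_ext ?_ ?_ ?_ ?_ <;> simp only [SL2_mul_apply, weylSL_apply, mkSL2_apply] <;> simp
    rw [this]
    exact mkSL2_apply _ _ _ _ _
  have hcore : ∀ g, IsCoreWord E w g → ‖φ ((ρ g).1 1 0)‖ < ‖φ ((ρ g).1 1 1)‖ := by
    intro g hg
    induction hg with
    | base x =>
      rw [hE, upSL_apply, upSL_apply]
      simp
    | neg_base x =>
      rw [map_mul, SL2_mul_apply, SL2_mul_apply, hsq, hsq, hE]
      simp only [upSL_apply]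
      simp
    | step g x hg h0 h1 h2 ih =>
      have e0 : (ρ (g * w * E x)).1 1 0 = (ρ g).1 1 1 := by
        rw [map_mul, map_mul, hw, hE]
        simp only [SL2_mul_apply, upSL_apply, weylSL_apply]
        simp
      have e1 : (ρ (g * w * E x)).1 1 1 = (ρ g).1 1 1 * x - (ρ g).1 1 0 := by
        rw [map_mul, map_mul, hw, hE]
        simp only [SL2_mul_apply, upSL_apply, weylSL_apply]
        simp
        ring
      rw [e0, e1, map_sub, map_mul]
      have n1 := norm_sub_norm_le (φ ((ρ g).1 1 1) * φ x) (φ ((ρ g).1 1 0))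
      rw [norm_mul] at n1
      have n2 := mul_le_mul_of_nonneg_left (hφ x h0 h1 h2) (norm_nonneg (φ ((ρ g).1 1 1)))
      linarith
  rw [injective_iff_map_eq_one]
  intro q hq
  obtain ⟨x, rfl | rfl⟩ | ⟨h, x, hh, rfl⟩ := H.reduced htop q
  · rw [hE] at hq
    have h1 := upSL_apply x 0 1
    rw [hq, SL2_one_apply] at h1
    have : x = 0 := by simpa using h1.symm
    rw [this, H.zero]
  · exfalso
    have h1 : (ρ (w ^ 2 * E x)).1 1 1 = -1 := by
      rw [map_mul, SL2_mul_apply, hsq, hsq, hE]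
      simp only [upSL_apply]
      simp
    rw [hq, SL2_one_apply] at h1
    have h2 := congrArg φ h1
    simp at h2
    norm_num [eq_neg_iff_add_eq_zero] at h2
  · exfalso
    have h1 : (ρ (h * w * E x)).1 1 0 = (ρ h).1 1 1 := by
      rw [map_mul, map_mul, hw, hE]
      simp only [SL2_mul_apply, upSL_apply, weylSL_apply]
      simp
    rw [hq, SL2_one_apply] at h1
    have h2 := hcore h hh
    rw [← h1] at h2
    simp at h2
    linarith [norm_nonneg (φ ((ρ h).1 1 0))]

end IsElementaryPair

end StandardPresentation

section FinitePresentation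

variable {A : Type*} [CommRing A]

lemma elemSL_two_le {H : Subgroup (Matrix.SpecialLinearGroup (Fin 2) A)}
    (hE : ∀ x, upSL x ∈ H) (hw : weylSL ∈ H) : elemSL 2 A ≤ H := by
  refine (Subgroup.closure_le _).2 ?_
  rintro _ ⟨i, j, h, t, rfl⟩
  have hl : loSL t ∈ H := by
    rw [← neg_neg t, ← weylSL_mul_upSL]
    exact H.mul_mem (H.mul_mem hw (hE _)) (H.inv_mem hw)
  fin_cases i <;> fin_cases j
  · exact absurd rfl h
  · exact hE t
  · exact hl
  · exact absurd rfl h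

open Monoid.Coprod in
/-- The finitely many relations of `IsElementaryPair`, the commutation being imposed only on a
generating set `S`. -/
def elementaryRelators (S : Set A) :
    Set (Monoid.Coprod (Multiplicative A) (Multiplicative ℤ)) :=
  let E : A → Monoid.Coprod (Multiplicative A) (Multiplicative ℤ) :=
    fun x => inl (Multiplicative.ofAdd x)
  let w : Monoid.Coprod (Multiplicative A) (Multiplicative ℤ) := inr (Multiplicative.ofAdd 1)
  {w ^ 4, w * E 1 * w * (E (-1) * w * E (-1))⁻¹} ∪
    (fun x => w ^ 2 * E x * (E x * w ^ 2)⁻¹) '' S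

lemma finite_elementaryRelators {S : Set A} (hS : S.Finite) : (elementaryRelators S).Finite :=
  (Set.toFinite _).union (hS.image _)

open Monoid.Coprod in
lemma isElementaryPair_quotient {S : Set A} (hS : AddSubgroup.closure S = ⊤) :
    IsElementaryPair
      (fun x : A => (QuotientGroup.mk (inl (Multiplicative.ofAdd x)) :
        Monoid.Coprod (Multiplicative A) (Multiplicative ℤ) ⧸
          Subgroup.normalClosure (elementaryRelators S)))
      (QuotientGroup.mk (inr (Multiplicative.ofAdd 1))) := by
  have key : ∀ a b : Monoid.Coprod (Multiplicative A) (Multiplicative ℤ),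
      a * b⁻¹ ∈ elementaryRelators S →
      (QuotientGroup.mk a : _ ⧸ Subgroup.normalClosure (elementaryRelators S)) =
        QuotientGroup.mk b := by
    intro a b h
    have : _ ∈ Subgroup.normalClosure _ := Subgroup.subset_normalClosure h
    rw [← QuotientGroup.eq_one_iff, QuotientGroup.mk_mul, QuotientGroup.mk_inv] at this
    exact mul_inv_eq_one.1 this
  have hadd : ∀ x y : A, (QuotientGroup.mk (inl (Multiplicative.ofAdd (x + y))) :
        Monoid.Coprod (Multiplicative A) (Multiplicative ℤ) ⧸
          Subgroup.normalClosure (elementaryRelators S)) =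
        QuotientGroup.mk (inl (Multiplicative.ofAdd x)) *
          QuotientGroup.mk (inl (Multiplicative.ofAdd y)) := by
    intro x y
    rw [ofAdd_add, map_mul, QuotientGroup.mk_mul]
  refine ⟨hadd, ?_, ?_, ?_⟩
  · refine key (_ ^ 4) 1 ?_
    rw [inv_one, mul_one]
    exact .inl (.inl rfl)
  · intro x
    have hx : x ∈ AddSubgroup.closure S := hS ▸ AddSubgroup.mem_top x
    induction hx using AddSubgroup.closure_induction with
    | mem x hx => exact key _ _ (.inr ⟨x, hx, rfl⟩)
    | zero =>
      rw [ofAdd_zero, map_one inl, QuotientGroup.mk_one]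
      exact Commute.one_right _
    | add x y _ _ hx hy =>
      rw [hadd]
      exact hx.mul_right hy
    | neg x _ hx =>
      rw [ofAdd_neg, map_inv, QuotientGroup.mk_inv]
      exact hx.inv_right
  · exact key _ _ (.inl (.inr rfl))

/-- The relators of `elementaryRelators` present the elementary group as soon as the nonzero
elements of the ring other than `1` and `-1` have absolute value at least two. -/
theorem elemSL_two_isFinitelyPresented_of_two_le [AddGroup.FG A] (φ : A →+* ℂ)
    (hφ : ∀ x, x ≠ 0 → x ≠ 1 → x ≠ -1 → 2 ≤ ‖φ x‖) :
    Group.IsFinitelyPresented (elemSL 2 A) := by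
  obtain ⟨S, hS⟩ := AddGroup.fg_def.1 (inferInstance : AddGroup.FG A)
  have : Group.IsFinitelyPresented (Multiplicative A) := .of_comm _
  let P := Monoid.Coprod (Multiplicative A) (Multiplicative ℤ)
  let N : Subgroup P := Subgroup.normalClosure (elementaryRelators (S : Set A))
  have hN : Group.IsFinitelyPresented (P ⧸ N) :=
    Group.IsFinitelyPresented.quotient N ⟨_, finite_elementaryRelators S.finite_toSet, rfl⟩
  let u : Multiplicative A →* Matrix.SpecialLinearGroup (Fin 2) A :=
    { toFun := fun x => upSL x.toAdd
      map_one' := by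
        refine SL2_ext ?_ ?_ ?_ ?_ <;> simp only [upSL_apply, SL2_one_apply] <;> simp
      map_mul' := fun x y => upSL_add _ _ }
  let f : P →* Matrix.SpecialLinearGroup (Fin 2) A := Monoid.Coprod.lift u (zpowersHom _ weylSL)
  have hfE : ∀ x, f (Monoid.Coprod.inl (Multiplicative.ofAdd x)) = upSL x := fun x => rfl
  have hfw : f (Monoid.Coprod.inr (Multiplicative.ofAdd 1)) = weylSL :=
    (Monoid.Coprod.lift_apply_inr _ _ _).trans (by simp [zpowersHom_apply])
  have hf : N ≤ f.ker := by
    refine Subgroup.normalClosure_le_normal ?_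
    rintro _ ((rfl | rfl) | ⟨x, -, rfl⟩)
    · change f (_ ^ 4) = 1
      rw [map_pow, hfw]
      refine SL2_ext ?_ ?_ ?_ ?_ <;>
        simp only [pow_succ, pow_zero, one_mul, SL2_mul_apply, weylSL_apply, SL2_one_apply] <;> simp
    · change f (_ * _ * _ * (_ * _ * _)⁻¹) = 1
      rw [map_mul, map_inv, mul_inv_eq_one]
      simp only [map_mul, hfw, hfE]
      refine SL2_ext ?_ ?_ ?_ ?_ <;> simp only [SL2_mul_apply, upSL_apply, weylSL_apply] <;> simp
    · change f (_ ^ 2 * _ * (_ * _ ^ 2)⁻¹) = 1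
      rw [map_mul, map_inv, mul_inv_eq_one]
      simp only [map_mul, map_pow, hfw, hfE]
      refine SL2_ext ?_ ?_ ?_ ?_ <;>
        simp only [pow_succ, pow_zero, one_mul, SL2_mul_apply, upSL_apply, weylSL_apply] <;> simp
  let ρ : P ⧸ N →* Matrix.SpecialLinearGroup (Fin 2) A := QuotientGroup.lift N f hf
  have htop : Subgroup.closure (Set.range
      (fun x : A => (QuotientGroup.mk (Monoid.Coprod.inl (Multiplicative.ofAdd x)) : P ⧸ N)) ∪
      {QuotientGroup.mk (Monoid.Coprod.inr (Multiplicative.ofAdd 1))}) = ⊤ := by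
    rw [eq_top_iff]
    rintro q -
    obtain ⟨p, rfl⟩ := QuotientGroup.mk_surjective q
    induction p using Monoid.Coprod.induction_on with
    | inl x => exact Subgroup.subset_closure (.inl ⟨x.toAdd, rfl⟩)
    | inr k =>
      have : (QuotientGroup.mk (Monoid.Coprod.inr k) : P ⧸ N) =
          QuotientGroup.mk (Monoid.Coprod.inr (Multiplicative.ofAdd 1)) ^ k.toAdd := by
        rw [← QuotientGroup.mk_zpow, ← map_zpow, ← ofAdd_zsmul, smul_eq_mul, mul_one, ofAdd_toAdd]
      rw [this]
      exact Subgroup.zpow_mem _ (Subgroup.subset_closure (.inr rfl)) _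
    | mul x y hx hy =>
      rw [QuotientGroup.mk_mul]
      exact Subgroup.mul_mem _ hx hy
  have hinj : Function.Injective ρ :=
    (isElementaryPair_quotient hS).injective htop φ hφ ρ hfE hfw
  have hrange : ρ.range = elemSL 2 A := by
    refine le_antisymm ?_ (elemSL_two_le (fun x => ⟨QuotientGroup.mk (Monoid.Coprod.inl _), hfE x⟩)
      ⟨QuotientGroup.mk (Monoid.Coprod.inr _), hfw⟩)
    rw [MonoidHom.range_eq_map, ← htop, MonoidHom.map_closure, Subgroup.closure_le]
    rintro _ ⟨_, ⟨x, rfl⟩ | rfl, rfl⟩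
    · exact (hfE x).symm ▸ upSL_mem x
    · exact hfw.symm ▸ weylSL_mem
  exact Group.IsFinitelyPresented.equiv
    ((MonoidHom.ofInjective hinj).trans (MulEquiv.subgroupCongr hrange))

end FinitePresentation

section EuclideanEmbedding

variable {R : Type*} [CommRing R] {φ : R →+* ℂ}

lemma Complex.sq_norm_eq_re_im (z : ℂ) : ‖z‖ ^ 2 = z.re ^ 2 + z.im ^ 2 := by
  rw [Complex.sq_norm, Complex.normSq_apply]
  ring

lemma norm_sq_eq_two_or_three {x : R} (hk : ∃ k : ℕ, ‖φ x‖ ^ 2 = k) (h1 : 1 < ‖φ x‖)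
    (h2 : ‖φ x‖ < 2) : ‖φ x‖ ^ 2 = 2 ∨ ‖φ x‖ ^ 2 = 3 := by
  obtain ⟨k, hk⟩ := hk
  have h3 : (1 : ℝ) < k := by rw [← hk]; nlinarith
  have h4 : (k : ℝ) < 4 := by rw [← hk]; nlinarith
  have h5 : 1 < k := by exact_mod_cast h3
  have h6 : k < 4 := by exact_mod_cast h4
  rw [hk]
  interval_cases k
  · exact .inl (by norm_num)
  · exact .inr (by norm_num)

lemma exists_im_sq_lt_three (hφ : Function.Injective φ) (hu : ∀ u : Rˣ, ‖φ u‖ = 1)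
    (h3 : ∀ x : R, x ^ 2 = -3 → ∃ y, 2 * y = 1 + x) {x : R}
    (hx : ‖φ x‖ ^ 2 = 2 ∨ ‖φ x‖ ^ 2 = 3) : ∃ y, (φ y).im ≠ 0 ∧ (φ y).im ^ 2 < 3 := by
  have hn := Complex.sq_norm_eq_re_im (φ x)
  have hφ2 : φ 2 = 2 := map_ofNat φ 2
  have hφ3 : φ 3 = 3 := map_ofNat φ 3
  by_cases him : (φ x).im = 0
  · exfalso
    rw [him] at hn
    have hsq : ∀ k : ℕ, ‖φ x‖ ^ 2 = k → x ^ 2 = k := by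
      intro k hk
      refine hφ (Complex.ext ?_ ?_)
      · rw [map_pow, map_natCast, Complex.natCast_re, ← hk, hn]
        simp [sq, him]
      · simp [sq, him]
    rcases hx with hx | hx
    · have h := hsq 2 (by exact_mod_cast hx)
      have := hu ⟨1 + x, x - 1, by push_cast at h; linear_combination h,
        by push_cast at h; linear_combination h⟩
      have h' := Complex.sq_norm_eq_re_im (φ (1 + x))
      rw [show ‖φ (1 + x)‖ = 1 from this] at h'
      simp [him] at h'
      nlinarith
    · have h := hsq 3 (by exact_mod_cast hx)
      have := hu ⟨2 + x, 2 - x, by push_cast at h; linear_combination -h,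
        by push_cast at h; linear_combination -h⟩
      have h' := Complex.sq_norm_eq_re_im (φ (2 + x))
      rw [show ‖φ (2 + x)‖ = 1 from this] at h'
      simp [him, hφ2] at h'
      nlinarith
  · by_cases hlt : (φ x).im ^ 2 < 3
    · exact ⟨x, him, hlt⟩
    · have h4 : (φ x).im ^ 2 = 3 := by rcases hx with hx | hx <;> nlinarith [sq_nonneg (φ x).re]
      have hre : (φ x).re = 0 := by
        rcases hx with hx | hx <;> nlinarith [sq_nonneg (φ x).re]
      obtain ⟨y, hy⟩ := h3 x (hφ (Complex.ext
        (by simp [sq, hre, hφ3]; linarith) (by simp [sq, hre, hφ3])))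
      have hy' := congrArg (fun z => (φ z).im) hy
      simp [hφ2] at hy'
      refine ⟨y, fun h => him (by rw [← hy', h, mul_zero]), ?_⟩
      rw [← hy'] at h4
      nlinarith

lemma exists_norm_sub_mul_lt {y : R} (hy0 : (φ y).im ≠ 0) (hy : (φ y).im ^ 2 < 3) (a b : R)
    (hb : φ b ≠ 0) : ∃ q, ‖φ (a - q * b)‖ < ‖φ b‖ := by
  let z := φ a / φ b
  let n : ℤ := round (z.im / (φ y).im)
  let m : ℤ := round (z.re - n * (φ y).re)
  have h1 := abs_sub_round (z.im / (φ y).im)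
  have h2 := abs_sub_round (z.re - n * (φ y).re)
  have e : φ (a - ((m : R) + n * y) * b) = (z - (m + n * φ y)) * φ b := by
    simp only [map_sub, map_mul, map_add, map_intCast, z]
    field_simp
  refine ⟨(m : R) + n * y, ?_⟩
  rw [e, norm_mul]
  refine mul_lt_of_lt_one_left (norm_pos_iff.2 hb) ?_
  rw [← sq_lt_one_iff₀ (norm_nonneg _), Complex.sq_norm_eq_re_im]
  have h3 : (z - (m + n * φ y)).im = (z.im / (φ y).im - n) * (φ y).im := by
    simp
    field_simp
  have h4 : (z - (m + n * φ y)).re = z.re - n * (φ y).re - m := by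
    simp
    ring
  have h5 : (z.im / (φ y).im - n) ^ 2 ≤ 1 / 4 := by
    rw [← sq_abs]
    nlinarith [abs_nonneg (z.im / (φ y).im - n)]
  have h6 : (z.re - n * (φ y).re - m) ^ 2 ≤ 1 / 4 := by
    rw [← sq_abs]
    nlinarith [abs_nonneg (z.re - n * (φ y).re - m)]
  rw [h3, h4, mul_pow]
  nlinarith [sq_nonneg (φ y).im]

lemma elemSL_two_eq_top_of_exists_norm_lt (hφ : Function.Injective φ)
    (hk : ∀ x, ∃ k : ℕ, ‖φ x‖ ^ 2 = k)
    (hlt : ∀ a b : R, φ b ≠ 0 → ∃ q, ‖φ (a - q * b)‖ < ‖φ b‖) : elemSL 2 R = ⊤ := by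
  rw [eq_top_iff]
  rintro g -
  obtain ⟨k, hg⟩ := hk (g.1 1 0)
  induction k using Nat.strong_induction_on generalizing g with
  | _ k ih =>
    by_cases h0 : g.1 1 0 = 0
    · have hd := SL2_det g
      rw [h0, mul_zero, sub_zero] at hd
      let u : Rˣ := ⟨g.1 0 0, g.1 1 1, hd, by rw [mul_comm, hd]⟩
      have e : g = diagSL u * upSL (g.1 1 1 * g.1 0 1) := by
        refine SL2_ext ?_ ?_ ?_ ?_ <;> simp only [SL2_mul_apply, upSL_apply, diagSL_apply] <;>
          simp [u, h0, ← mul_assoc, hd]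
      rw [e]
      exact mul_mem (diagSL_mem _) (upSL_mem _)
    · obtain ⟨q, hq⟩ := hlt (g.1 0 0) (g.1 1 0) ((map_ne_zero_iff φ hφ).2 h0)
      let g' := weylSL * upSL (-q) * g
      have e : g'.1 1 0 = g.1 0 0 - q * g.1 1 0 := by
        simp only [g', SL2_mul_apply, upSL_apply, weylSL_apply]
        simp
        ring
      obtain ⟨l, hl⟩ := hk (g'.1 1 0)
      have hlk : l < k := by
        have : (l : ℝ) < k := by
          rw [← hl, ← hg, e]
          gcongr
        exact_mod_cast this
      have : g' ∈ elemSL 2 R := ih l hlk hl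
      exact (Subgroup.mul_mem_cancel_left _ (mul_mem weylSL_mem (upSL_mem _))).1 this

/-- A ring with an embedding in the complex numbers whose absolute value squared is integral either
has a euclidean algorithm or is covered by `elemSL_two_isFinitelyPresented_of_two_le`. -/
theorem elemSL_two_isFinitelyPresented_of_norm [AddGroup.FG R]
    [Group.IsFinitelyPresented (Matrix.SpecialLinearGroup (Fin 2) R)] (hφ : Function.Injective φ)
    (hk : ∀ x, ∃ k : ℕ, ‖φ x‖ ^ 2 = k) (hu : ∀ u : Rˣ, ‖φ u‖ = 1)
    (h3 : ∀ x : R, x ^ 2 = -3 → ∃ y, 2 * y = 1 + x) :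
    Group.IsFinitelyPresented (elemSL 2 R) := by
  by_cases h : ∃ x, ‖φ x‖ ^ 2 = 2 ∨ ‖φ x‖ ^ 2 = 3
  · obtain ⟨x, hx⟩ := h
    obtain ⟨y, hy0, hy⟩ := exists_im_sq_lt_three hφ hu h3 hx
    rw [elemSL_two_eq_top_of_exists_norm_lt hφ hk (exists_norm_sub_mul_lt hy0 hy)]
    exact Group.IsFinitelyPresented.equiv Subgroup.topEquiv.symm
  · push Not at h
    refine elemSL_two_isFinitelyPresented_of_two_le φ fun x h0 h1 h1' => ?_
    by_contra! hx
    have hpos : ∀ z : R, z ≠ 0 → 1 ≤ ‖φ z‖ ^ 2 := by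
      intro z hz
      obtain ⟨k, hk⟩ := hk z
      have : 0 < ‖φ z‖ ^ 2 := by
        have := norm_pos_iff.2 ((map_ne_zero_iff φ hφ).2 hz)
        positivity
      rw [hk] at this ⊢
      exact_mod_cast this
    have hx1 : ‖φ x‖ ^ 2 = 1 := by
      refine le_antisymm ?_ (hpos x h0)
      by_contra! hlt
      have := norm_sq_eq_two_or_three (hk x) (by nlinarith [norm_nonneg (φ x)]) hx
      exact this.elim (h x).1 (h x).2
    have hpar : ‖φ (1 + x)‖ ^ 2 + ‖φ (1 - x)‖ ^ 2 = 4 := by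
      simp only [Complex.sq_norm_eq_re_im] at hx1 ⊢
      simp
      nlinarith
    have ha := hpos (1 + x) fun hz => h1' (by linear_combination hz)
    have hb := hpos (1 - x) fun hz => h1 (by linear_combination -hz)
    obtain ⟨k, hk⟩ := hk (1 + x)
    have hkk := h (1 + x)
    rw [hk] at hkk ha hpar
    have k1 : 1 ≤ k := by exact_mod_cast ha
    have k3 : k ≤ 3 := by
      have : (k : ℝ) ≤ 3 := by linarith
      exact_mod_cast this
    interval_cases k
    · exact (h (1 - x)).2 (by push_cast at hpar; linarith)
    · exact hkk.1 (by norm_num)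
    · exact hkk.2 (by norm_num)

end EuclideanEmbedding

section RankZero

open NumberField

variable {K : Type*} [Field K] [NumberField K]

lemma subsingleton_infinitePlace (hu : ∀ u : (𝓞 K)ˣ, IsOfFinOrder u) :
    Subsingleton (InfinitePlace K) := by
  classical
  rw [← Fintype.card_le_one_iff_subsingleton]
  by_contra! h
  have hr : 0 < Units.rank K := Nat.sub_pos_of_lt h
  refine (Units.basisUnitLattice K).ne_zero ⟨0, hr⟩ (Subtype.ext ?_)
  rw [← Units.logEmbedding_fundSystem]
  exact Units.dirichletUnitTheorem.logEmbedding_eq_zero_iff.2 (hu _)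

lemma exists_norm_placeEmb_sq [Subsingleton (InfinitePlace K)] (w : InfinitePlace K) (x : 𝓞 K) :
    ∃ k : ℕ, ‖placeEmb w x‖ ^ 2 = k := by
  have h := InfinitePlace.prod_eq_abs_norm (x : K)
  rw [Fintype.prod_subsingleton _ w, ← norm_placeEmb, ← Algebra.coe_norm_int] at h
  have h' : ‖placeEmb w x‖ ^ w.mult = ((Algebra.norm ℤ x).natAbs : ℕ) := by
    rw [h, Nat.cast_natAbs]
    push_cast
    rfl
  unfold InfinitePlace.mult at h'
  split_ifs at h' with hw
  · exact ⟨(Algebra.norm ℤ x).natAbs ^ 2, by rw [pow_one] at h'; rw [h', Nat.cast_pow]⟩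
  · exact ⟨_, h'⟩

lemma norm_placeEmb_unit {K : Type*} [Field K] {u : (𝓞 K)ˣ} (hu : IsOfFinOrder u)
    (w : InfinitePlace K) :
    ‖placeEmb w u‖ = 1 := by
  obtain ⟨n, hn, h⟩ := isOfFinOrder_iff_pow_eq_one.1 hu
  refine (pow_eq_one_iff_of_nonneg (norm_nonneg _) hn.ne').1 ?_
  rw [← norm_pow, ← map_pow, ← Units.val_pow_eq_pow_val, h, Units.val_one, map_one, norm_one]

lemma exists_two_mul_eq_one_add {x : 𝓞 K} (hx : x ^ 2 = -3) : ∃ y : 𝓞 K, 2 * y = 1 + x := by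
  have hx' : (x : K) ^ 2 = -3 := by
    have := congrArg (algebraMap (𝓞 K) K) hx
    rwa [map_pow, map_neg, map_ofNat] at this
  have hint : IsIntegral ℤ ((1 + (x : K)) / 2) := by
    refine ⟨Polynomial.X ^ 2 - Polynomial.X + 1, ?_, ?_⟩
    · monicity!
    · simp only [Polynomial.eval₂_add, Polynomial.eval₂_sub, Polynomial.eval₂_pow,
        Polynomial.eval₂_X, Polynomial.eval₂_one]
      linear_combination hx' / 4
  obtain ⟨y, hy⟩ : ∃ y : 𝓞 K, (y : K) = (1 + (x : K)) / 2 := ⟨⟨_, hint⟩, rfl⟩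
  refine ⟨y, RingOfIntegers.coe_injective ?_⟩
  rw [map_mul, map_add, map_ofNat, map_one]
  linear_combination 2 * hy

lemma elemSL_two_isFinitelyPresented_of_isOfFinOrder (hu : ∀ u : (𝓞 K)ˣ, IsOfFinOrder u) :
    Group.IsFinitelyPresented (elemSL 2 (𝓞 K)) := by
  have := subsingleton_infinitePlace hu
  obtain ⟨w⟩ : Nonempty (InfinitePlace K) := inferInstance
  have : AddGroup.FG (𝓞 K) := AddGroup.fg_iff_addMonoid_fg.2 inferInstance
  exact elemSL_two_isFinitelyPresented_of_norm (φ := placeEmb w) (w.embedding.injective.comp RingOfIntegers.coe_injective)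
    (exists_norm_placeEmb_sq w) (fun u => norm_placeEmb_unit (hu u) w)
    fun x => exists_two_mul_eq_one_add

lemma elemSL_isFinitelyPresented (n : ℕ) : Group.IsFinitelyPresented (elemSL n (𝓞 K)) := by
  match n with
  | 0 =>
    have : Finite (elemSL 0 (𝓞 K)) := inferInstance
    infer_instance
  | 1 =>
    have : Subsingleton (Matrix.SpecialLinearGroup (Fin 1) (𝓞 K)) := inferInstance
    infer_instance
  | 2 =>
    by_cases h : ∃ u : (𝓞 K)ˣ, ¬ IsOfFinOrder u
    · obtain ⟨u, hu⟩ := h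
      have := elemSL_two_finiteIndex u hu
      exact .of_finiteIndex _
    · push Not at h
      exact elemSL_two_isFinitelyPresented_of_isOfFinOrder h
  | n + 3 =>
    have : Group.FG (Matrix.SpecialLinearGroup (Fin 3) (𝓞 K)) := Group.IsFinitelyPresented.fg _
    have := elemSL_finiteIndex_of_three_le (A := 𝓞 K) (n := n + 3) (by omega)
    exact .of_finiteIndex _

end RankZero

/-- Characteristic-zero case: every standard parabolic subgroup of SL_n over the ring
of integers of a number field is finitely presented. -/
theorem parabolic_ringOfIntegers_finitelyPresented
    (K : Type*) [Field K] [NumberField K] {n : ℕ} (hn : 2 ≤ n)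
    (I : Set ℕ) (hI : I ⊆ Set.Icc 1 (n - 1)) :
    IsFinitelyPresented ↥(parabolic n (NumberField.RingOfIntegers K) I) := by
  have : AddGroup.FG (NumberField.RingOfIntegers K) := AddGroup.fg_iff_addMonoid_fg.2 inferInstance
  have : Group.FG (NumberField.RingOfIntegers K)ˣ := Group.fg_iff_monoid_fg.2 inferInstance
  refine (parabolic_isFinitelyPresented (fun m => ?_) I).exists_finset
  have := elemSL_isFinitelyPresented (K := K) m
  exact elemGL_isFinitelyPresented_of_elemSL
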